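/- For every real number x ≥ 1, the inequality |W(x)| < 2260·x holds. In particular, W(x) = O(x). -/

import Mathlib

open Finset Filter Asymptotics ArithmeticFunction

/-- `W x = ∑_{1 ≤ n ≤ x} (-2)^{Ω(n)}`. -/
noncomputable def W (x : ℝ) : ℝ :=
  ∑ n ∈ Finset.Icc 1 ⌊x⌋₊, (-2 : ℝ) ^ (cardFactors n)

section
open Metric Complex

lemma zero_extract {U : Set ℂ} (hU : IsOpen U) {f : ℂ → ℂ} (hf : DifferentiableOn ℂ f U)
    {a : ℂ} (ha : a ∈ U) (hne : ¬ ∀ᶠ z in nhds a, f z = 0) :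
    ∃ (n : ℕ) (g : ℂ → ℂ), DifferentiableOn ℂ g U ∧ g a ≠ 0 ∧
      ∀ z ∈ U, f z = (z - a) ^ n * g z := by
  have han : AnalyticAt ℂ f a := hf.analyticAt (hU.mem_nhds ha)
  obtain ⟨n, g0, hg0, hg0a, hev⟩ := han.exists_eventuallyEq_pow_smul_nonzero_iff.mpr hne
  classical
  refine ⟨n, Function.update (fun z => f z / (z - a) ^ n) a (g0 a), ?_, by simpa using hg0a, ?_⟩
  · intro z hz
    by_cases hza : z = a
    · subst hza
      have : Function.update (fun w => f w / (w - z) ^ n) z (g0 z) =ᶠ[nhds z] g0 := by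
        filter_upwards [hev] with w hw
        by_cases hwz : w = z
        · subst hwz; simp
        · have : w - z ≠ 0 := sub_ne_zero.mpr hwz
          rw [Function.update_of_ne hwz, hw, smul_eq_mul]
          field_simp
      exact (this.differentiableAt_iff.mpr hg0.differentiableAt).differentiableWithinAt
    · have : Function.update (fun w => f w / (w - a) ^ n) a (g0 a) =ᶠ[nhds z]
          fun w => f w / (w - a) ^ n := by
        filter_upwards [isOpen_ne.mem_nhds hza] with w hw
        exact Function.update_of_ne hw _ _
      refine (this.differentiableAt_iff.mpr ?_).differentiableWithinAt
      refine ((hf z hz).differentiableAt (hU.mem_nhds hz)).div (by fun_prop) ?_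
      exact pow_ne_zero _ (sub_ne_zero.mpr hza)
  · intro z hz
    by_cases hza : z = a
    · subst hza
      have := hev.self_of_nhds
      simpa using this
    · have : z - a ≠ 0 := sub_ne_zero.mpr hza
      rw [Function.update_of_ne hza]
      field_simp

lemma zeros_finite {c : ℂ} {ρ R : ℝ} (hR : ρ < R) (hρ : 0 < ρ) {f : ℂ → ℂ}
    (hf : DifferentiableOn ℂ f (ball c R)) (hc : f c ≠ 0) :
    {z | z ∈ closedBall c ρ ∧ f z = 0}.Finite := by
  have han : AnalyticOnNhd ℂ f (ball c R) := hf.analyticOnNhd isOpen_ball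
  have h0 : c ∈ ball c R := mem_ball_self (hρ.trans hR)
  by_contra hinf
  obtain ⟨x, hx, hacc⟩ := (show Set.Infinite _ from hinf).exists_accPt_of_subset_isCompact
    (isCompact_closedBall c ρ) (fun z hz => hz.1)
  have hxU : x ∈ ball c R := closedBall_subset_ball hR hx
  have hfr : ∃ᶠ z in nhdsWithin x {x}ᶜ, f z = 0 := by
    have := (accPt_iff_frequently_nhdsNE).mp hacc
    exact this.mono fun z hz => hz.2
  exact hc (han.eqOn_zero_of_preconnected_of_frequently_eq_zero
    (convex_ball c R).isPreconnected hxU hfr h0)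

lemma zero_factor {c : ℂ} {ρ R : ℝ} (hR : ρ < R) (hρ : 0 < ρ) :
    ∀ (n : ℕ) (f : ℂ → ℂ) (_ : DifferentiableOn ℂ f (ball c R)) (_ : f c ≠ 0)
      (_ : {z | z ∈ closedBall c ρ ∧ f z = 0}.ncard = n),
    ∃ (Z : Multiset ℂ) (g : ℂ → ℂ), DifferentiableOn ℂ g (ball c R) ∧
      (∀ z ∈ closedBall c ρ, g z ≠ 0) ∧ (∀ a ∈ Z, a ∈ closedBall c ρ ∧ f a = 0) ∧
      (∀ z ∈ ball c R, f z = (Z.map (fun a => z - a)).prod * g z) := by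
  intro n
  induction n with
  | zero =>
    intro f hf hc hcard
    refine ⟨0, f, hf, ?_, by simp, by simp⟩
    intro z hz h0
    have := (Set.ncard_eq_zero (zeros_finite hR hρ hf hc)).mp hcard
    exact (Set.eq_empty_iff_forall_notMem.mp this z) ⟨hz, h0⟩
  | succ n ih =>
    intro f hf hc hcard
    have hfin := zeros_finite hR hρ hf hc
    have hpos : 0 < {z | z ∈ closedBall c ρ ∧ f z = 0}.ncard := by omega
    obtain ⟨a, ha⟩ := (Set.ncard_pos hfin).mp hpos
    have han : AnalyticOnNhd ℂ f (ball c R) := hf.analyticOnNhd isOpen_ball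
    have h0 : c ∈ ball c R := mem_ball_self (hρ.trans hR)
    have haU : a ∈ ball c R := closedBall_subset_ball hR ha.1
    obtain ⟨m, g, hg, hga, hfg⟩ := zero_extract isOpen_ball hf haU (by
      intro hev
      exact hc (han.eqOn_zero_of_preconnected_of_eventuallyEq_zero
        (convex_ball c R).isPreconnected haU hev h0))
    have hgc : g c ≠ 0 := fun h => hc (by rw [hfg c h0, h, mul_zero])
    have hset : {z | z ∈ closedBall c ρ ∧ g z = 0} = {z | z ∈ closedBall c ρ ∧ f z = 0} \ {a} := by
      ext z
      simp only [Set.mem_ofPred_eq, Set.mem_sdiff, Set.mem_singleton_iff]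
      constructor
      · rintro ⟨h1, h2⟩
        refine ⟨⟨h1, by rw [hfg z (closedBall_subset_ball hR h1), h2, mul_zero]⟩, ?_⟩
        rintro rfl; exact hga h2
      · rintro ⟨⟨h1, h2⟩, h3⟩
        refine ⟨h1, ?_⟩
        rw [hfg z (closedBall_subset_ball hR h1)] at h2
        exact (mul_eq_zero.mp h2).resolve_left (pow_ne_zero _ (sub_ne_zero.mpr h3))
    have hcg : {z | z ∈ closedBall c ρ ∧ g z = 0}.ncard = n := by
      rw [hset, Set.ncard_sdiff_singleton_of_mem ha, hcard]; rfl
    obtain ⟨Z, k, hk, hk0, hZ, hgk⟩ := ih g hg hgc hcg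
    refine ⟨Multiset.replicate m a + Z, k, hk, hk0, ?_, ?_⟩
    · intro b hb
      rcases Multiset.mem_add.mp hb with h | h
      · rw [Multiset.eq_of_mem_replicate h]; exact ha
      · refine ⟨(hZ b h).1, ?_⟩
        rw [hfg b (closedBall_subset_ball hR (hZ b h).1), (hZ b h).2, mul_zero]
    · intro z hz
      rw [hfg z hz, hgk z hz]
      simp [mul_assoc]
end

section
open Metric Complex

lemma exists_log_ball {c : ℂ} {r : ℝ} (hr : 0 < r) {h : ℂ → ℂ} (hh : DifferentiableOn ℂ h (ball c r))
    (h0 : ∀ z ∈ ball c r, h z ≠ 0) :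
    ∃ g : ℂ → ℂ, DifferentiableOn ℂ g (ball c r) ∧ ∀ z ∈ ball c r, h z = exp (g z) := by
  have hd : DifferentiableOn ℂ (fun z => deriv h z / h z) (ball c r) :=
    (hh.deriv isOpen_ball).div hh h0
  obtain ⟨g, hgc, hg⟩ := hd.isExactOn_ball.with_val_at c (Complex.log (h c))
  have hgd : DifferentiableOn ℂ g (ball c r) := fun z hz =>
    (hg z hz).differentiableAt.differentiableWithinAt
  refine ⟨g, hgd, ?_⟩
  have hc : c ∈ ball c r := mem_ball_self hr
  have key : ∀ z ∈ ball c r, HasDerivAt (fun z => h z * exp (-g z)) 0 z := by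
    intro z hz
    have h1 : HasDerivAt h (deriv h z) z := (hh.differentiableAt (isOpen_ball.mem_nhds hz)).hasDerivAt
    have h2 := h1.mul ((hg z hz).neg.cexp)
    refine h2.congr_deriv ?_
    have h3 : h z * (deriv h z / h z) = deriv h z := mul_div_cancel₀ _ (h0 z hz)
    linear_combination (-(exp (-g z)) : ℂ) * h3
  intro z hz
  have hconst := isOpen_ball.is_const_of_deriv_eq_zero (convex_ball c r).isPreconnected
    (f := fun z => h z * exp (-g z))
    (fun z hz => (key z hz).differentiableAt.differentiableWithinAt)
    (fun z hz => (key z hz).deriv) hz hc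
  have h1 : h c * exp (-g c) = 1 := by
    rw [hgc, Complex.exp_neg, Complex.exp_log (h0 c hc)]
    exact mul_inv_cancel₀ (h0 c hc)
  simp only [h1] at hconst
  rw [Complex.exp_neg] at hconst
  field_simp at hconst
  exact hconst

/-- The Blaschke denominator. -/
noncomputable def bden (c : ℂ) (ρ : ℝ) (a z : ℂ) : ℂ :=
  (ρ ^ 2 - (starRingEnd ℂ) (a - c) * (z - c)) / ρ

lemma bden_ne {c : ℂ} {ρ : ℝ} (hρ : 0 < ρ) {a z : ℂ} (ha : a ∈ ball c ρ) (hz : z ∈ closedBall c ρ) :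
    bden c ρ a z ≠ 0 := by
  unfold bden
  have h1 : ‖a - c‖ < ρ := by simpa [dist_eq_norm] using ha
  have h2 : ‖z - c‖ ≤ ρ := by simpa [dist_eq_norm] using hz
  refine div_ne_zero ?_ (by exact_mod_cast hρ.ne')
  intro h
  have h3 : (ρ:ℂ)^2 = (starRingEnd ℂ) (a - c) * (z - c) := sub_eq_zero.mp h
  have h4 := congrArg norm h3
  rw [norm_mul, norm_pow, RCLike.norm_conj, norm_real, Real.norm_of_nonneg hρ.le] at h4
  nlinarith [norm_nonneg (a-c), norm_nonneg (z-c)]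

lemma bden_norm_sphere {c : ℂ} {ρ : ℝ} (hρ : 0 < ρ) {a z : ℂ} (hz : z ∈ sphere c ρ) :
    ‖bden c ρ a z‖ = ‖z - a‖ := by
  unfold bden
  have h2 : ‖z - c‖ = ρ := by simpa [dist_eq_norm] using hz
  have h3 : (ρ:ℂ)^2 = (starRingEnd ℂ) (z - c) * (z - c) := by
    rw [← normSq_eq_conj_mul_self, normSq_eq_norm_sq, h2]; push_cast; ring
  rw [norm_div, h3, ← sub_mul, norm_mul, h2, norm_real, Real.norm_of_nonneg hρ.le,
    ← map_sub, RCLike.norm_conj]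
  rw [mul_div_assoc, div_self hρ.ne', mul_one]
  congr 1; ring

lemma multiset_prod_diff {U : Set ℂ} (Z : Multiset ℂ) (q : ℂ → ℂ → ℂ)
    (hq : ∀ a, DifferentiableOn ℂ (q a) U) :
    DifferentiableOn ℂ (fun z => (Z.map (fun a => q a z)).prod) U := by
  induction Z using Multiset.induction with
  | empty => simp
  | cons a Z ih =>
    simp only [Multiset.map_cons, Multiset.prod_cons]
    exact (hq a).mul ih

lemma multiset_logDeriv (Z : Multiset ℂ) (q : ℂ → ℂ → ℂ) (z : ℂ)
    (hq : ∀ a ∈ Z, DifferentiableAt ℂ (q a) z) (h0 : ∀ a ∈ Z, q a z ≠ 0) :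
    DifferentiableAt ℂ (fun z => (Z.map (fun a => q a z)).prod) z ∧
    logDeriv (fun z => (Z.map (fun a => q a z)).prod) z = (Z.map (fun a => logDeriv (q a) z)).sum := by
  induction Z using Multiset.induction with
  | empty => simp
  | cons a Z ih =>
    obtain ⟨h1, h2⟩ := ih (fun b hb => hq b (Multiset.mem_cons_of_mem hb))
      (fun b hb => h0 b (Multiset.mem_cons_of_mem hb))
    have ha := hq a (Multiset.mem_cons_self a Z)
    constructor
    · simp only [Multiset.map_cons, Multiset.prod_cons]
      exact ha.mul h1
    · simp only [Multiset.map_cons, Multiset.prod_cons, Multiset.sum_cons]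
      rw [logDeriv_mul _ (h0 a (Multiset.mem_cons_self a Z)) _ ha h1, h2]
      rw [Ne, Multiset.prod_eq_zero_iff]
      simp only [Multiset.mem_map, not_exists, not_and]
      exact fun b hb => h0 b (Multiset.mem_cons_of_mem hb)

theorem disc_lemma {c : ℂ} {ρ R : ℝ} (hR : ρ < R) (hρ : 0 < ρ) {f : ℂ → ℂ}
    (hf : DifferentiableOn ℂ f (ball c R)) (hc : f c ≠ 0) (hs : ∀ z ∈ sphere c ρ, f z ≠ 0) :
    ∃ (Z : Multiset ℂ) (g : ℂ → ℂ) (r : ℝ), ρ < r ∧ DifferentiableOn ℂ g (ball c r) ∧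
      (∀ a ∈ Z, a ∈ ball c ρ ∧ f a = 0) ∧ (∀ a ∈ ball c ρ, f a = 0 → a ∈ Z) ∧
      (∀ z ∈ sphere c ρ, (g z).re = Real.log ‖f z‖) ∧
      (Real.log ‖f c‖ = (g c).re + (Z.map (fun a => Real.log (‖c - a‖ / ρ))).sum) ∧
      (∀ z ∈ ball c ρ, f z ≠ 0 → logDeriv f z = deriv g z + (Z.map (fun a => (1 / (z - a)
        + (starRingEnd ℂ) (a - c) / (ρ ^ 2 - (starRingEnd ℂ) (a - c) * (z - c))))).sum) := by
  obtain ⟨Z, k, hk, hk0, hZ, hfk⟩ := zero_factor hR hρ _ f hf hc rfl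
  have hZb : ∀ a ∈ Z, a ∈ ball c ρ := by
    intro a ha
    have h1 := (hZ a ha).1
    rcases eq_or_lt_of_le (mem_closedBall.mp h1) with h | h
    · exact absurd (hZ a ha).2 (hs a h)
    · exact h
  set Q : ℂ → ℂ := fun z => (Z.map (fun a => bden c ρ a z)).prod with hQ
  have hqd : ∀ a, Differentiable ℂ (bden c ρ a) := by
    intro a; unfold bden; fun_prop
  have hQd : DifferentiableOn ℂ Q (ball c R) :=
    multiset_prod_diff Z (bden c ρ) (fun a => (hqd a).differentiableOn)
  have hQ0 : ∀ z ∈ closedBall c ρ, Q z ≠ 0 := by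
    intro z hz
    rw [hQ, Ne, Multiset.prod_eq_zero_iff]
    simp only [Multiset.mem_map, not_exists, not_and]
    exact fun a ha => bden_ne hρ (hZb a ha) hz
  set h : ℂ → ℂ := fun z => k z * Q z with hh
  have hhd : DifferentiableOn ℂ h (ball c R) := hk.mul hQd
  have hh0 : ∀ z ∈ closedBall c ρ, h z ≠ 0 := fun z hz => mul_ne_zero (hk0 z hz) (hQ0 z hz)
  obtain ⟨r, hr, hrR, hr0⟩ : ∃ r, ρ < r ∧ r ≤ R ∧ ∀ z ∈ ball c r, h z ≠ 0 := by
    have hopen : IsOpen (ball c R ∩ h ⁻¹' {0}ᶜ) :=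
      hhd.continuousOn.isOpen_inter_preimage isOpen_ball isOpen_compl_singleton
    obtain ⟨δ, hδ, hsub⟩ := (isCompact_closedBall c ρ).exists_cthickening_subset_open hopen
      (fun z hz => ⟨closedBall_subset_ball hR hz, hh0 z hz⟩)
    rw [cthickening_closedBall hδ.le hρ.le] at hsub
    refine ⟨min R (δ + ρ), lt_min hR (by linarith), min_le_left _ _, fun z hz => ?_⟩
    exact (hsub (ball_subset_closedBall (ball_subset_ball (min_le_right _ _) hz))).2
  obtain ⟨g, hg, hgh⟩ := exists_log_ball (hρ.trans hr) (hhd.mono (ball_subset_ball hrR)) hr0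
  have hgre : ∀ z ∈ ball c r, (g z).re = Real.log ‖h z‖ := by
    intro z hz
    rw [hgh z hz, Complex.norm_exp, Real.log_exp]
  have hfQ : ∀ z ∈ ball c R, f z * Q z = (Z.map (fun a => z - a)).prod * h z := by
    intro z hz; rw [hfk z hz]; simp only [hh]; ring
  have hcb : closedBall c ρ ⊆ ball c R := closedBall_subset_ball hR
  have hcc : c ∈ closedBall c ρ := mem_closedBall_self hρ.le
  refine ⟨Z, g, r, hr, hg, fun a ha => ⟨hZb a ha, (hZ a ha).2⟩, ?_, ?_, ?_, ?_⟩
  · intro a ha h0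
    have := hfk a (ball_subset_ball hR.le ha)
    rw [h0] at this
    have h2 := (mul_eq_zero.mp this.symm).resolve_right (hk0 a (ball_subset_closedBall ha))
    rw [Multiset.prod_eq_zero_iff] at h2
    obtain ⟨b, hb, hb2⟩ := Multiset.mem_map.mp h2
    rwa [sub_eq_zero.mp hb2]
  · intro z hz
    rw [hgre z (closedBall_subset_ball hr (sphere_subset_closedBall hz))]
    congr 1
    have hz2 := sphere_subset_closedBall hz
    have h1 := congrArg norm (hfQ z (hcb hz2))
    rw [norm_mul, norm_mul] at h1
    have h2 : ‖Q z‖ = ‖(Z.map (fun a => z - a)).prod‖ := by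
      have : ∀ W : Multiset ℂ, ‖(W.map (fun a => bden c ρ a z)).prod‖ = ‖(W.map (fun a => z - a)).prod‖ := by
        intro W
        induction W using Multiset.induction with
        | empty => simp
        | cons a W ih => simp [ih, bden_norm_sphere hρ hz]
      exact this Z
    have h3 : ‖Q z‖ ≠ 0 := norm_ne_zero_iff.mpr (hQ0 z hz2)
    rw [← h2, mul_comm] at h1
    exact (mul_left_cancel₀ h3 h1).symm
  · rw [hgre c (closedBall_subset_ball hr hcc)]
    have h1 : f c = (Z.map (fun a => (c - a) / ρ)).prod * h c := by
      have h2 := hfQ c (hcb hcc)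
      have h3 : Q c = (Z.map (fun _ => (ρ:ℂ))).prod := by
        simp only [hQ]; congr 1; apply Multiset.map_congr rfl
        intro a _
        have : (ρ:ℂ) ≠ 0 := by exact_mod_cast hρ.ne'
        simp [bden]; field_simp
      have h4 : (Z.map (fun a => c - a)).prod = (Z.map (fun a => (c - a)/ρ)).prod * Q c := by
        rw [h3, ← Multiset.prod_map_mul]; congr 1; apply Multiset.map_congr rfl
        intro a _
        have : (ρ:ℂ) ≠ 0 := by exact_mod_cast hρ.ne'
        field_simp
      rw [h4] at h2
      have h5 := hQ0 c hcc
      apply mul_right_cancel₀ h5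
      rw [h2]; ring
    have hp : ∀ W : Multiset ℂ, (∀ a ∈ W, c - a ≠ 0) →
        ‖(W.map (fun a => (c - a)/ρ)).prod‖ ≠ 0 ∧
        Real.log ‖(W.map (fun a => (c - a)/ρ)).prod‖ = (W.map (fun a => Real.log (‖c - a‖ / ρ))).sum := by
      intro W
      induction W using Multiset.induction with
      | empty => simp
      | cons a W ih =>
        intro hW
        obtain ⟨i1, i2⟩ := ih (fun b hb => hW b (Multiset.mem_cons_of_mem hb))
        have ha : ‖c - a‖ / ρ ≠ 0 := div_ne_zero (norm_ne_zero_iff.mpr (hW a (Multiset.mem_cons_self a W))) hρ.ne'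
        have e : ‖(c - a)/(ρ:ℂ)‖ = ‖c - a‖ / ρ := by
          rw [norm_div, norm_real, Real.norm_of_nonneg hρ.le]
        simp only [Multiset.map_cons, Multiset.prod_cons, Multiset.sum_cons, norm_mul, e]
        exact ⟨mul_ne_zero ha i1, by rw [Real.log_mul ha i1, i2]⟩
    obtain ⟨p1, p2⟩ := hp Z (by
      intro a ha h0
      rw [sub_eq_zero.mp h0] at hc
      exact hc (hZ a ha).2)
    rw [h1, norm_mul, Real.log_mul p1 (norm_ne_zero_iff.mpr (hh0 c hcc)), p2, add_comm]
  · intro z hz hfz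
    have hz2 := ball_subset_closedBall hz
    have hzR := hcb hz2
    have hzr : z ∈ ball c r := ball_subset_ball hr.le hz
    have hza : ∀ a ∈ Z, z - a ≠ 0 := by
      intro a ha h0
      rw [sub_eq_zero.mp h0] at hfz
      exact hfz (hZ a ha).2
    have hfd := hf.differentiableAt (isOpen_ball.mem_nhds hzR)
    have hQz := hQd.differentiableAt (isOpen_ball.mem_nhds hzR)
    obtain ⟨e1, e2⟩ := multiset_logDeriv Z (fun a z => z - a) z (by intros; fun_prop) hza
    obtain ⟨_, e3⟩ := multiset_logDeriv Z (bden c ρ) z (fun a _ => (hqd a) z) (fun a ha => bden_ne hρ (hZb a ha) hz2)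
    have hP0 : (Z.map (fun a => z - a)).prod ≠ 0 := by
      rw [Ne, Multiset.prod_eq_zero_iff]
      simp only [Multiset.mem_map, not_exists, not_and]
      exact hza
    have hdh := hhd.differentiableAt (isOpen_ball.mem_nhds hzR)
    have hdg := hg.differentiableAt (isOpen_ball.mem_nhds hzr)
    have hL : logDeriv (fun z => f z * Q z) z = logDeriv (fun z => (Z.map (fun a => z - a)).prod * h z) z := by
      have : (fun z => f z * Q z) =ᶠ[nhds z] (fun z => (Z.map (fun a => z - a)).prod * h z) := by
        filter_upwards [isOpen_ball.mem_nhds hzR] with w hw using hfQ w hw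
      simp only [logDeriv, Pi.div_apply, this.deriv_eq, this.self_of_nhds]
    rw [logDeriv_mul z hfz (hQ0 z hz2) hfd hQz, logDeriv_mul z hP0 (hh0 z hz2) e1 hdh, e2] at hL
    have hlh : logDeriv h z = deriv g z := by
      have : h =ᶠ[nhds z] (fun z => exp (g z)) := by
        filter_upwards [isOpen_ball.mem_nhds hzr] with w hw using hgh w hw
      simp only [logDeriv, Pi.div_apply, this.deriv_eq, this.self_of_nhds]
      rw [hdg.hasDerivAt.cexp.deriv]
      field_simp
    have hlQ : logDeriv Q z = (Z.map (fun a => logDeriv (bden c ρ a) z)).sum := e3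
    rw [hlh, hlQ] at hL
    rw [eq_sub_of_add_eq hL, Multiset.sum_map_add]
    have t1 : (Z.map (fun a => logDeriv (fun z => z - a) z)).sum = (Z.map (fun a => 1 / (z - a))).sum := by
      congr 1; apply Multiset.map_congr rfl; intro a _
      simp [logDeriv_apply]
    have t2 : (Z.map (fun a => logDeriv (bden c ρ a) z)).sum = - (Z.map (fun a =>
        (starRingEnd ℂ) (a - c) / (ρ ^ 2 - (starRingEnd ℂ) (a - c) * (z - c)))).sum := by
      rw [← Multiset.sum_map_neg', Multiset.map_map]
      congr 1; apply Multiset.map_congr rfl; intro a ha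
      have hb := bden_ne hρ (hZb a ha) hz2
      have hρ' : (ρ:ℂ) ≠ 0 := by exact_mod_cast hρ.ne'
      have hd : HasDerivAt (bden c ρ a) (-(starRingEnd ℂ) (a - c) / ρ) z := by
        unfold bden
        have := ((((hasDerivAt_id z).sub_const c).const_mul ((starRingEnd ℂ) (a - c))).const_sub ((ρ:ℂ)^2)).div_const (ρ:ℂ)
        simpa using this
      rw [logDeriv_apply, hd.deriv, Function.comp_apply]
      unfold bden at hb ⊢
      have hb2 : (ρ:ℂ) ^ 2 - (starRingEnd ℂ) (a - c) * (z - c) ≠ 0 := fun h => hb (by rw [h, zero_div])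
      field_simp
    rw [t1, t2]; ring
end

section
open Metric Complex Real MeasureTheory

lemma circle_cont {c : ℂ} {ρ r : ℝ} (hρ : 0 < ρ) (hr : ρ < r) {g : ℂ → ℂ}
    (hg : DifferentiableOn ℂ g (ball c r)) : Continuous fun θ : ℝ => g (circleMap c ρ θ) := by
  have h : ContinuousOn g (closedBall c ρ) := (hg.mono (closedBall_subset_ball hr)).continuousOn
  exact h.comp_continuous (continuous_circleMap c ρ) (fun θ => circleMap_mem_closedBall c hρ.le θ)

lemma circle_coef {c : ℂ} {ρ r : ℝ} (hρ : 0 < ρ) (hr : ρ < r) {g : ℂ → ℂ}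
    (hg : DifferentiableOn ℂ g (ball c r)) (j : ℕ) :
    ∫ θ in (0:ℝ)..2 * π, g (circleMap c ρ θ) * cexp (-(j * θ * I)) =
      2 * π * ρ ^ j / j.factorial * iteratedDeriv j g c := by
  have h1 := (hg.mono (closedBall_subset_ball hr)).circleIntegral_one_div_sub_center_pow_smul hρ j
  simp only [circleIntegral, deriv_circleMap, smul_eq_mul] at h1
  have hρ' : (ρ:ℂ) ≠ 0 := by exact_mod_cast hρ.ne'
  have h2 : ∀ θ : ℝ, circleMap 0 ρ θ * I * (1 / (circleMap c ρ θ - c) ^ (j + 1) * g (circleMap c ρ θ))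
      = (I / ρ ^ j) * (g (circleMap c ρ θ) * cexp (-(j * θ * I))) := by
    intro θ
    have : circleMap c ρ θ - c = ρ * cexp (θ * I) := by simp [circleMap]
    rw [this, circleMap_zero, mul_pow, ← Complex.exp_nat_mul, Complex.exp_neg]
    have e : cexp (((j+1 : ℕ):ℂ) * (θ * I)) = cexp (j * θ * I) * cexp (θ * I) := by
      rw [← Complex.exp_add]; congr 1; push_cast; ring
    rw [e]
    have := Complex.exp_ne_zero (θ * I)
    have := Complex.exp_ne_zero (j * θ * I)
    field_simp
    ring
  simp only [h2] at h1
  rw [intervalIntegral.integral_const_mul] at h1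
  have hI : I ≠ 0 := I_ne_zero
  field_simp at h1 ⊢
  rw [← h1]

lemma circle_coef_neg {c : ℂ} {ρ r : ℝ} (hρ : 0 < ρ) (hr : ρ < r) {g : ℂ → ℂ}
    (hg : DifferentiableOn ℂ g (ball c r)) (j : ℕ) (hj : 1 ≤ j) :
    ∫ θ in (0:ℝ)..2 * π, g (circleMap c ρ θ) * cexp (j * θ * I) = 0 := by
  obtain ⟨k, rfl⟩ : ∃ k, j = k + 1 := ⟨j - 1, by omega⟩
  have hd : DifferentiableOn ℂ (fun z => (z - c) ^ k * g z) (closedBall c ρ) :=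
    DifferentiableOn.mul (by fun_prop) (hg.mono (closedBall_subset_ball hr))
  have h1 := (hd.mono closure_ball_subset_closedBall).diffContOnCl.circleIntegral_eq_zero hρ.le
  simp only [circleIntegral, deriv_circleMap, smul_eq_mul] at h1
  have hρ' : (ρ:ℂ) ≠ 0 := by exact_mod_cast hρ.ne'
  have h2 : ∀ θ : ℝ, circleMap 0 ρ θ * I * ((circleMap c ρ θ - c) ^ k * g (circleMap c ρ θ))
      = (I * ρ ^ (k+1)) * (g (circleMap c ρ θ) * cexp ((k+1:ℕ) * θ * I)) := by
    intro θ
    have : circleMap c ρ θ - c = ρ * cexp (θ * I) := by simp [circleMap]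
    rw [this, circleMap_zero, mul_pow, ← Complex.exp_nat_mul]
    have e : cexp (((k+1 : ℕ):ℂ) * θ * I) = cexp (k * (θ * I)) * cexp (θ * I) := by
      rw [← Complex.exp_add]; congr 1; push_cast; ring
    rw [e]; ring
  simp only [h2] at h1
  rw [intervalIntegral.integral_const_mul] at h1
  exact (mul_eq_zero.mp h1).resolve_left (mul_ne_zero I_ne_zero (pow_ne_zero _ hρ'))

lemma circle_coef_re {c : ℂ} {ρ r : ℝ} (hρ : 0 < ρ) (hr : ρ < r) {g : ℂ → ℂ}
    (hg : DifferentiableOn ℂ g (ball c r)) (j : ℕ) (hj : 1 ≤ j) :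
    ∫ θ in (0:ℝ)..2 * π, ((g (circleMap c ρ θ)).re : ℂ) * cexp (-(j * θ * I)) =
      π * ρ ^ j / j.factorial * iteratedDeriv j g c := by
  have hc := circle_cont hρ hr hg
  have hcr : Continuous fun θ : ℝ => (g (circleMap c ρ θ)).re := Complex.continuous_re.comp hc
  have h1 := circle_coef hρ hr hg j
  have h2 := congrArg (starRingEnd ℂ) (circle_coef_neg hρ hr hg j hj)
  rw [_root_.map_zero, ← intervalIntegral.intervalIntegral_conj] at h2
  have h3 : ∀ θ : ℝ, ((g (circleMap c ρ θ)).re : ℂ) * cexp (-(j * θ * I)) =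
      (1/2) * (g (circleMap c ρ θ) * cexp (-(j * θ * I)) + (starRingEnd ℂ) (g (circleMap c ρ θ) * cexp (j * θ * I))) := by
    intro θ
    rw [Complex.re_eq_add_conj, map_mul, ← Complex.exp_conj]
    simp
    ring
  simp only [h3]
  rw [intervalIntegral.integral_const_mul, intervalIntegral.integral_add, h1, h2]
  · ring
  · apply Continuous.intervalIntegrable
    exact hc.mul (by fun_prop)
  · apply Continuous.intervalIntegrable
    exact continuous_conj.comp (hc.mul (by fun_prop))

lemma circle_mean_re {c : ℂ} {ρ r : ℝ} (hρ : 0 < ρ) (hr : ρ < r) {g : ℂ → ℂ}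
    (hg : DifferentiableOn ℂ g (ball c r)) :
    ∫ θ in (0:ℝ)..2 * π, (g (circleMap c ρ θ)).re = 2 * π * (g c).re := by
  have hc := circle_cont hρ hr hg
  have hcr : Continuous fun θ : ℝ => (g (circleMap c ρ θ)).re := Complex.continuous_re.comp hc
  have h1 := circle_coef hρ hr hg 0
  simp only [Nat.cast_zero, zero_mul, neg_zero, Complex.exp_zero, mul_one, pow_zero, Nat.factorial_zero,
    Nat.cast_one, div_one, iteratedDeriv_zero] at h1
  have h2 := congrArg Complex.re h1
  rw [show (2 * (π:ℂ) * g c) = ((2 * π : ℝ) : ℂ) * g c by push_cast; ring, Complex.re_ofReal_mul] at h2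
  rw [← h2]
  have := Complex.reCLM.intervalIntegral_comp_comm (f := fun θ : ℝ => g (circleMap c ρ θ)) (μ := volume) (a := 0) (b := 2 * π) (hc.intervalIntegrable _ _)
  simpa using this

lemma coef_bound {c : ℂ} {ρ r A : ℝ} (hρ : 0 < ρ) (hr : ρ < r) {g : ℂ → ℂ}
    (hg : DifferentiableOn ℂ g (ball c r)) (hA : ∀ z ∈ sphere c ρ, (g z).re ≤ A) (j : ℕ) (hj : 1 ≤ j) :
    ‖iteratedDeriv j g c‖ ≤ j.factorial / ρ ^ j * (2 * (A - (g c).re)) := by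
  have hc := circle_cont hρ hr hg
  have hcr : Continuous fun θ : ℝ => (g (circleMap c ρ θ)).re := Complex.continuous_re.comp hc
  have h1 := circle_coef_re hρ hr hg j hj
  have hz : ∫ θ in (0:ℝ)..2 * π, (A:ℂ) * cexp (-(j * θ * I)) = 0 := by
    have := circle_coef_re (c := c) hρ hr (g := fun _ => (A:ℂ)) (by fun_prop) j hj
    simp only [ofReal_re] at this
    rw [this, iteratedDeriv_const]
    rw [if_neg (by omega), mul_zero]
  have h2 : ∫ θ in (0:ℝ)..2 * π, ((A - (g (circleMap c ρ θ)).re : ℝ) : ℂ) * cexp (-(j * θ * I)) =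
      - (π * ρ ^ j / j.factorial * iteratedDeriv j g c) := by
    simp only [ofReal_sub, sub_mul]
    rw [intervalIntegral.integral_sub, h1, hz]
    · ring
    · apply Continuous.intervalIntegrable; fun_prop
    · apply Continuous.intervalIntegrable; fun_prop
  have h3 : ‖π * (ρ:ℂ) ^ j / j.factorial * iteratedDeriv j g c‖ ≤ 2 * π * (A - (g c).re) := by
    rw [← norm_neg, ← h2]
    refine (intervalIntegral.norm_integral_le_integral_norm (by positivity)).trans (le_of_eq ?_)
    have : ∀ θ : ℝ, ‖((A - (g (circleMap c ρ θ)).re : ℝ) : ℂ) * cexp (-(j * θ * I))‖ = A - (g (circleMap c ρ θ)).re := by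
      intro θ
      rw [norm_mul, norm_real, Real.norm_of_nonneg, show -((j:ℂ) * θ * I) = ((-(j * θ) : ℝ) : ℂ) * I by push_cast; ring,
        Complex.norm_exp_ofReal_mul_I, mul_one]
      linarith [hA _ (circleMap_mem_sphere c hρ.le θ)]
    simp only [this]
    rw [intervalIntegral.integral_sub, circle_mean_re hρ hr hg]
    · simp; ring
    · simp
    · apply Continuous.intervalIntegrable; fun_prop
  rw [norm_mul, norm_div, norm_mul, norm_pow, norm_real, norm_real, Real.norm_of_nonneg pi_pos.le,
    Real.norm_of_nonneg hρ.le, Complex.norm_natCast] at h3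
  have hf : (0:ℝ) < j.factorial := by exact_mod_cast j.factorial_pos
  have hp := pow_pos hρ j
  have h4 : ‖iteratedDeriv j g c‖ = (j.factorial / (π * ρ ^ j)) * (π * ρ ^ j / j.factorial * ‖iteratedDeriv j g c‖) := by
    field_simp
  rw [h4]
  calc _ ≤ (j.factorial / (π * ρ ^ j)) * (2 * π * (A - (g c).re)) := by gcongr
    _ = _ := by field_simp

lemma deriv_re_formula {c : ℂ} {ρ r : ℝ} (hρ : 0 < ρ) (hr : ρ < r) {g : ℂ → ℂ}
    (hg : DifferentiableOn ℂ g (ball c r)) :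
    (deriv g c).re = 1 / (π * ρ) * ∫ θ in (0:ℝ)..2 * π, (g (circleMap c ρ θ)).re * Real.cos θ := by
  have hc := circle_cont hρ hr hg
  have hcr : Continuous fun θ : ℝ => (g (circleMap c ρ θ)).re := Complex.continuous_re.comp hc
  have h1 := circle_coef_re hρ hr hg 1 le_rfl
  simp only [pow_one, Nat.factorial_one, Nat.cast_one, div_one, iteratedDeriv_one, one_mul] at h1
  have h2 := congrArg Complex.re h1
  rw [show ((π:ℂ) * ρ * deriv g c) = ((π * ρ : ℝ) : ℂ) * deriv g c by push_cast; ring, Complex.re_ofReal_mul] at h2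
  have h3 := Complex.reCLM.intervalIntegral_comp_comm (f := fun θ : ℝ => ((g (circleMap c ρ θ)).re : ℂ) * cexp (-(θ * I)))
    (μ := volume) (a := 0) (b := 2 * π) (Continuous.intervalIntegrable (by fun_prop) _ _)
  simp only [Complex.reCLM_apply] at h3
  rw [← h3] at h2
  have h4 : ∀ θ : ℝ, (((g (circleMap c ρ θ)).re : ℂ) * cexp (-(θ * I))).re = (g (circleMap c ρ θ)).re * Real.cos θ := by
    intro θ
    rw [Complex.re_ofReal_mul, ← neg_mul, ← ofReal_neg, Complex.exp_ofReal_mul_I_re, Real.cos_neg]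
  simp only [h4] at h2
  rw [h2]; field_simp

lemma iteratedDeriv_lin_inv (α β : ℂ) (j : ℕ) : ∀ z : ℂ, α + β * z ≠ 0 →
    iteratedDeriv j (fun z => (α + β * z)⁻¹) z = (-β) ^ j * j.factorial * ((α + β * z)⁻¹) ^ (j + 1) := by
  induction j with
  | zero => intro z _; simp
  | succ j ih =>
    intro z hz
    rw [iteratedDeriv_succ]
    have hev : iteratedDeriv j (fun z => (α + β * z)⁻¹) =ᶠ[nhds z]
        fun z => (-β) ^ j * j.factorial * ((α + β * z)⁻¹) ^ (j + 1) := by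
      have : ∀ᶠ w in nhds z, α + β * w ≠ 0 :=
        (continuous_const.add (continuous_const.mul continuous_id)).continuousAt.eventually_ne hz
      filter_upwards [this] with w hw using ih w hw
    rw [hev.deriv_eq]
    have h1 : HasDerivAt (fun z => α + β * z) β z := by
      simpa using ((hasDerivAt_id z).const_mul β).const_add α
    have h2 := ((h1.inv hz).pow (j+1)).const_mul ((-β) ^ j * (j.factorial:ℂ))
    refine (HasDerivAt.deriv h2).trans ?_
    rw [Nat.factorial_succ]
    push_cast
    simp only [Pi.inv_apply, Nat.add_sub_cancel]
    have e : -β / (α + β * z) ^ 2 = -β * ((α + β * z)⁻¹) ^ 2 := by rw [div_eq_mul_inv, inv_pow]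
    rw [e]
    ring

lemma lin_inv_contDiffAt (α β : ℂ) (z : ℂ) (hz : α + β * z ≠ 0) (n : ℕ) :
    ContDiffAt ℂ n (fun z => (α + β * z)⁻¹) z := by
  exact ContDiffAt.inv (by fun_prop) hz

/-- Blaschke log-derivative term. -/
noncomputable def bterm (c : ℂ) (ρ : ℝ) (a z : ℂ) : ℂ :=
  1 / (z - a) + (starRingEnd ℂ) (a - c) / (ρ ^ 2 - (starRingEnd ℂ) (a - c) * (z - c))

lemma bterm_eq (c : ℂ) (ρ : ℝ) (a : ℂ) : bterm c ρ a = fun z => (-a + 1 * z)⁻¹ +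
    (starRingEnd ℂ) (a - c) * ((ρ ^ 2 + (starRingEnd ℂ) (a - c) * c) + (-(starRingEnd ℂ) (a - c)) * z)⁻¹ := by
  funext z
  unfold bterm
  rw [one_div, div_eq_mul_inv]
  congr 2
  · ring
  · congr 1; ring

lemma bterm_contDiffAt {c : ℂ} {ρ : ℝ} (hρ : 0 < ρ) {a : ℂ} (ha : c - a ≠ 0) (n : ℕ) :
    ContDiffAt ℂ n (bterm c ρ a) c := by
  rw [bterm_eq]
  refine (lin_inv_contDiffAt _ _ _ ?_ n).add (contDiffAt_const.mul (lin_inv_contDiffAt _ _ _ ?_ n))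
  · rw [one_mul]; intro h; apply ha; linear_combination h
  · have : (ρ:ℂ) ≠ 0 := by exact_mod_cast hρ.ne'
    intro h
    exact pow_ne_zero 2 this (by linear_combination h)

lemma iteratedDeriv_bterm {c : ℂ} {ρ : ℝ} (hρ : 0 < ρ) {a : ℂ} (ha : c - a ≠ 0) (j : ℕ) :
    iteratedDeriv j (bterm c ρ a) c = (-1) ^ j * j.factorial *
      (((c - a)⁻¹) ^ (j+1) - ((starRingEnd ℂ) (c - a) / ρ ^ 2) ^ (j+1)) := by
  have hρ' : (ρ:ℂ) ≠ 0 := by exact_mod_cast hρ.ne'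
  have n1 : -a + 1 * c ≠ 0 := by rw [one_mul]; intro h; apply ha; linear_combination h
  have n2 : ((ρ:ℂ) ^ 2 + (starRingEnd ℂ) (a - c) * c) + (-(starRingEnd ℂ) (a - c)) * c ≠ 0 := by
    intro h
    exact pow_ne_zero 2 hρ' (by linear_combination h)
  rw [bterm_eq, iteratedDeriv_fun_add (lin_inv_contDiffAt _ _ _ n1 j)
    (contDiffAt_const.mul (lin_inv_contDiffAt _ _ _ n2 j)), iteratedDeriv_const_mul_field,
    iteratedDeriv_lin_inv _ _ _ _ n1, iteratedDeriv_lin_inv _ _ _ _ n2]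
  have e1 : -a + 1 * c = c - a := by ring
  have e2 : ((ρ:ℂ) ^ 2 + (starRingEnd ℂ) (a - c) * c) + (-(starRingEnd ℂ) (a - c)) * c = ρ ^ 2 := by ring
  have e3 : (starRingEnd ℂ) (a - c) = - (starRingEnd ℂ) (c - a) := by rw [← map_neg]; congr 1; ring
  rw [e1, e2, e3]
  field_simp
  have e4 : (-(1:ℂ)) ^ j * (-1) ^ j = 1 := by rw [← mul_pow]; simp
  ring

lemma iteratedDeriv_multiset_sum (Z : Multiset ℂ) (q : ℂ → ℂ → ℂ) (z : ℂ) (j : ℕ)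
    (hq : ∀ a ∈ Z, ContDiffAt ℂ j (q a) z) :
    ContDiffAt ℂ j (fun z => (Z.map (fun a => q a z)).sum) z ∧
    iteratedDeriv j (fun z => (Z.map (fun a => q a z)).sum) z = (Z.map (fun a => iteratedDeriv j (q a) z)).sum := by
  induction Z using Multiset.induction with
  | empty =>
    refine ⟨by simpa using contDiffAt_const, ?_⟩
    simp only [Multiset.map_zero, Multiset.sum_zero]
    rw [iteratedDeriv_const]; simp
  | cons a Z ih =>
    obtain ⟨h1, h2⟩ := ih (fun b hb => hq b (Multiset.mem_cons_of_mem hb))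
    have ha := hq a (Multiset.mem_cons_self a Z)
    constructor
    · simp only [Multiset.map_cons, Multiset.sum_cons]
      exact ha.add h1
    · simp only [Multiset.map_cons, Multiset.sum_cons]
      rw [iteratedDeriv_fun_add ha h1, h2]

/-- elementary inequality for one zero, at index `j+1 ≥ 2` -/
lemma zero_ineq {v ρ η X : ℝ} (hη : 0 < η) (hv : η ≤ v) (hvρ : v ≤ ρ) (hX : η ≤ X) (hq : η ≤ ρ / 2)
    (j : ℕ) (hj : 1 ≤ j) :
    v⁻¹ ^ (j+1) * (1 - (v^2/ρ^2)^(j+1)) ≤ (η⁻¹) ^ j * (X * (1/v^2 - 1/ρ^2)) +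
      2 * (ρ^2)⁻¹ * (η * η⁻¹ ^ j) * (1 - v^2/ρ^2) := by
  have hv0 : 0 < v := hη.trans_le hv
  have hρ0 : 0 < ρ := hv0.trans_le hvρ
  set x := v^2/ρ^2 with hx
  have hx1 : x ≤ 1 := by rw [hx, div_le_one (by positivity)]; gcongr
  have hx0 : 0 < x := by positivity
  obtain ⟨k, rfl⟩ : ∃ k, j = k + 1 := ⟨j-1, by omega⟩
  have hinv : v⁻¹ ≤ η⁻¹ := inv_anti₀ hη hv
  have hgeom : 1 - x ^ (k+1) = (1 - x) * ∑ i ∈ range (k+1), x ^ i := by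
    have := mul_neg_geom_sum x (k+1); linarith
  -- first part
  have p1 : v⁻¹ ^ (k+1+1) * (1 - x) ≤ (η⁻¹) ^ (k+1) * (X * (1/v^2 - 1/ρ^2)) := by
    have e : (1/v^2 - 1/ρ^2) = v⁻¹^2 * (1 - x) := by rw [hx]; field_simp
    rw [e]
    have : v⁻¹ ^ (k+1+1) * (1 - x) = (v⁻¹ ^ k) * (v⁻¹^2 * (1-x)) := by ring
    rw [this]
    have h2 : v⁻¹ ^ k ≤ (η⁻¹) ^ (k+1) * X := by
      calc v⁻¹ ^ k ≤ η⁻¹ ^ k := by gcongr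
        _ = η⁻¹ ^ (k+1) * η := by rw [pow_succ]; field_simp
        _ ≤ _ := by gcongr
    calc _ ≤ ((η⁻¹) ^ (k+1) * X) * (v⁻¹^2 * (1-x)) := by
          apply mul_le_mul_of_nonneg_right h2
          have : 0 ≤ 1 - x := by linarith
          positivity
      _ = _ := by ring
  -- second part
  have p2 : v⁻¹ ^ k * ∑ i ∈ range (k+1), x ^ i ≤ 2 * η⁻¹ ^ k := by
    rw [Finset.mul_sum]
    have hterm : ∀ i ∈ range (k+1), v⁻¹ ^ k * x ^ i ≤ η⁻¹ ^ k * (1/2) ^ i := by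
      intro i hi
      have hik : i ≤ k := by have := Finset.mem_range.mp hi; omega
      have e1 : v⁻¹ ^ k * x ^ i = v⁻¹ ^ (k - i) * (v / ρ^2) ^ i := by
        obtain ⟨m, rfl⟩ := Nat.exists_eq_add_of_le hik
        rw [Nat.add_sub_cancel_left, hx, pow_add]
        have : (v^2/ρ^2)^i = v^i * (v/ρ^2)^i := by rw [← mul_pow]; congr 1; ring
        rw [this]
        have : v⁻¹ ^ i * v ^ i = 1 := by rw [← mul_pow, inv_mul_cancel₀ hv0.ne', one_pow]
        linear_combination (v⁻¹ ^ m * (v/ρ^2)^i) * this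
      have e2 : η⁻¹ ^ k * (1/2:ℝ)^i = η⁻¹ ^ (k-i) * (η⁻¹ * (1/2)) ^ i := by
        obtain ⟨m, rfl⟩ := Nat.exists_eq_add_of_le hik
        rw [Nat.add_sub_cancel_left, pow_add, mul_pow]; ring
      rw [e1, e2]
      have h3 : v / ρ^2 ≤ η⁻¹ * (1/2) := by
        rw [div_le_iff₀ (by positivity)]
        have : η⁻¹ * (1/2) * ρ^2 = (ρ / (2 * η)) * ρ := by field_simp
        rw [this]
        have : 1 ≤ ρ / (2*η) := by rw [le_div_iff₀ (by positivity)]; linarith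
        nlinarith
      gcongr
    refine (Finset.sum_le_sum hterm).trans ?_
    rw [← Finset.mul_sum]
    have : ∑ i ∈ range (k+1), (1/2:ℝ)^i ≤ 2 := by
      have := mul_neg_geom_sum (1/2:ℝ) (k+1)
      have h : (0:ℝ) ≤ (1/2)^(k+1) := by positivity
      linarith
    have h0 : 0 ≤ η⁻¹ ^ k := by positivity
    nlinarith
  have e : v⁻¹ ^ (k+1+1) * (1 - x^(k+1+1)) = v⁻¹ ^ (k+1+1) * (1 - x)
      + (ρ^2)⁻¹ * (v⁻¹ ^ k * ∑ i ∈ range (k+1), x ^ i) * (1 - x) := by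
    have : v⁻¹ ^ (k+1+1) * x = (ρ^2)⁻¹ * v⁻¹ ^ k := by
      rw [hx, pow_succ, pow_succ]; field_simp
    have h1 : 1 - x^(k+1+1) = (1-x) + x * (1 - x^(k+1)) := by ring
    rw [h1, hgeom]
    linear_combination ((1-x) * ∑ i ∈ range (k+1), x ^ i) * this
  rw [e]
  have e5 : η * η⁻¹ ^ (k+1) = η⁻¹ ^ k := by rw [pow_succ]; field_simp
  rw [e5]
  have : (ρ^2)⁻¹ * (v⁻¹ ^ k * ∑ i ∈ range (k+1), x ^ i) * (1 - x) ≤ 2 * (ρ^2)⁻¹ * η⁻¹ ^ k * (1 - x) := by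
    apply mul_le_mul_of_nonneg_right _ (by linarith)
    calc _ ≤ (ρ^2)⁻¹ * (2 * η⁻¹ ^ k) := by gcongr
      _ = _ := by ring
  linarith

lemma bterm_re (c : ℂ) (ρ : ℝ) (a : ℂ) :
    (bterm c ρ a c).re = (c - a).re * (1 / ‖c - a‖ ^ 2 - 1 / ρ ^ 2) := by
  unfold bterm
  have e3 : (starRingEnd ℂ) (a - c) = - (starRingEnd ℂ) (c - a) := by rw [← map_neg]; congr 1; ring
  rw [sub_self, mul_zero, sub_zero, e3, Complex.add_re, one_div, Complex.inv_re,
    show ((ρ:ℂ)^2) = ((ρ^2:ℝ):ℂ) by push_cast; rfl, Complex.div_ofReal_re, Complex.normSq_eq_norm_sq]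
  simp only [Complex.neg_re, Complex.conj_re]
  ring

lemma multiset_re_sum (Z : Multiset ℂ) (q : ℂ → ℂ) :
    ((Z.map q).sum).re = (Z.map (fun a => (q a).re)).sum := by
  induction Z using Multiset.induction with
  | empty => simp
  | cons a Z ih => simp [ih]

theorem disc_re {f : ℂ → ℂ} {c : ℂ} {ρ R B : ℝ} (hR : ρ < R) (hρ : 0 < ρ)
    (hf : DifferentiableOn ℂ f (ball c R)) (hc : f c ≠ 0) (hs : ∀ z ∈ sphere c ρ, f z ≠ 0)
    (hz : ∀ a ∈ ball c ρ, f a = 0 → 0 ≤ (c - a).re)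
    (hB : -(1 / (π * ρ) * ∫ θ in (0:ℝ)..(2 * π), Real.log ‖f (circleMap c ρ θ)‖ * Real.cos θ) ≤ B) :
    -(logDeriv f c).re ≤ B ∧ ∀ a ∈ ball c ρ, f a = 0 →
      -(logDeriv f c).re + (c - a).re * (1 / ‖c - a‖ ^ 2 - 1 / ρ ^ 2) ≤ B := by
  obtain ⟨Z, g, r, hr, hg, hZ1, hZ2, hgs, hJ, hld⟩ := disc_lemma hR hρ hf hc hs
  have h1 := deriv_re_formula hρ hr hg
  have h2 : ∀ θ, (g (circleMap c ρ θ)).re = Real.log ‖f (circleMap c ρ θ)‖ := fun θ =>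
    hgs _ (circleMap_mem_sphere c hρ.le θ)
  simp only [h2] at h1
  have h3 := hld c (mem_ball_self hρ) hc
  have h4 : (logDeriv f c).re = (deriv g c).re +
      (Z.map (fun a => (c - a).re * (1 / ‖c - a‖ ^ 2 - 1 / ρ ^ 2))).sum := by
    rw [h3, Complex.add_re, multiset_re_sum]
    congr 3
    funext a
    exact bterm_re c ρ a
  have hnn : ∀ a ∈ Z, 0 ≤ (c - a).re * (1 / ‖c - a‖ ^ 2 - 1 / ρ ^ 2) := by
    intro a ha
    obtain ⟨ha1, ha2⟩ := hZ1 a ha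
    apply mul_nonneg (hz a ha1 ha2)
    have hv : ‖c - a‖ < ρ := by rw [← dist_eq_norm, dist_comm]; exact ha1
    have hv0 : 0 < ‖c - a‖ := by
      rw [norm_pos_iff, sub_ne_zero]; rintro rfl; exact hc ha2
    rw [sub_nonneg]
    apply one_div_le_one_div_of_le (by positivity)
    gcongr
  have hS : ∀ x ∈ (Z.map (fun a => (c - a).re * (1 / ‖c - a‖ ^ 2 - 1 / ρ ^ 2))), 0 ≤ x := by
    intro x hx
    obtain ⟨a, ha, rfl⟩ := Multiset.mem_map.mp hx
    exact hnn a ha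
  constructor
  · have := Multiset.sum_nonneg hS
    rw [h4]; linarith
  · intro a ha hfa
    have := Multiset.single_le_sum hS _ (Multiset.mem_map_of_mem (fun a => (c - a).re * (1 / ‖c - a‖ ^ 2 - 1 / ρ ^ 2)) (hZ2 a ha hfa))
    rw [h4]; linarith

lemma multiset_sum_le (Z : Multiset ℂ) (p q : ℂ → ℝ) (h : ∀ a ∈ Z, p a ≤ q a) :
    (Z.map p).sum ≤ (Z.map q).sum := Multiset.sum_map_le_sum_map p q h

lemma multiset_norm_sum (Z : Multiset ℂ) (p : ℂ → ℂ) :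
    ‖(Z.map p).sum‖ ≤ (Z.map (fun a => ‖p a‖)).sum := by
  induction Z using Multiset.induction with
  | empty => simp
  | cons a Z ih => simp only [Multiset.map_cons, Multiset.sum_cons]; exact (norm_add_le _ _).trans (by gcongr)

theorem disc_package {f : ℂ → ℂ} {c : ℂ} {ρ R B A η : ℝ} (hR : ρ < R) (hρ : 0 < ρ)
    (hf : DifferentiableOn ℂ f (ball c R)) (hc : f c ≠ 0) (hs : ∀ z ∈ sphere c ρ, f z ≠ 0)
    (hη : 0 < η) (hηρ : η ≤ ρ / 2)
    (hz : ∀ a ∈ ball c ρ, f a = 0 → η ≤ (c - a).re)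
    (hA : ∀ z ∈ sphere c ρ, Real.log ‖f z‖ ≤ A)
    (hB : -(1 / (π * ρ) * ∫ θ in (0:ℝ)..(2 * π), Real.log ‖f (circleMap c ρ θ)‖ * Real.cos θ) ≤ B)
    (j : ℕ) (hj : 1 ≤ j) :
    ‖iteratedDeriv j (logDeriv f) c‖ ≤ j.factorial * (η⁻¹) ^ j *
      ((logDeriv f c).re + B + 4 * (ρ ^ 2)⁻¹ * η * (A - Real.log ‖f c‖)) := by
  obtain ⟨Z, g, r, hr, hg, hZ1, hZ2, hgs, hJ, hld⟩ := disc_lemma hR hρ hf hc hs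
  have h1 := deriv_re_formula hρ hr hg
  have h2 : ∀ θ, (g (circleMap c ρ θ)).re = Real.log ‖f (circleMap c ρ θ)‖ := fun θ =>
    hgs _ (circleMap_mem_sphere c hρ.le θ)
  simp only [h2] at h1
  have h3 := hld c (mem_ball_self hρ) hc
  have h4 : (logDeriv f c).re = (deriv g c).re +
      (Z.map (fun a => (c - a).re * (1 / ‖c - a‖ ^ 2 - 1 / ρ ^ 2))).sum := by
    rw [h3, Complex.add_re, multiset_re_sum]
    congr 3
    funext a
    exact bterm_re c ρ a
  set S := (Z.map (fun a => (c - a).re * (1 / ‖c - a‖ ^ 2 - 1 / ρ ^ 2))).sum with hS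
  have hS' : S ≤ (logDeriv f c).re + B := by rw [h4]; linarith
  set T := (Z.map (fun a => -Real.log (‖c - a‖ / ρ))).sum with hT
  have hT' : (Z.map (fun a => Real.log (‖c - a‖ / ρ))).sum = - T := by
    rw [hT, Multiset.sum_map_neg, neg_neg]
  have hA' : ∀ z ∈ sphere c ρ, (g z).re ≤ A := fun z hz => by rw [hgs z hz]; exact hA z hz
  have hcoef := fun k hk => coef_bound hρ hr hg hA' k hk
  have hgc : (g c).re = Real.log ‖f c‖ + T := by rw [hJ, hT']; ring
  have hne : ∀ a ∈ Z, c - a ≠ 0 := by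
    intro a ha h
    obtain ⟨ha1, ha2⟩ := hZ1 a ha
    rw [sub_eq_zero] at h; subst h; exact hc ha2
  -- pos of A - re g
  have hpos : 0 ≤ A - (g c).re := by
    have := (norm_nonneg _).trans (hcoef 1 le_rfl)
    by_contra hcon
    push Not at hcon
    have h5 : (Nat.factorial 1 : ℝ) / ρ ^ 1 > 0 := by positivity
    nlinarith
  -- formula for iterated derivative
  have hev : logDeriv f =ᶠ[nhds c] fun z => deriv g z + (Z.map (fun a => bterm c ρ a z)).sum := by
    have hb : ∀ᶠ z in nhds c, z ∈ ball c ρ := isOpen_ball.mem_nhds (mem_ball_self hρ)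
    have hc0 : ContinuousAt f c := (hf.differentiableAt (isOpen_ball.mem_nhds (mem_ball_self (hρ.trans hR)))).continuousAt
    filter_upwards [hb, hc0.eventually_ne hc] with z h1 h2
    exact hld z h1 h2
  have hgan : AnalyticAt ℂ g c := (hg.analyticOnNhd isOpen_ball) c (mem_ball_self (hρ.trans hr))
  obtain ⟨s1, s2⟩ := iteratedDeriv_multiset_sum Z (bterm c ρ) c j (fun a ha => bterm_contDiffAt hρ (hne a ha) j)
  have hform : iteratedDeriv j (logDeriv f) c = iteratedDeriv (j+1) g c +
      (Z.map (fun a => iteratedDeriv j (bterm c ρ a) c)).sum := by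
    rw [hev.iteratedDeriv_eq, iteratedDeriv_fun_add hgan.deriv.contDiffAt s1, s2, iteratedDeriv_succ']
  have hsum : ‖(Z.map (fun a => iteratedDeriv j (bterm c ρ a) c)).sum‖ ≤
      j.factorial * ((η⁻¹) ^ j * S + 2 * (ρ^2)⁻¹ * (η * η⁻¹ ^ j) * (2 * T)) := by
    refine (multiset_norm_sum _ _).trans ?_
    have e : (j.factorial * ((η⁻¹) ^ j * S + 2 * (ρ^2)⁻¹ * (η * η⁻¹ ^ j) * (2 * T)) : ℝ) =
      (Z.map (fun a => (j.factorial * η⁻¹ ^ j) * ((c - a).re * (1 / ‖c - a‖ ^ 2 - 1 / ρ ^ 2)) +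
        (j.factorial * (2 * (ρ^2)⁻¹ * (η * η⁻¹ ^ j) * 2)) * (-Real.log (‖c - a‖ / ρ)))).sum := by
      rw [Multiset.sum_map_add, Multiset.sum_map_mul_left, Multiset.sum_map_mul_left, ← hS, ← hT]; ring
    rw [e]
    apply multiset_sum_le
    intro a ha
    obtain ⟨ha1, ha2⟩ := hZ1 a ha
    have hv : ‖c - a‖ < ρ := by rw [← dist_eq_norm, dist_comm]; exact ha1
    have hv0 : 0 < ‖c - a‖ := norm_pos_iff.mpr (hne a ha)
    have hX := hz a ha1 ha2
    have hvη : η ≤ ‖c - a‖ := hX.trans ((le_abs_self _).trans (Complex.abs_re_le_norm _))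
    have hi := zero_ineq hη hvη hv.le hX hηρ j hj
    rw [iteratedDeriv_bterm hρ (hne a ha)]
    have en : ‖((c - a)⁻¹) ^ (j+1) - ((starRingEnd ℂ) (c - a) / ρ ^ 2) ^ (j+1)‖ =
        ‖c-a‖⁻¹ ^ (j+1) * (1 - (‖c-a‖^2/ρ^2)^(j+1)) := by
      have hρ' : (ρ:ℂ) ≠ 0 := by exact_mod_cast hρ.ne'
      have : (starRingEnd ℂ) (c - a) / ρ ^ 2 = (c-a)⁻¹ * ((‖c-a‖^2/ρ^2 : ℝ) : ℂ) := by
        have h := Complex.conj_mul' (c - a)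
        have h0 := hne a ha
        push_cast
        rw [← h]; field_simp
      rw [this, mul_pow]
      have e2 : (c-a)⁻¹ ^ (j+1) - (c-a)⁻¹ ^ (j+1) * ((‖c-a‖^2/ρ^2 : ℝ) : ℂ)^(j+1) =
          (c-a)⁻¹ ^ (j+1) * ((1 - (‖c-a‖^2/ρ^2)^(j+1) : ℝ) : ℂ) := by push_cast; ring
      rw [e2, norm_mul, norm_pow, norm_inv, Complex.norm_real, Real.norm_of_nonneg]
      rw [sub_nonneg]
      apply pow_le_one₀ (by positivity)
      rw [div_le_one (by positivity)]
      gcongr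
    rw [norm_mul, norm_mul, norm_pow, norm_neg, norm_one, one_pow, one_mul, en, Complex.norm_natCast]
    have hlog : 1 - ‖c-a‖^2/ρ^2 ≤ 2 * (-Real.log (‖c - a‖ / ρ)) := by
      have h := Real.log_le_sub_one_of_pos (show 0 < ‖c-a‖^2/ρ^2 by positivity)
      rw [← div_pow, Real.log_pow] at h
      push_cast at h
      rw [← div_pow]
      linarith
    have hfac : (0:ℝ) < j.factorial := by exact_mod_cast Nat.factorial_pos j
    have hk : 0 ≤ 2 * (ρ^2)⁻¹ * (η * η⁻¹ ^ j) := by positivity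
    have hm := mul_le_mul_of_nonneg_left hlog hk
    calc _ ≤ (j.factorial:ℝ) * ((η⁻¹) ^ j * ((c-a).re * (1/‖c-a‖^2 - 1/ρ^2)) +
      2 * (ρ^2)⁻¹ * (η * η⁻¹ ^ j) * (2 * (-Real.log (‖c - a‖ / ρ)))) := by
          apply mul_le_mul_of_nonneg_left _ hfac.le
          linarith
      _ = _ := by ring
  have hg1 : ‖iteratedDeriv (j+1) g c‖ ≤ j.factorial * (4 * (ρ^2)⁻¹ * (η * η⁻¹ ^ j) * (A - (g c).re)) := by
    refine (hcoef (j+1) (by omega)).trans ?_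
    have hk : ((j:ℝ)+1) / ρ^(j+1) ≤ 2 * (ρ^2)⁻¹ * (η * η⁻¹ ^ j) := by
      obtain ⟨k, rfl⟩ : ∃ k, j = k + 1 := ⟨j-1, by omega⟩
      have e5 : η * η⁻¹ ^ (k+1) = η⁻¹ ^ k := by rw [pow_succ]; field_simp
      rw [e5]
      have h6 : (((k+1:ℕ):ℝ)+1) ≤ 2 * 2 ^ k := by
        have : k + 1 + 1 ≤ 2 * 2 ^ k := by
          have := Nat.lt_two_pow_self (n := k); omega
        exact_mod_cast this
      have h7 : 2 * ρ⁻¹ ≤ η⁻¹ := by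
        rw [← div_eq_mul_inv, div_le_iff₀ hρ, inv_mul_eq_div, le_div_iff₀ hη]; linarith
      have h8 : (2:ℝ)^k * ρ⁻¹ ^ k ≤ η⁻¹ ^ k := by rw [← mul_pow]; gcongr
      calc (((k+1:ℕ):ℝ)+1) / ρ^(k+1+1) = (((k+1:ℕ):ℝ)+1) * (ρ⁻¹ ^ k * (ρ^2)⁻¹) := by
            rw [div_eq_mul_inv]; congr 1; rw [inv_pow, ← mul_inv]; congr 1; ring
        _ ≤ (2 * 2 ^ k) * (ρ⁻¹ ^ k * (ρ^2)⁻¹) := by gcongr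
        _ = 2 * (ρ^2)⁻¹ * (2^k * ρ⁻¹^k) := by ring
        _ ≤ _ := by gcongr
    have e : ((j+1).factorial : ℝ) / ρ ^ (j+1) * (2 * (A - (g c).re)) =
        j.factorial * (((j:ℝ)+1) / ρ^(j+1)) * (2 * (A - (g c).re)) := by
      rw [Nat.factorial_succ]; push_cast; ring
    rw [e]
    calc _ ≤ j.factorial * (2 * (ρ^2)⁻¹ * (η * η⁻¹ ^ j)) * (2 * (A - (g c).re)) := by gcongr
      _ = _ := by ring
  rw [hform]
  refine (norm_add_le _ _).trans ((add_le_add hg1 hsum).trans ?_)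
  rw [hgc]
  have hfac : (0:ℝ) < j.factorial := by exact_mod_cast Nat.factorial_pos j
  have hk : 0 ≤ j.factorial * (η⁻¹) ^ j := by positivity
  have := mul_le_mul_of_nonneg_left hS' hk
  calc _ = (j.factorial * (η⁻¹) ^ j) * S + (j.factorial * (η⁻¹) ^ j) * (4 * (ρ ^ 2)⁻¹ * η * (A - Real.log ‖f c‖)) := by ring
    _ ≤ _ := by linarith

/-- trapezoid error term multiplied by `s - 1` -/
noncomputable def tz (n : ℕ) (s : ℂ) : ℂ :=
  (s - 1) / 2 * ((n:ℂ) ^ (-s) + ((n:ℂ) + 1) ^ (-s)) - ((n:ℂ) ^ (1 - s) - ((n:ℂ) + 1) ^ (1 - s))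

lemma cpow_deriv {x : ℝ} (hx : 0 < x) (r : ℂ) :
    HasDerivAt (fun y : ℝ => (y : ℂ) ^ r) (r * x ^ (r - 1)) x := by
  have : (x:ℂ) ∈ slitPlane := Or.inl (by simpa using hx)
  exact (hasStrictDerivAt_cpow_const this).hasDerivAt.comp_ofReal

lemma tz_integral (n : ℕ) (hn : 1 ≤ n) (s : ℂ) :
    tz n s = ((s - 1) * s * (s + 1) / 2) * ∫ x in (n:ℝ)..(n+1:ℝ),
      (((x - n) * (n + 1 - x) : ℝ) : ℂ) * (x:ℂ) ^ (-s - 2) := by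
  have hn0 : (0:ℝ) < n := by exact_mod_cast hn
  set Q : ℝ → ℂ := fun x => (s-1) * ((((x - n) * (n + 1 - x) : ℝ) : ℂ) * (-s * (x:ℂ) ^ (-s-1))
    - ((2 * n + 1 - 2 * x : ℝ):ℂ) * (x:ℂ)^(-s)) + 2 * (x:ℂ)^(1-s) with hQ
  have hpos : ∀ x ∈ Set.uIcc (n:ℝ) (n+1), 0 < x := by
    intro x hx; rw [Set.uIcc_of_le (by linarith)] at hx; linarith [hx.1]
  have hd : ∀ x ∈ Set.uIcc (n:ℝ) (n+1), HasDerivAt Q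
      (((s - 1) * s * (s + 1)) * ((((x - n) * (n + 1 - x) : ℝ) : ℂ) * (x:ℂ) ^ (-s - 2))) x := by
    intro x hx
    have hx0 := hpos x hx
    have h1 := cpow_deriv hx0 (-s-1)
    have h2 := cpow_deriv hx0 (-s)
    have h3 := cpow_deriv hx0 (1-s)
    have q1 : HasDerivAt (fun x : ℝ => (((x - n) * (n + 1 - x) : ℝ) : ℂ)) ((2 * n + 1 - 2 * x : ℝ):ℂ) x := by
      apply HasDerivAt.ofReal_comp
      refine (((hasDerivAt_id x).sub_const (n:ℝ)).mul ((hasDerivAt_id x).const_sub ((n:ℝ)+1))).congr_deriv ?_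
      simp; ring
    have q2 : HasDerivAt (fun x : ℝ => ((2 * n + 1 - 2 * x : ℝ):ℂ)) ((-2:ℝ):ℂ) x := by
      apply HasDerivAt.ofReal_comp
      refine (((hasDerivAt_id x).const_mul 2).const_sub (2*(n:ℝ)+1)).congr_deriv ?_
      simp
    have := (((q1.mul (h1.const_mul (-s))).sub (q2.mul h2)).const_mul (s-1)).add (h3.const_mul 2)
    refine this.congr_deriv ?_
    rw [show -s - 1 - 1 = -s-2 by ring, show 1 - s - 1 = -s by ring]
    push_cast
    ring
  have hcont : ContinuousOn (fun x : ℝ => ((s - 1) * s * (s + 1)) * ((((x - n) * (n + 1 - x) : ℝ) : ℂ) * (x:ℂ) ^ (-s - 2)))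
      (Set.uIcc (n:ℝ) (n+1)) := by
    apply continuousOn_const.mul
    apply ContinuousOn.mul
    · exact (Complex.continuous_ofReal.comp (by fun_prop)).continuousOn
    · intro x hx
      exact (cpow_deriv (hpos x hx) (-s-2)).continuousAt.continuousWithinAt
  have hI := intervalIntegral.integral_eq_sub_of_hasDerivAt hd hcont.intervalIntegrable
  rw [intervalIntegral.integral_const_mul] at hI
  have e : tz n s = (1/2) * (Q (n+1) - Q n) := by
    simp only [hQ, tz]
    push_cast
    ring
  rw [e, ← hI]; ring

lemma tz_bound (n : ℕ) (hn : 1 ≤ n) (s : ℂ) (hs : -1 < s.re) :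
    ‖tz n s‖ ≤ ‖s - 1‖ * ‖s‖ * ‖s + 1‖ / (8 * (s.re + 1)) *
      ((n:ℝ) ^ (-(s.re + 1)) - ((n:ℝ)+1) ^ (-(s.re + 1))) := by
  have hn0 : (0:ℝ) < n := by exact_mod_cast hn
  rw [tz_integral n hn s, norm_mul, norm_div, norm_mul, norm_mul]
  have h1 : ‖∫ x in (n:ℝ)..(n+1:ℝ), (((x - n) * (n + 1 - x) : ℝ) : ℂ) * (x:ℂ) ^ (-s - 2)‖ ≤
      ∫ x in (n:ℝ)..(n+1:ℝ), (1/4) * x ^ (-s.re - 2) := by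
    apply intervalIntegral.norm_integral_le_of_norm_le (by linarith)
    · refine Eventually.of_forall fun x hx => ?_
      have hx0 : 0 < x := hn0.trans hx.1
      rw [norm_mul, Complex.norm_real, Complex.norm_cpow_eq_rpow_re_of_pos hx0]
      have : ‖(x - n) * (n + 1 - x)‖ ≤ 1/4 := by
        rw [Real.norm_of_nonneg (mul_nonneg (by linarith [hx.1]) (by linarith [hx.2]))]
        nlinarith [sq_nonneg (x - n - 1/2)]
      have e : (-s - 2).re = -s.re - 2 := by simp
      rw [e]
      gcongr
    · apply ContinuousOn.intervalIntegrable
      intro x hx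
      rw [Set.uIcc_of_le (by linarith)] at hx
      have hx0 : x ≠ 0 := by linarith [hx.1]
      exact (continuousAt_const.mul (Real.continuousAt_rpow_const _ _ (Or.inl hx0))).continuousWithinAt
  have h2 : ∫ x in (n:ℝ)..(n+1:ℝ), (1/4) * x ^ (-s.re - 2) =
     1/(4*(s.re+1)) * ((n:ℝ) ^ (-(s.re + 1)) - ((n:ℝ)+1) ^ (-(s.re + 1))) := by
    rw [intervalIntegral.integral_const_mul, integral_rpow]
    · rw [show -s.re - 2 + 1 = -(s.re+1) by ring]
      have : s.re + 1 ≠ 0 := by linarith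
      field_simp
      ring
    · right
      refine ⟨by linarith, ?_⟩
      rw [Set.uIcc_of_le (by linarith)]
      intro h; linarith [h.1]
  rw [h2] at h1
  calc _ ≤ ‖s - 1‖ * ‖s‖ * ‖s + 1‖ / ‖(2:ℂ)‖ * (1/(4*(s.re+1)) * ((n:ℝ) ^ (-(s.re + 1)) - ((n:ℝ)+1) ^ (-(s.re + 1)))) := by gcongr
    _ = _ := by
      have : s.re + 1 ≠ 0 := by linarith
      simp only [Complex.norm_ofNat]
      field_simp
      ring

lemma tz_differentiable (n : ℕ) (hn : 1 ≤ n) : Differentiable ℂ (tz n) := by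
  have h1 : (n:ℂ) ≠ 0 := by exact_mod_cast (by omega : n ≠ 0)
  have h2 : (n:ℂ) + 1 ≠ 0 := by exact_mod_cast (by omega : n + 1 ≠ 0)
  have d1 : Differentiable ℂ fun s : ℂ => (n:ℂ) ^ (-s) := fun s => (differentiableAt_id.neg).const_cpow (Or.inl h1)
  have d2 : Differentiable ℂ fun s : ℂ => ((n:ℂ)+1) ^ (-s) := fun s => (differentiableAt_id.neg).const_cpow (Or.inl h2)
  have d3 : Differentiable ℂ fun s : ℂ => (n:ℂ) ^ (1-s) := fun s => (differentiableAt_id.const_sub 1).const_cpow (Or.inl h1)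
  have d4 : Differentiable ℂ fun s : ℂ => ((n:ℂ)+1) ^ (1-s) := fun s => (differentiableAt_id.const_sub 1).const_cpow (Or.inl h2)
  unfold tz
  fun_prop

/-- telescoping real sequence -/
lemma tele_hasSum (a : ℝ) (ha : 0 < a) (N : ℕ) :
    HasSum (fun k : ℕ => ((N + k : ℕ):ℝ) ^ (-a) - (((N + k : ℕ):ℝ) + 1) ^ (-a)) ((N:ℝ) ^ (-a)) := by
  have hnn : ∀ k : ℕ, 1 ≤ N + k → 0 ≤ ((N + k : ℕ):ℝ) ^ (-a) - (((N + k : ℕ):ℝ) + 1) ^ (-a) := by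
    intro k hk
    rw [sub_nonneg]
    have : (0:ℝ) < ((N+k:ℕ):ℝ) := by exact_mod_cast hk
    exact Real.rpow_le_rpow_of_nonpos this (by linarith) (by linarith)
  have hsum : ∀ K : ℕ, ∑ k ∈ range K, (((N + k : ℕ):ℝ) ^ (-a) - (((N + k : ℕ):ℝ) + 1) ^ (-a)) =
      (N:ℝ)^(-a) - ((N + K : ℕ):ℝ)^(-a) := by
    intro K
    induction K with
    | zero => simp
    | succ K ih => rw [sum_range_succ, ih]; push_cast; ring_nf
  have hlim : Tendsto (fun K : ℕ => (N:ℝ)^(-a) - ((N + K : ℕ):ℝ)^(-a)) atTop (nhds ((N:ℝ)^(-a))) := by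
    have h : Tendsto (fun K : ℕ => ((N + K : ℕ):ℝ)^(-a)) atTop (nhds 0) :=
      (tendsto_rpow_neg_atTop ha).comp (tendsto_natCast_atTop_atTop.comp (tendsto_atTop_mono (fun K => Nat.le_add_left K N) tendsto_id))
    simpa using tendsto_const_nhds.sub h
  have habs : Summable (fun k : ℕ => ((N + k : ℕ):ℝ) ^ (-a) - (((N + k : ℕ):ℝ) + 1) ^ (-a)) := by
    rw [← summable_nat_add_iff 1]
    apply summable_of_sum_range_le (c := ((N+1:ℕ):ℝ)^(-a))
    · intro k; exact hnn (k+1) (by omega)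
    · intro K
      have : ∑ k ∈ range K, (((N + (k+1) : ℕ):ℝ) ^ (-a) - (((N + (k+1) : ℕ):ℝ) + 1) ^ (-a)) =
        ((N+1:ℕ):ℝ)^(-a) - ((N + 1 + K : ℕ):ℝ)^(-a) := by
        induction K with
        | zero => simp
        | succ K ih => rw [sum_range_succ, ih]; push_cast; ring_nf
      rw [this]
      have : 0 ≤ ((N + 1 + K : ℕ):ℝ)^(-a) := by positivity
      linarith
  have := habs.hasSum.tendsto_sum_nat
  simp only [hsum] at this
  rw [← tendsto_nhds_unique this hlim]
  exact habs.hasSum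

lemma tz_summable (N : ℕ) (hN : 1 ≤ N) (s : ℂ) (hs : -1 < s.re) : Summable (fun k : ℕ => tz (N + k) s) := by
  have h := (tele_hasSum (s.re+1) (by linarith) N).summable.mul_left (‖s - 1‖ * ‖s‖ * ‖s + 1‖ / (8 * (s.re + 1)))
  exact Summable.of_norm_bounded h (fun k => tz_bound (N+k) (by omega) s hs)

lemma tz_tsum_bound (N : ℕ) (hN : 1 ≤ N) (s : ℂ) (hs : -1 < s.re) : ‖∑' k : ℕ, tz (N + k) s‖ ≤
    ‖s - 1‖ * ‖s‖ * ‖s + 1‖ / (8 * (s.re + 1)) * (N:ℝ) ^ (-(s.re + 1)) := by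
  have h := (tele_hasSum (s.re+1) (by linarith) N).mul_left (‖s - 1‖ * ‖s‖ * ‖s + 1‖ / (8 * (s.re + 1)))
  exact tsum_of_norm_bounded h (fun k => tz_bound (N+k) (by omega) s hs)

lemma tz_sum (N K : ℕ) (s : ℂ) : ∑ k ∈ range K, tz (N + k) s =
    (s - 1) * (∑ k ∈ range K, ((N + k : ℕ):ℂ) ^ (-s) - 1/2 * (N:ℂ)^(-s) + 1/2 * ((N + K : ℕ):ℂ)^(-s))
    - ((N:ℂ)^(1-s) - ((N+K:ℕ):ℂ)^(1-s)) := by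
  induction K with
  | zero => simp
  | succ K ih =>
    rw [sum_range_succ, sum_range_succ, ih, tz]
    push_cast
    ring_nf

lemma zeta1_of_re_gt (s : ℂ) (hs : 1 < s.re) :
    riemannZeta₁ s = 1 + (s - 1) / 2 + ∑' k : ℕ, tz (1 + k) s := by
  have hs1 : s ≠ 1 := by rintro rfl; simp at hs
  have h1 := (tz_summable 1 le_rfl s (by linarith)).hasSum.tendsto_sum_nat
  simp only [tz_sum] at h1
  have hz := zeta_eq_tsum_one_div_nat_add_one_cpow hs
  have hsum : Summable fun n : ℕ => 1 / ((n:ℂ) + 1) ^ s := by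
    have := (summable_nat_add_iff 1).mpr (Complex.summable_one_div_nat_cpow.mpr hs)
    simpa using this
  have h2 := hsum.hasSum.tendsto_sum_nat
  rw [← hz] at h2
  have aux : ∀ r : ℂ, r.re < 0 → Tendsto (fun K : ℕ => ((1 + K : ℕ):ℂ) ^ r) atTop (nhds 0) := by
    intro r hr
    rw [tendsto_zero_iff_norm_tendsto_zero]
    have h : Tendsto (fun K : ℕ => ((1 + K : ℕ):ℝ)^(-(-r.re))) atTop (nhds 0) :=
      (tendsto_rpow_neg_atTop (by linarith)).comp (tendsto_natCast_atTop_atTop.comp (tendsto_atTop_mono (fun K => Nat.le_add_left K 1) tendsto_id))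
    refine h.congr fun K => ?_
    rw [neg_neg, Complex.norm_natCast_cpow_of_pos (by omega)]
  have h3 := aux (-s) (by simp; linarith)
  have h4 := aux (1-s) (by simp; linarith)
  have h5 := (((h2.sub_const (1/2 * ((1:ℕ):ℂ)^(-s))).add (h3.const_mul (1/2))).const_mul (s-1)).sub
    ((h4.const_sub (((1:ℕ):ℂ)^(1-s))))
  have h6 := tendsto_nhds_unique h1 (h5.congr fun K => by
    simp only [one_div, Complex.cpow_neg]
    push_cast
    simp only [add_comm])
  rw [h6, riemannZeta₁]
  rw [riemannZeta_eq_inv_sub_add hs1]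
  have : s - 1 ≠ 0 := sub_ne_zero.mpr hs1
  simp only [Nat.cast_one, Complex.one_cpow]
  field_simp
  ring

lemma zeta1_eq (s : ℂ) (hs : -1 < s.re) :
    riemannZeta₁ s = 1 + (s - 1) / 2 + ∑' k : ℕ, tz (1 + k) s := by
  set ε := (s.re + 1) / 2 with hε
  have hε0 : 0 < ε := by linarith
  set M := max (‖s‖ + 1) 3 with hM
  set U : Set ℂ := {z | ε < z.re + 1} ∩ ball 0 M with hU
  have hUo : IsOpen U := (isOpen_lt continuous_const (by fun_prop)).inter isOpen_ball
  have hUc : Convex ℝ U := by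
    refine Convex.inter ?_ (convex_ball _ _)
    have : {z : ℂ | ε < z.re + 1} = {z : ℂ | ε - 1 < z.re} := by ext z; simp [sub_lt_iff_lt_add]
    rw [this]
    exact convex_halfSpace_re_gt _
  have hsU : s ∈ U := ⟨by simp only [Set.mem_setOf_eq]; linarith, by simp [hM]⟩
  set p : ℂ := ((max (3/2) (ε) : ℝ) : ℂ) with hp
  have hεM : ε < M := by
    have : s.re ≤ ‖s‖ := Complex.re_le_norm s
    have : ‖s‖ + 1 ≤ M := le_max_left _ _
    have : 0 ≤ ‖s‖ := norm_nonneg s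
    linarith
  have hM3 : 3 ≤ M := le_max_right _ _
  have hpU : p ∈ U := by
    refine ⟨?_, ?_⟩
    · simp only [Set.mem_setOf_eq, hp, Complex.ofReal_re]
      have := le_max_right (3/2) ε; linarith
    · rw [mem_ball_zero_iff, hp, Complex.norm_real, Real.norm_of_nonneg (le_max_of_le_right hε0.le)]
      exact max_lt (by linarith) hεM
  have hd : DifferentiableOn ℂ (fun z => 1 + (z - 1) / 2 + ∑' k : ℕ, tz (1 + k) z) U := by
    apply DifferentiableOn.add (by fun_prop)
    have hsm := (tele_hasSum ε hε0 1).summable.mul_left ((M+1) * M * (M+1) / 8)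
    have hsm2 : Summable (fun k : ℕ => (M+1) * M * (M+1) * (1/2) * (1/4)*(1/2) * 2 * (((1 + k : ℕ):ℝ)^(-(ε+1)))) := by
      apply Summable.mul_left
      have := (summable_nat_add_iff 1).mpr (Real.summable_nat_rpow.mpr (by linarith : -(ε+1) < -1))
      simpa [add_comm] using this
    refine differentiableOn_tsum_of_summable_norm hsm2 (fun k => (tz_differentiable (1+k) (by omega)).differentiableOn) hUo ?_
    intro k z hz
    have hz1 : ε < z.re + 1 := hz.1
    have hz2 : ‖z‖ < M := by simpa using hz.2
    rw [tz_integral (1+k) (by omega) z, norm_mul, norm_div, norm_mul, norm_mul]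
    have hn0 : (0:ℝ) < ((1+k:ℕ):ℝ) := by positivity
    have h1 : ‖∫ x in ((1+k:ℕ):ℝ)..(((1+k:ℕ):ℝ)+1), (((x - (1+k:ℕ)) * ((1+k:ℕ) + 1 - x) : ℝ) : ℂ) * (x:ℂ) ^ (-z - 2)‖ ≤
        (1/4) * ((1+k:ℕ):ℝ) ^ (-(ε + 1)) * |(((1+k:ℕ):ℝ)+1) - ((1+k:ℕ):ℝ)| := by
      apply intervalIntegral.norm_integral_le_of_norm_le_const
      intro x hx
      rw [Set.uIoc_of_le (by linarith)] at hx
      have hx0 : 0 < x := hn0.trans hx.1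
      rw [norm_mul, Complex.norm_real, Complex.norm_cpow_eq_rpow_re_of_pos hx0]
      have : ‖(x - (1+k:ℕ)) * ((1+k:ℕ) + 1 - x)‖ ≤ 1/4 := by
        rw [Real.norm_of_nonneg (mul_nonneg (by linarith [hx.1]) (by linarith [hx.2]))]
        nlinarith [sq_nonneg (x - (1+k:ℕ) - 1/2)]
      have e : (-z - 2).re = -(z.re + 2) := by simp; ring
      rw [e]
      have h1k : (1:ℝ) ≤ ((1+k:ℕ):ℝ) := by push_cast; linarith [Nat.cast_nonneg (α := ℝ) k]
      have : x ^ (-(z.re+2)) ≤ ((1+k:ℕ):ℝ) ^ (-(ε + 1)) := by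
        calc x ^ (-(z.re+2)) ≤ x ^ (-(ε+1)) := Real.rpow_le_rpow_of_exponent_le (by linarith [hx.1]) (by linarith)
          _ ≤ _ := Real.rpow_le_rpow_of_nonpos hn0 hx.1.le (by linarith)
      gcongr
    have hA : ‖z - 1‖ ≤ M + 1 := (norm_sub_le _ _).trans (by simp; linarith)
    have hB : ‖z + 1‖ ≤ M + 1 := (norm_add_le _ _).trans (by simp; linarith)
    have hM0 : 0 ≤ M := by linarith
    calc _ ≤ (M+1) * M * (M+1) / ‖(2:ℂ)‖ * ((1/4) * ((1+k:ℕ):ℝ) ^ (-(ε + 1)) * |(((1+k:ℕ):ℝ)+1) - ((1+k:ℕ):ℝ)|) := by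
          gcongr
      _ = _ := by rw [add_sub_cancel_left]; simp; ring
  have ha := hd.analyticOnNhd hUo
  have hb : AnalyticOnNhd ℂ riemannZeta₁ U := (differentiable_riemannZeta₁.differentiableOn).analyticOnNhd hUo
  have hev : riemannZeta₁ =ᶠ[nhds p] (fun z => 1 + (z - 1) / 2 + ∑' k : ℕ, tz (1 + k) z) := by
    have : ∀ᶠ z in nhds p, 1 < z.re := by
      apply (isOpen_lt continuous_const Complex.continuous_re).mem_nhds
      simp only [Set.mem_setOf_eq, hp, Complex.ofReal_re]
      exact lt_of_lt_of_le (by norm_num) (le_max_left _ _)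
    filter_upwards [this] with z hz using zeta1_of_re_gt z hz
  exact hb.eqOn_of_preconnected_of_eventuallyEq ha hUc.isPreconnected hpU hev hsU

lemma zeta1_em (s : ℂ) (hs : -1 < s.re) (N : ℕ) (hN : 1 ≤ N) :
    riemannZeta₁ s = (s - 1) * (∑ n ∈ Ico 1 N, (n:ℂ)^(-s) + 1/2 * (N:ℂ)^(-s)) + (N:ℂ)^(1-s)
      + ∑' k : ℕ, tz (N + k) s := by
  rw [zeta1_eq s hs, ← (tz_summable 1 le_rfl s hs).sum_add_tsum_nat_add (N-1), tz_sum]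
  have e : ∀ k, 1 + (k + (N - 1)) = N + k := by intro k; omega
  simp only [e]
  rw [Finset.sum_Ico_eq_sum_range, show 1 + (N-1) = N by omega]
  simp only [Nat.cast_one, Complex.one_cpow]
  ring

lemma zeta_em (s : ℂ) (hs : -1 < s.re) (hs1 : s ≠ 1) (N : ℕ) (hN : 1 ≤ N) :
    ‖riemannZeta s - (∑ n ∈ Ico 1 N, (n:ℂ)^(-s) + 1/2 * (N:ℂ)^(-s) + (N:ℂ)^(1-s) / (s - 1))‖ ≤
      ‖s‖ * ‖s + 1‖ / (8 * (s.re + 1)) * (N:ℝ) ^ (-(s.re + 1)) := by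
  have h0 : s - 1 ≠ 0 := sub_ne_zero.mpr hs1
  have h := tz_tsum_bound N hN s hs
  have e : riemannZeta s - (∑ n ∈ Ico 1 N, (n:ℂ)^(-s) + 1/2 * (N:ℂ)^(-s) + (N:ℂ)^(1-s) / (s - 1)) =
      (s-1)⁻¹ * ∑' k : ℕ, tz (N + k) s := by
    rw [riemannZeta_eq_inv_sub_mul hs1, zeta1_em s hs N hN]
    field_simp
    ring
  rw [e, norm_mul, norm_inv]
  have hp : 0 < ‖s - 1‖ := norm_pos_iff.mpr h0
  calc _ ≤ ‖s-1‖⁻¹ * (‖s - 1‖ * ‖s‖ * ‖s + 1‖ / (8 * (s.re + 1)) * (N:ℝ) ^ (-(s.re + 1))) := by gcongr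
    _ = _ := by field_simp

lemma norm_le_sqrt_of {z : ℂ} {b : ℝ} (h : z.re ^ 2 + z.im ^ 2 ≤ b) : ‖z‖ ≤ √b := by
  apply Real.le_sqrt_of_sq_le
  rw [← Complex.normSq_eq_norm_sq, Complex.normSq_apply]; nlinarith

lemma s_prod_bound1 (s : ℂ) (h0 : 0 ≤ s.re) (h1 : s.re ≤ 1) :
    ‖s‖ * ‖s + 1‖ / (8 * (s.re + 1)) ≤ (1 + s.im ^ 2) / 8 := by
  have a1 : ‖s‖ ≤ √(1 + s.im^2) := norm_le_sqrt_of (by nlinarith)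
  have a2 : ‖s + 1‖ ≤ (s.re + 1) * √(1 + s.im^2) := by
    have : ‖s + 1‖ ≤ √((s.re+1)^2 * (1 + s.im^2)) := norm_le_sqrt_of (by
      simp only [Complex.add_re, Complex.one_re, Complex.add_im, Complex.one_im, add_zero]
      nlinarith [mul_nonneg h0 (sq_nonneg s.im), mul_nonneg (sq_nonneg s.re) (sq_nonneg s.im)])
    rwa [Real.sqrt_mul (sq_nonneg _), Real.sqrt_sq (by linarith)] at this
  have a3 : √(1 + s.im^2) * √(1 + s.im^2) = 1 + s.im^2 := Real.mul_self_sqrt (by positivity)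
  have hp : 0 < 8 * (s.re + 1) := by linarith
  rw [div_le_div_iff₀ hp (by norm_num)]
  have : ‖s‖ * ‖s + 1‖ ≤ √(1 + s.im^2) * ((s.re + 1) * √(1 + s.im^2)) := by gcongr
  nlinarith

lemma s_prod_bound2 (s : ℂ) (h0 : 1 ≤ s.re) (h1 : s.re ≤ 2) :
    ‖s‖ * ‖s + 1‖ / (8 * (s.re + 1)) ≤ (4 + s.im ^ 2) / 16 := by
  have a1 : ‖s‖ ≤ √(4 + s.im^2) := norm_le_sqrt_of (by nlinarith)
  have a2 : ‖s + 1‖ ≤ ((s.re + 1)/2) * √(4 + s.im^2) := by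
    have : ‖s + 1‖ ≤ √(((s.re+1)/2)^2 * (4 + s.im^2)) := norm_le_sqrt_of (by
      simp only [Complex.add_re, Complex.one_re, Complex.add_im, Complex.one_im, add_zero]
      nlinarith [mul_nonneg (sub_nonneg.mpr h0) (sq_nonneg s.im), mul_nonneg (sq_nonneg (s.re-1)) (sq_nonneg s.im)])
    rwa [Real.sqrt_mul (sq_nonneg _), Real.sqrt_sq (by linarith)] at this
  have a3 : √(4 + s.im^2) * √(4 + s.im^2) = 4 + s.im^2 := Real.mul_self_sqrt (by positivity)
  have hp : 0 < 8 * (s.re + 1) := by linarith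
  rw [div_le_div_iff₀ hp (by norm_num)]
  have : ‖s‖ * ‖s + 1‖ ≤ √(4 + s.im^2) * (((s.re + 1)/2) * √(4 + s.im^2)) := by gcongr
  nlinarith

lemma im_le_norm_sub_one (s : ℂ) : |s.im| ≤ ‖s - 1‖ := by
  have := Complex.abs_im_le_norm (s - 1); simpa using this

lemma zeta_low (s : ℂ) (h0 : 0 ≤ s.re) (h1 : s.re ≤ 2) (ht : 0.35 ≤ s.im) (ht2 : s.im ≤ 4) :
    ‖riemannZeta s‖ ≤ 3.65 := by
  have hs1 : s ≠ 1 := by rintro rfl; simp at ht; norm_num at ht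
  have h := zeta_em s (by linarith) hs1 1 le_rfl
  simp only [Finset.Ico_self, Finset.sum_empty, Nat.cast_one, Complex.one_cpow, Real.one_rpow, mul_one, zero_add] at h
  have h2 : ‖(1/2 : ℂ) + 1 / (s-1)‖ ≤ 1/2 + 1 / s.im := by
    refine (norm_add_le _ _).trans ?_
    rw [norm_div, norm_div, norm_one]
    have := im_le_norm_sub_one s
    rw [abs_of_pos (by linarith)] at this
    have : 1 / ‖s-1‖ ≤ 1 / s.im := one_div_le_one_div_of_le (by linarith) this
    simp only [Complex.norm_ofNat]
    linarith
  have h3 : ‖riemannZeta s‖ ≤ 1/2 + 1/s.im + ‖s‖ * ‖s + 1‖ / (8 * (s.re + 1)) := by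
    have := norm_sub_norm_le (riemannZeta s) ((1/2 : ℂ) + 1 / (s-1))
    linarith
  have hinv : ∀ a : ℝ, 0 < a → a ≤ s.im → 1 / s.im ≤ 1 / a := fun a ha hle => one_div_le_one_div_of_le ha hle
  rcases le_total s.re 1 with hc | hc
  · have h4 := s_prod_bound1 s h0 hc
    rcases le_total s.im 1 with hd | hd
    · have := hinv 0.35 (by norm_num) ht
      have : s.im ^ 2 ≤ 1 := by nlinarith
      have e2 : (1:ℝ)/0.35 ≤ 2.858 := by norm_num
      linarith [show (1:ℝ)/0.5 = 2 by norm_num, show (1:ℝ)/1 = 1 by norm_num]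
    · have := hinv 1 (by norm_num) hd
      have : s.im ^ 2 ≤ 16 := by nlinarith
      have e2 : (1:ℝ)/0.35 ≤ 2.858 := by norm_num
      linarith [show (1:ℝ)/0.5 = 2 by norm_num, show (1:ℝ)/1 = 1 by norm_num]
  · have h4 := s_prod_bound2 s hc h1
    rcases le_total s.im 0.5 with hd | hd
    · have := hinv 0.35 (by norm_num) ht
      have : s.im ^ 2 ≤ 0.25 := by nlinarith
      have e2 : (1:ℝ)/0.35 ≤ 2.858 := by norm_num
      linarith [show (1:ℝ)/0.5 = 2 by norm_num, show (1:ℝ)/1 = 1 by norm_num]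
    · rcases le_total s.im 2 with he | he
      · have := hinv 0.5 (by norm_num) hd
        have : s.im ^ 2 ≤ 4 := by nlinarith
        have e2 : (1:ℝ)/0.35 ≤ 2.858 := by norm_num
        linarith [show (1:ℝ)/0.5 = 2 by norm_num, show (1:ℝ)/1 = 1 by norm_num]
      · have := hinv 2 (by norm_num) he
        have : s.im ^ 2 ≤ 16 := by nlinarith
        have e2 : (1:ℝ)/0.35 ≤ 2.858 := by norm_num
        linarith [show (1:ℝ)/0.5 = 2 by norm_num, show (1:ℝ)/1 = 1 by norm_num]

/-- harmonic-type bound -/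
lemma harm_bound (N : ℕ) (hN : 2 ≤ N) :
    ∑ n ∈ Ico 1 N, (1:ℝ)/n + 1/(2*N) + 1/(8*N^2) ≤ Real.log N + 0.589 := by
  induction N, hN using Nat.le_induction with
  | base =>
    have := Real.log_two_gt_d9
    rw [show Ico 1 2 = {1} from rfl]
    norm_num; linarith
  | succ n hn ih =>
    rw [Finset.sum_Ico_succ_top (by omega)]
    have hn0 : (0:ℝ) < n := by positivity
    have hl := Real.le_log_one_add_of_nonneg (show (0:ℝ) ≤ 1/n by positivity)
    have e : Real.log ((n+1:ℕ):ℝ) = Real.log n + Real.log (1 + 1/n) := by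
      rw [← Real.log_mul (by positivity) (by positivity)]; congr 1; push_cast; field_simp
    rw [e]
    have e2 : 2 * (1/(n:ℝ)) / (1/n + 2) = 2/(2*n+1) := by field_simp; ring
    rw [e2] at hl
    have key : (1:ℝ)/n + 1/(2*((n+1:ℕ):ℝ)) + 1/(8*((n+1:ℕ):ℝ)^2) - 1/(2*n) - 1/(8*n^2) ≤ 2/(2*n+1) := by
      push_cast
      have : 2/(2*(n:ℝ)+1) - ((1:ℝ)/n + 1/(2*((n:ℝ)+1)) + 1/(8*((n:ℝ)+1)^2) - 1/(2*n) - 1/(8*n^2))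
        = 1 / (8 * n^2 * (n+1)^2 * (2*n+1)) := by field_simp; ring
      have h2 : 0 ≤ 1 / (8 * (n:ℝ)^2 * (n+1)^2 * (2*n+1)) := by positivity
      linarith
    linarith

/-- bound for zeta on `1 ≤ σ ≤ 2` -/
noncomputable def hh (t : ℝ) : ℝ := Real.log t + 0.2 + 3.2 / t

lemma zeta_one_line (s : ℂ) (h0 : 1 ≤ s.re) (h1 : s.re ≤ 2) (ht : 3 ≤ s.im) :
    ‖riemannZeta s‖ ≤ hh s.im := by
  have hs1 : s ≠ 1 := by rintro rfl; simp at ht; norm_num at ht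
  set t := s.im with htd
  set N := ⌈t/2⌉₊ with hN
  have hN1 : t/2 ≤ N := Nat.le_ceil _
  have hN2 : (N:ℝ) < t/2 + 1 := Nat.ceil_lt_add_one (by linarith)
  have hN3 : 2 ≤ N := by
    have : (1:ℝ) < N := by linarith
    exact_mod_cast this
  have hNp : (0:ℝ) < N := by linarith
  have h := zeta_em s (by linarith) hs1 N (by omega)
  have hterm : ∀ n : ℕ, 1 ≤ n → ‖(n:ℂ)^(-s)‖ ≤ 1/n := by
    intro n hn
    rw [Complex.norm_natCast_cpow_of_pos (by omega), one_div, ← Real.rpow_neg_one]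
    apply Real.rpow_le_rpow_of_exponent_le (by exact_mod_cast hn)
    simp; linarith
  have hsum : ‖∑ n ∈ Ico 1 N, (n:ℂ)^(-s)‖ ≤ ∑ n ∈ Ico 1 N, (1:ℝ)/n := by
    refine (norm_sum_le _ _).trans (Finset.sum_le_sum fun n hn => hterm n (Finset.mem_Ico.mp hn).1)
  have h2 : ‖(1/2:ℂ) * (N:ℂ)^(-s)‖ ≤ 1/(2*N) := by
    rw [norm_mul]
    have := hterm N (by omega)
    calc _ ≤ ‖(1/2:ℂ)‖ * (1/N) := by gcongr
      _ = _ := by norm_num; ring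
  have h3 : ‖(N:ℂ)^(1-s) / (s-1)‖ ≤ 1/t := by
    rw [norm_div, Complex.norm_natCast_cpow_of_pos (by omega)]
    have i1 : (N:ℝ) ^ (1-s).re ≤ 1 := by
      apply Real.rpow_le_one_of_one_le_of_nonpos (by linarith)
      simp; linarith
    have i2 := im_le_norm_sub_one s
    rw [abs_of_pos (by linarith)] at i2
    exact div_le_div₀ (by norm_num) i1 (by linarith) i2
  have h4 : ‖s‖ * ‖s + 1‖ / (8 * (s.re + 1)) * (N:ℝ) ^ (-(s.re + 1)) ≤ 1/4 + 1/t^2 := by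
    have j1 := s_prod_bound2 s h0 h1
    have j2 : (N:ℝ) ^ (-(s.re + 1)) ≤ (2/t)^2 := by
      calc (N:ℝ) ^ (-(s.re + 1)) ≤ (N:ℝ) ^ (-(2:ℝ)) := by
            apply Real.rpow_le_rpow_of_exponent_le (by linarith); linarith
        _ = ((N:ℝ)^2)⁻¹ := by rw [Real.rpow_neg hNp.le]; norm_num
        _ ≤ ((t/2)^2)⁻¹ := by apply inv_anti₀ (by positivity); gcongr
        _ = _ := by rw [← inv_pow, inv_div]
    calc _ ≤ (4 + t^2)/16 * (2/t)^2 := by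
          apply mul_le_mul j1 j2 (by positivity) (by positivity)
      _ = _ := by field_simp; ring
  have h5 := harm_bound N hN3
  have h6 : 0 ≤ 1/(8*(N:ℝ)^2) := by positivity
  have h7 : Real.log N ≤ Real.log t - 0.693 + 2/t := by
    have k1 : Real.log N ≤ Real.log (t/2+1) := Real.log_le_log hNp hN2.le
    have k2 : Real.log (t/2+1) = Real.log t - Real.log 2 + Real.log (1 + 2/t) := by
      rw [← Real.log_div (by positivity) (by norm_num), ← Real.log_mul (by positivity) (by positivity)]
      congr 1; field_simp
    have k3 := Real.log_le_sub_one_of_pos (show 0 < 1 + 2/t by positivity)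
    have := Real.log_two_gt_d9
    linarith
  have h8 : ‖riemannZeta s‖ ≤ ∑ n ∈ Ico 1 N, (1:ℝ)/n + 1/(2*N) + 1/t + (1/4 + 1/t^2) := by
    have := norm_sub_norm_le (riemannZeta s) (∑ n ∈ Ico 1 N, (n:ℂ)^(-s) + 1/2 * (N:ℂ)^(-s) + (N:ℂ)^(1-s) / (s - 1))
    have n1 := norm_add_le (∑ n ∈ Ico 1 N, (n:ℂ)^(-s) + 1/2 * (N:ℂ)^(-s)) ((N:ℂ)^(1-s) / (s - 1))
    have n2 := norm_add_le (∑ n ∈ Ico 1 N, (n:ℂ)^(-s)) (1/2 * (N:ℂ)^(-s))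
    linarith
  have h9 : 1/t^2 ≤ 0.0534 + 0.2/t := by
    have : 1/t ≤ 1/3 := one_div_le_one_div_of_le (by norm_num) ht
    have hp : 0 < 1/t := by positivity
    rw [show 1/t^2 = (1/t)^2 by ring, show 0.2/t = 0.2*(1/t) by ring]
    nlinarith
  unfold hh
  have e1 : 3.2/t = 2/t + 1/t + 0.2/t := by ring
  linarith

/-- on the 0-line -/
lemma zeta_zero_line (t : ℝ) (ht : 0 < t) :
    ‖riemannZeta (t * I)‖ ≤ √(t / (2*π)) * ‖riemannZeta (1 + t * I)‖ := by
  set s : ℂ := 1 + (-t : ℝ) * I with hs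
  have hsim : s.im = -t := by simp [hs]
  have hsre : s.re = 1 := by simp [hs]
  have hne : ∀ n : ℕ, s ≠ -n := by
    intro n h
    have := congrArg Complex.im h
    rw [hsim] at this; simp at this; linarith
  have hne1 : s ≠ 1 := by
    intro h
    have := congrArg Complex.im h
    rw [hsim] at this; simp at this; linarith
  have h := riemannZeta_one_sub hne hne1
  have e1 : 1 - s = t * I := by rw [hs]; push_cast; ring
  have econj : s = (starRingEnd ℂ) (1 + t * I) := by
    rw [hs]; simp
  rw [e1] at h
  rw [h, econj, riemannZeta_conj, ← econj]
  rw [norm_mul, norm_mul, norm_mul, norm_mul, Complex.norm_conj]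
  apply mul_le_mul_of_nonneg_right _ (norm_nonneg _)
  -- gamma factor
  have hG : ‖Complex.Gamma s‖ ^ 2 = π * t / Real.sinh (π * t) := by
    have g1 : Complex.Gamma s * Complex.Gamma ((starRingEnd ℂ) s) = ((‖Complex.Gamma s‖ ^ 2 : ℝ) : ℂ) := by
      rw [Complex.Gamma_conj, Complex.mul_conj']; push_cast; rfl
    have g2 : (starRingEnd ℂ) s = t * I + 1 := by rw [econj]; simp; ring
    have htI : (t:ℂ) * I ≠ 0 := by simp [ht.ne']
    rw [g2, Complex.Gamma_add_one _ htI, show s = 1 - t * I by rw [hs]; push_cast; ring] at g1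
    have g3 := Complex.Gamma_mul_Gamma_one_sub ((t:ℂ) * I)
    have g4 : Complex.sin (π * (t * I)) = Real.sinh (π * t) * I := by
      rw [show (π:ℂ) * (t * I) = (((π * t : ℝ)):ℂ) * I by push_cast; ring, Complex.sin_mul_I]; simp
    have hsh : (Real.sinh (π * t)) ≠ 0 := (Real.sinh_pos_iff.mpr (by positivity)).ne'
    have hsh' : ((Real.sinh (π * t) : ℝ):ℂ) ≠ 0 := by exact_mod_cast hsh
    rw [g4] at g3
    have : ((‖Complex.Gamma s‖ ^ 2 : ℝ) : ℂ) = ((π * t / Real.sinh (π * t) : ℝ):ℂ) := by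
      rw [show s = 1 - t * I by rw [hs]; push_cast; ring, ← g1]
      have : Complex.Gamma (1 - t * I) * (t * I * Complex.Gamma (t * I)) = t * I * (Complex.Gamma (t * I) * Complex.Gamma (1 - t * I)) := by ring
      rw [this, g3]
      push_cast at hsh' ⊢
      have hI := Complex.I_ne_zero
      field_simp
    exact_mod_cast this
  have hcos : ‖Complex.cos (π * s / 2)‖ = Real.sinh (π * t / 2) := by
    have : (π:ℂ) * s / 2 = π / 2 - (((π * t / 2 : ℝ)):ℂ) * I := by rw [hs]; push_cast; ring
    rw [this, Complex.cos_pi_div_two_sub, Complex.sin_mul_I, ← Complex.ofReal_sinh, norm_mul, Complex.norm_I, mul_one,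
      Complex.norm_real, Real.norm_of_nonneg (Real.sinh_nonneg_iff.mpr (by positivity))]
  have h2pi : ‖(2 * (π:ℂ)) ^ (-s)‖ = (2 * π)⁻¹ := by
    rw [show (2 * (π:ℂ)) = ((2 * π : ℝ):ℂ) by push_cast; rfl, Complex.norm_cpow_eq_rpow_re_of_pos (by positivity)]
    rw [Complex.neg_re, hsre, Real.rpow_neg_one]
  rw [hcos, h2pi, Complex.norm_ofNat]
  apply Real.le_sqrt_of_sq_le
  have hsh : 0 < Real.sinh (π * t / 2) := Real.sinh_pos_iff.mpr (by positivity)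
  have hdbl : Real.sinh (π * t) = 2 * Real.sinh (π * t/2) * Real.cosh (π * t/2) := by
    rw [← Real.sinh_two_mul]; congr 1; ring
  have hch : 0 < Real.cosh (π * t / 2) := Real.cosh_pos _
  have hlt : Real.sinh (π*t/2) ≤ Real.cosh (π*t/2) := (Real.sinh_lt_cosh _).le
  calc (2 * (2*π)⁻¹ * ‖Complex.Gamma s‖ * Real.sinh (π * t / 2))^2
      = (2 * (2*π)⁻¹)^2 * ‖Complex.Gamma s‖^2 * Real.sinh (π * t / 2)^2 := by ring
    _ = (t / (2 * π)) * (Real.sinh (π * t/2) / Real.cosh (π * t/2)) := by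
        rw [hG, hdbl]; field_simp
    _ ≤ (t / (2*π)) * 1 := by
        gcongr
        rw [div_le_one hch]; exact hlt
    _ = _ := mul_one _

/-- conductor-like factor -/
noncomputable def PP (t : ℝ) : ℝ := max 1 (t / (2 * π))

lemma PP_one_le (t : ℝ) : 1 ≤ PP t := le_max_left _ _

lemma PP_mono {a b : ℝ} (h : a ≤ b) : PP a ≤ PP b := by
  unfold PP; gcongr

/-- `ζ₁(s)/(s+1)` -/
noncomputable def qq (s : ℂ) : ℂ := riemannZeta₁ s / (s + 1)

lemma qq_crude (s : ℂ) (h0 : 0 ≤ s.re) :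
    ‖qq s‖ ≤ 1/2 + ‖s - 1‖ * ‖s‖ / (8 * (s.re + 1)) := by
  have h := zeta1_em s (by linarith) 1 le_rfl
  have hb := tz_tsum_bound 1 le_rfl s (by linarith)
  simp only [Finset.Ico_self, Finset.sum_empty, Nat.cast_one, Complex.one_cpow, Real.one_rpow, mul_one, zero_add] at h hb
  have hne : s + 1 ≠ 0 := by
    intro h; have := congrArg Complex.re h; simp at this; linarith
  have hn : 0 < ‖s + 1‖ := norm_pos_iff.mpr hne
  unfold qq
  rw [norm_div, div_le_iff₀ hn, h]
  calc ‖(s - 1) * (1/2) + 1 + ∑' k : ℕ, tz (1 + k) s‖ = ‖(s + 1)/2 + ∑' k : ℕ, tz (1 + k) s‖ := by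
        congr 1; ring
    _ ≤ ‖(s+1)/2‖ + ‖∑' k : ℕ, tz (1 + k) s‖ := norm_add_le _ _
    _ ≤ ‖s+1‖/2 + ‖s - 1‖ * ‖s‖ * ‖s + 1‖ / (8 * (s.re + 1)) := by
        rw [norm_div, Complex.norm_ofNat]; gcongr
    _ = _ := by ring

lemma qq_eq (s : ℂ) (hs : s ≠ 1) : ‖qq s‖ = ‖riemannZeta s‖ * (‖s - 1‖ / ‖s + 1‖) := by
  have h := riemannZeta_eq_inv_sub_mul hs
  have : riemannZeta₁ s = (s - 1) * riemannZeta s := by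
    rw [h, ← mul_assoc, mul_inv_cancel₀ (sub_ne_zero.mpr hs), one_mul]
  rw [qq, this, norm_div, norm_mul]; ring

lemma sub_le_add_norm (s : ℂ) (h : 0 ≤ s.re) : ‖s - 1‖ ≤ ‖s + 1‖ := by
  apply le_of_sq_le_sq _ (norm_nonneg _)
  rw [← Complex.normSq_eq_norm_sq, ← Complex.normSq_eq_norm_sq, Complex.normSq_apply, Complex.normSq_apply]
  simp; nlinarith

lemma qq_le_zeta (s : ℂ) (hs : s ≠ 1) (h : 0 ≤ s.re) : ‖qq s‖ ≤ ‖riemannZeta s‖ := by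
  rw [qq_eq s hs]
  have := sub_le_add_norm s h
  have : ‖s - 1‖ / ‖s + 1‖ ≤ 1 := div_le_one_of_le₀ this (norm_nonneg _)
  nlinarith [norm_nonneg (riemannZeta s)]

lemma zeta_abs_im (s : ℂ) : ‖riemannZeta s‖ = ‖riemannZeta (⟨s.re, |s.im|⟩ : ℂ)‖ := by
  rcases abs_choice s.im with h | h
  · rw [h]
  · rw [h]
    have : (⟨s.re, -s.im⟩ : ℂ) = (starRingEnd ℂ) s := by apply Complex.ext <;> simp
    rw [this, riemannZeta_conj, Complex.norm_conj]

lemma hh_mono {a b : ℝ} (ha : 3.2 ≤ a) (hab : a ≤ b) : hh a ≤ hh b := by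
  unfold hh
  have ha0 : 0 < a := by linarith
  have hb0 : 0 < b := by linarith
  have h1 : Real.log a - Real.log b ≤ a / b - 1 := by
    rw [← Real.log_div ha0.ne' hb0.ne']; exact Real.log_le_sub_one_of_pos (by positivity)
  have h2 : 3.2 / a - 3.2 / b ≤ 1 - a / b := by
    have : 1 - a / b - (3.2 / a - 3.2 / b) = (b - a) * (a - 3.2) / (a * b) := by field_simp; try ring
    have h3 : 0 ≤ (b - a) * (a - 3.2) / (a * b) := by
      apply div_nonneg _ (by positivity)
      apply mul_nonneg <;> linarith
    linarith
  linarith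

lemma hh_ge {y : ℝ} (hy : 4 ≤ y) : 2.38 ≤ hh y := by
  refine le_trans ?_ (hh_mono (by norm_num) hy)
  unfold hh
  have : Real.log 4 = 2 * Real.log 2 := by
    rw [show (4:ℝ) = 2^2 by norm_num, Real.log_pow]; norm_num
  have := Real.log_two_gt_d9
  norm_num; linarith

lemma hh_growth {y t : ℝ} (hy : 4 ≤ y) (ht : 3.2 ≤ t) :
    hh t ≤ hh y * Real.exp (1 / (2.3 * y) * max 0 (t - y)) := by
  have hp := hh_ge hy
  rcases le_total t y with h | h
  · rw [max_eq_left (by linarith)]; simpa using hh_mono ht h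
  · rw [max_eq_right (by linarith)]
    have h1 : Real.log t ≤ Real.log y + (t - y) / y := by
      have := Real.log_le_sub_one_of_pos (show 0 < t / y by positivity)
      rw [Real.log_div (by positivity) (by positivity)] at this
      have e : (t - y) / y = t / y - 1 := by field_simp
      linarith
    have h2 : hh t ≤ hh y + (t - y) / y := by
      unfold hh
      have : 3.2 / t ≤ 3.2 / y := by gcongr
      linarith
    have h3 : (t - y) / y ≤ hh y * (1 / (2.3 * y) * (t - y)) := by
      have : hh y * (1 / (2.3 * y) * (t - y)) = (hh y / 2.3) * ((t - y) / y) := by field_simp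
      rw [this]
      have h4 : 0 ≤ (t - y) / y := div_nonneg (by linarith) (by linarith)
      have h5 : 1 ≤ hh y / 2.3 := by rw [le_div_iff₀ (by norm_num)]; linarith
      nlinarith
    have := Real.add_one_le_exp (1 / (2.3 * y) * (t - y))
    nlinarith

lemma PP_growth {y t : ℝ} (hy : 4 ≤ y) :
    √(PP t) ≤ √(PP y) * Real.exp (1 / (2 * y) * max 0 (t - y)) := by
  have hP := PP_one_le y
  rcases le_total t y with h | h
  · rw [max_eq_left (by linarith)]; simpa using Real.sqrt_le_sqrt (PP_mono h)
  · rw [max_eq_right (by linarith)]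
    have e : Real.exp (1 / (2 * y) * (t - y)) = √(Real.exp ((t - y) / y)) := by
      rw [← Real.exp_half]; congr 1; field_simp
    rw [e, ← Real.sqrt_mul (by linarith)]
    apply Real.sqrt_le_sqrt
    have h1 : t / y ≤ Real.exp ((t - y) / y) := by
      have := Real.add_one_le_exp ((t - y) / y)
      have e : (t - y) / y = t / y - 1 := by field_simp
      linarith
    have hty : 1 ≤ t / y := by rw [le_div_iff₀ (by linarith)]; linarith
    refine le_trans ?_ (mul_le_mul_of_nonneg_left h1 (by linarith))
    have hy2 : y / (2 * π) ≤ PP y := le_max_right _ _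
    apply max_le
    · nlinarith
    · calc t / (2 * π) = y / (2 * π) * (t / y) := by field_simp
        _ ≤ _ := by gcongr

lemma line_one {y : ℝ} (hy : 4 ≤ y) (s : ℂ) (hs : s.re = 1) :
    ‖qq s‖ ≤ hh y * Real.exp (1 / (2.3 * y) * max 0 (|s.im| - y)) := by
  have hp := hh_ge hy
  rcases le_total |s.im| 3.2 with h | h
  · have h1 := qq_crude s (by linarith)
    have h2 : ‖s - 1‖ ≤ √(3.2^2) := norm_le_sqrt_of (by
      simp [hs]; rw [← sq_abs]; nlinarith [abs_nonneg s.im])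
    have h3 : ‖s‖ ≤ √(3.4^2) := norm_le_sqrt_of (by
      simp [hs]; rw [← sq_abs]; nlinarith [abs_nonneg s.im])
    rw [Real.sqrt_sq (by norm_num)] at h2 h3
    have h4 : ‖s - 1‖ * ‖s‖ ≤ 3.2 * 3.4 := by gcongr
    rw [hs] at h1
    have h5 : ‖qq s‖ ≤ hh y := by
      have : ‖s - 1‖ * ‖s‖ / (8 * (1 + 1)) ≤ 3.2 * 3.4 / (8 * (1+1)) := by gcongr
      norm_num at this h1; linarith
    have h6 : 1 ≤ Real.exp (1 / (2.3 * y) * max 0 (|s.im| - y)) := by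
      apply Real.one_le_exp; positivity
    nlinarith
  · have hs1 : s ≠ 1 := by rintro rfl; simp at h; norm_num at h
    refine (qq_le_zeta s hs1 (by linarith)).trans ?_
    rw [zeta_abs_im]
    exact (zeta_one_line ⟨s.re, |s.im|⟩ (by simp [hs]) (by simp [hs]) (by simp; linarith)).trans (hh_growth hy h)

lemma line_zero {y : ℝ} (hy : 4 ≤ y) (s : ℂ) (hs : s.re = 0) :
    ‖qq s‖ ≤ √(PP y) * hh y * Real.exp ((1 / (2.3 * y) + 1 / (2 * y)) * max 0 (|s.im| - y)) := by
  have hp := hh_ge hy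
  have hP : 1 ≤ √(PP y) := Real.one_le_sqrt.mpr (PP_one_le y)
  rcases le_total |s.im| 3.2 with h | h
  · have h1 := qq_crude s (by linarith)
    have h2 : ‖s - 1‖ ≤ √(3.36^2) := norm_le_sqrt_of (by
      simp [hs]; rw [← sq_abs]; nlinarith [abs_nonneg s.im])
    have h3 : ‖s‖ ≤ √(3.2^2) := norm_le_sqrt_of (by
      simp [hs]; rw [← sq_abs]; nlinarith [abs_nonneg s.im])
    rw [Real.sqrt_sq (by norm_num)] at h2 h3
    have h4 : ‖s - 1‖ * ‖s‖ ≤ 3.36 * 3.2 := by gcongr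
    rw [hs] at h1
    have h5 : ‖qq s‖ ≤ hh y := by
      have : ‖s - 1‖ * ‖s‖ / (8 * (0 + 1)) ≤ 3.36 * 3.2 / (8 * (0+1)) := by gcongr
      norm_num at this h1; linarith
    have h6 : 1 ≤ Real.exp ((1 / (2.3 * y) + 1 / (2 * y)) * max 0 (|s.im| - y)) := by
      apply Real.one_le_exp; positivity
    calc ‖qq s‖ ≤ 1 * hh y * 1 := by linarith
      _ ≤ _ := by gcongr
  · have hs1 : s ≠ 1 := by rintro rfl; simp at hs
    refine (qq_le_zeta s hs1 (by linarith)).trans ?_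
    rw [zeta_abs_im, hs]
    have e0 : (⟨0, |s.im|⟩ : ℂ) = (|s.im| : ℝ) * I := by apply Complex.ext <;> simp
    have hz := zeta_zero_line |s.im| (by linarith)
    have h1 := (zeta_one_line (1 + (|s.im| : ℝ) * I) (by simp) (by simp) (by simp; linarith)).trans
      (show hh (1 + (|s.im| : ℝ) * I : ℂ).im ≤ _ by
        have e : (1 + (|s.im| : ℝ) * I : ℂ).im = |s.im| := by simp
        rw [e])
    replace h1 := h1.trans (hh_growth hy h)
    have h2 : √(|s.im| / (2 * π)) ≤ √(PP |s.im|) := Real.sqrt_le_sqrt (le_max_right _ _)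
    have h3 := PP_growth (t := |s.im|) hy
    rw [e0]
    calc _ ≤ _ := hz
      _ ≤ (√(PP y) * Real.exp (1 / (2 * y) * max 0 (|s.im| - y))) * (hh y * Real.exp (1 / (2.3 * y) * max 0 (|s.im| - y))) := by
        apply mul_le_mul (h2.trans h3) h1 (norm_nonneg _) (by positivity)
      _ = _ := by rw [add_mul, Real.exp_add]; ring

/-- quadratic in the exponent -/
lemma exp_quad (a κ m : ℝ) (hκ : 0 < κ) : a * m - κ * m^2 ≤ a^2 / (4 * κ) := by
  rw [le_div_iff₀ (by positivity)]
  nlinarith [sq_nonneg (a - 2 * κ * m)]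

lemma gauss_norm (κ y : ℝ) (s : ℂ) :
    ‖Complex.exp (κ * (s - y * I)^2)‖ = Real.exp (κ * (s.re^2 - (s.im - y)^2)) := by
  rw [Complex.norm_exp]; congr 1
  simp [pow_two]

lemma gauss_le (κ y : ℝ) (hκ : 0 < κ) (hy : 0 ≤ y) (s : ℂ) :
    ‖Complex.exp (κ * (s - y * I)^2)‖ ≤ Real.exp (κ * s.re^2 - κ * (max 0 (|s.im| - y))^2) := by
  rw [gauss_norm]
  apply Real.exp_le_exp.mpr
  have : (max 0 (|s.im| - y))^2 ≤ (s.im - y)^2 := by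
    have h1 : |s.im| - y ≤ |s.im - y| := by
      have := abs_sub_abs_le_abs_sub s.im y; rwa [abs_of_nonneg hy] at this
    have h2 : max 0 (|s.im| - y) ≤ |s.im - y| := max_le (abs_nonneg _) h1
    rw [← sq_abs (s.im - y)]
    have h3 : 0 ≤ max 0 (|s.im| - y) := le_max_left _ _
    gcongr
  nlinarith

/-- the three lines bound -/
lemma three_lines {y : ℝ} (hy : 4 ≤ y) (σ : ℝ) (h0 : 0 ≤ σ) (h1 : σ ≤ 1) :
    ‖riemannZeta (σ + y * I)‖ ≤ PP y ^ ((1 - σ)/2) * (√(1 + 4 / y^2) * Real.exp (0.56 / y) * hh y) := by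
  have hy0 : 0 < y := by linarith
  set κ : ℝ := 0.4 / y with hκ
  have hκ0 : 0 < κ := by positivity
  have hp := hh_ge hy
  have hP := PP_one_le y
  set f : ℂ → ℂ := fun s => qq s * Complex.exp (κ * (s - y * I)^2) with hf
  set Z : ℝ := Real.exp (0.56 / y) * hh y with hZ
  have hZ0 : 0 < Z := by positivity
  set s0 : ℂ := σ + y * I with hs0
  have hs0re : s0.re = σ := by simp [hs0]
  have hs0im : s0.im = y := by simp [hs0]
  have key := Complex.HadamardThreeLines.norm_le_interp_of_mem_verticalClosedStrip' (f := f) (z := s0)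
    (a := √(PP y) * Z) (b := Z) (l := 0) (u := 1) (by norm_num) (by
      simp only [Complex.HadamardThreeLines.verticalClosedStrip, Set.mem_preimage, Set.mem_Icc, hs0re]; exact ⟨h0, h1⟩)
    (by
      apply DifferentiableOn.diffContOnCl
      have hcl : closure (Complex.HadamardThreeLines.verticalStrip 0 1) ⊆ {s : ℂ | 0 ≤ s.re} := by
        apply closure_minimal
        · intro s hs; exact hs.1.le
        · exact isClosed_le continuous_const Complex.continuous_re
      intro s hs
      have hsr : 0 ≤ s.re := hcl hs
      have hne : s + 1 ≠ 0 := by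
        intro h; have := congrArg Complex.re h; simp at this; linarith
      apply DifferentiableAt.differentiableWithinAt
      apply DifferentiableAt.mul
      · exact (differentiable_riemannZeta₁ s).div (by fun_prop) hne
      · fun_prop)
    (by
      refine ⟨(1/2 + (2 * (2 + y)^2 + 2 / κ)/8) * Real.exp κ , ?_⟩
      rintro _ ⟨s, hs, rfl⟩
      obtain ⟨hs1, hs2⟩ := hs
      simp only [Function.comp, hf, norm_mul]
      rw [gauss_norm]
      have c1 := qq_crude s hs1
      have c2 : ‖s‖ ≤ 2 + y + |s.im - y| := by
        have := Complex.norm_le_abs_re_add_abs_im s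
        rw [abs_of_nonneg hs1] at this
        have h3 : |s.im| ≤ |s.im - y| + |y| := by
          have := abs_add_le (s.im - y) y; simpa using this
        rw [abs_of_pos hy0] at h3
        linarith
      have c3 : ‖s - 1‖ ≤ 2 + y + |s.im - y| := by
        have := Complex.norm_le_abs_re_add_abs_im (s-1)
        simp only [Complex.sub_re, Complex.one_re, Complex.sub_im, Complex.one_im, sub_zero] at this
        rw [abs_of_nonpos (by linarith)] at this
        have h3 : |s.im| ≤ |s.im - y| + |y| := by
          have := abs_add_le (s.im - y) y; simpa using this
        rw [abs_of_pos hy0] at h3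
        linarith
      set x := |s.im - y| with hx
      have hx0 : 0 ≤ x := abs_nonneg _
      have hxx : (s.im - y)^2 = x^2 := (sq_abs _).symm
      rw [hxx]
      have c4 : ‖qq s‖ ≤ 1/2 + (2 * (2+y)^2 + 2 * x^2)/8 := by
        refine c1.trans ?_
        have : ‖s - 1‖ * ‖s‖ / (8 * (s.re + 1)) ≤ (2 + y + x) * (2 + y + x) / 8 := by
          apply div_le_div₀ (by positivity) (by gcongr) (by norm_num) (by linarith)
        nlinarith [sq_nonneg (2 + y - x)]
      have c5 : Real.exp (κ * (s.re^2 - x^2)) ≤ Real.exp κ * Real.exp (-(κ * x^2)) := by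
        rw [← Real.exp_add]; apply Real.exp_le_exp.mpr
        have : s.re^2 ≤ 1 := by nlinarith
        nlinarith
      have c6 : Real.exp (-(κ * x^2)) ≤ 1 := Real.exp_le_one_iff.mpr (by simp; positivity)
      have c7 : x^2 * Real.exp (-(κ * x^2)) ≤ 1 / κ := by
        have := Real.add_one_le_exp (κ * x^2)
        rw [Real.exp_neg, le_div_iff₀ hκ0, ← div_eq_mul_inv, div_mul_eq_mul_div, div_le_one (Real.exp_pos _)]
        linarith
      calc ‖qq s‖ * Real.exp (κ * (s.re^2 - x^2)) ≤ (1/2 + (2 * (2+y)^2 + 2 * x^2)/8) * (Real.exp κ * Real.exp (-(κ * x^2))) := by gcongr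
        _ = ((1/2 + (2 * (2+y)^2)/8) * Real.exp (-(κ * x^2)) + (x^2 * Real.exp (-(κ * x^2)))/4) * Real.exp κ := by ring
        _ ≤ ((1/2 + (2 * (2+y)^2)/8) * 1 + (1/κ)/4) * Real.exp κ := by gcongr
        _ = _ := by ring)
    (by
      intro s hs
      have hs : s.re = 0 := hs
      simp only [hf, norm_mul]
      have l1 := line_zero hy s hs
      have l2 := gauss_le κ y hκ0 hy0.le s
      set m := max 0 (|s.im| - y)
      calc _ ≤ (√(PP y) * hh y * Real.exp ((1 / (2.3 * y) + 1 / (2 * y)) * m)) * Real.exp (κ * s.re^2 - κ * m^2) := by gcongr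
        _ = √(PP y) * hh y * Real.exp ((1 / (2.3 * y) + 1 / (2 * y)) * m - κ * m^2) := by
          rw [mul_assoc, ← Real.exp_add, hs]; congr 2; ring
        _ ≤ √(PP y) * hh y * Real.exp (0.56 / y) := by
          gcongr
          refine (exp_quad _ _ _ hκ0).trans ?_
          rw [hκ]
          have : (1 / (2.3 * y) + 1 / (2 * y)) ^ 2 / (4 * (0.4 / y)) = ((1/2.3 + 1/2)^2/1.6) / y := by field_simp; norm_num
          rw [this]; gcongr; norm_num
        _ = _ := by rw [hZ]; ring)
    (by
      intro s hs
      have hs : s.re = 1 := hs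
      simp only [hf, norm_mul]
      have l1 := line_one hy s hs
      have l2 := gauss_le κ y hκ0 hy0.le s
      set m := max 0 (|s.im| - y)
      calc _ ≤ (hh y * Real.exp ((1 / (2.3 * y)) * m)) * Real.exp (κ * s.re^2 - κ * m^2) := by gcongr
        _ = hh y * Real.exp (κ + (1 / (2.3 * y) * m - κ * m^2)) := by
          rw [mul_assoc, ← Real.exp_add, hs]; congr 2; ring
        _ ≤ hh y * Real.exp (0.56 / y) := by
          gcongr
          have h5 := exp_quad (1 / (2.3 * y)) κ m hκ0
          have : (1 / (2.3 * y)) ^ 2 / (4 * κ) = ((1/2.3)^2/1.6) / y := by rw [hκ]; field_simp; norm_num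
          rw [this] at h5
          have h6 : κ + ((1/2.3)^2/1.6) / y ≤ 0.56 / y := by
            rw [hκ, ← add_div]; gcongr; norm_num
          linarith
        _ = _ := by rw [hZ]; ring)
  have hs1 : s0 ≠ 1 := by
    intro h; rw [h] at hs0im; simp at hs0im; linarith
  have hge : ‖riemannZeta s0‖ ≤ ‖f s0‖ * √(1 + 4 / y^2) := by
    simp only [hf, norm_mul, gauss_norm, hs0re, hs0im]
    rw [qq_eq s0 hs1]
    have e1 : 1 ≤ Real.exp (κ * (σ^2 - (y - y)^2)) := by
      apply Real.one_le_exp; simp; positivity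
    have e2 : 1 ≤ ‖s0 - 1‖ / ‖s0 + 1‖ * √(1 + 4 / y^2) := by
      have n1 : y ≤ ‖s0 - 1‖ := by
        have := im_le_norm_sub_one s0; rw [hs0im, abs_of_pos hy0] at this; exact this
      have n2 : ‖s0 + 1‖ ≤ √(y^2 + 4) := norm_le_sqrt_of (by
        simp only [Complex.add_re, Complex.add_im, Complex.one_re, Complex.one_im, hs0re, hs0im]; nlinarith)
      have n3 : √(y^2 + 4) = y * √(1 + 4/y^2) := by
        rw [show y^2 + 4 = y^2 * (1 + 4/y^2) by field_simp, Real.sqrt_mul (by positivity), Real.sqrt_sq hy0.le]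
      have n4 : 0 < ‖s0 + 1‖ := by
        have := Complex.abs_im_le_norm (s0 + 1)
        simp only [Complex.add_im, Complex.one_im, hs0im, add_zero] at this
        have := le_abs_self y; linarith
      rw [div_mul_eq_mul_div, le_div_iff₀ n4, one_mul]
      calc _ ≤ _ := n2
        _ = _ := n3
        _ ≤ _ := by gcongr
    calc ‖riemannZeta s0‖ = ‖riemannZeta s0‖ * 1 * 1 := by ring
      _ ≤ ‖riemannZeta s0‖ * (‖s0 - 1‖ / ‖s0 + 1‖ * √(1 + 4 / y^2)) * Real.exp (κ * (σ^2 - (y - y)^2)) := by gcongr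
      _ = _ := by ring
  refine hge.trans ?_
  rw [hs0re] at key
  simp only [sub_zero, div_one] at key
  have e3 : (√(PP y) * Z) ^ (1 - σ) * Z ^ σ = PP y ^ ((1 - σ)/2) * Z := by
    rw [Real.mul_rpow (by positivity) hZ0.le, mul_assoc, ← Real.rpow_add hZ0, sub_add_cancel, Real.rpow_one,
      Real.sqrt_eq_rpow, ← Real.rpow_mul (by linarith)]
    congr 2; ring
  rw [e3] at key
  calc _ ≤ (PP y ^ ((1 - σ)/2) * Z) * √(1 + 4/y^2) := by gcongr
    _ = _ := by rw [hZ]; ring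

/-- explicit bound for zeta to the right of the 1-line up to height `τ` -/
noncomputable def ZZ (τ : ℝ) : ℝ := 3.65 + Real.log (max 1 (τ / 22))

lemma ZZ_ge (τ : ℝ) : 3.65 ≤ ZZ τ := by
  unfold ZZ; have := Real.log_nonneg (le_max_left 1 (τ/22)); linarith

lemma ZZ_mono {a b : ℝ} (h : a ≤ b) : ZZ a ≤ ZZ b := by
  unfold ZZ; gcongr

lemma log_le_of_pow {a : ℝ} {n m : ℕ} (ha : 0 < a) (h : a ^ n ≤ 2 ^ m) : n * Real.log a ≤ m * 0.6931472 := by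
  have := Real.log_le_log (by positivity) h
  rw [Real.log_pow, Real.log_pow] at this
  have h2 := Real.log_two_lt_d9
  have : (m:ℝ) * Real.log 2 ≤ m * 0.6931472 := by gcongr; linarith
  linarith

lemma exp_le_quad {x : ℝ} (h0 : 0 ≤ x) (h1 : x ≤ 1) : Real.exp x ≤ 1 + x + x^2 := by
  have := Real.abs_exp_sub_one_sub_id_le (x := x) (by rwa [abs_of_nonneg h0])
  have := le_abs_self (Real.exp x - 1 - x)
  linarith

lemma sqrt_le_lin {x : ℝ} (hx : 0 ≤ x) : √(1 + x) ≤ 1 + x/2 := by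
  apply Real.sqrt_le_iff.mpr; constructor
  · positivity
  · nlinarith [sq_nonneg x]

lemma mm_interval {a b y : ℝ} (ha : 4 ≤ a) (h1 : a ≤ y) (h2 : y ≤ b) :
    √(1 + 4 / y^2) * Real.exp (0.56 / y) * hh y ≤
      (1 + 2 / a^2) * (1 + 0.56/a + (0.56/a)^2) * hh b := by
  have hy : 4 ≤ y := ha.trans h1
  have hp := hh_ge hy
  have e1 : √(1 + 4 / y^2) ≤ 1 + 2 / a^2 := by
    refine (sqrt_le_lin (by positivity)).trans ?_
    have : 4 / y^2 ≤ 4 / a^2 := by gcongr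
    have : 4 / a^2 / 2 = 2 / a^2 := by ring
    linarith
  have e2 : Real.exp (0.56 / y) ≤ 1 + 0.56/a + (0.56/a)^2 := by
    have h3 : 0.56 / y ≤ 0.56 / a := by gcongr
    refine (Real.exp_le_exp.mpr h3).trans (exp_le_quad (by positivity) ?_)
    rw [div_le_one (by linarith)]; linarith
  have e3 : hh y ≤ hh b := hh_mono (by linarith) h2
  gcongr

lemma mm_bound {y : ℝ} (hy : 4 ≤ y) :
    √(1 + 4 / y^2) * Real.exp (0.56 / y) * hh y ≤ ZZ y := by
  have h6 := log_le_of_pow (a := 6) (n := 5) (m := 13) (by norm_num) (by norm_num)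
  have h10 := log_le_of_pow (a := 10) (n := 3) (m := 10) (by norm_num) (by norm_num)
  have h16 : Real.log 16 ≤ 4 * 0.6931472 := by
    have := log_le_of_pow (a := 16) (n := 1) (m := 4) (by norm_num) (by norm_num)
    norm_num at this ⊢; linarith
  have h22 := log_le_of_pow (a := 22) (n := 2) (m := 9) (by norm_num) (by norm_num)
  push_cast at h6 h10 h22
  rcases le_total y 22 with h | h
  · refine le_trans ?_ (ZZ_ge y)
    rcases le_total y 6 with h' | h'
    · refine (mm_interval (a := 4) (b := 6) le_rfl hy h').trans ?_
      have : hh 6 ≤ 2.5356 := by unfold hh; norm_num at *; linarith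
      norm_num at this ⊢; linarith
    rcases le_total y 10 with h'' | h''
    · refine (mm_interval (a := 6) (b := 10) (by norm_num) h' h'').trans ?_
      have : hh 10 ≤ 2.8308 := by unfold hh; norm_num at *; linarith
      norm_num at this ⊢; linarith
    rcases le_total y 16 with h3 | h3
    · refine (mm_interval (a := 10) (b := 16) (by norm_num) h'' h3).trans ?_
      have : hh 16 ≤ 3.1728 := by unfold hh; norm_num at *; linarith
      norm_num at this ⊢; linarith
    · refine (mm_interval (a := 16) (b := 22) (by norm_num) h3 h).trans ?_
      have : hh 22 ≤ 3.4648 := by unfold hh; norm_num at *; linarith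
      norm_num at this ⊢; linarith
  · have hy0 : 0 < y := by linarith
    refine (mm_interval (a := y) (b := y) hy le_rfl le_rfl).trans ?_
    have hi : 1 / y ≤ 1/22 := one_div_le_one_div_of_le (by norm_num) h
    have hi0 : 0 < 1/y := by positivity
    have p1 : (1 + 2 / y^2) * (1 + 0.56/y + (0.56/y)^2) ≤ 1 + 0.68 * (1/y) := by
      have : (1 + 2 / y^2) * (1 + 0.56/y + (0.56/y)^2) = (1 + 2 * (1/y)^2) * (1 + 0.56 * (1/y) + (0.56 * (1/y))^2) := by ring
      rw [this]
      set x := 1/y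
      have : x^2 ≤ x/22 := by nlinarith
      have : x^3 ≤ x/22/22 := by nlinarith
      have : x^4 ≤ x/22/22/22 := by nlinarith
      nlinarith
    have p2 : hh y ≤ 0.2 * y := by
      have l1 := Real.log_le_sub_one_of_pos (show 0 < y/22 by positivity)
      rw [Real.log_div (by positivity) (by norm_num)] at l1
      unfold hh
      have : 3.2 / y = 3.2 * (1/y) := by ring
      linarith
    have p3 : ZZ y = 3.65 + (Real.log y - Real.log 22) := by
      unfold ZZ
      rw [max_eq_right (by rw [le_div_iff₀ (by norm_num)]; linarith), Real.log_div (by positivity) (by norm_num)]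
    have hp := hh_ge hy
    calc _ ≤ (1 + 0.68 * (1/y)) * hh y := by gcongr
      _ = hh y + 0.68 * (hh y / y) := by ring
      _ ≤ hh y + 0.68 * 0.2 := by
        gcongr; rw [div_le_iff₀ hy0]; exact p2
      _ ≤ _ := by
        rw [p3]; unfold hh
        have : 3.2 / y = 3.2 * (1/y) := by ring
        linarith

lemma zeta_bd (τ : ℝ) (s : ℂ) (h0 : 0 ≤ s.re) (h1 : s.re ≤ 2) (ht : 0.35 ≤ s.im) (ht2 : s.im ≤ τ) :
    ‖riemannZeta s‖ ≤ PP τ ^ (max 0 (1 - s.re) / 2) * ZZ τ := by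
  have hP1 : 1 ≤ PP τ ^ (max 0 (1 - s.re) / 2) := Real.one_le_rpow (PP_one_le τ) (by positivity)
  have hZ := ZZ_ge τ
  rcases le_total s.im 4 with h | h
  · have := zeta_low s h0 h1 ht h
    nlinarith
  rcases le_total s.re 1 with hc | hc
  · have h2 := three_lines h s.re h0 hc
    rw [Complex.re_add_im] at h2
    rw [max_eq_right (by linarith)]
    refine h2.trans ?_
    have h3 := (mm_bound h).trans (ZZ_mono ht2)
    have := PP_one_le s.im
    have hp := hh_ge h
    apply mul_le_mul _ h3 (by positivity) (by have := PP_one_le τ; positivity)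
    apply Real.rpow_le_rpow (by linarith) (PP_mono ht2) (by linarith)
  · have h2 := zeta_one_line s hc h1 (by linarith)
    have h3 := (mm_bound h).trans (ZZ_mono ht2)
    have hp := hh_ge h
    have e1 : 1 ≤ √(1 + 4 / s.im^2) := Real.one_le_sqrt.mpr (by linarith [show 0 ≤ 4 / s.im^2 by positivity])
    have e2 : 1 ≤ Real.exp (0.56 / s.im) := Real.one_le_exp (by positivity)
    have : hh s.im ≤ √(1 + 4 / s.im^2) * Real.exp (0.56 / s.im) * hh s.im := by
      calc hh s.im = 1 * 1 * hh s.im := by ring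
        _ ≤ _ := by gcongr
    nlinarith

lemma term_ofReal (g : ℕ → ℝ) (σ : ℝ) (n : ℕ) :
    LSeries.term (fun n => (g n : ℂ)) (σ : ℂ) n = ((if n = 0 then 0 else g n / (n:ℝ)^σ : ℝ) : ℂ) := by
  rw [LSeries.term_def]
  split_ifs with h
  · simp
  · push_cast
    rw [Complex.ofReal_cpow (by positivity)]; simp

lemma norm_term_ofReal (g : ℕ → ℝ) (hg : ∀ n, 0 ≤ g n) (σ : ℝ) (n : ℕ) :
    ((‖LSeries.term (fun n => (g n : ℂ)) (σ : ℂ) n‖ : ℝ) : ℂ) = LSeries.term (fun n => (g n : ℂ)) (σ : ℂ) n := by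
  rw [term_ofReal, Complex.norm_real, Real.norm_of_nonneg]
  split_ifs
  · exact le_rfl
  · have := hg n; positivity

/-- majorant principle -/
lemma norm_LSeries_le (f : ℕ → ℂ) (g : ℕ → ℝ) (hg : ∀ n, 0 ≤ g n) (hfg : ∀ n, n ≠ 0 → ‖f n‖ ≤ g n) (s : ℂ)
    (hs : LSeriesSummable (fun n => (g n : ℂ)) (s.re : ℂ)) :
    ‖LSeries f s‖ ≤ (LSeries (fun n => (g n : ℂ)) (s.re : ℂ)).re := by
  have hn : Summable (fun n => ‖LSeries.term (fun n => (g n : ℂ)) (s.re : ℂ) n‖) := hs.norm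
  have hle : ∀ n, ‖LSeries.term f s n‖ ≤ ‖LSeries.term (fun n => (g n : ℂ)) (s.re : ℂ) n‖ := by
    intro n
    rw [LSeries.norm_term_eq, LSeries.norm_term_eq]
    split_ifs with h
    · exact le_rfl
    · rw [Complex.ofReal_re, Complex.norm_real, Real.norm_of_nonneg (hg n)]
      have := hfg n h
      gcongr
  have h1 : ‖LSeries f s‖ ≤ ∑' n, ‖LSeries.term (fun n => (g n : ℂ)) (s.re : ℂ) n‖ :=
    tsum_of_norm_bounded hn.hasSum hle
  refine h1.trans (le_of_eq ?_)
  unfold LSeries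
  have : (((∑' n, ‖LSeries.term (fun n => (g n : ℂ)) (s.re : ℂ) n‖ : ℝ)) : ℂ) = ∑' n, LSeries.term (fun n => (g n : ℂ)) (s.re : ℂ) n := by
    rw [Complex.ofReal_tsum]
    exact tsum_congr (fun n => norm_term_ofReal g hg s.re n)
  rw [← this, Complex.ofReal_re]

lemma zeta_real_le (σ : ℝ) (h : 1 < σ) (h2 : σ ≤ 4) : (riemannZeta σ).re ≤ 1 + 1/(σ-1) := by
  have hs1 : (σ:ℂ) ≠ 1 := by exact_mod_cast h.ne'
  have h3 := zeta_em σ (by simp; linarith) hs1 1 le_rfl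
  simp only [Finset.Ico_self, Finset.sum_empty, Nat.cast_one, Complex.one_cpow, Real.one_rpow, mul_one, zero_add] at h3
  have h4 := (Complex.re_le_norm _).trans h3
  have e : ((1/2 : ℂ) + 1 / ((σ:ℂ)-1)) = ((1/2 + 1/(σ-1) : ℝ) : ℂ) := by push_cast; ring
  rw [e, Complex.sub_re, Complex.ofReal_re, Complex.ofReal_re] at h4
  have e2 : ‖(σ:ℂ)‖ = σ := by rw [Complex.norm_real, Real.norm_of_nonneg (by linarith)]
  have e3 : ‖(σ:ℂ) + 1‖ = σ + 1 := by
    rw [show (σ:ℂ) + 1 = ((σ + 1 : ℝ):ℂ) by push_cast; rfl, Complex.norm_real, Real.norm_of_nonneg (by linarith)]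
  rw [e2, e3] at h4
  have e4 : σ * (σ + 1) / (8 * (σ + 1)) = σ / 8 := by field_simp
  rw [e4] at h4
  linarith

lemma one_ofReal : (fun _ : ℕ => ((1:ℝ):ℂ)) = 1 := by funext n; simp

lemma zeta_norm_le_real (s : ℂ) (hs : 1 < s.re) : ‖riemannZeta s‖ ≤ (riemannZeta s.re).re := by
  have h := norm_LSeries_le 1 (fun _ => 1) (fun _ => by norm_num) (fun n _ => by simp) s
    (by rw [one_ofReal]; exact LSeriesSummable_one_iff.mpr (by simpa using hs))
  rw [one_ofReal, LSeries_one_eq_riemannZeta hs, LSeries_one_eq_riemannZeta (by simpa using hs)] at h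
  exact h

lemma zeta_inv_norm_le_real (s : ℂ) (hs : 1 < s.re) : ‖(riemannZeta s)⁻¹‖ ≤ (riemannZeta s.re).re := by
  have h := norm_LSeries_le (fun n => (ArithmeticFunction.moebius n : ℂ)) (fun _ => 1) (fun _ => by norm_num) (fun n _ => by
      have := ArithmeticFunction.abs_moebius_le_one (n := n)
      simp only [Complex.norm_intCast]; exact_mod_cast this) s
    (by rw [one_ofReal]; exact LSeriesSummable_one_iff.mpr (by simpa using hs))
  rw [one_ofReal, LSeries_one_eq_riemannZeta (s := s.re) (by simpa using hs)] at h
  have h2 := LSeries_one_mul_Lseries_moebius hs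
  rw [LSeries_one_eq_riemannZeta hs] at h2
  rw [← eq_inv_of_mul_eq_one_right h2]; exact h

lemma zeta_norm_le (s : ℂ) (hs : 1 < s.re) (h4 : s.re ≤ 4) : ‖riemannZeta s‖ ≤ 1 + 1/(s.re - 1) :=
  (zeta_norm_le_real s hs).trans (zeta_real_le _ hs h4)

lemma zeta_inv_norm_le (s : ℂ) (hs : 1 < s.re) (h4 : s.re ≤ 4) : ‖(riemannZeta s)⁻¹‖ ≤ 1 + 1/(s.re - 1) :=
  (zeta_inv_norm_le_real s hs).trans (zeta_real_le _ hs h4)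

lemma abs_log_zeta_le (s : ℂ) (hs : 1 < s.re) (h4 : s.re ≤ 4) : |Real.log ‖riemannZeta s‖| ≤ Real.log (1 + 1/(s.re-1)) := by
  have h0 := norm_pos_iff.mpr (riemannZeta_ne_zero_of_one_lt_re hs)
  rw [abs_le]; constructor
  · rw [neg_le, ← Real.log_inv, ← norm_inv]
    exact Real.log_le_log (by rw [norm_inv]; positivity) (zeta_inv_norm_le s hs h4)
  · exact Real.log_le_log h0 (zeta_norm_le s hs h4)

/-- extension of `zeta_bd` -/
lemma zeta_bd' (τ : ℝ) (s : ℂ) (h0 : 0 ≤ s.re) (h1 : s.re ≤ 4) (ht : 0.35 ≤ s.im) (ht2 : s.im ≤ τ) :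
    ‖riemannZeta s‖ ≤ PP τ ^ (max 0 (1 - s.re) / 2) * ZZ τ := by
  rcases le_total s.re 2 with h | h
  · exact zeta_bd τ s h0 h ht ht2
  · have h2 := zeta_norm_le s (by linarith) h1
    have h3 : 1 / (s.re - 1) ≤ 1 := by rw [div_le_one (by linarith)]; linarith
    have hP1 : 1 ≤ PP τ ^ (max 0 (1 - s.re) / 2) := Real.one_le_rpow (PP_one_le τ) (by positivity)
    have hZ := ZZ_ge τ
    nlinarith

/-- von Mangoldt series -/
lemma neg_logDeriv_zeta (s : ℂ) (hs : 1 < s.re) :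
    LSeries (fun n => ((ArithmeticFunction.vonMangoldt n : ℝ) : ℂ)) s = - logDeriv riemannZeta s := by
  have := ArithmeticFunction.LSeries_vonMangoldt_eq_deriv_riemannZeta_div hs
  rw [this, logDeriv_apply]; ring

lemma riemannZeta₁_eq (s : ℂ) (hs : s ≠ 1) : riemannZeta₁ s = (s - 1) * riemannZeta s := by
  rw [riemannZeta_eq_inv_sub_mul hs, ← mul_assoc, mul_inv_cancel₀ (sub_ne_zero.mpr hs), one_mul]

lemma zeta1_err (s : ℂ) (h0 : -1 < s.re) :
    ‖riemannZeta₁ s - (s+1)/2‖ ≤ ‖s - 1‖ * ‖s‖ * ‖s + 1‖ / (8 * (s.re + 1)) := by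
  have h := zeta1_em s (by linarith) 1 le_rfl
  have hb := tz_tsum_bound 1 le_rfl s (by linarith)
  simp only [Finset.Ico_self, Finset.sum_empty, Nat.cast_one, Complex.one_cpow, Real.one_rpow, mul_one, zero_add] at h hb
  rw [h]
  have : (s - 1) * (1 / 2) + 1 + ∑' k : ℕ, tz (1 + k) s - (s + 1) / 2 = ∑' k : ℕ, tz (1 + k) s := by ring
  rw [this]; exact hb

lemma logDeriv_zeta_eq (s : ℂ) (hs : s ≠ 1) (hz : riemannZeta s ≠ 0) :
    logDeriv riemannZeta s = logDeriv riemannZeta₁ s - 1/(s-1) := by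
  have hev : riemannZeta =ᶠ[nhds s] fun z => (z - 1)⁻¹ * riemannZeta₁ z := by
    filter_upwards [isOpen_ne.mem_nhds hs] with z hz
    exact riemannZeta_eq_inv_sub_mul hz
  have h1 : riemannZeta₁ s ≠ 0 := by
    rw [riemannZeta₁_eq s hs]; exact mul_ne_zero (sub_ne_zero.mpr hs) hz
  have hs' := sub_ne_zero.mpr hs
  rw [(logDeriv_congr_nhds hev).eq_of_nhds, logDeriv_mul (f := fun z : ℂ => (z-1)⁻¹) s (inv_ne_zero hs') h1
    ((differentiableAt_id.sub_const (1:ℂ)).inv hs') (differentiable_riemannZeta₁ s)]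
  have hi : HasDerivAt (fun z : ℂ => (z - 1)⁻¹) (-1 / (s - 1)^2) s :=
    ((hasDerivAt_id s).sub_const (1:ℂ)).inv hs'
  have e : logDeriv (fun z : ℂ => (z - 1)⁻¹) s = - (1 / (s-1)) := by
    rw [logDeriv_apply, hi.deriv]; field_simp
  rw [e]; ring

lemma neg_logDeriv_zeta_real (σ : ℝ) (h1 : 1 < σ) (h2 : σ ≤ 1.2) :
    (-logDeriv riemannZeta (σ : ℂ)).re ≤ 1 / (σ - 1) := by
  have hs1 : (σ:ℂ) ≠ 1 := by exact_mod_cast h1.ne'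
  have hz := riemannZeta_ne_zero_of_one_lt_re (s := σ) (by simpa using h1)
  rw [logDeriv_zeta_eq _ hs1 hz]
  -- derivative of ζ₁
  have hd : ‖deriv (fun s => riemannZeta₁ s - (s+1)/2) (σ:ℂ)‖ ≤ 0.14 / 0.3 := by
    apply Complex.norm_deriv_le_of_forall_mem_sphere_norm_le (by norm_num)
    · apply Differentiable.diffContOnCl
      have := differentiable_riemannZeta₁
      fun_prop
    · intro s hs
      have hs' : ‖s - σ‖ = 0.3 := by simpa [dist_eq_norm] using hs
      have r1 : |(s - σ).re| ≤ 0.3 := (Complex.abs_re_le_norm _).trans hs'.le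
      simp only [Complex.sub_re, Complex.ofReal_re, abs_le] at r1
      refine (zeta1_err s (by linarith)).trans ?_
      have aux : ∀ a : ℝ, 0 ≤ σ + a → ‖s + a‖ ≤ 0.3 + σ + a := by
        intro a ha
        have : s + a = (s - σ) + ((σ + a : ℝ) : ℂ) := by push_cast; ring
        rw [this]
        refine (norm_add_le _ _).trans ?_
        rw [hs', Complex.norm_real, Real.norm_of_nonneg ha]; linarith
      have a1 := aux (-1) (by linarith)
      have a2 := aux 0 (by linarith)
      have a3 := aux 1 (by linarith)
      push_cast at a1 a2 a3
      rw [← sub_eq_add_neg] at a1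
      rw [add_zero] at a2
      calc ‖s - 1‖ * ‖s‖ * ‖s + 1‖ / (8 * (s.re + 1)) ≤ 0.5 * 1.5 * 2.5 / (8 * 1.7) := by
            gcongr <;> linarith
        _ ≤ 0.14 := by norm_num
  have hd2 : deriv (fun s => riemannZeta₁ s - (s+1)/2) (σ:ℂ) = deriv riemannZeta₁ σ - 1/2 := by
    rw [deriv_fun_sub (differentiable_riemannZeta₁ _) (by fun_prop)]
    simp
  rw [hd2] at hd
  have hre : 0 ≤ (deriv riemannZeta₁ (σ:ℂ)).re := by
    have := (Complex.abs_re_le_norm _).trans hd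
    rw [Complex.sub_re, abs_le] at this
    norm_num at this; linarith
  have hpos : ∃ b : ℝ, 0 < b ∧ riemannZeta₁ (σ:ℂ) = b := by
    refine ⟨(σ - 1) * (riemannZeta σ).re, mul_pos (by linarith) (riemannZeta_re_pos_of_one_lt h1), ?_⟩
    rw [riemannZeta₁_eq _ hs1]; push_cast
    congr 1
    apply Complex.ext <;> simp [riemannZeta_im_eq_zero_of_one_lt h1]
  obtain ⟨b, hb, hb2⟩ := hpos
  have : 0 ≤ (logDeriv riemannZeta₁ (σ:ℂ)).re := by
    rw [logDeriv_apply, hb2, Complex.div_ofReal_re]; positivity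
  have e : (1 / ((σ:ℂ) - 1)).re = 1 / (σ - 1) := by
    rw [show (1 / ((σ:ℂ) - 1)) = ((1/(σ-1) : ℝ) : ℂ) by push_cast; rfl, Complex.ofReal_re]
  rw [Complex.neg_re, Complex.sub_re, e]
  linarith

lemma trig_poly_nonneg (x : ℝ) : 0 ≤ 5 + 8 * Real.cos x + 4 * Real.cos (2*x) + Real.cos (3*x) := by
  rw [Real.cos_two_mul, Real.cos_three_mul]
  have := Real.neg_one_le_cos x
  nlinarith [mul_nonneg (show 0 ≤ Real.cos x + 1 by linarith) (sq_nonneg (2 * Real.cos x + 1))]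

lemma term_re_cos (g : ℕ → ℝ) (σ t : ℝ) (n : ℕ) :
    (LSeries.term (fun n => (g n : ℂ)) (σ + t * I) n).re = (if n = 0 then 0 else g n / (n:ℝ)^σ) * Real.cos (t * Real.log n) := by
  rw [LSeries.term_def]
  split_ifs with h
  · simp
  · have hn : (0:ℝ) < n := by positivity
    have e : ((n:ℂ)) ^ ((σ:ℂ) + t * I) = (((n:ℝ)^σ : ℝ) : ℂ) * Complex.exp ((t * Real.log n : ℝ) * I) := by
      rw [Complex.cpow_add _ _ (by exact_mod_cast h), Complex.ofReal_cpow hn.le]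
      congr 1
      rw [Complex.cpow_def_of_ne_zero (by exact_mod_cast h), Complex.natCast_log.symm]
      push_cast; ring_nf
    rw [e, div_mul_eq_div_div, ← Complex.ofReal_div, div_eq_mul_inv, ← Complex.exp_neg, Complex.re_ofReal_mul,
      show -(((t * Real.log n : ℝ) : ℂ) * I) = ((-(t * Real.log n) : ℝ) : ℂ) * I by push_cast; ring,
      Complex.exp_ofReal_mul_I_re, Real.cos_neg]

lemma trig_ineq (σ t : ℝ) (h1 : 1 < σ) :
    8 * (logDeriv riemannZeta (σ + t * I)).re ≤ 5 * (-logDeriv riemannZeta (σ:ℂ)).re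
      - 4 * (logDeriv riemannZeta (σ + (2*t:ℝ) * I)).re - (logDeriv riemannZeta (σ + (3*t:ℝ) * I)).re := by
  have hsum : ∀ t : ℝ, HasSum (fun n => (if n = 0 then 0 else ArithmeticFunction.vonMangoldt n / (n:ℝ)^σ) * Real.cos (t * Real.log n))
      (-(logDeriv riemannZeta (σ + t * I)).re) := by
    intro t
    have hs : 1 < ((σ:ℂ) + t * I).re := by simpa using h1
    have := (ArithmeticFunction.LSeriesSummable_vonMangoldt hs).hasSum
    have h2 := Complex.hasSum_re this
    have e : (∑' n, LSeries.term (fun n => ((ArithmeticFunction.vonMangoldt n : ℝ) : ℂ)) (σ + t * I) n) = - logDeriv riemannZeta (σ + t * I) :=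
      neg_logDeriv_zeta _ hs
    rw [e, Complex.neg_re] at h2
    convert h2 using 2 with n
    rw [term_re_cos]
  have H := ((((hsum 0).mul_left 5).add ((hsum t).mul_left 8)).add ((hsum (2*t)).mul_left 4)).add (hsum (3*t))
  have h0 := hasSum_le (f := fun _ => (0:ℝ)) (fun n => by
    have hp : 0 ≤ (if n = 0 then (0:ℝ) else ArithmeticFunction.vonMangoldt n / (n:ℝ)^σ) := by
      split_ifs
      · exact le_rfl
      · have := ArithmeticFunction.vonMangoldt_nonneg (n := n); positivity
    have := mul_nonneg hp (trig_poly_nonneg (t * Real.log n))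
    refine this.trans (le_of_eq ?_)
    simp only [zero_mul, Real.cos_zero]
    rw [mul_assoc 2 t, mul_assoc 3 t]; ring) hasSum_zero H
  simp only [Complex.ofReal_zero, zero_mul, add_zero] at h0
  rw [Complex.neg_re]; linarith

/-- bound for the first Fourier coefficient of log|ζ| on a disc of radius about .945 -/
noncomputable def CC (τ : ℝ) : ℝ := 1/4 * Real.log (PP τ) + 0.678 * Real.log (ZZ τ) + 0.67

lemma log_le_div_e (x : ℝ) (hx : 0 < x) : Real.log x ≤ x * 0.3679 := by
  have h1 := Real.log_le_sub_one_of_pos (x := x * 0.3679) (by positivity)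
  rw [Real.log_mul hx.ne' (by norm_num)] at h1
  have h2 : -1 ≤ Real.log 0.3679 := by
    rw [Real.le_log_iff_exp_le (by norm_num), Real.exp_neg]
    have := Real.exp_one_gt_d9
    rw [inv_le_comm₀ (by positivity) (by norm_num)]
    linarith
  linarith

lemma right_bd (c ρ l : ℝ) (hc : 0 ≤ c) (hρ : 0.94 ≤ ρ) (hl : 0 < l) :
    c * Real.log (1 + 1/(l + ρ*c)) ≤ 0.3679 * c + 0.3679 * (1/0.94) := by
  rcases hc.eq_or_lt with rfl | hc
  · simp; norm_num
  have h1 : 0 < l + ρ * c := by positivity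
  have h3 : Real.log (1 + 1/(l+ρ*c)) ≤ (1 + 1/(l+ρ*c)) * 0.3679 := log_le_div_e _ (by positivity)
  have h4 : 1/(l+ρ*c) ≤ 1/(0.94*c) := by
    apply one_div_le_one_div_of_le (by positivity); nlinarith
  calc c * Real.log (1 + 1/(l + ρ*c)) ≤ c * ((1 + 1/(0.94*c)) * 0.3679) := by
        gcongr; exact h3.trans (by gcongr)
    _ = _ := by field_simp; try ring

lemma disc_int (σ y τ ρ : ℝ) (h1 : 1 < σ) (h2 : σ ≤ 1.07) (hy : 1.3 ≤ y) (hτ : y + 1 ≤ τ)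
    (hρ1 : 0.94 ≤ ρ) (hρ2 : ρ ≤ 0.95) (hs : ∀ z ∈ sphere ((σ:ℂ) + y * I) ρ, riemannZeta z ≠ 0) :
    -(1/(π*ρ) * ∫ θ in (0:ℝ)..(2*π), Real.log ‖riemannZeta (circleMap ((σ:ℂ) + y * I) ρ θ)‖ * Real.cos θ) ≤ CC τ := by
  set c : ℂ := (σ:ℂ) + y * I with hc
  set f : ℝ → ℝ := fun θ => Real.log ‖riemannZeta (circleMap c ρ θ)‖ * Real.cos θ with hf
  have hρ0 : 0 < ρ := by linarith
  have hre : ∀ θ, (circleMap c ρ θ).re = σ + ρ * Real.cos θ := by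
    intro θ; simp [circleMap, hc, Complex.exp_ofReal_mul_I_re]
  have him : ∀ θ, (circleMap c ρ θ).im = y + ρ * Real.sin θ := by
    intro θ; simp [circleMap, hc, Complex.exp_ofReal_mul_I_im]
  have hmem : ∀ θ, circleMap c ρ θ ∈ sphere c ρ := fun θ => circleMap_mem_sphere c hρ0.le θ
  have hi1 : ∀ θ, 0.35 ≤ (circleMap c ρ θ).im := by
    intro θ; rw [him]; nlinarith [Real.neg_one_le_sin θ]
  have hi2 : ∀ θ, (circleMap c ρ θ).im ≤ τ := by
    intro θ; rw [him]; nlinarith [Real.sin_le_one θ]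
  have hcont : Continuous f := by
    refine Continuous.mul ?_ Real.continuous_cos
    refine Continuous.log ?_ (fun θ => norm_ne_zero_iff.mpr (hs _ (hmem θ)))
    refine continuous_norm.comp ?_
    refine continuous_iff_continuousAt.mpr fun θ => ?_
    refine ContinuousAt.comp (f := circleMap c ρ) (g := riemannZeta) ?_ (continuous_circleMap c ρ).continuousAt
    apply (differentiableAt_riemannZeta _).continuousAt
    intro h
    have := hi1 θ
    rw [h] at this; norm_num at this
  have hper : Function.Periodic f (2*π) := by
    intro θ; simp only [hf, periodic_circleMap c ρ θ, Real.cos_add_two_pi]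
  have e1 : ∫ θ in (0:ℝ)..(2*π), f θ = ∫ θ in (-(π/2))..(-(π/2)+2*π), f θ := by
    have := hper.intervalIntegral_add_eq 0 (-(π/2))
    simpa using this
  have e2 : ∫ θ in (-(π/2))..(-(π/2)+2*π), f θ = (∫ θ in (-(π/2))..(π/2), f θ) + ∫ θ in (π/2)..(π/2+π), f θ := by
    rw [intervalIntegral.integral_add_adjacent_intervals (hcont.intervalIntegrable _ _) (hcont.intervalIntegrable _ _)]
    congr 1; ring
  have hP := PP_one_le τ
  have hZ : 3.65 ≤ ZZ τ := ZZ_ge τ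
  have hlP : 0 ≤ Real.log (PP τ) := Real.log_nonneg hP
  have hlZ : 0 ≤ Real.log (ZZ τ) := Real.log_nonneg (by linarith)
  have pi := Real.pi_pos
  -- right half
  have b1 : ∫ θ in (-(π/2))..(π/2), (-f θ) ≤ ∫ θ in (-(π/2))..(π/2), (0.3679 * Real.cos θ + 0.3679 * (1/0.94)) := by
    apply intervalIntegral.integral_mono_on (by linarith) (hcont.neg.intervalIntegrable _ _)
      (Continuous.intervalIntegrable (by fun_prop) _ _)
    intro θ hθ
    have hcos := Real.cos_nonneg_of_mem_Icc hθ
    refine le_trans ?_ (right_bd (Real.cos θ) ρ (σ-1) hcos hρ1 (by linarith))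
    have hr : 1 < (circleMap c ρ θ).re := by rw [hre]; nlinarith
    have := abs_log_zeta_le _ hr (by rw [hre]; nlinarith [Real.cos_le_one θ])
    rw [hre] at this
    have h5 := (abs_le.mp this).1
    rw [show σ + ρ * Real.cos θ - 1 = σ - 1 + ρ * Real.cos θ by ring] at h5
    simp only [hf, Pi.neg_apply]
    nlinarith
  have b2 : ∫ θ in (π/2)..(π/2+π), (-f θ) ≤ ∫ θ in (π/2)..(π/2+π), (ρ/2 * Real.log (PP τ) * Real.cos θ ^ 2 - Real.log (ZZ τ) * Real.cos θ) := by
    apply intervalIntegral.integral_mono_on (by linarith) (hcont.neg.intervalIntegrable _ _)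
      (Continuous.intervalIntegrable (by fun_prop) _ _)
    intro θ hθ
    have hcos : Real.cos θ ≤ 0 := Real.cos_nonpos_of_pi_div_two_le_of_le hθ.1 (by linarith [hθ.2])
    have hz := zeta_bd' τ _ (by rw [hre]; nlinarith [Real.neg_one_le_cos θ]) (by rw [hre]; nlinarith) (hi1 θ) (hi2 θ)
    have hn := norm_pos_iff.mpr (hs _ (hmem θ))
    have hl := Real.log_le_log hn hz
    rw [Real.log_mul (by positivity) (by positivity), Real.log_rpow (by linarith)] at hl
    have hm : max 0 (1 - (circleMap c ρ θ).re) ≤ -(ρ * Real.cos θ) := by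
      rw [hre]; apply max_le <;> nlinarith
    have hl2 : Real.log ‖riemannZeta (circleMap c ρ θ)‖ ≤ -(ρ * Real.cos θ)/2 * Real.log (PP τ) + Real.log (ZZ τ) := by
      refine hl.trans ?_
      gcongr
    simp only [hf, Pi.neg_apply]
    nlinarith
  have i1 : ∫ θ in (-(π/2))..(π/2), (0.3679 * Real.cos θ + 0.3679 * (1/0.94)) = 0.3679*2 + 0.3679*(1/0.94)*π := by
    rw [intervalIntegral.integral_add (Continuous.intervalIntegrable (by fun_prop) _ _) (by simp), intervalIntegral.integral_const_mul, integral_cos]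
    simp only [Real.sin_neg, Real.sin_pi_div_two, intervalIntegral.integral_const, smul_eq_mul]
    ring
  have i2 : ∫ θ in (π/2)..(π/2+π), (ρ/2 * Real.log (PP τ) * Real.cos θ ^ 2 - Real.log (ZZ τ) * Real.cos θ) = ρ/2*Real.log (PP τ)*(π/2) + Real.log (ZZ τ) * 2 := by
    rw [intervalIntegral.integral_sub (Continuous.intervalIntegrable (by fun_prop) _ _) (Continuous.intervalIntegrable (by fun_prop) _ _), intervalIntegral.integral_const_mul,
      intervalIntegral.integral_const_mul, integral_cos, integral_cos_sq]
    simp only [Real.sin_add_pi, Real.cos_add_pi, Real.sin_pi_div_two, Real.cos_pi_div_two]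
    ring
  rw [intervalIntegral.integral_neg] at b1 b2
  have hfin : -(∫ θ in (0:ℝ)..(2*π), f θ) ≤ 0.3679*2 + 0.3679*(1/0.94)*π + (ρ/2*Real.log (PP τ)*(π/2) + Real.log (ZZ τ) * 2) := by
    rw [e1, e2]; linarith
  rw [show -(1/(π*ρ) * ∫ θ in (0:ℝ)..(2*π), f θ) = (-(∫ θ in (0:ℝ)..(2*π), f θ)) / (π*ρ) by ring]
  rw [div_le_iff₀ (by positivity)]
  refine hfin.trans ?_
  unfold CC
  have p1 := Real.pi_gt_d4
  have p2 : 3.1415 * 0.94 ≤ π * ρ := by gcongr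
  have t1 : Real.log (ZZ τ) * 2 ≤ 0.678 * Real.log (ZZ τ) * (π * ρ) := by nlinarith
  have t2 : 0.3679*2 + 0.3679*(1/0.94)*π ≤ 0.67 * (π * ρ) := by
    have : 0.67*(π * 0.94) ≤ 0.67*(π*ρ) := by gcongr
    nlinarith
  nlinarith

lemma good_radius (c : ℂ) (h1 : 1 < c.re) (hy : 1.3 ≤ c.im) :
    ∃ ρ : ℝ, 0.94 ≤ ρ ∧ ρ ≤ 0.95 ∧ ∀ z ∈ sphere c ρ, riemannZeta z ≠ 0 := by
  have hd : DifferentiableOn ℂ riemannZeta (ball c 1) := by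
    intro z hz
    apply (differentiableAt_riemannZeta _).differentiableWithinAt
    rintro rfl
    have : ‖(1:ℂ) - c‖ < 1 := by simpa [dist_eq_norm] using hz
    have h3 := (Complex.abs_im_le_norm _).trans this.le
    simp [abs_le] at h3; linarith
  have hf := zeros_finite (c := c) (f := riemannZeta) (R := 1) (ρ := 0.95) (by norm_num) (by norm_num) hd
    (riemannZeta_ne_zero_of_one_lt_re h1)
  have hinf : (Set.Icc (0.94:ℝ) 0.95).Infinite := Set.Icc_infinite (by norm_num)
  obtain ⟨ρ, hρ, hρ2⟩ := (hinf.sdiff (hf.image (fun z => dist z c))).nonempty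
  refine ⟨ρ, hρ.1, hρ.2, fun z hz h0 => hρ2 ⟨z, ?_, hz⟩⟩
  have : dist z c = ρ := hz
  exact ⟨by rw [mem_closedBall, this]; exact hρ.2, h0⟩

lemma zeta_diffOn (c : ℂ) (hy : 1.3 ≤ c.im) : DifferentiableOn ℂ riemannZeta (ball c 1) := by
  intro z hz
  apply (differentiableAt_riemannZeta _).differentiableWithinAt
  rintro rfl
  have : ‖(1:ℂ) - c‖ < 1 := by simpa [dist_eq_norm] using hz
  have h3 := (Complex.abs_im_le_norm _).trans this.le
  simp [abs_le] at h3; linarith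

lemma zero_re_lt (a : ℂ) (h : riemannZeta a = 0) : a.re < 1 := by
  by_contra h1
  exact riemannZeta_ne_zero_of_one_le_re (not_lt.mp h1) h

lemma neg_re_le_CC (σ y τ : ℝ) (h1 : 1 < σ) (h2 : σ ≤ 1.07) (hy : 1.3 ≤ y) (hτ : y + 1 ≤ τ) :
    -(logDeriv riemannZeta ((σ:ℂ) + y * I)).re ≤ CC τ := by
  have hcre : ((σ:ℂ) + y * I).re = σ := by simp
  have hcim : ((σ:ℂ) + y * I).im = y := by simp
  obtain ⟨ρ, ha, hb, hs⟩ := good_radius ((σ:ℂ) + y * I) (by rw [hcre]; exact h1) (by rw [hcim]; exact hy)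
  refine (disc_re (R := 1) (by linarith) (by linarith) (zeta_diffOn _ (by rw [hcim]; exact hy))
    (riemannZeta_ne_zero_of_one_lt_re (by rw [hcre]; exact h1)) hs (fun a _ h => ?_) (disc_int σ y τ ρ h1 h2 hy hτ ha hb hs)).1
  have := zero_re_lt a h
  rw [Complex.sub_re, hcre]; linarith

lemma neg_re_zero_le_CC (σ y τ β : ℝ) (h1 : 1 < σ) (h2 : σ ≤ 1.07) (hy : 1.3 ≤ y) (hτ : y + 1 ≤ τ)
    (hz : riemannZeta ((β:ℂ) + y * I) = 0) (hβ : σ - β < 0.94) :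
    -(logDeriv riemannZeta ((σ:ℂ) + y * I)).re + 1/(σ-β) - (σ-β)/0.94^2 ≤ CC τ := by
  have hcre : ((σ:ℂ) + y * I).re = σ := by simp
  have hcim : ((σ:ℂ) + y * I).im = y := by simp
  have hβ1 : β < 1 := by simpa using zero_re_lt _ hz
  obtain ⟨ρ, ha, hb, hs⟩ := good_radius ((σ:ℂ) + y * I) (by rw [hcre]; exact h1) (by rw [hcim]; exact hy)
  have e : ((σ:ℂ) + y * I) - ((β:ℂ) + y * I) = ((σ - β : ℝ) : ℂ) := by push_cast; ring
  have en : ‖((σ:ℂ) + y * I) - ((β:ℂ) + y * I)‖ = σ - β := by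
    rw [e, Complex.norm_real, Real.norm_of_nonneg (by linarith)]
  have h := (disc_re (R := 1) (by linarith) (by linarith) (zeta_diffOn _ (by rw [hcim]; exact hy))
    (riemannZeta_ne_zero_of_one_lt_re (by rw [hcre]; exact h1)) hs (fun a _ h => by
      have := zero_re_lt a h
      rw [Complex.sub_re, hcre]; linarith) (disc_int σ y τ ρ h1 h2 hy hτ ha hb hs)).2 ((β:ℂ) + y * I)
      (by rw [mem_ball, dist_comm, dist_eq_norm, en]; linarith) hz
  rw [en, e, Complex.ofReal_re] at h
  have h0 : 0 < σ - β := by linarith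
  have k1 : (σ-β) * (1/(σ-β)^2 - 1/ρ^2) = 1/(σ-β) - (σ-β)/ρ^2 := by field_simp
  have k2 : (σ-β)/ρ^2 ≤ (σ-β)/0.94^2 := by gcongr
  linarith

/-- the averaged constant -/
noncomputable def DD (T : ℝ) : ℝ := (8 * CC (T+1) + 4 * CC (2*T+1) + CC (3*T+1))/13 + 0.06

lemma CC_ge (τ : ℝ) : 1.547 ≤ CC τ := by
  unfold CC
  have h1 := Real.log_nonneg (PP_one_le τ)
  have h2 : 1.2945 ≤ Real.log (ZZ τ) := by
    have h3 : Real.log 3.65 ≤ Real.log (ZZ τ) := Real.log_le_log (by norm_num) (ZZ_ge τ)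
    refine le_trans ?_ h3
    rw [Real.le_log_iff_exp_le (by norm_num)]
    have : Real.exp 1.2945 = Real.exp 1 * (Real.exp 0.2945) := by rw [← Real.exp_add]; norm_num
    rw [this]
    have a := Real.exp_one_lt_d9
    have b : Real.exp 0.2945 ≤ 1.3425 := by
      have := Real.exp_bound' (x := 0.2945) (by norm_num) (by norm_num) (n := 6) (by norm_num)
      refine this.trans ?_
      norm_num [Finset.sum_range_succ, Nat.factorial]
    nlinarith [Real.exp_pos 0.2945]
  linarith

lemma ZZ_pos (τ : ℝ) : 0 < ZZ τ := by have := ZZ_ge τ; linarith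

lemma CC_mono {a b : ℝ} (h : a ≤ b) : CC a ≤ CC b := by
  unfold CC
  have h1 : PP a ≤ PP b := PP_mono h
  have h2 : ZZ a ≤ ZZ b := ZZ_mono h
  have h3 := PP_one_le a
  have h4 := ZZ_pos a
  gcongr

lemma DD_ge (T : ℝ) : 1.607 ≤ DD T := by
  unfold DD
  have := CC_ge (T+1); have := CC_ge (2*T+1); have := CC_ge (3*T+1); linarith

lemma CC_le_DD (T : ℝ) (hT : 0 ≤ T) : CC (T+1) ≤ DD T - 0.06 := by
  unfold DD
  have := CC_mono (a := T+1) (b := 2*T+1) (by linarith)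
  have := CC_mono (a := T+1) (b := 3*T+1) (by linarith)
  linarith

/-- 3-4-1 type bound -/
lemma re_logDeriv_le (σ y T : ℝ) (h1 : 1 < σ) (h2 : σ ≤ 1.07) (hy : 1.3 ≤ y) (hT : y ≤ T) :
    8 * (logDeriv riemannZeta ((σ:ℂ) + y * I)).re ≤ 5 / (σ-1) + 4 * CC (2*T+1) + CC (3*T+1) := by
  have a := trig_ineq σ y h1
  have b := neg_logDeriv_zeta_real σ h1 (by linarith)
  have c := neg_re_le_CC σ (2*y) (2*T+1) h1 h2 (by linarith) (by linarith)
  have d := neg_re_le_CC σ (3*y) (3*T+1) h1 h2 (by linarith) (by linarith)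
  have e : 5/(σ-1) = 5 * (1/(σ-1)) := by ring
  rw [e]; linarith

lemma zfr_high (T β y : ℝ) (hy : 1.3 ≤ y) (hT : y ≤ T) (hz : riemannZeta ((β:ℂ) + y * I) = 0) :
    0.0269 / DD T ≤ 1 - β := by
  by_contra! hlt
  have hD := DD_ge T
  have hD0 : 0 < DD T := by linarith
  have hβ1 : β < 1 := by simpa using zero_re_lt _ hz
  set σ := 1 + 0.102 / DD T with hσ
  have k1 : 0.102 / DD T ≤ 0.102/1.607 := by gcongr
  have k3 : 0.1289 / DD T ≤ 0.1289/1.607 := by gcongr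
  have k2 : 0 < 0.102 / DD T := by positivity
  have e1 : σ - β < 0.1289 / DD T := by
    have : 0.1289 / DD T = 0.102/DD T + 0.0269/DD T := by ring
    rw [this]; linarith
  have b0 : 0 < σ - β := by linarith
  have hσ1 : 1 < σ := by linarith
  have hσ2 : σ ≤ 1.07 := by norm_num at k1 ⊢; linarith
  have a := re_logDeriv_le σ y T hσ1 hσ2 hy hT
  have b := neg_re_zero_le_CC σ y (T+1) β hσ1 hσ2 hy (by linarith) hz (by norm_num at k3 ⊢; linarith)
  have e2 : 5/(σ-1) = 5/0.102 * DD T := by rw [hσ]; field_simp; try ring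
  have e3 : 1/(0.1289 / DD T) ≤ 1/(σ-β) := one_div_le_one_div_of_le b0 e1.le
  have e4 : 1/(0.1289/DD T) = 1/0.1289 * DD T := by field_simp
  have e5 : (σ-β)/0.94^2 ≤ 0.0908 := by
    rw [div_le_iff₀ (by norm_num)]; norm_num at k3 ⊢; linarith
  have e6 : 8 * CC (T+1) + 4 * CC (2*T+1) + CC (3*T+1) = 13 * (DD T - 0.06) := by unfold DD; ring
  rw [e4] at e3
  rw [e2] at a
  norm_num at a b e3 e5 e6 ⊢
  linarith

lemma zeta_low_ne (s : ℂ) (h0 : 0.9 ≤ s.re) (hs : s ≠ 1) (him : |s.im| ≤ 1.3) : riemannZeta s ≠ 0 := by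
  intro hz
  have h1 := zero_re_lt s hz
  have he := zeta1_err s (by linarith)
  rw [riemannZeta₁_eq s hs, hz, mul_zero, zero_sub, norm_neg, norm_div] at he
  have hp : 0 < ‖s + 1‖ := by
    rw [norm_pos_iff]; intro h; have := congrArg Complex.re h; simp at this; linarith
  have him2 : s.im^2 ≤ 1.69 := by rw [← sq_abs]; nlinarith [abs_nonneg s.im]
  have n1 : ‖s - 1‖ ≤ √1.7 := norm_le_sqrt_of (by simp; nlinarith)
  have n2 : ‖s‖ ≤ √2.7 := norm_le_sqrt_of (by nlinarith)
  have q1 : √1.7 ≤ 1.4 := by rw [Real.sqrt_le_left (by norm_num)]; norm_num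
  have q2 : √2.7 ≤ 1.7 := by rw [Real.sqrt_le_left (by norm_num)]; norm_num
  have : ‖s - 1‖ * ‖s‖ * ‖s + 1‖ / (8 * (s.re + 1)) ≤ 1.4 * 1.7 * ‖s+1‖ / (8 * 1.9) := by
    gcongr <;> linarith
  rw [show ‖(2:ℂ)‖ = 2 by simp] at he
  norm_num at this he
  linarith

lemma zfr (T : ℝ) (a : ℂ) (h0 : 0 < a.im) (hT : a.im ≤ T) (hz : riemannZeta a = 0) :
    0.0269 / DD T ≤ 1 - a.re := by
  rcases le_or_gt 1.3 a.im with h | h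
  · apply zfr_high T a.re a.im h hT
    rwa [Complex.re_add_im]
  · by_contra! hlt
    have hD := DD_ge T
    have k3 : 0.0269 / DD T ≤ 0.0269/1.607 := by gcongr
    refine zeta_low_ne a (by norm_num at k3 ⊢; linarith) ?_ ?_ hz
    · rintro rfl; simp at h0
    · rw [abs_of_pos h0]; exact h.le

/-- zero-free width -/
noncomputable def ww (T : ℝ) : ℝ := 0.0269 / DD T

lemma ww_pos (T : ℝ) : 0 < ww T := by
  have := DD_ge T
  unfold ww; positivity

lemma ww_le (T : ℝ) : ww T ≤ 0.01674 := by
  have := DD_ge T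
  unfold ww
  rw [div_le_iff₀ (by linarith)]; linarith

lemma log_tangent (D : ℝ) (h : 1.607 ≤ D) : Real.log (1 + 1/(3 * (0.0269/D))) ≤ 0.6 * D + 2.1 := by
  have hD : 0 < D := by linarith
  have e : 1 + 1/(3 * (0.0269/D)) = 1 + D/0.0807 := by field_simp; try ring
  rw [e]
  have h1 : 1 + D/0.0807 ≤ 20.9 * (1 + 0.6 * (D - 1.6)) := by
    rw [div_eq_mul_inv]; norm_num; linarith
  refine (Real.log_le_log (by positivity) h1).trans ?_
  rw [Real.log_mul (by norm_num) (by linarith)]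
  have h2 := Real.log_le_sub_one_of_pos (x := 1 + 0.6*(D-1.6)) (by linarith)
  have h3 : Real.log 20.9 ≤ 3.05 := by
    rw [Real.log_le_iff_le_exp (by norm_num)]
    have : Real.exp 3.05 = Real.exp 1 ^ 3 * Real.exp 0.05 := by
      rw [← Real.exp_nat_mul, ← Real.exp_add]; norm_num
    rw [this]
    have a := Real.exp_one_gt_d9
    have b := Real.add_one_le_exp (0.05:ℝ)
    have : (2.718:ℝ)^3 ≤ Real.exp 1 ^ 3 := by gcongr; linarith
    nlinarith
  linarith

lemma zeta_pack (T y : ℝ) (hy : 1.3 ≤ y) (hT : y + 1 ≤ T) (j : ℕ) (hj : 1 ≤ j) :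
    ‖iteratedDeriv j (logDeriv riemannZeta) (((1 + 3 * ww T : ℝ) : ℂ) + y * I)‖ ≤
      (Nat.factorial j) * ((4 * ww T)⁻¹)^j * (1/(3 * ww T) - 32.5 * (4 * ww T)) := by
  set σ := 1 + 3 * ww T with hσ
  have w0 := ww_pos T
  have w1 := ww_le T
  have h1 : 1 < σ := by linarith
  have h2 : σ ≤ 1.07 := by norm_num at w1 ⊢; linarith
  set c : ℂ := (σ:ℂ) + y * I with hc
  have hcre : c.re = σ := by simp [hc]
  have hcim : c.im = y := by simp [hc]
  obtain ⟨ρ, ha, hb, hs⟩ := good_radius c (by rw [hcre]; exact h1) (by rw [hcim]; exact hy)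
  have hP := PP_one_le (T+1)
  have hZ := ZZ_ge (T+1)
  have hlP : 0 ≤ Real.log (PP (T+1)) := Real.log_nonneg hP
  have hlZ : 0 ≤ Real.log (ZZ (T+1)) := Real.log_nonneg (by linarith)
  have near : ∀ z, ‖z - c‖ ≤ ρ → σ - ρ ≤ z.re ∧ z.re ≤ σ + ρ ∧ y - ρ ≤ z.im ∧ z.im ≤ y + ρ := by
    intro z hz
    have r1 := (Complex.abs_re_le_norm (z - c)).trans hz
    have r2 := (Complex.abs_im_le_norm (z - c)).trans hz
    rw [Complex.sub_re, hcre, abs_le] at r1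
    rw [Complex.sub_im, hcim, abs_le] at r2
    refine ⟨?_, ?_, ?_, ?_⟩ <;> linarith
  have key := disc_package (f := riemannZeta) (c := c) (ρ := ρ) (R := 1) (η := 4 * ww T)
    (A := 1/2 * Real.log (PP (T+1)) + Real.log (ZZ (T+1))) (B := CC (T+1)) (j := j) (by linarith) (by linarith)
    (hf := zeta_diffOn _ (by rw [hcim]; exact hy)) (hc := riemannZeta_ne_zero_of_one_lt_re (by rw [hcre]; exact h1)) (hs := hs)
    (hη := by positivity) (hηρ := by norm_num at w1 ha ⊢; linarith)
    (hz := fun a hab h0 => by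
      have hab' : ‖a - c‖ ≤ ρ := by rw [← dist_eq_norm]; exact (mem_ball.mp hab).le
      have := near a hab'
      have hz := zfr T a (by linarith [this.2.2.1]) (by linarith [this.2.2.2]) h0
      rw [Complex.sub_re, hcre]
      have : 0.0269 / DD T = ww T := rfl
      linarith)
    (hA := fun z hzs => by
      have hz' : ‖z - c‖ ≤ ρ := by rw [← dist_eq_norm]; exact (mem_sphere.mp hzs).le
      have hn := near z hz'
      have hb := zeta_bd' (T+1) z (by linarith [hn.1]) (by linarith [hn.2.1]) (by linarith [hn.2.2.1]) (by linarith [hn.2.2.2])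
      have hl := Real.log_le_log (norm_pos_iff.mpr (hs z hzs)) hb
      rw [Real.log_mul (by positivity) (by have := ZZ_pos (T+1); positivity), Real.log_rpow (by linarith)] at hl
      refine hl.trans ?_
      have : max 0 (1 - z.re) ≤ 1 := max_le (by norm_num) (by linarith [hn.1])
      have : max 0 (1 - z.re) / 2 ≤ 1 / 2 := by linarith
      gcongr)
    (hB := disc_int σ y (T+1) ρ h1 h2 hy (by linarith) ha hb hs) (hj := hj)
  refine key.trans ?_
  refine mul_le_mul_of_nonneg_left ?_ (by positivity)
  have hre := re_logDeriv_le σ y T h1 h2 hy (by linarith)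
  have hl := abs_log_zeta_le c (by rw [hcre]; exact h1) (by rw [hcre]; linarith)
  rw [hcre, show σ - 1 = 3 * ww T by rw [hσ]; ring] at hl
  have hlog := log_tangent (DD T) (DD_ge T)
  have hlow := (abs_le.mp hl).1
  change Real.log (1 + 1/(3 * ww T)) ≤ _ at hlog
  have hD := DD_ge T
  have hD0 : 0 < DD T := by linarith
  have e6 : 8 * CC (T+1) + 4 * CC (2*T+1) + CC (3*T+1) = 13 * (DD T - 0.06) := by unfold DD; ring
  have hC1 := CC_le_DD T (by linarith)
  have hJ : 1/2 * Real.log (PP (T+1)) + Real.log (ZZ (T+1)) ≤ 2 * (DD T - 0.06) - 1.34 := by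
    have : CC (T+1) = 1/4 * Real.log (PP (T+1)) + 0.678 * Real.log (ZZ (T+1)) + 0.67 := rfl
    norm_num at *; linarith
  have hJ2 : 1/2 * Real.log (PP (T+1)) + Real.log (ZZ (T+1)) - Real.log ‖riemannZeta c‖ ≤ 2.6 * DD T + 0.64 := by
    norm_num at *; linarith
  have hw : ww T * DD T = 0.0269 := by unfold ww; field_simp
  have hinv : 1/(3 * ww T) = DD T / 0.0807 := by unfold ww; field_simp; try ring
  have h5 : 5/(σ-1) = 5 * (DD T / 0.0807) := by rw [← hinv, hσ]; field_simp; try ring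
  have hρ : (ρ^2)⁻¹ ≤ 1.1318 := by
    rw [inv_le_comm₀ (by positivity) (by norm_num)]
    have : (0.94:ℝ)^2 ≤ ρ^2 := by gcongr
    refine le_trans ?_ this; norm_num
  have hprod : 4 * (ρ^2)⁻¹ * (4 * ww T) * (1/2 * Real.log (PP (T+1)) + Real.log (ZZ (T+1)) - Real.log ‖riemannZeta c‖)
      ≤ 4 * 1.1318 * (4 * ww T) * (2.6 * DD T + 0.64) := by
    refine (mul_le_mul_of_nonneg_left hJ2 (by positivity)).trans ?_
    gcongr
  have hprod2 : 4 * 1.1318 * (4 * ww T) * (2.6 * DD T + 0.64) ≤ 1.5 := by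
    have : 4 * 1.1318 * (4 * ww T) * (2.6 * DD T + 0.64) = 4 * 1.1318 * 4 * (2.6 * (ww T * DD T) + 0.64 * ww T) := by ring
    rw [this, hw]; norm_num at w1 ⊢; linarith
  rw [hinv]
  rw [h5] at hre
  norm_num at hre e6 hprod hprod2 w1 hD ⊢
  linarith

lemma norm_logDeriv_zeta_far (s : ℂ) (h : 1.2 ≤ s.re) : ‖logDeriv riemannZeta s‖ ≤ 5 := by
  have hs : 1 < s.re := by norm_num at h; linarith
  rw [← norm_neg, ← neg_logDeriv_zeta s hs]
  have h12 : 1 < (((1.2:ℝ):ℂ)).re := by rw [Complex.ofReal_re]; norm_num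
  have b := neg_logDeriv_zeta_real 1.2 (by norm_num) le_rfl
  have hS1 := LSeriesSummable_vonMangoldt hs
  have hS2 := LSeriesSummable_vonMangoldt h12
  have : ‖LSeries (fun n => (vonMangoldt n : ℂ)) s‖ ≤ ∑' n, ‖LSeries.term (fun n => (vonMangoldt n : ℂ)) ((1.2:ℝ):ℂ) n‖ := by
    refine (norm_tsum_le_tsum_norm hS1.norm).trans (hS1.norm.tsum_le_tsum (fun n => ?_) hS2.norm)
    exact LSeries.norm_term_le_of_re_le_re _ (by simpa using h) n
  refine this.trans ?_
  have e : ∑' n, ‖LSeries.term (fun n => (vonMangoldt n : ℂ)) ((1.2:ℝ):ℂ) n‖ = (-logDeriv riemannZeta ((1.2:ℝ):ℂ)).re := by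
    rw [← neg_logDeriv_zeta _ h12, LSeries, Complex.re_tsum hS2]
    congr 1; funext n
    have := norm_term_ofReal (fun n => vonMangoldt n) (fun n => vonMangoldt_nonneg) 1.2 n
    rw [← this]
    simp
  rw [e]
  norm_num at b ⊢; linarith

/-- Liouville function restricted to odd integers -/
noncomputable def lo (n : ℕ) : ℝ := if Odd n then (-1)^(cardFactors n) else 0

lemma lo_zero : lo 0 = 0 := by simp [lo]
lemma lo_one : lo 1 = 1 := by simp [lo]
lemma lo_two : lo 2 = 0 := by simp [lo]
lemma lo_abs_le (n : ℕ) : |lo n| ≤ 1 := by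
  unfold lo; split_ifs <;> simp
lemma lo_even (n : ℕ) (h : ¬ Odd n) : lo n = 0 := by simp [lo, h]
lemma lo_mul (m n : ℕ) : lo (m * n) = lo m * lo n := by
  unfold lo
  by_cases hm : Odd m <;> by_cases hn : Odd n <;> simp [Nat.odd_mul, hm, hn]
  rw [cardFactors_mul (by rintro rfl; simp at hm) (by rintro rfl; simp at hn), pow_add]
lemma lo_prime (p : ℕ) (hp : p.Prime) (h2 : p ≠ 2) : lo p = -1 := by
  simp [lo, hp.odd_of_ne_two h2, cardFactors_apply_prime hp]

/-- the Dirichlet series -/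
noncomputable def Fo (s : ℂ) : ℂ := (1 + (2:ℂ)^(-s)) * riemannZeta (2*s) / riemannZeta s

lemma lo_summable (s : ℂ) (hs : 1 < s.re) : LSeriesSummable (fun n => (lo n : ℂ)) s := by
  apply LSeriesSummable_of_bounded_of_one_lt_re (m := 1) (fun n _ => ?_) hs
  rw [Complex.norm_real]; exact lo_abs_le n

lemma cpow_neg_prime_ne (p : ℕ) (hp : p.Prime) (s : ℂ) (hs : 0 < s.re) : ‖(p:ℂ)^(-s)‖ < 1 := by
  have h2 : (2:ℝ) ≤ p := by exact_mod_cast hp.two_le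
  rw [Complex.norm_natCast_cpow_of_pos hp.pos, Complex.neg_re]
  apply Real.rpow_lt_one_of_one_lt_of_neg (by linarith) (by linarith)

lemma LSeries_lo (s : ℂ) (hs : 1 < s.re) : LSeries (fun n => (lo n : ℂ)) s = Fo s := by
  classical
  have hs2 : 1 < (2*s).re := by simp; linarith
  have hz := riemannZeta_ne_zero_of_one_lt_re hs
  rw [Fo, eq_div_iff hz]
  -- the multiplicative hom
  let φ : ℕ →*₀ ℂ :=
    { toFun := fun n => (lo n : ℂ) * (n:ℂ)^(-s)
      map_zero' := by simp [lo_zero]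
      map_one' := by simp [lo_one]
      map_mul' := fun m n => by
        simp only [lo_mul, Nat.cast_mul, Complex.natCast_mul_natCast_cpow]; push_cast; ring }
  have hterm : ∀ n, LSeries.term (fun n => (lo n : ℂ)) s n = φ n := by
    intro n
    rw [LSeries.term_def]
    split_ifs with h
    · simp [h]
    · show _ = (lo n : ℂ) * (n:ℂ)^(-s)
      rw [Complex.cpow_neg, div_eq_mul_inv]
  have hsum : Summable (fun n => ‖φ n‖) := by
    have := (lo_summable s hs).norm
    simpa only [hterm] using this
  obtain ⟨two, htwo⟩ : ∃ q : Nat.Primes, (q:ℕ) = 2 := ⟨⟨2, Nat.prime_two⟩, rfl⟩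
  have P1 := EulerProduct.eulerProduct_completely_multiplicative_hasProd (f := φ) hsum
  have e1 : ∑' n, φ n = LSeries (fun n => (lo n : ℂ)) s := by
    unfold LSeries; exact tsum_congr (fun n => (hterm n).symm)
  rw [e1] at P1
  have P2 := P1.mul (riemannZeta_eulerProduct_hasProd hs)
  have P3 := (hasProd_ite_eq two (1 + (2:ℂ)^(-s))).mul (riemannZeta_eulerProduct_hasProd hs2)
  have this_aux : ∀ p : Nat.Primes, (1 - φ p)⁻¹ * (1 - ((p:ℕ):ℂ)^(-s))⁻¹ =
      (if p = two then 1 + (2:ℂ)^(-s) else 1) * (1 - ((p:ℕ):ℂ)^(-(2*s)))⁻¹ := by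
    intro p
    have hpp := cpow_neg_prime_ne p p.2 s (by linarith)
    have e2 : ((p:ℕ):ℂ)^(-(2*s)) = (((p:ℕ):ℂ)^(-s))^2 := by
      rw [← Complex.cpow_nat_mul]; congr 1; push_cast; ring
    show (1 - (lo p : ℂ) * ((p:ℕ):ℂ)^(-s))⁻¹ * _ = _
    rw [e2]
    have n1 : (1:ℂ) - ((p:ℕ):ℂ)^(-s) ≠ 0 := by
      intro h; rw [← sub_eq_zero.mp h] at hpp; simp at hpp
    have n2 : (1:ℂ) + ((p:ℕ):ℂ)^(-s) ≠ 0 := by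
      intro h; rw [← neg_eq_of_add_eq_zero_right h] at hpp; simp at hpp
    have n3 : (1:ℂ) - (((p:ℕ):ℂ)^(-s))^2 ≠ 0 := by
      rw [show (1:ℂ) - (((p:ℕ):ℂ)^(-s))^2 = (1 - ((p:ℕ):ℂ)^(-s)) * (1 + ((p:ℕ):ℂ)^(-s)) by ring]
      exact mul_ne_zero n1 n2
    by_cases h : p = two
    · subst h
      rw [if_pos rfl, htwo, lo_two]
      rw [htwo] at n1 n2 n3
      push_cast at n1 n2 n3 ⊢
      field_simp; simp; try ring
    · have hp2 : (p:ℕ) ≠ 2 := fun h' => h (Subtype.ext (h'.trans htwo.symm))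
      rw [if_neg h, lo_prime p p.2 hp2]
      push_cast
      rw [show (1:ℂ) - -1 * ((p:ℕ):ℂ)^(-s) = 1 + ((p:ℕ):ℂ)^(-s) by ring]
      field_simp; try ring
  have hfun : (fun b : Nat.Primes => (1 - φ b)⁻¹ * (1 - ((b:ℕ):ℂ)^(-s))⁻¹) =
      fun b : Nat.Primes => (if b = two then 1 + (2:ℂ)^(-s) else 1) * (1 - ((b:ℕ):ℂ)^(-(2*s)))⁻¹ := by
    funext p
    exact this_aux p
  refine P2.unique ?_
  rw [hfun]; exact P3

lemma lo_abscissa : LSeries.abscissaOfAbsConv (fun n => (lo n : ℂ)) ≤ 1 := by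
  apply LSeries.abscissaOfAbsConv_le_of_forall_lt_LSeriesSummable
  intro y hy
  apply lo_summable; simpa using hy

lemma logDeriv_LSeries_lo (s : ℂ) (hs : 1 < s.re) (h0 : LSeries (fun n => (lo n : ℂ)) s ≠ 0) :
    logDeriv (LSeries (fun n => (lo n : ℂ))) s = - LSeries (fun n => ((lo n * vonMangoldt n : ℝ) : ℂ)) s := by
  have hab : LSeries.abscissaOfAbsConv (fun n => (lo n : ℂ)) < s.re :=
    lt_of_le_of_lt lo_abscissa (by exact_mod_cast hs)
  rw [logDeriv_apply, LSeries_deriv hab, neg_div, neg_inj, div_eq_iff h0]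
  have hS : LSeriesSummable (fun n => ((lo n * vonMangoldt n : ℝ) : ℂ)) s := by
    refine Summable.of_norm_bounded (LSeriesSummable_vonMangoldt hs).norm (fun n => ?_)
    apply LSeries.norm_term_le
    rw [Complex.norm_real, Complex.norm_real, norm_mul]
    exact mul_le_of_le_one_left (norm_nonneg _) (lo_abs_le n)
  rw [← LSeries_convolution' hS (lo_summable s hs)]
  apply LSeries_congr
  intro n hn
  rw [LSeries.convolution_def]
  have := congrFun convolution_vonMangoldt_const_one n
  rw [LSeries.convolution_def] at this
  rw [LSeries.logMul, ← this, Finset.sum_mul]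
  apply Finset.sum_congr rfl
  intro x hx
  rw [← (Nat.mem_divisorsAntidiagonal.mp hx).1, lo_mul]
  simp; ring

lemma cpow_analyticAt (s : ℂ) : AnalyticAt ℂ (fun z : ℂ => (2:ℂ)^z) s := by
  have h : Differentiable ℂ (fun z : ℂ => (2:ℂ)^z) := fun z => by
    exact (differentiableAt_id.const_cpow (Or.inl two_ne_zero))
  exact h.analyticAt s

lemma hasDerivAt_two_cpow (s : ℂ) : HasDerivAt (fun z : ℂ => (2:ℂ)^z) ((2:ℂ)^s * Real.log 2) s := by
  have := (hasDerivAt_id s).const_cpow (c := 2) (Or.inl two_ne_zero)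
  refine this.congr_deriv ?_
  simp

lemma zeta_analyticAt (s : ℂ) (hs : s ≠ 1) : AnalyticAt ℂ riemannZeta s := by
  have h : DifferentiableOn ℂ riemannZeta {1}ᶜ := fun z hz => (differentiableAt_riemannZeta hz).differentiableWithinAt
  exact h.analyticAt (isOpen_compl_singleton.mem_nhds hs)

lemma logDeriv_zeta_analyticAt (s : ℂ) (hs : s ≠ 1) (hz : riemannZeta s ≠ 0) : AnalyticAt ℂ (logDeriv riemannZeta) s := by
  have h := zeta_analyticAt s hs
  have : logDeriv riemannZeta = fun z => deriv riemannZeta z / riemannZeta z := by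
    funext z; exact logDeriv_apply _ _
  rw [this]
  exact h.deriv.div h hz

lemma two_cpow_norm (s : ℂ) : ‖(2:ℂ)^s‖ = (2:ℝ)^s.re := by
  have := Complex.norm_natCast_cpow_of_pos (n := 2) (by norm_num) s
  simpa using this

lemma two_cpow_add_one_ne (s : ℂ) (hs : 0 < s.re) : (2:ℂ)^s + 1 ≠ 0 := by
  intro h
  have h1 : ‖(2:ℂ)^s‖ = 1 := by rw [eq_neg_of_add_eq_zero_left h]; simp
  rw [two_cpow_norm] at h1
  have := Real.one_lt_rpow (x := 2) (by norm_num) hs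
  linarith

/-- the main function -/
noncomputable def FF (s : ℂ) : ℂ := Fo s / s

/-- the error part of the log derivative -/
noncomputable def ee (s : ℂ) : ℂ := 2 * logDeriv riemannZeta (2*s) - Real.log 2 / ((2:ℂ)^s + 1) - 1/s

lemma Fo_eq (s : ℂ) : Fo s = (1 + ((2:ℂ)^s)⁻¹) * riemannZeta (2*s) / riemannZeta s := by
  rw [Fo, Complex.cpow_neg]

lemma FF_logDeriv (s : ℂ) (h12 : 1/2 < s.re) (hs : s ≠ 1) (hz : riemannZeta s ≠ 0) :
    logDeriv FF s = ee s - logDeriv riemannZeta s := by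
  have h2s : 1 < (2*s).re := by simp; linarith
  have h2s1 : 2*s ≠ 1 := by rintro h; rw [h] at h2s; simp at h2s
  have hz2 := riemannZeta_ne_zero_of_one_lt_re h2s
  have hs0 : s ≠ 0 := by rintro rfl; simp at h12; linarith
  have hp := two_cpow_add_one_ne s (by linarith)
  have hc0 : (2:ℂ)^s ≠ 0 := by simp [Complex.cpow_eq_zero_iff]
  have d1 : HasDerivAt (fun z : ℂ => 1 + ((2:ℂ)^z)⁻¹) (-((2:ℂ)^s * Real.log 2)/((2:ℂ)^s)^2) s :=
    ((hasDerivAt_two_cpow s).inv hc0).const_add 1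
  have d2 : HasDerivAt (fun z : ℂ => riemannZeta (2*z)) (deriv riemannZeta (2*s) * 2) s := by
    have h := (differentiableAt_riemannZeta h2s1).hasDerivAt
    have h3 : HasDerivAt (fun z : ℂ => 2*z) 2 s := by simpa using (hasDerivAt_id s).const_mul (2:ℂ)
    exact h.comp s h3
  have d3 := (differentiableAt_riemannZeta hs).hasDerivAt
  have d4 := (((d1.mul d2).div d3 hz).div (hasDerivAt_id s) hs0)
  have e : (((fun z : ℂ => 1 + ((2:ℂ)^z)⁻¹) * fun z => riemannZeta (2*z)) / riemannZeta / id) = FF := by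
    funext z; rw [FF, Fo_eq]; rfl
  rw [e] at d4
  rw [logDeriv_apply, d4.deriv, FF, Fo_eq, ee, logDeriv_apply, logDeriv_apply]
  simp only [id]
  have hp' : 1 + (2:ℂ)^s ≠ 0 := by rwa [add_comm]
  simp only [Pi.mul_apply, Pi.div_apply]
  field_simp
  ring

lemma FF_ne (s : ℂ) (hs : 1 < s.re) : FF s ≠ 0 := by
  have hz := riemannZeta_ne_zero_of_one_lt_re hs
  have hz2 : riemannZeta (2*s) ≠ 0 := riemannZeta_ne_zero_of_one_lt_re (by simp; linarith)
  have hs0 : s ≠ 0 := by rintro rfl; simp at hs; linarith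
  have hc0 : (2:ℂ)^s ≠ 0 := by simp [Complex.cpow_eq_zero_iff]
  have hp := two_cpow_add_one_ne s (by linarith)
  rw [FF, Fo_eq]
  have : 1 + ((2:ℂ)^s)⁻¹ = ((2:ℂ)^s + 1) * ((2:ℂ)^s)⁻¹ := by field_simp
  rw [this]
  have := inv_ne_zero hc0
  positivity

lemma ee_analyticAt (s : ℂ) (h12 : 1/2 < s.re) : AnalyticAt ℂ ee s := by
  have h2s : 1 < (2*s).re := by simp; linarith
  have h2s1 : 2*s ≠ 1 := by rintro h; rw [h] at h2s; simp at h2s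
  have hz2 := riemannZeta_ne_zero_of_one_lt_re h2s
  have hs0 : s ≠ 0 := by rintro rfl; simp at h12; linarith
  have hp := two_cpow_add_one_ne s (by linarith)
  unfold ee
  refine AnalyticAt.sub (AnalyticAt.sub ?_ ?_) ?_
  · refine analyticAt_const.mul ?_
    exact (logDeriv_zeta_analyticAt _ h2s1 hz2).comp (f := fun z : ℂ => 2*z) (analyticAt_const.mul analyticAt_id)
  · exact analyticAt_const.div ((cpow_analyticAt s).add analyticAt_const) hp
  · exact analyticAt_const.div analyticAt_id hs0

lemma ee_bound (s : ℂ) (h6 : 0.6 ≤ s.re) (him : 0.9 ≤ s.im) : ‖ee s‖ ≤ 13 := by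
  unfold ee
  have a : ‖2 * logDeriv riemannZeta (2*s)‖ ≤ 10 := by
    rw [norm_mul]
    have := norm_logDeriv_zeta_far (2*s) (by simp; norm_num at h6 ⊢; linarith)
    simp; linarith
  have h15 : 1.5 ≤ ‖(2:ℂ)^s‖ := by
    rw [two_cpow_norm]
    have h1 : (2:ℝ)^(0.6:ℝ) ≤ (2:ℝ)^s.re := Real.rpow_le_rpow_of_exponent_le (by norm_num) h6
    refine le_trans ?_ h1
    have h5 : ((2:ℝ)^(0.6:ℝ))^5 = 8 := by
      rw [← Real.rpow_natCast, ← Real.rpow_mul (by norm_num)]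
      rw [show (0.6:ℝ) * ((5:ℕ):ℝ) = ((3:ℕ):ℝ) by norm_num, Real.rpow_natCast]; norm_num
    refine le_of_pow_le_pow_left₀ (n := 5) (by norm_num) (by positivity) ?_
    rw [h5]; norm_num
  have b : ‖(Real.log 2 : ℂ) / ((2:ℂ)^s + 1)‖ ≤ 1.4 := by
    rw [norm_div, Complex.norm_real, Real.norm_of_nonneg (Real.log_nonneg (by norm_num))]
    have : 0.5 ≤ ‖(2:ℂ)^s + 1‖ := by
      have := norm_sub_norm_le ((2:ℂ)^s) (-1)
      rw [sub_neg_eq_add, norm_neg, norm_one] at this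
      norm_num at h15 this ⊢; linarith
    rw [div_le_iff₀ (lt_of_lt_of_le (by norm_num) this)]
    have h9 := Real.log_two_lt_d9
    norm_num at this h9 ⊢; linarith
  have c : ‖1/s‖ ≤ 1.2 := by
    rw [norm_div, norm_one]
    have : 0.9 ≤ ‖s‖ := him.trans ((le_abs_self _).trans (Complex.abs_im_le_norm s))
    rw [div_le_iff₀ (lt_of_lt_of_le (by norm_num) this)]
    norm_num at this ⊢; linarith
  calc _ ≤ ‖2 * logDeriv riemannZeta (2*s)‖ + ‖(Real.log 2 : ℂ) / ((2:ℂ)^s + 1)‖ + ‖1/s‖ :=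
        (norm_sub_le _ _).trans (add_le_add_left (norm_sub_le _ _) _)
    _ ≤ 13 := by norm_num at *; linarith

lemma ee_deriv_bound (c : ℂ) (h1 : 1 ≤ c.re) (him : 1.3 ≤ c.im) (j : ℕ) :
    ‖iteratedDeriv j ee c‖ ≤ (Nat.factorial j) * 13 / 0.4^j := by
  apply Complex.norm_iteratedDeriv_le_of_forall_mem_sphere_norm_le j (by norm_num)
  · apply DifferentiableOn.diffContOnCl
    intro z hz
    have hz' : ‖z - c‖ ≤ 0.4 := by
      have := closure_ball_subset_closedBall hz
      simpa [dist_eq_norm] using this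
    have r1 := (Complex.abs_re_le_norm (z - c)).trans hz'
    rw [Complex.sub_re, abs_le] at r1
    exact (ee_analyticAt z (by norm_num at r1 ⊢; linarith [r1.1])).differentiableAt.differentiableWithinAt
  · intro z hz
    have hz' : ‖z - c‖ ≤ 0.4 := by
      have := sphere_subset_closedBall hz
      simpa [dist_eq_norm] using this
    have r1 := (Complex.abs_re_le_norm (z - c)).trans hz'
    have r2 := (Complex.abs_im_le_norm (z - c)).trans hz'
    rw [Complex.sub_re, abs_le] at r1
    rw [Complex.sub_im, abs_le] at r2
    apply ee_bound
    · norm_num at r1 ⊢; linarith [r1.1]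
    · norm_num at r2 him ⊢; linarith [r2.1]

lemma FF_analyticAt (s : ℂ) (h12 : 1/2 < s.re) (hs : s ≠ 1) (hz : riemannZeta s ≠ 0) : AnalyticAt ℂ FF s := by
  have h2s : 1 < (2*s).re := by simp; linarith
  have h2s1 : 2*s ≠ 1 := by rintro h; rw [h] at h2s; simp at h2s
  have hs0 : s ≠ 0 := by rintro rfl; simp at h12; linarith
  have e : FF = fun z => ((1 + ((2:ℂ)^z)⁻¹) * riemannZeta (2*z) / riemannZeta z) / z := by
    funext z; rw [FF, Fo_eq]
  have hc0 : (2:ℂ)^s ≠ 0 := by simp [Complex.cpow_eq_zero_iff]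
  rw [e]
  refine AnalyticAt.div (AnalyticAt.div (AnalyticAt.mul ?_ ?_) (zeta_analyticAt s hs) hz) analyticAt_id hs0
  · exact analyticAt_const.add ((cpow_analyticAt s).inv hc0)
  · exact (zeta_analyticAt _ h2s1).comp (f := fun z : ℂ => 2*z) (analyticAt_const.mul analyticAt_id)

/-- j = 0 -/
lemma FF_logDeriv_zero (σ y : ℝ) (h1 : 1 < σ) (h2 : σ ≤ 1.0503) (hy : 1.3 ≤ y) :
    ‖logDeriv FF ((σ:ℂ) + y * I)‖ ≤ 1/(σ-1) := by
  set s : ℂ := (σ:ℂ) + y * I with hs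
  have hre : s.re = σ := by simp [hs]
  have him : s.im = y := by simp [hs]
  have hs1 : 1 < s.re := by rw [hre]; exact h1
  have hs0 : s ≠ 0 := by intro h; rw [h] at hs1; simp at hs1; linarith
  have hL0 : LSeries (fun n => (lo n : ℂ)) s ≠ 0 := by
    rw [LSeries_lo s hs1]
    have := FF_ne s hs1
    intro h; rw [FF, h] at this; simp at this
  have hopen : {z : ℂ | 1 < z.re} ∈ nhds s := (isOpen_lt continuous_const Complex.continuous_re).mem_nhds hs1
  have hev : FF =ᶠ[nhds s] fun z => LSeries (fun n => (lo n : ℂ)) z * z⁻¹ := by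
    filter_upwards [hopen] with z hz
    rw [FF, LSeries_lo z hz, div_eq_mul_inv]
  have hdL : DifferentiableAt ℂ (LSeries (fun n => (lo n : ℂ))) s := by
    have hab : LSeries.abscissaOfAbsConv (fun n => (lo n : ℂ)) < s.re :=
      lt_of_le_of_lt lo_abscissa (by exact_mod_cast hs1)
    exact (LSeries_hasDerivAt hab).differentiableAt
  have e : logDeriv FF s = - LSeries (fun n => ((lo n * vonMangoldt n : ℝ) : ℂ)) s - 1/s := by
    rw [(logDeriv_congr_nhds hev).eq_of_nhds, logDeriv_mul (f := LSeries (fun n => (lo n : ℂ))) (g := fun z => z⁻¹) s hL0 (inv_ne_zero hs0)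
      hdL (differentiableAt_inv hs0), logDeriv_LSeries_lo s hs1 hL0, logDeriv_inv]
    ring
  -- majorant
  let S : Finset ℕ := {2, 4, 8, 16, 32}
  let g : ℕ → ℝ := fun n => if n ∈ S then 0 else vonMangoldt n
  have hg : ∀ n, 0 ≤ g n := by
    intro n; simp only [g]; split_ifs
    · exact le_rfl
    · exact vonMangoldt_nonneg
  have hfg : ∀ n, n ≠ 0 → ‖((lo n * vonMangoldt n : ℝ) : ℂ)‖ ≤ g n := by
    intro n _
    rw [Complex.norm_real, norm_mul, Real.norm_of_nonneg vonMangoldt_nonneg]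
    simp only [g]; split_ifs with h
    · have : ¬ Odd n := by
        simp only [S, Finset.mem_insert, Finset.mem_singleton] at h
        rcases h with rfl | rfl | rfl | rfl | rfl <;> decide
      simp [lo_even n this]
    · exact mul_le_of_le_one_left vonMangoldt_nonneg (lo_abs_le n)
  have hσ : 1 < ((σ:ℂ)).re := by simpa using h1
  have hΛ := (LSeriesSummable_vonMangoldt hσ).hasSum
  have hΛ' : ∑' n, LSeries.term (fun n => (vonMangoldt n : ℂ)) (σ:ℂ) n = - logDeriv riemannZeta (σ:ℂ) := neg_logDeriv_zeta _ hσ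
  rw [hΛ'] at hΛ
  have hfin : HasSum (fun n => if n ∈ S then LSeries.term (fun n => (vonMangoldt n : ℂ)) (σ:ℂ) n else 0) (∑ n ∈ S, if n ∈ S then LSeries.term (fun n => (vonMangoldt n : ℂ)) (σ:ℂ) n else 0) := hasSum_sum_of_ne_finset_zero (f := fun n => if n ∈ S then LSeries.term (fun n => (vonMangoldt n : ℂ)) (σ:ℂ) n else 0) (s := S)
    (fun n hn => by simp [hn])
  have hdiff := hΛ.sub hfin
  have hterm : (fun n => LSeries.term (fun n => (vonMangoldt n : ℂ)) (σ:ℂ) n - if n ∈ S then LSeries.term (fun n => (vonMangoldt n : ℂ)) (σ:ℂ) n else 0)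
      = LSeries.term (fun n => (g n : ℂ)) (σ:ℂ) := by
    funext n
    rw [LSeries.term_def, LSeries.term_def]
    simp only [g]
    split_ifs <;> simp
  rw [hterm] at hdiff
  have hmaj := norm_LSeries_le (fun n => ((lo n * vonMangoldt n : ℝ) : ℂ)) g hg hfg s (by rw [hre]; exact hdiff.summable)
  rw [hre, show LSeries (fun n => (g n : ℂ)) (σ:ℂ) = _ from hdiff.tsum_eq, Complex.sub_re] at hmaj
  have hζ := neg_logDeriv_zeta_real σ h1 (by norm_num at h2 ⊢; linarith)
  -- value of the finite sum
  have hlam : ∀ k : ℕ, 1 ≤ k → (LSeries.term (fun n => (vonMangoldt n : ℂ)) (σ:ℂ) (2^k)) = ((Real.log 2 * ((2:ℝ)^(-σ))^k : ℝ) : ℂ) := by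
    intro k hk
    have := term_ofReal (fun n => vonMangoldt n) σ (2^k)
    rw [this, if_neg (by positivity), vonMangoldt_apply_pow (by omega), vonMangoldt_apply_prime Nat.prime_two]
    congr 1
    push_cast
    rw [Real.rpow_neg (by norm_num), inv_pow, div_eq_mul_inv, ← Real.rpow_natCast, ← Real.rpow_mul (by norm_num), ← Real.rpow_natCast,
      ← Real.rpow_mul (by norm_num), mul_comm (k:ℝ)]
  have hsumS : (∑ n ∈ S, if n ∈ S then LSeries.term (fun n => (vonMangoldt n : ℂ)) (σ:ℂ) n else 0)
      = ((Real.log 2 * ((2:ℝ)^(-σ))^1 + (Real.log 2 * ((2:ℝ)^(-σ))^2 + (Real.log 2 * ((2:ℝ)^(-σ))^3 + (Real.log 2 * ((2:ℝ)^(-σ))^4 + Real.log 2 * ((2:ℝ)^(-σ))^5))) : ℝ) : ℂ) := by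
    rw [Finset.sum_congr rfl (fun n hn => if_pos hn)]
    simp only [S]
    rw [Finset.sum_insert (by decide), Finset.sum_insert (by decide), Finset.sum_insert (by decide), Finset.sum_insert (by decide), Finset.sum_singleton]
    have a1 := hlam 1 (by norm_num); have a2 := hlam 2 (by norm_num); have a3 := hlam 3 (by norm_num)
    have a4 := hlam 4 (by norm_num); have a5 := hlam 5 (by norm_num)
    rw [show (2:ℕ)^1 = 2 by norm_num] at a1
    rw [show (2:ℕ)^2 = 4 by norm_num] at a2
    rw [show (2:ℕ)^3 = 8 by norm_num] at a3
    rw [show (2:ℕ)^4 = 16 by norm_num] at a4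
    rw [show (2:ℕ)^5 = 32 by norm_num] at a5
    rw [a1, a2, a3, a4, a5]
    push_cast; ring
  rw [hsumS, Complex.ofReal_re] at hmaj
  have hx : 0.4825 ≤ (2:ℝ)^(-σ) := by
    have k1 : (2:ℝ)^(-1.0503:ℝ) ≤ (2:ℝ)^(-σ) := Real.rpow_le_rpow_of_exponent_le (by norm_num) (by linarith)
    refine le_trans ?_ k1
    rw [show (-1.0503:ℝ) = -1 + (-0.0503) by norm_num, Real.rpow_add (by norm_num), Real.rpow_neg_one,
      Real.rpow_def_of_pos (by norm_num)]
    have := Real.add_one_le_exp (Real.log 2 * -0.0503)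
    have h3 := Real.log_two_lt_d9
    norm_num at this h3 ⊢
    linarith
  have hlog := Real.log_two_gt_d9
  set x := (2:ℝ)^(-σ)
  have hpoly : 0.62 ≤ Real.log 2 * x^1 + (Real.log 2 * x^2 + (Real.log 2 * x^3 + (Real.log 2 * x^4 + Real.log 2 * x^5))) := by
    have : 0.6931 * ((0.4825:ℝ)^1 + (0.4825^2 + (0.4825^3 + (0.4825^4 + 0.4825^5)))) ≤ Real.log 2 * (x^1 + (x^2 + (x^3 + (x^4 + x^5)))) := by
      gcongr; norm_num at hlog ⊢; linarith
    norm_num at this ⊢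
    linarith
  have hs' : ‖1/s‖ ≤ 0.62 := by
    rw [norm_div, norm_one, div_le_iff₀ (norm_pos_iff.mpr hs0)]
    have : (1.613:ℝ)^2 ≤ ‖s‖^2 := by
      rw [Complex.sq_norm, Complex.normSq_apply, hre, him]; nlinarith
    have := abs_le_of_sq_le_sq this (norm_nonneg s)
    norm_num at this ⊢; linarith
  rw [e]
  calc _ ≤ ‖LSeries (fun n => ((lo n * vonMangoldt n : ℝ) : ℂ)) s‖ + ‖1/s‖ := by
        refine (norm_sub_le _ _).trans ?_; rw [norm_neg]
    _ ≤ _ := by linarith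

lemma FF_pack (T y : ℝ) (hy : 1.3 ≤ y) (hT : y + 1 ≤ T) (j : ℕ) :
    ‖iteratedDeriv j (logDeriv FF) (((1 + 3 * ww T : ℝ) : ℂ) + y * I)‖ ≤
      (Nat.factorial j) * ((4 * ww T)⁻¹)^j * (1/(3 * ww T)) := by
  have w0 := ww_pos T
  have w1 := ww_le T
  rcases Nat.eq_zero_or_pos j with rfl | hj
  · rw [iteratedDeriv_zero]
    have := FF_logDeriv_zero (1 + 3 * ww T) y (by linarith) (by norm_num at w1 ⊢; linarith) hy
    simpa using this
  set c : ℂ := (((1 + 3 * ww T : ℝ) : ℂ) + y * I) with hc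
  have hcre : c.re = 1 + 3 * ww T := by simp [hc]
  have hcim : c.im = y := by simp [hc]
  have hc1 : 1 < c.re := by rw [hcre]; linarith
  have hopen : {z : ℂ | 1 < z.re} ∈ nhds c := (isOpen_lt continuous_const Complex.continuous_re).mem_nhds hc1
  have hev : logDeriv FF =ᶠ[nhds c] (ee - logDeriv riemannZeta) := by
    filter_upwards [hopen] with z hz
    have hz' : 1 < z.re := hz
    rw [FF_logDeriv z (by linarith) (by rintro rfl; simp at hz') (riemannZeta_ne_zero_of_one_lt_re hz)]; rfl
  rw [hev.iteratedDeriv_eq j]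
  have hc1' : c ≠ 1 := by intro h; rw [h] at hc1; simp at hc1
  rw [iteratedDeriv_sub (ee_analyticAt c (by linarith)).contDiffAt
    (logDeriv_zeta_analyticAt c hc1' (riemannZeta_ne_zero_of_one_lt_re hc1)).contDiffAt]
  have b1 := ee_deriv_bound c hc1.le (by rw [hcim]; exact hy) j
  have b2 := zeta_pack T y hy hT j hj
  refine (norm_sub_le _ _).trans ((add_le_add b1 b2).trans ?_)
  have hq : (Nat.factorial j : ℝ) * 13 / 0.4^j ≤ (Nat.factorial j) * ((4 * ww T)⁻¹)^j * (32.5 * (4 * ww T)) := by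
    rw [mul_div_assoc, mul_assoc]
    gcongr
    obtain ⟨i, rfl⟩ : ∃ i, j = i + 1 := ⟨j - 1, by omega⟩
    have h1 : (4 * ww T) ≤ 0.4 := by norm_num at w1 ⊢; linarith
    have h2 : ((0.4:ℝ)⁻¹)^i ≤ ((4 * ww T)⁻¹)^i := by gcongr
    calc (13:ℝ)/0.4^(i+1) = 32.5 * ((0.4:ℝ)⁻¹)^i := by rw [pow_succ, inv_pow]; field_simp; norm_num
      _ ≤ 32.5 * ((4 * ww T)⁻¹)^i := by gcongr
      _ = _ := by rw [pow_succ]; field_simp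
  nlinarith

/-- rising factorial -/
noncomputable def poch (p : ℝ) : ℕ → ℝ
  | 0 => 1
  | k+1 => poch p k * (p + k)

lemma poch_nonneg (p : ℝ) (hp : 0 ≤ p) (k : ℕ) : 0 ≤ poch p k := by
  induction k with
  | zero => simp [poch]
  | succ k ih => rw [poch]; positivity

lemma poch_eq (p : ℝ) (k : ℕ) : (ascPochhammer ℝ k).eval p = poch p k := by
  induction k with
  | zero => simp [poch]
  | succ k ih => rw [poch, ascPochhammer_succ_eval, ih]

lemma poch_add (p : ℝ) (k n : ℕ) : poch p (k + n) = poch p k * poch (p + k) n := by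
  induction n with
  | zero => simp [poch]
  | succ n ih => rw [← add_assoc, poch, poch, ih]; push_cast; ring

lemma poch_sum (p : ℝ) (k : ℕ) :
    p * (Nat.factorial k) * ∑ i ∈ range (k+1), poch p i / (Nat.factorial i) = poch p (k+1) := by
  induction k with
  | zero => simp [poch]
  | succ k ih =>
    rw [Finset.sum_range_succ, mul_add]
    have h1 : ((Nat.factorial (k+1) : ℕ) : ℝ) = (k+1) * (Nat.factorial k) := by
      rw [Nat.factorial_succ]; push_cast; ring
    have h2 : p * ((Nat.factorial (k+1) : ℕ) : ℝ) * ∑ i ∈ range (k+1), poch p i / (Nat.factorial i)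
        = (k+1) * poch p (k+1) := by rw [← ih, h1]; ring
    have h3 : ((Nat.factorial (k+1) : ℕ) : ℝ) ≠ 0 := by positivity
    rw [h2, show poch p (k+1+1) = poch p (k+1) * (p + ((k+1:ℕ):ℝ)) from rfl]
    field_simp
    push_cast; ring

lemma poch_hasSum (a x : ℝ) (hx : |x| < 1) :
    HasSum (fun n => poch a n / (Nat.factorial n) * x^n) (1/(1-x)^a) := by
  have h := Real.one_div_one_sub_rpow_hasFPowerSeriesOnBall_zero a
  have h2 := h.hasSum (y := x) (by simpa [enorm_eq_nnnorm, ← NNReal.coe_lt_one] using hx)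
  simp only [FormalMultilinearSeries.ofScalars_apply_eq, zero_add] at h2
  suffices e : (fun n => poch a n / (Nat.factorial n) * x^n) = fun n : ℕ => Ring.choose (a + n - 1) n • x ^ n by
    rw [e]; exact h2
  funext n
  rw [smul_eq_mul, Ring.choose, show a + n - 1 - n + 1 = a by ring]
  have h3 := Ring.factorial_nsmul_multichoose_eq_ascPochhammer a n
  rw [Polynomial.ascPochhammer_smeval_eq_eval, poch_eq, nsmul_eq_mul] at h3
  rw [← h3]
  have : (Nat.factorial n : ℝ) ≠ 0 := by positivity
  field_simp

lemma iteratedDeriv_dom (f : ℂ → ℂ) (c : ℂ) (hf : AnalyticAt ℂ f c) (h0 : f c ≠ 0) (η p : ℝ) (hη : 0 < η) (hp : 0 ≤ p)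
    (hj : ∀ j : ℕ, ‖iteratedDeriv j (logDeriv f) c‖ ≤ (Nat.factorial j) * (η⁻¹)^j * (p * η⁻¹)) (k : ℕ) :
    ‖iteratedDeriv k f c‖ ≤ ‖f c‖ * poch p k * (η⁻¹)^k := by
  induction k using Nat.strong_induction_on with
  | _ k ih =>
  rcases k with _ | k
  · simp [poch]
  have hev : deriv f =ᶠ[nhds c] (f * logDeriv f) := by
    filter_upwards [hf.continuousAt.eventually_ne h0] with z hz
    simp only [Pi.mul_apply, logDeriv_apply]; field_simp
  have hlog : AnalyticAt ℂ (logDeriv f) c := hf.deriv.div hf h0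
  rw [iteratedDeriv_succ', hev.iteratedDeriv_eq, iteratedDeriv_mul hf.contDiffAt hlog.contDiffAt]
  refine (norm_sum_le _ _).trans ?_
  rw [← poch_sum]
  have : ‖f c‖ * (p * (Nat.factorial k) * ∑ i ∈ range (k+1), poch p i / (Nat.factorial i)) * η⁻¹^(k+1)
      = ∑ i ∈ range (k+1), (Nat.choose k i : ℝ) * (‖f c‖ * poch p i * (η⁻¹)^i) * ((Nat.factorial (k-i)) * (η⁻¹)^(k-i) * (p * η⁻¹)) := by
    rw [Finset.mul_sum, Finset.mul_sum, Finset.sum_mul]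
    refine Finset.sum_congr rfl fun i hi => ?_
    have hik : i ≤ k := by simp at hi; omega
    have e1 := Nat.choose_mul_factorial_mul_factorial hik
    have e2 : (Nat.choose k i : ℝ) * (Nat.factorial i) * (Nat.factorial (k-i)) = Nat.factorial k := by exact_mod_cast e1
    have e3 : (η⁻¹)^(k+1) = (η⁻¹)^i * (η⁻¹)^(k-i) * η⁻¹ := by rw [← pow_add, ← pow_succ]; congr 2; omega
    rw [e3, ← e2]
    have : (Nat.factorial i : ℝ) ≠ 0 := by positivity
    field_simp
  rw [this]
  refine Finset.sum_le_sum fun i hi => ?_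
  have hik : i < k + 1 := by simpa using hi
  rw [norm_mul, norm_mul, Complex.norm_natCast]
  have := poch_nonneg p hp i
  exact mul_le_mul (mul_le_mul_of_nonneg_left (ih i hik) (by positivity)) (hj _) (norm_nonneg _) (by positivity)

lemma dom_taylor (f : ℂ → ℂ) (c : ℂ) (r : ℝ) (hf : DifferentiableOn ℂ f (ball c r)) (η p B : ℝ) (hη : 0 < η) (hp : 0 ≤ p)
    (hk : ∀ k : ℕ, ‖iteratedDeriv k f c‖ ≤ B * poch p k * (η⁻¹)^k) (k : ℕ) (z : ℂ) (hz : z ∈ ball c r) (hz2 : ‖z - c‖ < η) :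
    ‖iteratedDeriv k f z‖ ≤ B * poch p k * (η⁻¹)^k * (1/(1-‖z-c‖/η)^(p+k)) := by
  have hfk : DifferentiableOn ℂ (iteratedDeriv k f) (ball c r) := by
    intro w hw
    have : AnalyticAt ℂ f w := hf.analyticAt (isOpen_ball.mem_nhds hw)
    rw [iteratedDeriv_eq_iterate]
    exact (this.iterated_deriv k).differentiableAt.differentiableWithinAt
  have h := Complex.hasSum_taylorSeries_on_ball hfk hz
  have h2 := (poch_hasSum (p + k) (‖z-c‖/η) (by rw [abs_of_nonneg (by positivity), div_lt_one hη]; exact hz2)).mul_left (B * poch p k * (η⁻¹)^k)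
  have := tsum_of_norm_bounded h2 (f := fun n : ℕ ↦ ((Nat.factorial n) : ℂ)⁻¹ • (z - c) ^ n • iteratedDeriv n (iteratedDeriv k f) c) ?_
  · rw [h.tsum_eq] at this; exact this
  intro n
  have e : iteratedDeriv n (iteratedDeriv k f) = iteratedDeriv (k + n) f := by
    rw [iteratedDeriv_eq_iterate, iteratedDeriv_eq_iterate, iteratedDeriv_eq_iterate, add_comm, Function.iterate_add_apply]
  rw [e, norm_smul, norm_smul, norm_inv, Complex.norm_natCast, norm_pow]
  have h3 := hk (k+n)
  rw [poch_add] at h3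
  calc _ ≤ ((Nat.factorial n):ℝ)⁻¹ * (‖z-c‖^n * (B * (poch p k * poch (p+k) n) * (η⁻¹)^(k+n))) := by gcongr
    _ = _ := by rw [pow_add, div_eq_mul_inv ‖z-c‖, mul_pow]; ring

/-- pointwise domination of the fifth derivative on the line `1 + λ` by the value at `1 + 3 w` -/
lemma FF_dom (T y lam : ℝ) (hy : 1.3 ≤ y) (hT : y + 1 ≤ T) (h0 : 0 < lam) (h1 : lam ≤ 3 * ww T) :
    ‖iteratedDeriv 5 FF (((1 + lam : ℝ) : ℂ) + y * I)‖ ≤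
      1530 * (ww T)⁻¹^5 * ‖FF (((1 + 3 * ww T : ℝ) : ℂ) + y * I)‖ := by
  have w0 := ww_pos T
  set c : ℂ := (((1 + 3 * ww T : ℝ) : ℂ) + y * I) with hc
  set z : ℂ := (((1 + lam : ℝ) : ℂ) + y * I) with hz
  have hcre : c.re = 1 + 3 * ww T := by simp [hc]
  have hc1 : 1 < c.re := by rw [hcre]; linarith
  have ana : ∀ s : ℂ, 1 < s.re → AnalyticAt ℂ FF s := fun s hs =>
    FF_analyticAt s (by linarith) (by rintro rfl; simp at hs) (riemannZeta_ne_zero_of_one_lt_re hs)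
  have hdo : DifferentiableOn ℂ FF (ball c (3 * ww T)) := by
    intro s hs
    refine (ana s ?_).differentiableAt.differentiableWithinAt
    rw [mem_ball, dist_eq_norm] at hs
    have := (Complex.abs_re_le_norm (s - c)).trans_lt hs
    rw [Complex.sub_re, hcre, abs_lt] at this
    linarith [this.1]
  have hzc : ‖z - c‖ = 3 * ww T - lam := by
    have : z - c = ((-(3 * ww T - lam) : ℝ) : ℂ) := by rw [hz, hc]; push_cast; ring
    rw [this, Complex.norm_real, norm_neg, Real.norm_of_nonneg (by linarith)]
  have key := dom_taylor FF c (3 * ww T) hdo (4 * ww T) (4/3) ‖FF c‖ (by linarith) (by norm_num)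
    (iteratedDeriv_dom FF c (ana c hc1) (FF_ne c hc1) (4 * ww T) (4/3) (by linarith) (by norm_num) (fun j => by
      have := FF_pack T y hy hT j
      refine this.trans (le_of_eq ?_)
      field_simp)) 5 z (by rw [mem_ball, dist_eq_norm, hzc]; linarith) (by rw [hzc]; linarith)
  refine key.trans ?_
  have hq : (1/4:ℝ) ≤ 1 - ‖z-c‖/(4 * ww T) := by
    rw [hzc, le_sub_iff_add_le, ← le_sub_iff_add_le', div_le_iff₀ (by linarith)]; linarith
  have hq2 : (1/4:ℝ)^((4:ℝ)/3 + (5:ℕ)) ≤ (1 - ‖z-c‖/(4 * ww T))^((4:ℝ)/3 + (5:ℕ)) :=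
    Real.rpow_le_rpow (by norm_num) hq (by positivity)
  have h4 : (4:ℝ)^((4:ℝ)/3) ≤ 6.35 := by
    refine le_of_pow_le_pow_left₀ (n := 3) (by norm_num) (by norm_num) ?_
    rw [← Real.rpow_natCast, ← Real.rpow_mul (by norm_num)]
    rw [show (4:ℝ)/3 * ((3:ℕ):ℝ) = ((4:ℕ):ℝ) by norm_num, Real.rpow_natCast]; norm_num
  have h5 : 1/(1 - ‖z-c‖/(4 * ww T))^((4:ℝ)/3 + (5:ℕ)) ≤ 6.35 * 4^5 := by
    calc _ ≤ 1/(1/4:ℝ)^((4:ℝ)/3 + (5:ℕ)) := by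
          apply one_div_le_one_div_of_le (by positivity) hq2
      _ = (4:ℝ)^((4:ℝ)/3) * 4^5 := by
          rw [one_div, ← Real.inv_rpow (by norm_num), Real.rpow_add (by norm_num), Real.rpow_natCast]
          norm_num
      _ ≤ _ := by gcongr
  have hp5 : poch (4/3) 5 ≤ 240 := by norm_num [poch]
  have hp0 := poch_nonneg (4/3) (by norm_num) 5
  calc _ ≤ ‖FF c‖ * poch (4/3) 5 * (4 * ww T)⁻¹^5 * (6.35 * 4^5) := by gcongr
    _ = ‖FF c‖ * (ww T)⁻¹^5 * (poch (4/3) 5 * 6.35) := by field_simp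
    _ ≤ ‖FF c‖ * (ww T)⁻¹^5 * 1530 := by
        gcongr
        norm_num [poch]
    _ = _ := by ring

lemma zeta1_lower (s : ℂ) (h0 : 0.8 ≤ s.re) (h1 : s.re ≤ 1.3) (him : |s.im| ≤ 1.55) : 0.4 ≤ ‖riemannZeta₁ s‖ := by
  have he := zeta1_err s (by linarith)
  have hp : 1.8 ≤ ‖s + 1‖ := by
    refine le_trans ?_ (Complex.re_le_norm _)
    simp; norm_num at h0 ⊢; linarith
  have him2 : s.im^2 ≤ 2.41 := by rw [← sq_abs]; nlinarith [abs_nonneg s.im]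
  have n1 : ‖s - 1‖ ≤ √2.5 := norm_le_sqrt_of (by simp; nlinarith)
  have n2 : ‖s‖ ≤ √4.1 := norm_le_sqrt_of (by nlinarith)
  have q1 : √2.5 ≤ 1.6 := by rw [Real.sqrt_le_left (by norm_num)]; norm_num
  have q2 : √4.1 ≤ 2.1 := by rw [Real.sqrt_le_left (by norm_num)]; norm_num
  have h3 : ‖s - 1‖ * ‖s‖ * ‖s + 1‖ / (8 * (s.re + 1)) ≤ 1.6 * 2.1 * ‖s+1‖ / (8 * 1.8) := by
    gcongr <;> linarith
  have h4 := norm_sub_norm_le ((s+1)/2) ((s+1)/2 - riemannZeta₁ s)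
  rw [sub_sub_cancel, norm_sub_rev ((s+1)/2), norm_div, show ‖(2:ℂ)‖ = 2 by simp] at h4
  norm_num at *
  linarith

/-- `FF` with the removable singularity removed -/
noncomputable def FF2 (s : ℂ) : ℂ := (1 + ((2:ℂ)^s)⁻¹) * riemannZeta (2*s) * ((s-1) / riemannZeta₁ s) / s

lemma FF2_eq (s : ℂ) (hs : s ≠ 1) : FF s = FF2 s := by
  have : s - 1 ≠ 0 := sub_ne_zero.mpr hs
  rw [FF, Fo_eq, FF2, riemannZeta₁_eq s hs, div_mul_eq_div_div, div_self this, mul_one_div]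

lemma FF2_bound (s : ℂ) (h0 : 0.8 ≤ s.re) (h1 : s.re ≤ 1.3) (him : |s.im| ≤ 1.55) :
    DifferentiableAt ℂ FF2 s ∧ ‖FF2 s‖ ≤ 30 := by
  have hl := zeta1_lower s h0 h1 him
  have hl0 : riemannZeta₁ s ≠ 0 := norm_pos_iff.mp (lt_of_lt_of_le (by norm_num) hl)
  have h2s : 1 < (2*s).re := by simp; norm_num at h0; linarith
  have h2s1 : 2*s ≠ 1 := by rintro h; rw [h] at h2s; simp at h2s
  have hs0 : s ≠ 0 := by rintro rfl; simp at h0; norm_num at h0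
  have hc0 : (2:ℂ)^s ≠ 0 := by simp [Complex.cpow_eq_zero_iff]
  constructor
  · unfold FF2
    refine DifferentiableAt.div (DifferentiableAt.mul (DifferentiableAt.mul ?_ ?_) ?_) differentiableAt_id hs0
    · exact (differentiableAt_const _).add ((cpow_analyticAt s).differentiableAt.inv hc0)
    · exact ((zeta_analyticAt _ h2s1).differentiableAt).comp s ((differentiableAt_const _).mul differentiableAt_id)
    · exact (differentiableAt_id.sub_const 1).div (differentiable_riemannZeta₁ s) hl0
  · have a1 : ‖1 + ((2:ℂ)^s)⁻¹‖ ≤ 2 := by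
      refine (norm_add_le _ _).trans ?_
      rw [norm_inv, two_cpow_norm, norm_one]
      have : (1:ℝ) ≤ 2^s.re := Real.one_le_rpow (by norm_num) (by norm_num at h0; linarith)
      have := inv_le_one_of_one_le₀ this
      linarith
    have a2 : ‖riemannZeta (2*s)‖ ≤ 2.7 := by
      refine (zeta_norm_le _ h2s (by simp; norm_num at h1; linarith)).trans ?_
      have : 1/((2*s).re - 1) ≤ 1/0.6 := by
        apply one_div_le_one_div_of_le (by norm_num); simp; norm_num at h0 ⊢; linarith
      norm_num at this ⊢; linarith
    have him2 : s.im^2 ≤ 2.41 := by rw [← sq_abs]; nlinarith [abs_nonneg s.im]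
    have a3 : ‖s - 1‖ ≤ 1.6 := (norm_le_sqrt_of (b := 2.5) (by simp; nlinarith)).trans
      (by rw [Real.sqrt_le_left (by norm_num)]; norm_num)
    have a4 : 0.8 ≤ ‖s‖ := h0.trans (Complex.re_le_norm s)
    unfold FF2
    rw [norm_div, norm_mul, norm_mul, norm_div]
    calc ‖1 + ((2:ℂ)^s)⁻¹‖ * ‖riemannZeta (2*s)‖ * (‖s-1‖ / ‖riemannZeta₁ s‖) / ‖s‖
        ≤ 2 * 2.7 * (1.6 / 0.4) / (0.8:ℝ) := by gcongr
      _ ≤ 30 := by norm_num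

lemma FF_low (lam y : ℝ) (h0 : 0 < lam) (h1 : lam ≤ 0.1) (hy : |y| ≤ 1.3) :
    ‖iteratedDeriv 5 FF (((1 + lam : ℝ) : ℂ) + y * I)‖ ≤ 12000000 := by
  set c : ℂ := (((1 + lam : ℝ) : ℂ) + y * I) with hc
  have hcre : c.re = 1 + lam := by simp [hc]
  have hcim : c.im = y := by simp [hc]
  have hc1 : c ≠ 1 := by intro h; rw [h] at hcre; simp at hcre; linarith
  have hev : FF =ᶠ[nhds c] FF2 := by
    filter_upwards [isOpen_ne.mem_nhds hc1] with z hz using FF2_eq z hz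
  rw [hev.iteratedDeriv_eq]
  have key : ∀ z : ℂ, z ∈ closedBall c 0.2 → DifferentiableAt ℂ FF2 z ∧ ‖FF2 z‖ ≤ 30 := by
    intro z hz
    have hz' : ‖z - c‖ ≤ 0.2 := by simpa [dist_eq_norm] using hz
    have r1 := (Complex.abs_re_le_norm (z - c)).trans hz'
    have r2 := (Complex.abs_im_le_norm (z - c)).trans hz'
    rw [Complex.sub_re, hcre, abs_le] at r1
    rw [Complex.sub_im, hcim, abs_le] at r2
    rw [abs_le] at hy
    apply FF2_bound
    · norm_num at r1 ⊢; linarith [r1.1]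
    · norm_num at r1 h1 ⊢; linarith [r1.1]
    · rw [abs_le]; norm_num at hy r2 ⊢; constructor <;> linarith [r2.1, r2.2, hy.1, hy.2]
  have := Complex.norm_iteratedDeriv_le_of_forall_mem_sphere_norm_le (f := FF2) (c := c) (R := 0.2) (C := 30) 5 (by norm_num)
    (DifferentiableOn.diffContOnCl (fun z hz => (key z (closure_ball_subset_closedBall hz)).1.differentiableWithinAt))
    (fun z hz => (key z (sphere_subset_closedBall hz)).2)
  refine this.trans ?_
  norm_num [Nat.factorial]
end

section
open Metric Complex Real MeasureTheory
open scoped FourierTransform SchwartzMap ENNReal ContDiff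

lemma eLpNorm_two_sq (f : ℝ → ℂ) : eLpNorm f 2 volume ^ (2:ℝ) = ∫⁻ x, ‖f x‖ₑ ^ (2:ℝ) := by
  have := eLpNorm_nnreal_pow_eq_lintegral (f := f) (μ := volume) (p := 2) (by norm_num)
  simpa using this

lemma plancherel (f : ℝ → ℂ) (h1 : Integrable f) (h2 : MemLp f 2) :
    ∫⁻ x, ‖𝓕 f x‖ₑ ^ (2:ℝ) = ∫⁻ x, ‖f x‖ₑ ^ (2:ℝ) := by
  set F : Lp ℂ 2 (volume : Measure ℝ) := h2.toLp f with hF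
  have hFf : F =ᵐ[volume] f := h2.coeFn_toLp
  have hin : Continuous fun p : ℝ × ℝ => (innerₗ ℝ) p.1 p.2 := by
    simpa using continuous_inner (𝕜 := ℝ) (E := ℝ)
  have hcont : Continuous (𝓕 f) := VectorFourier.fourierIntegral_continuous Real.continuous_fourierChar hin h1
  have hae : (𝓕 F : Lp ℂ 2 (volume : Measure ℝ)) =ᵐ[volume] 𝓕 f := by
    apply ae_eq_of_integral_contDiff_smul_eq
    · exact (Lp.memLp (𝓕 F)).locallyIntegrable (by norm_num)
    · exact hcont.locallyIntegrable
    intro g hg hgs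
    have hgC : ContDiff ℝ ∞ (fun x => (g x : ℂ)) := Complex.ofRealCLM.contDiff.comp hg
    have hgsC : HasCompactSupport (fun x => (g x : ℂ)) := hgs.comp_left (g := fun x : ℝ => (x:ℂ)) (by simp)
    let G : 𝓢(ℝ, ℂ) := hgsC.toSchwartzMap hgC
    have hG : ∀ x, G x = (g x : ℂ) := fun x => rfl
    have e := congrArg (fun D : 𝓢'(ℝ, ℂ) => D G) (Lp.fourier_toTemperedDistribution_eq F)
    simp only [TemperedDistribution.fourier_apply, Lp.toTemperedDistribution_apply] at e
    have e1 : ∫ x, g x • (𝓕 F : Lp ℂ 2 (volume : Measure ℝ)) x = ∫ x, (G x) • (𝓕 F : Lp ℂ 2 (volume : Measure ℝ)) x := by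
      congr 1
    rw [e1, ← e]
    have e2 : ∫ x, (𝓕 G) x • F x = ∫ x, (𝓕 G) x • f x := by
      apply integral_congr_ae
      filter_upwards [hFf] with x hx
      rw [hx]
    rw [e2]
    have := VectorFourier.integral_fourierIntegral_smul_eq_flip (f := (G : ℝ → ℂ)) (g := f) (L := innerₗ ℝ) (μ := volume) (ν := volume) Real.continuous_fourierChar hin G.integrable h1
    rw [flip_innerₗ] at this
    exact this
  rw [← eLpNorm_two_sq, ← eLpNorm_two_sq, ← eLpNorm_congr_ae hae, ← eLpNorm_congr_ae hFf]
  have := Lp.norm_fourier_eq F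
  rw [Lp.norm_def, Lp.norm_def, ENNReal.toReal_eq_toReal_iff' (Lp.eLpNorm_ne_top _) (Lp.eLpNorm_ne_top _)] at this
  rw [this]
end

section
open Metric Complex Real MeasureTheory
open scoped FourierTransform ENNReal Topology

noncomputable def Lo (x : ℝ) : ℝ := ∑ n ∈ Finset.Icc 1 ⌊x⌋₊, lo n

lemma Lo_of_lt (x : ℝ) (h : x < 1) : Lo x = 0 := by
  have : ⌊x⌋₊ = 0 := Nat.floor_eq_zero.mpr h
  simp [Lo, this]

lemma Lo_measurable : Measurable Lo := by
  have : Lo = (fun n : ℕ => ∑ n ∈ Finset.Icc 1 n, lo n) ∘ (fun x : ℝ => ⌊x⌋₊) := rfl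
  rw [this]
  exact (measurable_from_nat).comp Nat.measurable_floor

lemma Lo_abs_le (x : ℝ) (h : 0 ≤ x) : |Lo x| ≤ x := by
  unfold Lo
  refine (Finset.abs_sum_le_sum_abs _ _).trans ?_
  refine (Finset.sum_le_sum (fun n _ => lo_abs_le n)).trans ?_
  simp; exact Nat.floor_le h

noncomputable def fk (k : ℕ) (t : ℝ) : ℂ := (((Real.log t)^k * Lo t⁻¹ : ℝ) : ℂ)

lemma fk_meas (k : ℕ) : Measurable (fk k) := by
  unfold fk
  exact Complex.measurable_ofReal.comp ((Real.measurable_log.pow_const k).mul (Lo_measurable.comp measurable_inv))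

lemma fk_bd (k : ℕ) (t : ℝ) (ht : 0 < t) : ‖fk k t‖ ≤ |Real.log t|^k * t⁻¹ := by
  unfold fk
  rw [Complex.norm_real, norm_mul, norm_pow, Real.norm_eq_abs, Real.norm_eq_abs]
  gcongr
  exact Lo_abs_le _ (by positivity)

lemma fk_loc (k : ℕ) : LocallyIntegrableOn (fk k) (Set.Ioi 0) := by
  have hc : ContinuousOn (fun t : ℝ => |Real.log t|^k * t⁻¹) (Set.Ioi 0) := by
    refine ContinuousOn.mul ?_ (continuousOn_inv₀.mono (fun x hx => ne_of_gt hx))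
    exact ((Real.continuousOn_log.mono (fun x hx => ne_of_gt hx)).abs).pow k
  have h1 := hc.locallyIntegrableOn (μ := volume) measurableSet_Ioi
  rw [locallyIntegrableOn_iff (isOpen_Ioi.isLocallyClosed)] at h1 ⊢
  intro K hK hKc
  refine (h1 K hK hKc).mono' (fk_meas k).aestronglyMeasurable ?_
  filter_upwards [ae_restrict_mem hKc.measurableSet] with t ht
  exact fk_bd k t (hK ht)

lemma fk_top (k : ℕ) (a : ℝ) : fk k =O[atTop] (fun t : ℝ => t ^ (-a)) := by
  have : fk k =ᶠ[atTop] fun _ => (0:ℂ) := by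
    filter_upwards [eventually_gt_atTop 1] with t ht
    rw [fk, Lo_of_lt _ (inv_lt_one_of_one_lt₀ ht)]; simp
  exact this.trans_isBigO (isBigO_zero _ _)

lemma fk_bot (k : ℕ) (b : ℝ) (hb : 1 < b) : fk k =O[𝓝[>] 0] (fun t : ℝ => t ^ (-b)) := by
  have h1 := (isLittleO_abs_log_rpow_rpow_nhdsGT_zero (s := 1 - b) k (by linarith)).isBigO
  have h2 : fk k =O[𝓝[>] 0] (fun t : ℝ => |Real.log t|^(k:ℝ) * t⁻¹) := by
    apply IsBigO.of_bound 1
    filter_upwards [self_mem_nhdsWithin] with t ht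
    have ht : 0 < t := ht
    rw [one_mul, Real.norm_of_nonneg (by positivity), Real.rpow_natCast]
    exact fk_bd k t ht
  refine h2.trans ((h1.mul (isBigO_refl (fun t : ℝ => t⁻¹) _)).congr' (by rfl) ?_)
  filter_upwards [self_mem_nhdsWithin] with t ht
  have ht : 0 < t := ht
  rw [← Real.rpow_neg_one t, ← Real.rpow_add ht]; ring_nf

lemma fk_deriv (k : ℕ) (s : ℂ) (hs : 1 < s.re) :
    HasDerivAt (mellin (fk k)) (mellin (fk (k+1)) s) s := by
  have := (mellin_hasDerivAt_of_isBigO_rpow (a := s.re + 1) (b := (1 + s.re)/2) (fk_loc k) (fk_top k _) (by linarith)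
    (fk_bot k _ (by linarith)) (by linarith)).2
  have e : (fun t => Real.log t • fk k t) = fk (k+1) := by
    funext t; simp only [fk, Complex.real_smul]; push_cast; ring
  rwa [e] at this

lemma fk_zero (s : ℂ) (hs : 1 < s.re) : mellin (fk 0) s = FF s := by
  have hs0 : s ≠ 0 := by rintro rfl; simp at hs; linarith
  have e0 : fk 0 = fun t => (fun x : ℝ => (Lo x : ℂ)) t⁻¹ := by funext t; simp [fk]
  have h := LSeries_eq_mul_integral' (fun n => (lo n : ℂ)) (r := 1) (by norm_num) (s := s) hs (by
    apply IsBigO.of_bound 1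
    filter_upwards with n
    rw [Real.norm_of_nonneg (Finset.sum_nonneg (fun _ _ => norm_nonneg _)), Real.rpow_one, one_mul, Real.norm_of_nonneg (by positivity)]
    refine (Finset.sum_le_sum (fun n _ => show _ ≤ (1:ℝ) by rw [Complex.norm_real]; exact lo_abs_le n)).trans ?_
    simp)
  rw [e0, mellin_comp_inv (fun x : ℝ => (Lo x : ℂ)), FF, ← LSeries_lo s hs, h, mul_div_cancel_left₀ _ hs0, mellin,
    ← integral_indicator measurableSet_Ioi, ← integral_indicator measurableSet_Ioi]
  apply integral_congr_ae
  have : ∀ᵐ t : ℝ, t ≠ 1 := by simp [ae_iff, measure_singleton]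
  filter_upwards [this] with t ht
  by_cases h1 : 1 < t
  · rw [Set.indicator_of_mem (show t ∈ Set.Ioi (0:ℝ) from by simp; linarith), Set.indicator_of_mem (show t ∈ Set.Ioi (1:ℝ) from h1),
      smul_eq_mul, mul_comm, Lo]
    push_cast
    congr 2; ring
  · rw [Set.indicator_of_notMem (show t ∉ Set.Ioi (1:ℝ) from h1)]
    by_cases h0 : 0 < t
    · rw [Set.indicator_of_mem (show t ∈ Set.Ioi (0:ℝ) from h0), Lo_of_lt t (lt_of_le_of_ne (not_lt.mp h1) ht)]; simp
    · rw [Set.indicator_of_notMem (show t ∉ Set.Ioi (0:ℝ) from h0)]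

lemma FF_iter (k : ℕ) (s : ℂ) (hs : 1 < s.re) : iteratedDeriv k FF s = mellin (fk k) s := by
  induction k generalizing s with
  | zero => rw [iteratedDeriv_zero, fk_zero s hs]
  | succ k ih =>
    rw [iteratedDeriv_succ]
    have hev : iteratedDeriv k FF =ᶠ[nhds s] mellin (fk k) := by
      filter_upwards [(isOpen_lt continuous_const Complex.continuous_re).mem_nhds hs] with z hz using ih z hz
    rw [hev.deriv_eq, (fk_deriv k s hs).deriv]

/-- the weighted summatory function -/
noncomputable def gk (k : ℕ) (σ u : ℝ) : ℂ := ((Real.exp (-σ*u) * ((-u)^k * Lo (Real.exp u)) : ℝ) : ℂ)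

lemma FF_fourier (k : ℕ) (σ y : ℝ) (hs : 1 < σ) :
    iteratedDeriv k FF ((σ:ℂ) + y * I) = 𝓕 (gk k σ) (y/(2*π)) := by
  rw [FF_iter k _ (by simpa using hs), mellin_eq_fourier]
  have : (fun u : ℝ => Real.exp (-((σ:ℂ) + y*I).re * u) • fk k (Real.exp (-u))) = gk k σ := by
    funext u
    simp [gk, fk, ← Real.exp_neg]
  rw [this]; simp
end

section
open Metric Complex Real MeasureTheory
open scoped FourierTransform ENNReal Topology

lemma gk_meas (k : ℕ) (σ : ℝ) : Measurable (gk k σ) := by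
  unfold gk
  refine Complex.measurable_ofReal.comp ?_
  refine (Measurable.exp (by fun_prop)).mul ((by fun_prop : Measurable fun u : ℝ => (-u)^k).mul ?_)
  exact Lo_measurable.comp Real.measurable_exp

lemma gk_norm_le (k : ℕ) (σ u : ℝ) :
    ‖gk k σ u‖ ≤ (Set.Ioi (0:ℝ)).indicator (fun u : ℝ => u^(k:ℝ) * Real.exp (-(σ-1) * u^(1:ℝ))) u ∨ u = 0 := by
  rcases lt_trichotomy u 0 with h | h | h
  · left
    have : Lo (Real.exp u) = 0 := Lo_of_lt _ (by simpa using h)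
    rw [gk, this]
    simp [h.le]
  · right; exact h
  · left
    rw [Set.indicator_of_mem (by exact h), gk, Complex.norm_real, norm_mul, norm_mul, norm_pow, norm_neg,
      Real.norm_of_nonneg (Real.exp_pos _).le, Real.norm_of_nonneg h.le, Real.rpow_natCast, Real.rpow_one]
    have h1 := Lo_abs_le (Real.exp u) (Real.exp_pos _).le
    calc Real.exp (-σ*u) * (u^k * ‖Lo (Real.exp u)‖) ≤ Real.exp (-σ*u) * (u^k * Real.exp u) := by
          gcongr; exact h1
      _ = u^k * (Real.exp (-σ*u) * Real.exp u) := by ring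
      _ = _ := by rw [← Real.exp_add]; ring_nf

lemma gk_dom_int (k : ℝ) (hk : 0 ≤ k) (b : ℝ) (hb : 0 < b) :
    Integrable ((Set.Ioi (0:ℝ)).indicator (fun u : ℝ => u^k * Real.exp (-b * u^(1:ℝ)))) := by
  rw [integrable_indicator_iff measurableSet_Ioi]
  exact integrableOn_rpow_mul_exp_neg_mul_rpow (by linarith) (by norm_num) hb

lemma ae_ne_zero' : ∀ᵐ t : ℝ, t ≠ 0 := by simp [ae_iff, measure_singleton]

lemma gk_integrable (k : ℕ) (σ : ℝ) (hs : 1 < σ) : Integrable (gk k σ) := by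
  refine (gk_dom_int k (by positivity) (σ-1) (by linarith)).mono' (gk_meas k σ).aestronglyMeasurable ?_
  filter_upwards [ae_ne_zero'] with u hu
  exact (gk_norm_le k σ u).resolve_right hu

lemma gk_memLp (k : ℕ) (σ : ℝ) (hs : 1 < σ) : MemLp (gk k σ) 2 := by
  rw [memLp_two_iff_integrable_sq_norm (gk_meas k σ).aestronglyMeasurable]
  refine (gk_dom_int ((2*k : ℕ) : ℝ) (by positivity) (2*(σ-1)) (by linarith)).mono' ((gk_meas k σ).norm.pow_const 2).aestronglyMeasurable ?_
  filter_upwards [ae_ne_zero'] with u hu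
  have h := (gk_norm_le k σ u).resolve_right hu
  rw [norm_pow, norm_norm]
  refine (pow_le_pow_left₀ (norm_nonneg _) h 2).trans ?_
  by_cases h0 : u ∈ Set.Ioi (0:ℝ)
  · rw [Set.indicator_of_mem h0, Set.indicator_of_mem h0, Real.rpow_natCast, Real.rpow_natCast, mul_pow, ← Real.exp_nat_mul]
    apply le_of_eq
    push_cast
    ring_nf
  · rw [Set.indicator_of_notMem h0, Set.indicator_of_notMem h0]; norm_num

lemma gk_fourier_neg (k : ℕ) (σ ξ : ℝ) : ‖𝓕 (gk k σ) (-ξ)‖ = ‖𝓕 (gk k σ) ξ‖ := by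
  rw [Real.fourier_real_eq_integral_exp_smul, Real.fourier_real_eq_integral_exp_smul, ← Complex.norm_conj, ← integral_conj]
  congr 2
  funext u
  simp only [smul_eq_mul, map_mul, ← Complex.exp_conj, gk, Complex.conj_ofReal, Complex.conj_I]
  congr 2
  push_cast; ring

lemma Lo_eq (x : ℝ) : Lo x = ∑ m ∈ Finset.range ((⌊x⌋₊+1)/2), lo (2*m+1) := by
  unfold Lo
  generalize ⌊x⌋₊ = n
  induction n with
  | zero => simp
  | succ n ih =>
    rw [Finset.sum_Icc_succ_top (by omega), ih]
    rcases Nat.even_or_odd' n with ⟨k, rfl | rfl⟩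
    · rw [show (2*k+1+1)/2 = (2*k+1)/2 + 1 by omega, Finset.sum_range_succ]
      congr 3; omega
    · rw [lo_even (2*k+1+1) (by simp [Nat.not_odd_iff_even, Nat.even_add_one]), add_zero]
      congr 2
      omega

lemma cnt_le (x y : ℝ) (hx : 0 ≤ x) (hxy : x ≤ y) :
    (((⌊y⌋₊+1)/2 - (⌊x⌋₊+1)/2 : ℕ) : ℝ) ≤ (y-x)/2+1 := by
  have h1 := Nat.floor_le (hx.trans hxy)
  have h2 := Nat.lt_floor_add_one x
  have hle : ⌊x⌋₊ ≤ ⌊y⌋₊ := Nat.floor_mono hxy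
  have h3 : 2 * ((⌊y⌋₊+1)/2 - (⌊x⌋₊+1)/2) + ⌊x⌋₊ ≤ ⌊y⌋₊ + 1 := by omega
  have h4 : (2:ℝ) * (((⌊y⌋₊+1)/2 - (⌊x⌋₊+1)/2 : ℕ) : ℝ) + ⌊x⌋₊ ≤ ⌊y⌋₊ + 1 := by exact_mod_cast h3
  linarith

lemma Lo_diff (x y : ℝ) (hxy : x ≤ y) :
    |Lo y - Lo x| ≤ (((⌊y⌋₊+1)/2 - (⌊x⌋₊+1)/2 : ℕ) : ℝ) := by
  have hle : ⌊x⌋₊ ≤ ⌊y⌋₊ := Nat.floor_mono hxy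
  rw [Lo_eq, Lo_eq, ← Finset.sum_range_add_sum_Ico _ (show (⌊x⌋₊+1)/2 ≤ (⌊y⌋₊+1)/2 by omega), add_sub_cancel_left]
  refine (Finset.abs_sum_le_sum_abs _ _).trans ?_
  refine (Finset.sum_le_sum (fun n _ => lo_abs_le _)).trans ?_
  simp

lemma Lo_diff' (x y : ℝ) (hx : 0 ≤ x) (hxy : x ≤ y) : |Lo y - Lo x| ≤ (y-x)/2+1 :=
  (Lo_diff x y hxy).trans (cnt_le x y hx hxy)

/-- sums over odd numbers -/
lemma odd_sum_sq (a : ℝ) (ha : 2 ≤ a) (M : ℕ) : ∑ m ∈ Finset.range M, ((2*m+1 : ℕ) : ℝ)^(-a) ≤ 1.25 := by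
  have key : ∀ M : ℕ, ∑ m ∈ Finset.range (M+1), ((2*m+1 : ℕ) : ℝ)^(-a) ≤ 1.25 - 1/(4*(M+1)) := by
    intro M
    induction M with
    | zero => simp; norm_num
    | succ M ih =>
      rw [Finset.sum_range_succ]
      have h1 : ((2*(M+1)+1 : ℕ) : ℝ)^(-a) ≤ ((2*(M+1)+1 : ℕ) : ℝ)^(-2:ℝ) := by
        apply Real.rpow_le_rpow_of_exponent_le
        · push_cast; have : (0:ℝ) ≤ M := by positivity
          linarith
        · linarith
      have h1' := Real.rpow_neg (show (0:ℝ) ≤ ((2*(M+1)+1 : ℕ) : ℝ) by positivity) 2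
      have h1 := h1.trans h1'.le
      have h2 : (((2*(M+1)+1 : ℕ) : ℝ)^(2:ℝ))⁻¹ ≤ 1/(4*((M:ℝ)+1)) - 1/(4*((M+1:ℕ)+1)) := by
        push_cast
        rw [show (2:ℝ) = ((2:ℕ):ℝ) by norm_num, Real.rpow_natCast, div_sub_div _ _ (by positivity) (by positivity), inv_eq_one_div,
          div_le_div_iff₀ (by positivity) (by positivity)]
        have : (0:ℝ) ≤ M := by positivity
        push_cast
        nlinarith
      push_cast at *
      linarith [h1.trans h2]
  rcases M with _ | M
  · norm_num
  · have h0 : (0:ℝ) ≤ 1/(4*((M:ℝ)+1)) := by positivity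
    linarith [key M]

lemma odd_sum_b (b : ℝ) (hb : 0 < b) (M : ℕ) : ∑ m ∈ Finset.range M, ((2*m+1 : ℕ) : ℝ)^(-(1+b)) ≤ 1 + 1/(2*b) := by
  have key : ∀ M : ℕ, ∑ m ∈ Finset.range (M+1), ((2*m+1 : ℕ) : ℝ)^(-(1+b)) ≤ 1 + 1/(2*b) - ((2*M+1 : ℕ):ℝ)^(-b)/(2*b) := by
    intro M
    induction M with
    | zero => simp
    | succ M ih =>
      rw [Finset.sum_range_succ]
      have hM : (0:ℝ) ≤ M := by positivity
      have h1 : ((2*(M+1)+1 : ℕ) : ℝ)^(-(1+b)) ≤ ((2*M+1 : ℕ):ℝ)^(-b)/(2*b) - ((2*(M+1)+1 : ℕ):ℝ)^(-b)/(2*b) := by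
        rw [← sub_div, le_div_iff₀ (by positivity)]
        set n : ℝ := ((2*(M+1)+1 : ℕ) : ℝ) with hn
        have hn3 : 3 ≤ n := by rw [hn]; push_cast; linarith
        have e : ((2*M+1 : ℕ):ℝ) = n * (1 - 2/n) := by
          rw [mul_sub, mul_div_cancel₀ _ (by linarith), hn]; push_cast; ring
        have h2n : 2/n < 1 := by rw [div_lt_one (by linarith)]; linarith
        have hp : 0 < 1 - 2/n := by linarith
        rw [e, Real.mul_rpow (by linarith) hp.le, neg_add, add_comm, Real.rpow_add (by linarith), Real.rpow_neg_one]
        have hx : 1 + b * (2/n) ≤ (1-2/n)^(-b) := by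
          rw [Real.rpow_def_of_pos hp]
          have := Real.log_le_sub_one_of_pos hp
          have h3 := Real.add_one_le_exp (Real.log (1-2/n) * -b)
          nlinarith
        have hnb : 0 < n^(-b) := Real.rpow_pos_of_pos (by linarith) _
        have := mul_le_mul_of_nonneg_left hx hnb.le
        have e2 : n ^ (-b) * n⁻¹ * (2*b) = n^(-b) * (1 + b*(2/n)) - n^(-b) := by
          field_simp; ring
        rw [e2]; linarith
      linarith
  rcases M with _ | M
  · simp; positivity
  · have h0 : (0:ℝ) ≤ ((2*M+1 : ℕ):ℝ)^(-b)/(2*b) := by positivity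
    linarith [key M]
end

section
open Metric Complex Real MeasureTheory
open scoped FourierTransform ENNReal Topology

lemma exp_int (a h L : ℝ) (ha : 0 < a) (hh : 0 ≤ h) :
    ∫⁻ u in Set.Ico (L-h) L, ENNReal.ofReal (Real.exp (-a*u)) = ENNReal.ofReal (Real.exp (-a*L) * ((Real.exp (a*h) - 1)/a)) := by
  have hc : Continuous (fun u : ℝ => Real.exp (-a*u)) := by fun_prop
  rw [← ofReal_integral_eq_lintegral_ofReal ((hc.integrableOn_Icc).mono_set Set.Ico_subset_Icc_self)
    (ae_of_all _ fun u => (Real.exp_pos _).le), integral_Ico_eq_integral_Ioc, ← intervalIntegral.integral_of_le (by linarith)]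
  congr 1
  have hd : ∀ x ∈ Set.uIcc (L-h) L, HasDerivAt (fun u : ℝ => -(Real.exp (-a*u))/a) (Real.exp (-a*x)) x := by
    intro x _
    have h1 : HasDerivAt (fun u : ℝ => -a*u) (-a) x := by simpa using (hasDerivAt_id x).const_mul (-a)
    refine ((h1.exp.neg).div_const a).congr_deriv ?_
    field_simp
  rw [intervalIntegral.integral_eq_sub_of_hasDerivAt hd (hc.intervalIntegrable _ _)]
  rw [show -a*(L-h) = -a*L + a*h by ring, Real.exp_add]
  field_simp; ring

noncomputable def fB (σ h u : ℝ) : ℂ := ((Real.exp (-σ*u) * (Lo (Real.exp (u+h)) - Lo (Real.exp u)) : ℝ) : ℂ)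

lemma fB_eq (σ h : ℝ) : fB σ h = fun u => ((Real.exp (σ*h) : ℝ) : ℂ) * gk 0 σ (u+h) - gk 0 σ u := by
  funext u
  simp only [fB, gk]
  have : Real.exp (-σ*u) = Real.exp (σ*h) * Real.exp (-σ*(u+h)) := by rw [← Real.exp_add]; ring_nf
  rw [mul_sub]
  nth_rw 1 [this]
  push_cast
  ring

lemma fB_integrable (σ h : ℝ) (hs : 1 < σ) : Integrable (fB σ h) := by
  rw [fB_eq]
  exact (((gk_integrable 0 σ hs).comp_add_right h).const_mul _).sub (gk_integrable 0 σ hs)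

lemma fB_memLp (σ h : ℝ) (hs : 1 < σ) : MemLp (fB σ h) 2 := by
  rw [fB_eq]
  have h1 : MemLp (fun u => gk 0 σ (u+h)) 2 :=
    (gk_memLp 0 σ hs).comp_measurePreserving (measurePreserving_add_right volume h)
  exact (h1.const_mul _).sub (gk_memLp 0 σ hs)

lemma fB_fourier (σ h ξ : ℝ) (hs : 1 < σ) :
    𝓕 (fB σ h) ξ = (Complex.exp ((σ + (2*π*ξ:ℝ)*I)*h) - 1) * 𝓕 (gk 0 σ) ξ := by
  have hI := gk_integrable 0 σ hs
  have h1 : ∀ g : ℝ → ℂ, 𝓕 g ξ = ∫ v : ℝ, Complex.exp (((-2 * π * v * ξ : ℝ):ℂ) * I) * g v := by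
    intro g; rw [Real.fourier_real_eq_integral_exp_smul]; simp
  have hcI : ∀ g : ℝ → ℂ, Integrable g → Integrable (fun v : ℝ => Complex.exp (((-2 * π * v * ξ : ℝ):ℂ) * I) * g v) := by
    intro g hg
    refine (hg.norm).mono' (by
      refine AEStronglyMeasurable.mul (Continuous.aestronglyMeasurable (by fun_prop)) hg.1) (ae_of_all _ fun v => ?_)
    rw [norm_mul, Complex.norm_exp_ofReal_mul_I, one_mul]
  rw [h1, h1, fB_eq]
  have e : (fun v : ℝ => Complex.exp (((-2 * π * v * ξ : ℝ):ℂ) * I) * (((Real.exp (σ*h) : ℝ) : ℂ) * gk 0 σ (v+h) - gk 0 σ v)) =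
      fun v : ℝ => (fun w : ℝ => Complex.exp ((σ + (2*π*ξ:ℝ)*I)*h) * (Complex.exp (((-2 * π * w * ξ : ℝ):ℂ) * I) * gk 0 σ w)) (v+h)
        - Complex.exp (((-2 * π * v * ξ : ℝ):ℂ) * I) * gk 0 σ v := by
    funext v
    simp only
    rw [mul_sub, ← mul_assoc, ← mul_assoc, Complex.ofReal_exp, ← Complex.exp_add, ← Complex.exp_add]
    congr 3
    push_cast; ring
  have hJ := ((hcI _ hI).const_mul (Complex.exp ((σ + (2*π*ξ:ℝ)*I)*h)))
  rw [e, integral_sub (hJ.comp_add_right h) (hcI _ hI), integral_add_right_eq_self (μ := volume)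
    (fun w : ℝ => Complex.exp ((σ + (2*π*ξ:ℝ)*I)*h) * (Complex.exp (((-2 * π * w * ξ : ℝ):ℂ) * I) * gk 0 σ w)) h,
    integral_const_mul]
  ring

lemma exp_low (σ h y : ℝ) (h1 : π/2 ≤ |y*h|) (h2 : |y*h| ≤ 3*π/2) :
    1 + Real.exp (2*σ*h) ≤ ‖Complex.exp ((σ + (y:ℝ)*I)*h) - 1‖^2 := by
  have hc : Real.cos (y*h) ≤ 0 := by
    rw [← Real.cos_abs]
    exact Real.cos_nonpos_of_pi_div_two_le_of_le h1 (by linarith)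
  have e : ((σ:ℂ) + (y:ℝ)*I)*h = ((σ*h : ℝ):ℂ) + ((y*h:ℝ):ℂ) * I := by push_cast; ring
  rw [e, ← Complex.normSq_eq_norm_sq, Complex.exp_add, ← Complex.ofReal_exp, Complex.exp_mul_I, ← Complex.ofReal_cos, ← Complex.ofReal_sin,
    Complex.normSq_apply]
  simp only [sub_re, mul_re, ofReal_re, add_re, I_re, mul_zero, ofReal_im, I_im, mul_one, sub_self, add_zero, one_re, sub_im, mul_im, add_im, one_im, zero_mul, sub_zero, zero_add]
  rw [show 2*σ*h = σ*h + σ*h by ring, Real.exp_add]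
  have hs := Real.sin_sq_add_cos_sq (y*h)
  have hE := Real.exp_pos (σ*h)
  nlinarith [mul_nonneg hE.le (neg_nonneg.mpr hc)]

lemma fB_pt (σ h u : ℝ) (hh : 0 ≤ h) :
    ‖fB σ h u‖ₑ^(2:ℝ) ≤ ∑' m : ℕ, (Set.Ico (Real.log ((2*m+1:ℕ):ℝ) - h) (Real.log ((2*m+1:ℕ):ℝ))).indicator
      (fun u => ENNReal.ofReal (Real.exp (-(2*σ)*u)) + ENNReal.ofReal ((Real.exp h - 1)/2) * ENNReal.ofReal (Real.exp (-(2*σ-1)*u))) u := by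
  set A := (⌊Real.exp u⌋₊+1)/2
  set B := (⌊Real.exp (u+h)⌋₊+1)/2
  have hle : Real.exp u ≤ Real.exp (u+h) := Real.exp_le_exp.mpr (by linarith)
  refine le_trans ?_ (ENNReal.sum_le_tsum (Finset.Ico A B))
  have hmem : ∀ m ∈ Finset.Ico A B, u ∈ Set.Ico (Real.log ((2*m+1:ℕ):ℝ) - h) (Real.log ((2*m+1:ℕ):ℝ)) := by
    intro m hm
    rw [Finset.mem_Ico] at hm
    have hpos : (0:ℝ) < ((2*m+1:ℕ):ℝ) := by positivity
    constructor
    · have : 2*m+1 ≤ ⌊Real.exp (u+h)⌋₊ := by omega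
      have := (Nat.le_floor_iff (Real.exp_pos _).le).mp this
      have := (Real.log_le_iff_le_exp hpos).mpr this
      linarith
    · have : ⌊Real.exp u⌋₊ < 2*m+1 := by omega
      have := (Nat.floor_lt (Real.exp_pos _).le).mp this
      exact (Real.lt_log_iff_exp_lt hpos).mpr this
  rw [Finset.sum_congr rfl (fun m hm => Set.indicator_of_mem (hmem m hm) _), Finset.sum_const, Nat.card_Ico, nsmul_eq_mul]
  have hd := Lo_diff _ _ hle
  have hc := cnt_le _ _ (Real.exp_pos u).le hle
  rw [fB, ← ofReal_norm, Complex.norm_real, norm_mul, Real.norm_of_nonneg (Real.exp_pos _).le, ENNReal.ofReal_rpow_of_nonneg (by positivity) (by norm_num),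
    ← ENNReal.ofReal_mul (by have := Real.one_le_exp hh; linarith), ← ENNReal.ofReal_add (Real.exp_pos _).le (by have := Real.one_le_exp hh; have := Real.exp_pos (-(2*σ-1)*u); positivity),
    ← ENNReal.ofReal_natCast, ← ENNReal.ofReal_mul (by positivity)]
  apply ENNReal.ofReal_le_ofReal
  change _ ≤ ((B - A : ℕ):ℝ) at hd
  change ((B - A : ℕ):ℝ) ≤ _ at hc
  set N : ℝ := ((B - A : ℕ):ℝ)
  have hN : 0 ≤ N := by positivity
  rw [show (2:ℝ) = ((2:ℕ):ℝ) by norm_num, Real.rpow_natCast, mul_pow, Real.norm_eq_abs]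
  have e1 : Real.exp (-σ*u)^2 = Real.exp (-(((2:ℕ):ℝ)*σ)*u) := by rw [← Real.exp_nat_mul]; push_cast; ring_nf
  have e2 : Real.exp (-(((2:ℕ):ℝ)*σ-1)*u) = Real.exp (-(((2:ℕ):ℝ)*σ)*u) * Real.exp u := by rw [← Real.exp_add]; ring_nf
  rw [e1, e2]
  set E := Real.exp (-(((2:ℕ):ℝ)*σ)*u) with hE
  have hEp : 0 < E := Real.exp_pos _
  rw [Real.exp_add] at hc
  calc E * |Lo (Real.exp (u+h)) - Lo (Real.exp u)|^2 ≤ E * N^2 := by gcongr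
    _ = N * (E * N) := by ring
    _ ≤ N * (E * ((Real.exp u * Real.exp h - Real.exp u)/2+1)) := by gcongr
    _ = _ := by push_cast; ring

lemma tsum_ofReal_le (f : ℕ → ℝ) (hf : ∀ n, 0 ≤ f n) (c : ℝ) (h : ∀ M, ∑ m ∈ Finset.range M, f m ≤ c) :
    ∑' m, ENNReal.ofReal (f m) ≤ ENNReal.ofReal c := by
  apply ENNReal.tsum_le_of_sum_range_le
  intro M
  rw [← ENNReal.ofReal_sum_of_nonneg (fun i _ => hf i)]
  exact ENNReal.ofReal_le_ofReal (h M)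

lemma fB_ms (l h : ℝ) (hl : 0 < l) (hh : 0 ≤ h) :
    ∫⁻ u, ‖fB (1+l) h u‖ₑ^(2:ℝ) ≤ ENNReal.ofReal (1.25 * ((Real.exp (2*(1+l)*h)-1)/(2*(1+l)))
      + (Real.exp h - 1)/2 * ((1+1/(4*l)) * ((Real.exp ((2*(1+l)-1)*h)-1)/(2*(1+l)-1)))) := by
  set σ := 1+l with hσ
  have hexp : ∀ a : ℝ, 0 ≤ a → 0 ≤ Real.exp (a*h) - 1 := fun a ha => by
    have := Real.one_le_exp (mul_nonneg ha hh); linarith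
  refine (lintegral_mono (fun u => fB_pt σ h u hh)).trans ?_
  rw [lintegral_tsum (fun m => by
    refine AEMeasurable.indicator ?_ measurableSet_Ico
    fun_prop)]
  have hm : ∀ m : ℕ, ∫⁻ u, (Set.Ico (Real.log ((2*m+1:ℕ):ℝ) - h) (Real.log ((2*m+1:ℕ):ℝ))).indicator
      (fun u => ENNReal.ofReal (Real.exp (-(2*σ)*u)) + ENNReal.ofReal ((Real.exp h - 1)/2) * ENNReal.ofReal (Real.exp (-(2*σ-1)*u))) u
      = ENNReal.ofReal (((2*m+1:ℕ):ℝ)^(-(2*σ))) * ENNReal.ofReal ((Real.exp (2*σ*h)-1)/(2*σ)) +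
        ENNReal.ofReal (((2*m+1:ℕ):ℝ)^(-(1+2*l))) * (ENNReal.ofReal ((Real.exp h - 1)/2) * ENNReal.ofReal ((Real.exp ((2*σ-1)*h)-1)/(2*σ-1))) := by
    intro m
    have hpos : (0:ℝ) < ((2*m+1:ℕ):ℝ) := by positivity
    rw [lintegral_indicator measurableSet_Ico, lintegral_add_left (by fun_prop), lintegral_const_mul _ (by fun_prop),
      exp_int _ _ _ (by linarith) hh, exp_int _ _ _ (by linarith) hh, ENNReal.ofReal_mul (Real.exp_pos _).le, ENNReal.ofReal_mul (Real.exp_pos _).le,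
      Real.rpow_def_of_pos hpos, Real.rpow_def_of_pos hpos]
    rw [show -(2*σ) * Real.log ((2*m+1:ℕ):ℝ) = Real.log ((2*m+1:ℕ):ℝ) * -(2*σ) by ring,
      show -(2*σ-1) * Real.log ((2*m+1:ℕ):ℝ) = Real.log ((2*m+1:ℕ):ℝ) * -(1+2*l) by rw [hσ]; ring]
    ring
  rw [tsum_congr hm, ENNReal.tsum_add, ENNReal.tsum_mul_right, ENNReal.tsum_mul_right]
  have hA := tsum_ofReal_le (fun m : ℕ => ((2*m+1:ℕ):ℝ)^(-(2*σ))) (fun m => by positivity) 1.25 (odd_sum_sq _ (by linarith))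
  have hB := tsum_ofReal_le (fun m : ℕ => ((2*m+1:ℕ):ℝ)^(-(1+2*l))) (fun m => by positivity) _ (odd_sum_b _ (by linarith))
  refine (add_le_add (mul_le_mul_left hA _) (mul_le_mul_left hB _)).trans ?_
  have p1 : 0 ≤ (Real.exp (2*σ*h)-1)/(2*σ) := div_nonneg (hexp _ (by linarith)) (by linarith)
  have p2 : 0 ≤ (Real.exp h - 1)/2 := by have := hexp 1 (by norm_num); rw [one_mul] at this; linarith
  have p3 : 0 ≤ (Real.exp ((2*σ-1)*h)-1)/(2*σ-1) := div_nonneg (hexp _ (by linarith)) (by linarith)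
  rw [← ENNReal.ofReal_mul (by norm_num), ← ENNReal.ofReal_mul p2, ← ENNReal.ofReal_mul (by positivity), ← ENNReal.ofReal_add (by positivity) (by positivity)]
  apply ENNReal.ofReal_le_ofReal
  apply le_of_eq
  rw [show 2*(2*l) = 4*l by ring]; ring

lemma sinh_le_mul_cosh (a : ℝ) (ha : 0 ≤ a) : Real.sinh a ≤ a * Real.cosh a := by
  have hd : ∀ x : ℝ, HasDerivAt (fun x => x * Real.cosh x - Real.sinh x) (x * Real.sinh x) x := by
    intro x
    refine (((hasDerivAt_id x).mul (Real.hasDerivAt_cosh x)).sub (Real.hasDerivAt_sinh x)).congr_deriv ?_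
    simp
  have hm : MonotoneOn (fun x => x * Real.cosh x - Real.sinh x) (Set.Ici 0) := by
    apply monotoneOn_of_deriv_nonneg (convex_Ici 0)
    · exact (continuous_iff_continuousAt.mpr fun x => (hd x).continuousAt).continuousOn
    · exact fun x _ => (hd x).differentiableAt.differentiableWithinAt
    · intro x hx
      rw [interior_Ici] at hx
      rw [(hd x).deriv]
      exact mul_nonneg hx.le (Real.sinh_nonneg_iff.mpr hx.le)
  have := hm (show (0:ℝ) ∈ Set.Ici 0 from by simp) (show a ∈ Set.Ici 0 from ha) ha
  simp at this
  linarith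

lemma real_ineq (l h : ℝ) (hl : 0 < l) (hl' : l ≤ 0.0503) (hh : 0 ≤ h) :
    1.25 * ((Real.exp (2*(1+l)*h)-1)/(2*(1+l)))
      + (Real.exp h - 1)/2 * ((1+1/(4*l)) * ((Real.exp ((2*(1+l)-1)*h)-1)/(2*(1+l)-1)))
    ≤ (1 + Real.exp (2*(1+l)*h)) * (0.625*h + (1+1/(4*l)) * 1.003 * h^2/4) := by
  set σ := 1+l with hσ
  have hs : 0 < σ := by linarith
  set a := σ*h with ha
  have ha0 : 0 ≤ a := by positivity
  have e2 : Real.exp (2*σ*h) = Real.exp a ^2 := by rw [← Real.exp_nat_mul, ha]; push_cast; ring_nf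
  have hEa := Real.exp_pos a
  have hEa1 := Real.one_le_exp ha0
  have t1 : Real.exp (2*σ*h) - 1 ≤ (1+Real.exp (2*σ*h)) * a := by
    have h1 := sinh_le_mul_cosh a ha0
    rw [Real.sinh_eq, Real.cosh_eq, Real.exp_neg] at h1
    have h2 := mul_le_mul_of_nonneg_right h1 (show 0 ≤ 2 * Real.exp a by positivity)
    have e3 : (Real.exp a - (Real.exp a)⁻¹)/2 * (2*Real.exp a) = Real.exp a^2 - 1 := by field_simp
    have e4 : a * ((Real.exp a + (Real.exp a)⁻¹)/2) * (2*Real.exp a) = (1 + Real.exp a^2) * a := by field_simp; ring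
    rw [e2]; linarith
  have t2 : (Real.exp h - 1) * (Real.exp ((2*σ-1)*h)-1) ≤ (1+Real.exp (2*σ*h)) * (a^2/2) := by
    set c := Real.exp (h/2) with hc
    have f1 : Real.exp h * Real.exp ((2*σ-1)*h) = Real.exp a^2 := by
      rw [← e2, ← Real.exp_add]; ring_nf
    have f2 : 2 * Real.exp a ≤ Real.exp h + Real.exp ((2*σ-1)*h) := by
      nlinarith [sq_nonneg (Real.exp h - Real.exp ((2*σ-1)*h)), Real.exp_pos h, Real.exp_pos ((2*σ-1)*h)]
    have f3 : (Real.exp h - 1) * (Real.exp ((2*σ-1)*h)-1) ≤ (Real.exp a - 1)^2 := by nlinarith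
    refine f3.trans ?_
    rw [e2]
    have f4 := Real.cosh_le_exp_half_sq a
    rw [Real.cosh_eq, Real.exp_neg] at f4
    have f5 : 1 - a^2/2 ≤ Real.exp (-(a^2/2)) := by have := Real.add_one_le_exp (-(a^2/2)); linarith
    have f6 : (1 - a^2/2) * ((Real.exp a + (Real.exp a)⁻¹)/2) ≤ 1 := by
      calc _ ≤ Real.exp (-(a^2/2)) * ((Real.exp a + (Real.exp a)⁻¹)/2) := by gcongr
        _ ≤ Real.exp (-(a^2/2)) * Real.exp (a^2/2) := by gcongr
        _ = 1 := by rw [← Real.exp_add]; simp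
    have f7 : (1 - a^2/2) * (Real.exp a^2 + 1) ≤ 2 * Real.exp a := by
      have := mul_le_mul_of_nonneg_right f6 (show 0 ≤ 2 * Real.exp a by positivity)
      have e : (1 - a^2/2) * ((Real.exp a + (Real.exp a)⁻¹)/2) * (2*Real.exp a) = (1 - a^2/2) * (Real.exp a^2 + 1) := by
        field_simp
      linarith
    nlinarith
  set E := Real.exp (2*σ*h)
  have hE0 : 0 < E := Real.exp_pos _
  have u1 : 1.25 * ((E-1)/(2*σ)) ≤ (1+E) * (0.625*h) := by
    rw [← mul_div_assoc, div_le_iff₀ (by positivity)]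
    calc 1.25*(E-1) ≤ 1.25*((1+E)*a) := by gcongr
      _ = _ := by rw [ha]; ring
  have hl4 : 0 ≤ 1 + 1/(4*l) := by positivity
  have u2 : (Real.exp h - 1)/2 * ((1+1/(4*l)) * ((Real.exp ((2*σ-1)*h)-1)/(2*σ-1))) ≤ (1+E) * ((1+1/(4*l)) * 1.003 * h^2/4) := by
    have e : (Real.exp h - 1)/2 * ((1+1/(4*l)) * ((Real.exp ((2*σ-1)*h)-1)/(2*σ-1))) =
      (1+1/(4*l)) * (((Real.exp h - 1) * (Real.exp ((2*σ-1)*h)-1)/(2*σ-1))/2) := by ring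
    rw [e]
    have hs2 : σ^2/(2*σ-1) ≤ 1.003 := by
      rw [div_le_iff₀ (by linarith), hσ]; nlinarith
    calc _ ≤ (1+1/(4*l)) * (((1+E) * (a^2/2)/(2*σ-1))/2) := by
          have : 0 < 2*σ-1 := by linarith
          gcongr
      _ = (1+1/(4*l)) * ((1+E) * h^2/4 * (σ^2/(2*σ-1))) := by rw [ha]; ring
      _ ≤ (1+1/(4*l)) * ((1+E) * h^2/4 * 1.003) := by gcongr
      _ = _ := by ring
  linarith

lemma block_ms (Y l : ℝ) (hY : 0 < Y) (hl : 0 < l) (hl' : l ≤ 0.0503) :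
    ∫⁻ ξ in {ξ : ℝ | Y ≤ |2*π*ξ| ∧ |2*π*ξ| ≤ 3*Y}, ‖𝓕 (gk 0 (1+l)) ξ‖ₑ^(2:ℝ) ≤
      ENNReal.ofReal (0.625*(π/(2*Y)) + (1+1/(4*l)) * 1.003 * (π/(2*Y))^2/4) := by
  set h := π/(2*Y) with hh
  have hp : 0 < h := by positivity
  set S := {ξ : ℝ | Y ≤ |2*π*ξ| ∧ |2*π*ξ| ≤ 3*Y} with hS
  have hSm : MeasurableSet S := by
    have hc : Continuous (fun ξ : ℝ => |2*π*ξ|) := by fun_prop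
    exact (measurableSet_le measurable_const hc.measurable).inter (measurableSet_le hc.measurable measurable_const)
  set E := 1 + Real.exp (2*(1+l)*h) with hE
  have hE0 : 0 < E := by positivity
  have key : ENNReal.ofReal E * ∫⁻ ξ in S, ‖𝓕 (gk 0 (1+l)) ξ‖ₑ^(2:ℝ) ≤ ENNReal.ofReal (E * (0.625*h + (1+1/(4*l)) * 1.003 * h^2/4)) := by
    rw [← lintegral_const_mul' _ _ ENNReal.ofReal_ne_top]
    calc ∫⁻ ξ in S, ENNReal.ofReal E * ‖𝓕 (gk 0 (1+l)) ξ‖ₑ^(2:ℝ) ≤ ∫⁻ ξ in S, ‖𝓕 (fB (1+l) h) ξ‖ₑ^(2:ℝ) := by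
          apply setLIntegral_mono' hSm
          intro ξ hξ
          rw [fB_fourier _ _ _ (by linarith), enorm_mul, ENNReal.mul_rpow_of_nonneg _ _ (by norm_num)]
          gcongr
          rw [← ofReal_norm, ENNReal.ofReal_rpow_of_nonneg (norm_nonneg _) (by norm_num)]
          apply ENNReal.ofReal_le_ofReal
          rw [show (2:ℝ) = ((2:ℕ):ℝ) by norm_num, Real.rpow_natCast]
          have e : Y * h = π/2 := by rw [hh]; field_simp
          have := exp_low (1+l) h (2*π*ξ) (by rw [abs_mul, abs_of_pos hp, ← e]; exact mul_le_mul_of_nonneg_right hξ.1 hp.le)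
            (by rw [abs_mul, abs_of_pos hp, show 3*π/2 = (3*Y)*h by rw [mul_assoc, e]; ring]; exact mul_le_mul_of_nonneg_right hξ.2 hp.le)
          exact_mod_cast this
      _ ≤ ∫⁻ ξ, ‖𝓕 (fB (1+l) h) ξ‖ₑ^(2:ℝ) := setLIntegral_le_lintegral _ _
      _ = ∫⁻ u, ‖fB (1+l) h u‖ₑ^(2:ℝ) := plancherel _ (fB_integrable _ _ (by linarith)) (fB_memLp _ _ (by linarith))
      _ ≤ _ := (fB_ms l h hl hp.le).trans (ENNReal.ofReal_le_ofReal (real_ineq l h hl hl' hp.le))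
  rw [ENNReal.ofReal_mul hE0.le] at key
  exact (ENNReal.mul_le_mul_iff_right (by simpa using hE0) ENNReal.ofReal_ne_top).mp key
end

section
open Metric Complex Real MeasureTheory
open scoped FourierTransform ENNReal Topology

noncomputable def TT (i : ℕ) : ℝ := 3.9 * 3^i + 1

lemma CC_le (τ p z q : ℝ) (h1 : Real.log (PP τ) ≤ p) (h2 : ZZ τ ≤ z) (h3 : Real.log z ≤ q) :
    CC τ ≤ p/4 + 0.678*q + 0.67 := by
  have : Real.log (ZZ τ) ≤ Real.log z := Real.log_le_log (by linarith [ZZ_ge τ]) h2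
  unfold CC; linarith

lemma log365 : Real.log 3.65 ≤ 1.2976 := by
  have h1 := log_le_of_pow (a := 3.65) (n := 38) (m := 71) (by norm_num) (by norm_num)
  norm_num at h1 ⊢; linarith

lemma log_tan (z z0 q : ℝ) (hz : 0 < z) (hz0 : 0 < z0) (h : Real.log z0 ≤ q) : Real.log z ≤ q + z/z0 - 1 := by
  have := Real.log_le_sub_one_of_pos (show 0 < z/z0 by positivity)
  rw [Real.log_div hz.ne' hz0.ne'] at this
  linarith

lemma PP_log_le (τ m p : ℝ) (hm : 1 ≤ m) (h : τ ≤ m * 6.283) (hp : Real.log m ≤ p) : Real.log (PP τ) ≤ p := by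
  refine le_trans (Real.log_le_log (lt_of_lt_of_le one_pos (PP_one_le τ)) ?_) hp
  unfold PP
  apply max_le hm
  rw [div_le_iff₀ (by positivity)]
  have := Real.pi_gt_d4
  nlinarith

lemma ZZ_le' (τ m p : ℝ) (hm : 1 ≤ m) (h : τ ≤ m * 22) (hp : Real.log m ≤ p) : ZZ τ ≤ 3.65 + p := by
  unfold ZZ
  have : Real.log (max 1 (τ/22)) ≤ p := by
    refine le_trans (Real.log_le_log (lt_of_lt_of_le one_pos (le_max_left _ _)) ?_) hp
    apply max_le hm
    rw [div_le_iff₀ (by norm_num)]; exact h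
  linarith

lemma log3_le : Real.log 3 ≤ 1.0989 := by
  have h1 := log_le_of_pow (a := 3) (n := 41) (m := 65) (by norm_num) (by norm_num)
  norm_num at h1 ⊢; linarith

lemma log_le_nm (a q : ℝ) (n m : ℕ) (hn : 0 < n) (ha : 0 < a) (h : a^n ≤ 2^m) (hq : m * 0.6931472 ≤ n * q) : Real.log a ≤ q := by
  have := log_le_of_pow ha h
  have hn' : (0:ℝ) < n := by exact_mod_cast hn
  exact le_of_mul_le_mul_left (this.trans hq) hn'

lemma log_ge_nm (a q : ℝ) (n m : ℕ) (hn : 0 < n) (_ : 0 < a) (h : 2^m ≤ a^n) (hq : n * q ≤ m * 0.6931471) : q ≤ Real.log a := by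
  have := Real.log_le_log (by positivity) h
  rw [Real.log_pow, Real.log_pow] at this
  have h2 := Real.log_two_gt_d9
  have hm : (0:ℝ) ≤ m := by positivity
  have hn' : (0:ℝ) < n := by exact_mod_cast hn
  refine le_of_mul_le_mul_left (hq.trans (le_trans ?_ this)) hn'
  gcongr
  linarith

lemma DD_lin (i : ℕ) : DD (TT i) ≤ 1.7 + 0.36 * i := by
  rcases Nat.lt_or_ge i 2 with h | h
  · have c1 : i = 0 ∨ i = 1 := by omega
    rcases c1 with rfl | rfl
    · have h1 := CC_le (TT 0 + 1) 0 (3.65+0) 1.2976 (PP_log_le _ 1 0 le_rfl (by norm_num [TT]) (by simp)) (ZZ_le' _ 1 0 le_rfl (by norm_num [TT]) (by simp)) (by simpa using log365)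
      have h2 := CC_le (2*TT 0 + 1) 0.555 (3.65+0) 1.2976 (PP_log_le _ 1.73 0.555 (by norm_num) (by norm_num [TT]) (log_le_nm _ _ 5 4 (by norm_num) (by norm_num) (by norm_num) (by norm_num))) (ZZ_le' _ 1 0 le_rfl (by norm_num [TT]) (by simp)) (by simpa using log365)
      have h3 := CC_le (3*TT 0 + 1) 0.971 (3.65+0) 1.2976 (PP_log_le _ 2.5 0.971 (by norm_num) (by norm_num [TT]) (log_le_nm _ _ 5 7 (by norm_num) (by norm_num) (by norm_num) (by norm_num))) (ZZ_le' _ 1 0 le_rfl (by norm_num [TT]) (by simp)) (by simpa using log365)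
      unfold DD
      push_cast
      linarith
    · have l4 : Real.log 4.35 ≤ 1.4733 := by
        have := log_tan 4.35 3.65 1.2976 (by norm_num) (by norm_num) log365
        have h2 := log_le_nm 4.35 1.473 8 17 (by norm_num) (by norm_num) (by norm_num) (by norm_num)
        linarith
      have h1 := CC_le (TT 1 + 1) 0.84 (3.65+0) 1.2976 (PP_log_le _ 2.19 0.84 (by norm_num) (by norm_num [TT]) (log_le_nm _ _ 5 6 (by norm_num) (by norm_num) (by norm_num) (by norm_num))) (ZZ_le' _ 1 0 le_rfl (by norm_num [TT]) (by simp)) (by simpa using log365)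
      have h2 := CC_le (2*TT 1 + 1) 1.5 (3.65+0.7) 1.4733 (PP_log_le _ 4.23 1.5 (by norm_num) (by norm_num [TT]) (log_le_nm _ _ 12 25 (by norm_num) (by norm_num) (by norm_num) (by norm_num))) (ZZ_le' _ 2 0.7 (by norm_num) (by norm_num [TT]) (log_le_nm _ _ 1 1 (by norm_num) (by norm_num) (by norm_num) (by norm_num))) (by norm_num at l4 ⊢; linarith)
      have h3 := CC_le (3*TT 1 + 1) 1.9 (3.65+0.7) 1.4733 (PP_log_le _ 6.3 1.9 (by norm_num) (by norm_num [TT]) (log_le_nm _ _ 7 19 (by norm_num) (by norm_num) (by norm_num) (by norm_num))) (ZZ_le' _ 2 0.7 (by norm_num) (by norm_num [TT]) (log_le_nm _ _ 1 1 (by norm_num) (by norm_num) (by norm_num) (by norm_num))) (by norm_num at l4 ⊢; linarith)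
      unfold DD
      push_cast
      linarith
  · have hx : (9:ℝ) ≤ 3^i := by
      calc (9:ℝ) = 3^2 := by norm_num
        _ ≤ 3^i := pow_le_pow_right₀ (by norm_num) h
    have hi : (2:ℝ) ≤ i := by exact_mod_cast h
    have l3 := log3_le
    have gen : ∀ c p : ℝ, 0 < c → Real.log c ≤ p → Real.log (c * 3^i) ≤ p + 1.0989*i := by
      intro c p hc hp
      rw [Real.log_mul hc.ne' (by positivity), Real.log_pow]
      nlinarith
    have lz : Real.log 9 ≤ 2.1979 := by
      have e : (9:ℝ) = 3^2 := by norm_num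
      rw [e, Real.log_pow]; push_cast; linarith
    have T0 : TT i = 3.9*3^i+1 := rfl
    -- logs of constants
    have a1 : Real.log (4.124/6.283) ≤ -0.42 := by
      have := log_ge_nm (6.283/4.124) 0.42 33 20 (by norm_num) (by norm_num) (by norm_num) (by norm_num)
      rw [Real.log_div (by norm_num) (by norm_num)] at this ⊢; linarith
    have a2 : Real.log (8.1334/6.283) ≤ 0.2600 := log_le_nm _ _ 8 3 (by norm_num) (by norm_num) (by norm_num) (by norm_num)
    have a3 : Real.log (12.145/6.283) ≤ 0.6602 := log_le_nm _ _ 21 20 (by norm_num) (by norm_num) (by norm_num) (by norm_num)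
    have b1 : Real.log (4.124/22) ≤ -1.67 := by
      have := log_ge_nm (22/4.124) 1.67 29 70 (by norm_num) (by norm_num) (by norm_num) (by norm_num)
      rw [Real.log_div (by norm_num) (by norm_num)] at this ⊢; linarith
    have b2 : Real.log (8.1334/22) ≤ -0.99 := by
      have := log_ge_nm (22/8.1334) 0.99 30 43 (by norm_num) (by norm_num) (by norm_num) (by norm_num)
      rw [Real.log_div (by norm_num) (by norm_num)] at this ⊢; linarith
    have b3 : Real.log (12.145/22) ≤ -0.59 := by
      have := log_ge_nm (22/12.145) 0.59 34 29 (by norm_num) (by norm_num) (by norm_num) (by norm_num)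
      rw [Real.log_div (by norm_num) (by norm_num)] at this ⊢; linarith
    have h1 := CC_le (TT i + 1) _ _ _ (PP_log_le _ (4.124/6.283*3^i) _ (by nlinarith) (by rw [T0]; linarith) (gen _ _ (by norm_num) a1))
      (ZZ_le' _ (4.124/22*3^i) _ (by nlinarith) (by rw [T0]; linarith) (gen _ _ (by norm_num) b1)) (log_tan _ 9 _ (by linarith) (by norm_num) lz)
    have h2 := CC_le (2*TT i + 1) _ _ _ (PP_log_le _ (8.1334/6.283*3^i) _ (by nlinarith) (by rw [T0]; linarith) (gen _ _ (by norm_num) a2))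
      (ZZ_le' _ (8.1334/22*3^i) _ (by nlinarith) (by rw [T0]; linarith) (gen _ _ (by norm_num) b2)) (log_tan _ 9 _ (by linarith) (by norm_num) lz)
    have h3 := CC_le (3*TT i + 1) _ _ _ (PP_log_le _ (12.145/6.283*3^i) _ (by nlinarith) (by rw [T0]; linarith) (gen _ _ (by norm_num) a3))
      (ZZ_le' _ (12.145/22*3^i) _ (by nlinarith) (by rw [T0]; linarith) (gen _ _ (by norm_num) b3)) (log_tan _ 9 _ (by linarith) (by norm_num) lz)
    unfold DD
    linarith

lemma ww_inv_le (i : ℕ) : (ww (TT i))⁻¹ ≤ (1.7 + 0.36*i)/0.0269 := by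
  unfold ww
  rw [inv_div]
  gcongr
  exact DD_lin i
end

section
open Metric Complex Real MeasureTheory
open scoped FourierTransform ENNReal Topology

noncomputable def GG (i : ℕ) : ℝ :=
  1530^2 * ((1.7+0.36*i)/0.0269)^10 * (0.625*(1.2084/3^i) + (1 + (1.7+0.36*i)/0.3228) * 1.003 * (1.2084/3^i)^2/4)

lemma GG_nonneg (i : ℕ) : 0 ≤ GG i := by unfold GG; positivity

lemma enorm_sq (z : ℂ) : ‖z‖ₑ^(2:ℝ) = ENNReal.ofReal (‖z‖^2) := by
  rw [← ofReal_norm, ENNReal.ofReal_rpow_of_nonneg (norm_nonneg _) (by norm_num)]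
  congr 1
  exact_mod_cast Real.rpow_natCast ‖z‖ 2

lemma gk_dom_pt (T lam ξ : ℝ) (hy : 1.3 ≤ |2*π*ξ|) (hT : |2*π*ξ| + 1 ≤ T) (h0 : 0 < lam) (h1 : lam ≤ 3 * ww T) :
    ‖𝓕 (gk 5 (1+lam)) ξ‖ ≤ 1530 * (ww T)⁻¹^5 * ‖𝓕 (gk 0 (1 + 3*ww T)) ξ‖ := by
  have hw := ww_pos T
  have key : ∀ ξ : ℝ, 0 ≤ ξ → 1.3 ≤ |2*π*ξ| → |2*π*ξ| + 1 ≤ T →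
      ‖𝓕 (gk 5 (1+lam)) ξ‖ ≤ 1530 * (ww T)⁻¹^5 * ‖𝓕 (gk 0 (1 + 3*ww T)) ξ‖ := by
    intro ξ hξ h2 h3
    rw [abs_of_nonneg (by positivity)] at h2 h3
    have := FF_dom T (2*π*ξ) lam h2 h3 h0 h1
    have e0 := FF_fourier 0 (1+3*ww T) (2*π*ξ) (by linarith)
    rw [iteratedDeriv_zero] at e0
    have e : 2*π*ξ/(2*π) = ξ := by field_simp
    rw [FF_fourier 5 (1+lam) (2*π*ξ) (by linarith), e0, e] at this
    exact this
  rcases le_total 0 ξ with h | h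
  · exact key ξ h hy hT
  · rw [← gk_fourier_neg, ← gk_fourier_neg 0]
    have e : |2*π*(-ξ)| = |2*π*ξ| := by rw [mul_neg, abs_neg]
    exact key (-ξ) (by linarith) (by rwa [e]) (by rwa [e])

lemma block5 (i : ℕ) (lam : ℝ) (h0 : 0 < lam) (h1 : lam ≤ 3 * ww (TT i)) :
    ∫⁻ ξ in {ξ : ℝ | 1.3*3^i ≤ |2*π*ξ| ∧ |2*π*ξ| ≤ 3*(1.3*3^i)}, ‖𝓕 (gk 5 (1+lam)) ξ‖ₑ^(2:ℝ) ≤ ENNReal.ofReal (GG i) := by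
  have hw := ww_pos (TT i)
  have hwl := ww_le (TT i)
  have hwi := ww_inv_le i
  have h3 : (1:ℝ) ≤ 3^i := one_le_pow₀ (by norm_num)
  set C := 1530 * (ww (TT i))⁻¹^5 with hC
  have hC0 : 0 < C := by positivity
  have hSm : MeasurableSet {ξ : ℝ | 1.3*3^i ≤ |2*π*ξ| ∧ |2*π*ξ| ≤ 3*(1.3*3^i)} := by
    have hc : Continuous (fun ξ : ℝ => |2*π*ξ|) := by fun_prop
    exact (measurableSet_le measurable_const hc.measurable).inter (measurableSet_le hc.measurable measurable_const)
  calc _ ≤ ∫⁻ ξ in {ξ : ℝ | 1.3*3^i ≤ |2*π*ξ| ∧ |2*π*ξ| ≤ 3*(1.3*3^i)}, ENNReal.ofReal (C^2) * ‖𝓕 (gk 0 (1+3*ww (TT i))) ξ‖ₑ^(2:ℝ) := by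
        apply setLIntegral_mono' hSm
        intro ξ hξ
        rw [enorm_sq, enorm_sq, ← ENNReal.ofReal_mul (by positivity), ← mul_pow]
        apply ENNReal.ofReal_le_ofReal
        gcongr
        apply gk_dom_pt (TT i) lam ξ _ _ h0 h1
        · have := hξ.1; linarith
        · have := hξ.2; unfold TT; linarith
    _ ≤ ENNReal.ofReal (C^2) * ENNReal.ofReal (0.625*(π/(2*(1.3*3^i))) + (1+1/(4*(3*ww (TT i)))) * 1.003 * (π/(2*(1.3*3^i)))^2/4) := by
        rw [lintegral_const_mul' _ _ ENNReal.ofReal_ne_top]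
        gcongr
        exact block_ms (1.3*3^i) (3*ww (TT i)) (by positivity) (by linarith) (by linarith)
    _ ≤ _ := by
        rw [← ENNReal.ofReal_mul (by positivity)]
        apply ENNReal.ofReal_le_ofReal
        have hh : π/(2*(1.3*3^i)) ≤ 1.2084/3^i := by
          rw [div_le_div_iff₀ (by positivity) (by positivity)]
          have := Real.pi_lt_d4
          nlinarith
        have e1 : 1/(4*(3*ww (TT i))) ≤ (1.7+0.36*i)/0.3228 := by
          have : 1/(4*(3*ww (TT i))) = (ww (TT i))⁻¹/12 := by field_simp; norm_num
          rw [this]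
          have := div_le_div_of_nonneg_right hwi (show (0:ℝ) ≤ 12 by norm_num)
          refine this.trans (le_of_eq ?_)
          rw [div_div]; norm_num
        unfold GG
        have e2 : C^2 ≤ 1530^2 * ((1.7+0.36*i)/0.0269)^10 := by
          rw [hC, mul_pow, ← pow_mul]
          gcongr
        gcongr

lemma low5 (lam : ℝ) (h0 : 0 < lam) (h1 : lam ≤ 0.1) :
    ∫⁻ ξ in {ξ : ℝ | |2*π*ξ| ≤ 1.3}, ‖𝓕 (gk 5 (1+lam)) ξ‖ₑ^(2:ℝ) ≤ ENNReal.ofReal (12000000^2*0.42) := by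
  have hSm : MeasurableSet {ξ : ℝ | |2*π*ξ| ≤ 1.3} := by
    have hc : Continuous (fun ξ : ℝ => |2*π*ξ|) := by fun_prop
    exact (measurableSet_le hc.measurable measurable_const)
  have hsub : {ξ : ℝ | |2*π*ξ| ≤ 1.3} ⊆ Set.Icc (-0.21) 0.21 := by
    intro ξ hξ
    have hξ : |2*π*ξ| ≤ 1.3 := hξ
    rw [abs_mul, abs_of_pos (by positivity)] at hξ
    have := Real.pi_gt_d2
    have h2 : |ξ| ≤ 0.21 := by nlinarith [abs_nonneg ξ]
    rw [abs_le] at h2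
    exact ⟨by linarith [h2.1], h2.2⟩
  calc _ ≤ ∫⁻ ξ in {ξ : ℝ | |2*π*ξ| ≤ 1.3}, ENNReal.ofReal (12000000^2) := by
        apply setLIntegral_mono' hSm
        intro ξ hξ
        rw [enorm_sq]
        apply ENNReal.ofReal_le_ofReal
        have := FF_low lam (2*π*ξ) h0 h1 hξ
        rw [FF_fourier 5 (1+lam) (2*π*ξ) (by linarith), show 2*π*ξ/(2*π) = ξ by field_simp] at this
        gcongr
    _ ≤ ENNReal.ofReal (12000000^2) * ENNReal.ofReal 0.42 := by
        rw [setLIntegral_const]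
        gcongr
        refine (measure_mono hsub).trans ?_
        rw [Real.volume_Icc]; norm_num
    _ = _ := by rw [← ENNReal.ofReal_mul (by norm_num)]

lemma FF_norm_le (s : ℂ) (hs : 1 < s.re) (h4 : s.re ≤ 4) : ‖FF s‖ ≤ (1 + 1/(s.re-1))/‖s‖ := by
  rw [FF, norm_div]
  gcongr
  rw [← LSeries_lo s hs]
  have h := norm_LSeries_le (fun n => (lo n : ℂ)) (fun _ => 1) (fun _ => by norm_num) (fun n _ => by rw [Complex.norm_real]; exact lo_abs_le n) s
    (by
      have h := LSeriesSummable_one_iff.mpr (show 1 < ((s.re:ℂ)).re by simpa using hs)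
      simp only [Complex.ofReal_one]; exact h)
  refine h.trans ?_
  have h2 := zeta_norm_le (s.re : ℂ) (by simpa using hs) (by simpa using h4)
  have h3 : LSeries (fun n => (((fun _ => 1 : ℕ → ℝ) n : ℝ) : ℂ)) (s.re:ℂ) = riemannZeta (s.re:ℂ) := by
    have := LSeries_one_eq_riemannZeta (s := (s.re:ℂ)) (by simpa using hs)
    rw [← this]
    congr 1
  rw [h3]
  refine (Complex.re_le_norm _).trans ?_
  simpa using h2

lemma tail_pt (lam y : ℝ) (h0 : 0 < lam) (h1 : lam ≤ 1) (hy : 1 ≤ |y|) :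
    ‖iteratedDeriv 5 FF (((1 + lam : ℝ) : ℂ) + y * I)‖ ≤ 23040 * (1/lam)^6 / |y| := by
  set c : ℂ := (((1 + lam : ℝ) : ℂ) + y * I) with hc
  have hcre : c.re = 1 + lam := by simp [hc]
  have hcim : c.im = y := by simp [hc]
  have hmem : ∀ z ∈ closedBall c (lam/2), 1 + lam/2 ≤ z.re ∧ z.re ≤ 4 ∧ |y|/2 ≤ ‖z‖ := by
    intro z hz
    rw [mem_closedBall, dist_eq_norm] at hz
    have a := (abs_le.mp ((Complex.abs_re_le_norm (z-c)).trans hz))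
    have b := (Complex.abs_im_le_norm (z-c)).trans hz
    rw [sub_re, hcre] at a
    rw [sub_im, hcim] at b
    have d := Complex.abs_im_le_norm z
    have e := abs_sub_abs_le_abs_sub y z.im
    rw [abs_sub_comm] at b
    refine ⟨by linarith, by linarith, by linarith⟩
  have hdiff : DiffContOnCl ℂ FF (ball c (lam/2)) := by
    apply DifferentiableOn.diffContOnCl_ball (U := closedBall c (lam/2)) _ (by rfl)
    intro z hz
    have hm := (hmem z hz).1
    have hz1 : z ≠ 1 := by rintro rfl; simp at hm; linarith
    exact (FF_analyticAt z (by linarith) hz1 (riemannZeta_ne_zero_of_one_lt_re (by linarith))).differentiableAt.differentiableWithinAt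
  have hb : ∀ z ∈ sphere c (lam/2), ‖FF z‖ ≤ (3/lam)/(|y|/2) := by
    intro z hz
    have hm := hmem z (sphere_subset_closedBall hz)
    refine (FF_norm_le z (by linarith) hm.2.1).trans ?_
    have : 1/(z.re-1) ≤ 1/(lam/2) := one_div_le_one_div_of_le (by positivity) (by linarith)
    have h2 : 1 ≤ 1/lam := by rw [le_div_iff₀ h0]; linarith
    have h3 : 1 + 1/(z.re-1) ≤ 3/lam := by
      have e : 1/(lam/2) = 2*(1/lam) := by field_simp
      have e' : 3/lam = 3*(1/lam) := by ring
      linarith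
    have := hm.2.2
    have hpos : 0 ≤ 3/lam := by positivity
    gcongr
  have := Complex.norm_iteratedDeriv_le_of_forall_mem_sphere_norm_le 5 (by positivity : 0 < lam/2) hdiff hb
  refine this.trans (le_of_eq ?_)
  simp [Nat.factorial]
  field_simp
  norm_num

lemma inv_sq_tail (a : ℝ) (ha : 0 < a) : ∫⁻ ξ in {ξ : ℝ | a ≤ |ξ|}, ENNReal.ofReal (1/ξ^2) ≤ ENNReal.ofReal (2/a) := by
  have hs : {ξ : ℝ | a ≤ |ξ|} = Set.Iic (-a) ∪ Set.Ici a := by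
    ext x; simp [le_abs']
  have h1 : ∫⁻ ξ in Set.Ici a, ENNReal.ofReal (1/ξ^2) = ENNReal.ofReal (1/a) := by
    rw [setLIntegral_congr Ioi_ae_eq_Ici.symm]
    have hI := integrableOn_Ioi_rpow_of_lt (show (-2:ℝ) < -1 by norm_num) ha
    have e : ∀ ξ ∈ Set.Ioi a, ξ^(-2:ℝ) = 1/ξ^2 := by
      intro ξ hξ
      have : 0 < ξ := ha.trans hξ
      rw [Real.rpow_neg this.le, one_div]
      congr 1
      exact_mod_cast Real.rpow_natCast ξ 2
    have hI2 : IntegrableOn (fun ξ : ℝ => 1/ξ^2) (Set.Ioi a) := hI.congr_fun e measurableSet_Ioi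
    rw [← ofReal_integral_eq_lintegral_ofReal hI2 (ae_of_all _ fun x => by positivity)]
    congr 1
    rw [← setIntegral_congr_fun measurableSet_Ioi e, integral_Ioi_rpow_of_lt (by norm_num) ha]
    rw [show (-2:ℝ)+1 = -1 by norm_num, Real.rpow_neg_one]; ring
  have h2 : ∫⁻ ξ in Set.Iic (-a), ENNReal.ofReal (1/ξ^2) = ∫⁻ ξ in Set.Ici a, ENNReal.ofReal (1/ξ^2) := by
    have := (Measure.measurePreserving_neg (volume : Measure ℝ)).setLIntegral_comp_preimage (measurableSet_Ici (a := a)) (f := fun ξ : ℝ => ENNReal.ofReal (1/ξ^2)) (by fun_prop)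
    simpa using this
  rw [hs]
  refine (lintegral_union_le _ _ _).trans ?_
  rw [h2, h1, ← ENNReal.ofReal_add (by positivity) (by positivity)]
  apply le_of_eq; congr 1; ring

lemma tail5 (lam Y : ℝ) (h0 : 0 < lam) (h1 : lam ≤ 1) (hY : 1 ≤ Y) :
    ∫⁻ ξ in {ξ : ℝ | Y ≤ |2*π*ξ|}, ‖𝓕 (gk 5 (1+lam)) ξ‖ₑ^(2:ℝ) ≤ ENNReal.ofReal (23040^2 * (1/lam)^12 / Y) := by
  have hs : {ξ : ℝ | Y ≤ |2*π*ξ|} = {ξ : ℝ | Y/(2*π) ≤ |ξ|} := by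
    ext ξ
    simp only [Set.mem_ofPred_eq]
    rw [abs_mul, abs_of_pos (by positivity : 0 < 2*π), div_le_iff₀ (by positivity), mul_comm]
  have hSm : MeasurableSet {ξ : ℝ | Y ≤ |2*π*ξ|} := by
    have hc : Continuous (fun ξ : ℝ => |2*π*ξ|) := by fun_prop
    exact (measurableSet_le measurable_const hc.measurable)
  have hpi := Real.pi_gt_three
  calc _ ≤ ∫⁻ ξ in {ξ : ℝ | Y ≤ |2*π*ξ|}, ENNReal.ofReal (23040^2 * (1/lam)^12/(2*π)^2) * ENNReal.ofReal (1/ξ^2) := by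
        apply setLIntegral_mono' hSm
        intro ξ hξ
        have hξ : Y ≤ |2*π*ξ| := hξ
        rw [enorm_sq, ← ENNReal.ofReal_mul (by positivity)]
        apply ENNReal.ofReal_le_ofReal
        have := tail_pt lam (2*π*ξ) h0 h1 (by linarith)
        rw [FF_fourier 5 (1+lam) (2*π*ξ) (by linarith), show 2*π*ξ/(2*π) = ξ by field_simp] at this
        refine (pow_le_pow_left₀ (norm_nonneg _) this 2).trans (le_of_eq ?_)
        rw [div_pow, sq_abs]
        ring
    _ ≤ ENNReal.ofReal (23040^2 * (1/lam)^12/(2*π)^2) * ENNReal.ofReal (2/(Y/(2*π))) := by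
        rw [lintegral_const_mul' _ _ ENNReal.ofReal_ne_top, hs]
        gcongr
        exact inv_sq_tail _ (by positivity)
    _ ≤ _ := by
        rw [← ENNReal.ofReal_mul (by positivity)]
        apply ENNReal.ofReal_le_ofReal
        have e : 23040^2 * (1/lam)^12/(2*π)^2 * (2/(Y/(2*π))) = 23040^2 * (1/lam)^12/Y * (1/π) := by field_simp
        rw [e]
        apply mul_le_of_le_one_right (by positivity)
        rw [div_le_one (by positivity)]; linarith
end

section
open Metric Complex Real MeasureTheory
open scoped FourierTransform ENNReal Topology

lemma GG_half (j : ℕ) (hj : 30 ≤ j) : 2 * GG (j+1) ≤ GG j := by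
  have hj' : (30:ℝ) ≤ j := by exact_mod_cast hj
  unfold GG
  push_cast
  set D : ℝ := 1.7+0.36*j with hD
  have hDg : 12.5 ≤ D := by rw [hD]; linarith
  have e1 : 1.7 + 0.36*((j:ℝ)+1) ≤ 1.0288 * D := by rw [hD]; linarith
  have e0 : (1.7:ℝ) + 0.36*((j:ℝ)+1) = D + 0.36 := by rw [hD]; ring
  have hq : (1.2084:ℝ)/3^(j+1) = (1.2084/3^j)/3 := by rw [pow_succ]; field_simp
  set h : ℝ := 1.2084/3^j with hh
  have hh0 : 0 < h := by positivity
  rw [hq]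
  calc 2 * (1530^2 * ((1.7+0.36*((j:ℝ)+1))/0.0269)^10 * (0.625*(h/3) + (1 + (1.7+0.36*((j:ℝ)+1))/0.3228) * 1.003 * (h/3)^2/4))
      ≤ 2 * (1530^2 * ((1.0288*D)/0.0269)^10 * (0.625*(h/3) + (1 + (1.0288*D)/0.3228) * 1.003 * (h/3)^2/4)) := by
        gcongr
    _ = 1530^2 * (D/0.0269)^10 * ((2*1.0288^10) * (0.625*(h/3) + (1 + (1.0288*D)/0.3228) * 1.003 * (h/3)^2/4)) := by
        rw [mul_div_assoc 1.0288, mul_pow]; ring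
    _ ≤ 1530^2 * (D/0.0269)^10 * (3 * (0.625*(h/3) + (1 + 3*D/0.3228) * 1.003 * (h/3)^2/4)) := by
        gcongr
        · norm_num
        · norm_num
    _ ≤ _ := by
        gcongr
        have : 0 ≤ D/0.3228 := by positivity
        have e : 3*D/0.3228 = 3*(D/0.3228) := by ring
        rw [e]
        have hp : 0 ≤ h^2 := by positivity
        nlinarith [mul_nonneg this hp]

lemma GG_sum30 : ∑ i ∈ Finset.range 30, GG i + 2 * GG 30 ≤ 90800000000000000000000000 := by
  simp only [GG, Finset.sum_range_succ, Finset.sum_range_zero]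
  norm_num

lemma GG_sum (n : ℕ) : ∑ i ∈ Finset.range n, GG i ≤ 90800000000000000000000000 := by
  have key : ∀ k : ℕ, ∑ i ∈ Finset.range (30+k), GG i + 2 * GG (30+k) ≤ 90800000000000000000000000 := by
    intro k
    induction k with
    | zero => exact GG_sum30
    | succ k ih =>
      rw [← add_assoc, Finset.sum_range_succ]
      have := GG_half (30+k) (by omega)
      linarith
  have h1 : ∑ i ∈ Finset.range n, GG i ≤ ∑ i ∈ Finset.range (30+n), GG i := by
    apply Finset.sum_le_sum_of_subset_of_nonneg
    · intro x hx; simp at *; omega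
    · intro i _ _; exact GG_nonneg i
  have := key n
  have := GG_nonneg (30+n)
  linarith

lemma mid5 (n : ℕ) (lam : ℝ) (h0 : 0 < lam) (h1 : lam ≤ 0.04/(n+1)) :
    ∫⁻ ξ in {ξ : ℝ | |2*π*ξ| ≤ 1.3*3^n}, ‖𝓕 (gk 5 (1+lam)) ξ‖ₑ^(2:ℝ) ≤
      ENNReal.ofReal (12000000^2*0.42 + ∑ i ∈ Finset.range n, GG i) := by
  induction n with
  | zero =>
    simp only [Finset.range_zero, Finset.sum_empty, add_zero, pow_zero, mul_one]
    apply low5 lam h0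
    norm_num at h1 ⊢; linarith
  | succ n ih =>
    have hn : (0:ℝ) ≤ n := by positivity
    have hsub : {ξ : ℝ | |2*π*ξ| ≤ 1.3*3^(n+1)} ⊆ {ξ : ℝ | |2*π*ξ| ≤ 1.3*3^n} ∪ {ξ : ℝ | 1.3*3^n ≤ |2*π*ξ| ∧ |2*π*ξ| ≤ 3*(1.3*3^n)} := by
      intro ξ hξ
      have hξ : |2*π*ξ| ≤ 1.3*3^(n+1) := hξ
      rw [pow_succ] at hξ
      rcases le_total (|2*π*ξ|) (1.3*3^n) with h | h
      · left; exact h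
      · right; exact ⟨h, by linarith⟩
    have hl1 : lam ≤ 0.04/(n+1) := h1.trans (by push_cast; gcongr; linarith)
    refine (lintegral_mono_set hsub).trans ((lintegral_union_le _ _ _).trans ?_)
    rw [Finset.sum_range_succ, ← add_assoc, ENNReal.ofReal_add (add_nonneg (by norm_num) (Finset.sum_nonneg fun i _ => GG_nonneg i)) (GG_nonneg n)]
    refine add_le_add (ih hl1) (block5 n lam h0 ?_)
    have hw := ww_pos (TT n)
    have hwi := ww_inv_le n
    rw [inv_le_comm₀ hw (by positivity)] at hwi
    rw [inv_div] at hwi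
    have : 0.04/((n:ℝ)+1) ≤ 3*(0.0269/(1.7+0.36*n)) := by
      rw [← mul_div_assoc, div_le_div_iff₀ (by positivity) (by positivity)]
      linarith
    linarith

lemma all5 (n : ℕ) :
    ∫⁻ ξ, ‖𝓕 (gk 5 (1+0.04/((n:ℝ)+1))) ξ‖ₑ^(2:ℝ) ≤
      ENNReal.ofReal (90900000000000000000000000 + 23040^2 * 25^12 * (((n:ℝ)+1)^12/3^n)) := by
  have hn : (0:ℝ) ≤ n := by positivity
  have h0 : 0 < 0.04/((n:ℝ)+1) := by positivity
  have h1 : 0.04/((n:ℝ)+1) ≤ 1 := by rw [div_le_one (by positivity)]; linarith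
  have h3 : (1:ℝ) ≤ 3^n := one_le_pow₀ (by norm_num)
  rw [← setLIntegral_univ]
  have hsub : (Set.univ : Set ℝ) ⊆ {ξ : ℝ | |2*π*ξ| ≤ 1.3*3^n} ∪ {ξ : ℝ | 1.3*3^n ≤ |2*π*ξ|} :=
    fun ξ _ => (le_total (|2*π*ξ|) (1.3*3^n)).elim (fun h => Or.inl h) (fun h => Or.inr h)
  refine (lintegral_mono_set hsub).trans ((lintegral_union_le _ _ _).trans ?_)
  rw [ENNReal.ofReal_add (by norm_num) (by positivity)]
  refine add_le_add ((mid5 n _ h0 le_rfl).trans (ENNReal.ofReal_le_ofReal ?_)) ((tail5 _ (1.3*3^n) h0 h1 (by linarith)).trans (ENNReal.ofReal_le_ofReal ?_))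
  · have := GG_sum n
    norm_num at this ⊢; linarith
  · have e : 1/(0.04/((n:ℝ)+1)) = 25*((n:ℝ)+1) := by field_simp; norm_num
    rw [e, mul_pow, ← mul_assoc, mul_div_assoc]
    gcongr
    linarith

/-- the L² bound -/
theorem main_L2 (X : ℝ) :
    ∫⁻ u in Set.Ioc 0 X, ENNReal.ofReal (u^10 * (Lo (Real.exp u) * Real.exp (-u))^2) ≤ ENNReal.ofReal 90900000000000000000000000 := by
  set J := ∫⁻ u in Set.Ioc 0 X, ENNReal.ofReal (u^10 * (Lo (Real.exp u) * Real.exp (-u))^2) with hJ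
  have key : ∀ n : ℕ, ENNReal.ofReal (Real.exp (-(2*(0.04/((n:ℝ)+1))*X))) * J ≤
      ENNReal.ofReal (90900000000000000000000000 + 23040^2 * 25^12 * (((n:ℝ)+1)^12/3^n)) := by
    intro n
    have h0 : 0 < 0.04/((n:ℝ)+1) := by positivity
    refine le_trans ?_ (all5 n)
    rw [plancherel _ (gk_integrable 5 _ (by linarith)) (gk_memLp 5 _ (by linarith)), hJ, ← lintegral_const_mul' _ _ ENNReal.ofReal_ne_top]
    refine le_trans ?_ (setLIntegral_le_lintegral (Set.Ioc 0 X) _)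
    apply setLIntegral_mono' measurableSet_Ioc
    intro u hu
    rw [enorm_sq, ← ENNReal.ofReal_mul (Real.exp_pos _).le]
    apply ENNReal.ofReal_le_ofReal
    rw [gk, Complex.norm_real, Real.norm_eq_abs, sq_abs]
    set a := 0.04/((n:ℝ)+1)
    have e : (Real.exp (-(1+a)*u) * ((-u)^5 * Lo (Real.exp u)))^2 = Real.exp (-(2*a*u)) * (u^10 * (Lo (Real.exp u) * Real.exp (-u))^2) := by
      have : Real.exp (-(1+a)*u)^2 = Real.exp (-(2*a*u)) * Real.exp (-u)^2 := by
        rw [← Real.exp_nat_mul, ← Real.exp_nat_mul, ← Real.exp_add]; push_cast; ring_nf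
      rw [mul_pow, this]; ring
    rw [e]
    gcongr
    exact hu.2
  have l1 : Tendsto (fun n : ℕ => 0.04/((n:ℝ)+1)) atTop (𝓝 0) := by
    have := (tendsto_one_div_add_atTop_nhds_zero_nat (𝕜 := ℝ)).const_mul 0.04
    simpa [div_eq_mul_inv] using this
  have l2 : Tendsto (fun n : ℕ => ENNReal.ofReal (Real.exp (-(2*(0.04/((n:ℝ)+1))*X))) * J) atTop (𝓝 (ENNReal.ofReal (Real.exp (-(2*0*X))) * J)) := by
    apply ENNReal.Tendsto.mul_const
    · apply ENNReal.tendsto_ofReal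
      exact (Real.continuous_exp.tendsto _).comp (((l1.const_mul 2).mul_const X).neg)
    · left; simp
  have l3 : Tendsto (fun n : ℕ => ((n:ℝ)+1)^12/3^n) atTop (𝓝 0) := by
    have h := (tendsto_pow_const_div_const_pow_of_one_lt 12 (show (1:ℝ) < 3 by norm_num))
    have h2 := ((tendsto_add_atTop_iff_nat 1).mpr h).const_mul 3
    rw [mul_zero] at h2
    refine h2.congr ?_
    intro n
    push_cast
    rw [pow_succ (3:ℝ) n]; field_simp
  have l4 : Tendsto (fun n : ℕ => ENNReal.ofReal (90900000000000000000000000 + 23040^2 * 25^12 * (((n:ℝ)+1)^12/3^n))) atTop (𝓝 (ENNReal.ofReal (90900000000000000000000000 + 23040^2 * 25^12 * 0))) := by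
    apply ENNReal.tendsto_ofReal
    exact tendsto_const_nhds.add (l3.const_mul _)
  have := le_of_tendsto_of_tendsto' l2 l4 key
  simpa using this
end

section
open Metric Complex Real MeasureTheory

lemma mul_pp (f g : ArithmeticFunction ℝ) (p k : ℕ) (hp : p.Prime) :
    (f * g) (p^k) = ∑ i ∈ range (k+1), f (p^i) * g (p^(k-i)) := by
  rw [ArithmeticFunction.mul_apply, Nat.sum_divisorsAntidiagonal (f := fun a b => f a * g b), Nat.sum_divisors_prime_pow hp]
  refine Finset.sum_congr rfl fun i hi => ?_
  rw [Nat.pow_div (by simp at hi; omega) hp.pos]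

noncomputable def loA : ArithmeticFunction ℝ := ⟨lo, lo_zero⟩
noncomputable def oA : ArithmeticFunction ℝ := ⟨fun n => if Odd n then 1 else 0, by simp⟩
open Classical in
noncomputable def sqA : ArithmeticFunction ℝ := ⟨fun n => if Odd n ∧ IsSquare n then 1 else 0, by simp⟩

lemma loA_apply (n : ℕ) : loA n = lo n := rfl
lemma oA_apply (n : ℕ) : oA n = if Odd n then 1 else 0 := rfl
open Classical in
lemma sqA_apply (n : ℕ) : sqA n = if Odd n ∧ IsSquare n then 1 else 0 := rfl

lemma loA_mult : loA.IsMultiplicative := ⟨lo_one, fun {m n} _ => lo_mul m n⟩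
lemma oA_mult : oA.IsMultiplicative := by
  refine ⟨by simp [oA_apply], fun {m n} _ => ?_⟩
  simp only [oA_apply, Nat.odd_mul]
  by_cases h1 : Odd m <;> by_cases h2 : Odd n <;> simp [h1, h2]

lemma isSquare_cop (m n : ℕ) (h : m.Coprime n) : IsSquare (m*n) ↔ IsSquare m ∧ IsSquare n := by
  constructor
  · rintro ⟨c, hc⟩
    have h1 : m * n = c^2 := by rw [hc, sq]
    have h2 : n * m = c^2 := by rw [← h1, mul_comm]
    have hu : IsUnit (GCDMonoid.gcd m n) := by rw [Nat.isUnit_iff]; exact h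
    have hu' : IsUnit (GCDMonoid.gcd n m) := by rw [Nat.isUnit_iff]; exact h.symm
    obtain ⟨d, hd⟩ := exists_eq_pow_of_mul_eq_pow hu h1
    obtain ⟨e, he⟩ := exists_eq_pow_of_mul_eq_pow hu' h2
    exact ⟨⟨d, by rw [hd, sq]⟩, ⟨e, by rw [he, sq]⟩⟩
  · rintro ⟨h1, h2⟩; exact h1.mul h2

lemma sqA_mult : sqA.IsMultiplicative := by
  refine ⟨by simp [sqA_apply], fun {m n} h => ?_⟩
  simp only [sqA_apply, Nat.odd_mul, isSquare_cop m n h]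
  by_cases h1 : Odd m <;> by_cases h2 : Odd n <;> by_cases h3 : IsSquare m <;> by_cases h4 : IsSquare n <;> simp [h1, h2, h3, h4]

lemma lo_pp (p k : ℕ) (hp : p.Prime) (h2 : p ≠ 2) : lo (p^k) = (-1)^k := by
  have := hp.odd_of_ne_two h2
  rw [lo, if_pos this.pow, cardFactors_apply_prime_pow hp]

lemma odd_pp (p k : ℕ) (hp : p.Prime) (h2 : p ≠ 2) : Odd (p^k) := (hp.odd_of_ne_two h2).pow

lemma isSquare_pp (p k : ℕ) (hp : p.Prime) : IsSquare (p^k) ↔ Even k := by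
  constructor
  · rintro ⟨c, hc⟩
    have := congrArg (fun n => n.factorization p) hc
    have hc0 : c ≠ 0 := by rintro rfl; simp at hc; exact hp.ne_zero hc.1
    simp [Nat.factorization_mul hc0 hc0, hp.factorization_self] at this
    exact ⟨_, this⟩
  · rintro ⟨c, rfl⟩; exact ⟨p^c, pow_add _ _ _⟩

lemma two_pp_even (k : ℕ) : ¬ Odd (2^(k+1)) := by
  rw [Nat.not_odd_iff_even, pow_succ]; exact even_two.mul_left _

lemma lo_mul_o : loA * oA = sqA := by
  rw [(loA_mult.mul oA_mult).eq_iff_eq_on_prime_powers _ _ sqA_mult]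
  intro p k hp
  rw [mul_pp _ _ _ _ hp]
  by_cases h2 : p = 2
  · subst h2
    rcases k with _ | k
    · simp [sqA_apply, loA_apply, oA_apply, lo_one]
    · rw [sqA_apply, if_neg (by intro h; exact two_pp_even k h.1)]
      apply Finset.sum_eq_zero
      intro i hi
      rcases i with _ | i
      · rw [oA_apply, Nat.sub_zero, if_neg (two_pp_even k), mul_zero]
      · rw [loA_apply, lo_even _ (two_pp_even i), zero_mul]
  · rw [sqA_apply]
    have : ∀ i ∈ range (k+1), loA (p^i) * oA (p^(k-i)) = (-1)^i := by
      intro i _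
      rw [loA_apply, lo_pp p i hp h2, oA_apply, if_pos (odd_pp _ _ hp h2), mul_one]
    rw [Finset.sum_congr rfl this]
    simp only [odd_pp p k hp h2, true_and, isSquare_pp p k hp]
    clear this
    rw [neg_one_geom_sum]
    by_cases hk : Even k
    · rw [if_neg (by simpa [Nat.even_add_one] using hk), if_pos hk]
    · rw [if_pos (by simpa [Nat.even_add_one] using hk), if_neg hk]

lemma sum_oA (K : ℕ) : ∑ m ∈ Ioc 0 K, oA m = (((K+1)/2 : ℕ) : ℝ) := by
  induction K with
  | zero => simp
  | succ K ih =>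
    rw [Finset.sum_Ioc_succ_top (by omega), ih, oA_apply]
    by_cases h : Odd (K+1)
    · rw [if_pos h]
      have : (K+1+1)/2 = (K+1)/2+1 := by obtain ⟨r, hr⟩ := h; omega
      rw [this]; push_cast; ring
    · rw [if_neg h]
      have : (K+1+1)/2 = (K+1)/2 := by rw [Nat.not_odd_iff_even] at h; obtain ⟨r, hr⟩ := h; omega
      rw [this, add_zero]

lemma sum_sqA (K : ℕ) : ∑ m ∈ Ioc 0 K, sqA m = (((Nat.sqrt K+1)/2 : ℕ) : ℝ) := by
  classical
  rw [← sum_oA]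
  simp only [sqA_apply, oA_apply]
  rw [← Finset.sum_filter, ← Finset.sum_filter, Finset.sum_const, Finset.sum_const]
  congr 1
  symm
  apply Finset.card_bij (fun a _ => a*a)
  · intro a ha
    simp only [mem_filter, mem_Ioc] at ha ⊢
    refine ⟨⟨by nlinarith, ?_⟩, ha.2.mul ha.2, ⟨a, rfl⟩⟩
    exact Nat.le_sqrt.mp ha.1.2
  · intro a _ b _ h
    exact Nat.mul_self_inj.mp h
  · intro b hb
    simp only [mem_filter, mem_Ioc] at hb
    obtain ⟨⟨h1, h2⟩, h3, c, rfl⟩ := hb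
    refine ⟨c, ?_, rfl⟩
    simp only [mem_filter, mem_Ioc]
    exact ⟨⟨by rcases Nat.eq_zero_or_pos c with h | h; · simp [h] at h1
               · exact h, Nat.le_sqrt.mpr h2⟩, (Nat.odd_mul.mp h3).1⟩

lemma Lo_nat (N : ℕ) : Lo (N:ℝ) = ∑ n ∈ Ioc 0 N, lo n := by
  rw [Lo, Nat.floor_natCast]; rfl

/-- sum of lo(n) times the count of odd k ≤ N/n -/
lemma lo_count (N : ℕ) : ∑ n ∈ Ioc 0 N, lo n * (((N/n+1)/2 : ℕ) : ℝ) = (((Nat.sqrt N+1)/2 : ℕ) : ℝ) := by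
  have h := sum_Ioc_mul_eq_sum_sum loA oA N
  rw [lo_mul_o, sum_sqA] at h
  rw [h]
  refine Finset.sum_congr rfl fun n _ => ?_
  rw [sum_oA, loA_apply]

lemma lo_count_d (N d : ℕ) (hd : 0 < d) : ∑ n ∈ Ioc 0 N, lo n * (((N/n/d+1)/2 : ℕ) : ℝ) = (((Nat.sqrt (N/d)+1)/2 : ℕ) : ℝ) := by
  rw [← lo_count (N/d)]
  symm
  apply Finset.sum_subset_zero_on_sdiff
  · intro n hn; simp only [mem_Ioc] at hn ⊢
    exact ⟨hn.1, hn.2.trans (Nat.div_le_self _ _)⟩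
  · intro n hn
    rw [Finset.mem_sdiff, Finset.mem_Ioc, Finset.mem_Ioc] at hn
    have h1 : N/d < n := by by_contra h; exact hn.2 ⟨hn.1.1, not_lt.mp h⟩
    have : N/n/d = 0 := by
      rw [Nat.div_div_eq_div_mul, mul_comm, ← Nat.div_div_eq_div_mul]
      exact Nat.div_eq_of_lt h1
    rw [this]; simp
  · intro n _
    rw [Nat.div_div_eq_div_mul, Nat.div_div_eq_div_mul, mul_comm d n]

/-- number of odd k ≤ m/(2*i+1) -/
def oc (i k : ℕ) : ℕ := (k/(2*i+1)+1)/2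

noncomputable def psi (c : ℕ → ℝ) (E k : ℕ) : ℝ := 1 - ∑ i ∈ range E, c i * (oc i k : ℝ)

noncomputable def PPs (c : ℕ → ℝ) (E j : ℕ) : ℝ := if j = 0 then 0 else psi c E (2*j-1)

lemma oc_even (i j : ℕ) : oc i (2*j+2) = oc i (2*j+1) := by
  unfold oc
  by_cases h : (2*i+1) ∣ 2*j+2
  · obtain ⟨q, hq⟩ := h
    have h1 : (2*j+2)/(2*i+1) = q := by rw [hq]; exact Nat.mul_div_cancel_left _ (by omega)
    have hqp : 0 < q := by rcases Nat.eq_zero_or_pos q with h | h; · subst h; omega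
                           · exact h
    have h2 : (2*j+1)/(2*i+1) = q-1 := by
      rw [Nat.div_eq_iff (by omega)]
      obtain ⟨r, rfl⟩ : ∃ r, q = r+1 := ⟨q-1, by omega⟩
      constructor
      · simp only [Nat.add_sub_cancel]; nlinarith
      · simp only [Nat.add_sub_cancel]
        have e : (2*i+1)*(r+1) = r*(2*i+1)+(2*i+1) := by ring
        omega
    have hqe : Even q := by
      have : Even ((2*i+1)*q) := by rw [← hq]; exact ⟨j+1, by ring⟩
      rcases Nat.even_mul.mp this with h | h
      · exact absurd h (by simp)
      · exact h
    rw [h1, h2]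
    obtain ⟨r, rfl⟩ := hqe
    omega
  · rw [show 2*j+2 = (2*j+1)+1 from rfl, Nat.succ_div_of_not_dvd h]

lemma oc_err (i k : ℕ) : |(oc i k : ℝ) - k/(2*(2*i+1))| ≤ 1/2 := by
  unfold oc
  set d := 2*i+1 with hd
  have hdp : 0 < d := by omega
  set q := (k/d+1)/2 with hq
  have h1 : 2*q*d ≤ k + d := by
    have a : 2*q ≤ k/d+1 := by omega
    calc 2*q*d ≤ (k/d+1)*d := Nat.mul_le_mul_right _ a
      _ = k/d*d + d := by ring
      _ ≤ k+d := by have := Nat.div_mul_le_self k d; omega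
  have h2 : k < (2*q+1)*d := by
    have a : k/d+1 ≤ 2*q+1 := by omega
    calc k < (k/d+1)*d := by have := Nat.lt_div_mul_add (a := k) hdp; nlinarith
      _ ≤ _ := Nat.mul_le_mul_right _ a
  have h1' : 2*(q:ℝ)*d ≤ k+d := by exact_mod_cast h1
  have h2' : (k:ℝ) < (2*q+1)*d := by exact_mod_cast h2
  have hd' : (0:ℝ) < d := by exact_mod_cast hdp
  have hde : (2*(i:ℝ)+1) = d := by rw [hd]; push_cast; ring
  rw [hde, abs_le]
  constructor
  · rw [le_sub_iff_add_le, ← sub_nonneg]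
    have : (q:ℝ) - (-(1/2) + k/(2*d)) = ((2*q+1)*d - k)/(2*d) := by field_simp; ring
    rw [this]; apply div_nonneg <;> linarith
  · rw [sub_le_iff_le_add, ← sub_nonneg]
    have : (1/2 + (k:ℝ)/(2*d)) - q = (k + d - 2*q*d)/(2*d) := by field_simp; ring
    rw [this]; apply div_nonneg <;> linarith

lemma psi_le (c : ℕ → ℝ) (E k : ℕ) (h0 : ∑ i ∈ range E, c i/(2*i+1) = 0) (B : ℝ)
    (hB : 1 + (∑ i ∈ range E, |c i|)/2 ≤ B) : |psi c E k| ≤ B := by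
  have e : psi c E k = 1 - ∑ i ∈ range E, c i * ((oc i k : ℝ) - k/(2*(2*i+1))) := by
    unfold psi
    have : ∑ i ∈ range E, c i * ((k:ℝ)/(2*(2*i+1))) = (k/2) * ∑ i ∈ range E, c i/(2*i+1) := by
      rw [Finset.mul_sum]; refine Finset.sum_congr rfl fun i _ => ?_
      field_simp
    simp only [mul_sub, Finset.sum_sub_distrib]
    rw [this, h0]; ring
  rw [e]
  refine le_trans ?_ hB
  refine (abs_sub _ _).trans ?_
  rw [abs_one]
  gcongr
  refine (Finset.abs_sum_le_sum_abs _ _).trans ?_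
  rw [Finset.sum_div]
  refine Finset.sum_le_sum fun i _ => ?_
  rw [abs_mul]
  have := oc_err i k
  have := abs_nonneg (c i)
  nlinarith

lemma PPs_le (c : ℕ → ℝ) (E k : ℕ) (h0 : ∑ i ∈ range E, c i/(2*i+1) = 0) (B : ℝ)
    (hB : 1 + (∑ i ∈ range E, |c i|)/2 ≤ B) : |PPs c E k| ≤ B := by
  unfold PPs
  split_ifs
  · rw [abs_zero]; refine le_trans ?_ hB; positivity
  · exact psi_le c E _ h0 B hB

lemma psi_even (c : ℕ → ℝ) (E j : ℕ) : psi c E (2*j+2) = psi c E (2*j+1) := by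
  simp only [psi, oc_even]

lemma Lo_decomp (c : ℕ → ℝ) (E N : ℕ) :
    Lo (N:ℝ) = ∑ n ∈ Ioc 0 N, lo n * psi c E (N/n) +
      ∑ i ∈ range E, c i * (((Nat.sqrt (N/(2*i+1))+1)/2 : ℕ) : ℝ) := by
  have : ∀ i ∈ range E, c i * (((Nat.sqrt (N/(2*i+1))+1)/2 : ℕ) : ℝ) =
     ∑ n ∈ Ioc 0 N, lo n * (c i * (oc i (N/n) : ℝ)) := by
    intro i _
    rw [← lo_count_d N (2*i+1) (by omega), Finset.mul_sum]
    refine Finset.sum_congr rfl fun n _ => ?_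
    unfold oc; ring
  rw [Finset.sum_congr rfl this, Finset.sum_comm, ← Finset.sum_add_distrib, Lo_nat]
  refine Finset.sum_congr rfl fun n _ => ?_
  rw [← Finset.mul_sum, psi]; ring

lemma block_sum (c : ℕ → ℝ) (E N I : ℕ) :
    ∑ n ∈ Ioc (N/(2*I+1)) N, lo n * psi c E (N/n) =
    ∑ i ∈ range I, PPs c E (i+1) * (Lo ((N/(2*i+1) : ℕ):ℝ) - Lo ((N/(2*(i+1)+1) : ℕ):ℝ)) := by
  induction I with
  | zero => simp
  | succ I ih =>
    rw [Finset.sum_range_succ, ← ih]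
    have h1 : N/(2*(I+1)+1) ≤ N/(2*I+1) := Nat.div_le_div_left (by omega) (by omega)
    have h2 : N/(2*I+1) ≤ N := Nat.div_le_self _ _
    rw [← Finset.sum_Ioc_consecutive _ h1 h2, add_comm]
    congr 1
    rw [Lo_nat, Lo_nat, ← Finset.sum_Ioc_consecutive (fun n => lo n) (Nat.zero_le _) h1]
    rw [add_sub_cancel_left, Finset.mul_sum]
    refine Finset.sum_congr rfl fun n hn => ?_
    rw [mem_Ioc] at hn
    have hn0 : 0 < n := (Nat.zero_le _).trans_lt hn.1
    have a1 : 2*I+1 ≤ N/n := by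
      rw [Nat.le_div_iff_mul_le hn0, mul_comm]
      exact (Nat.le_div_iff_mul_le (by omega)).mp hn.2
    have a2 : N/n < 2*(I+1)+1 := by
      rw [Nat.div_lt_iff_lt_mul hn0, mul_comm]
      exact (Nat.div_lt_iff_lt_mul (by omega)).mp hn.1
    have : psi c E (N/n) = PPs c E (I+1) := by
      rw [PPs, if_neg (by omega), show 2*(I+1)-1 = 2*I+1 by omega]
      rcases (by omega : N/n = 2*I+1 ∨ N/n = 2*I+2) with h | h
      · rw [h]
      · rw [h, psi_even]
    rw [this]; ring

lemma abel_sum (P L : ℕ → ℝ) (h0 : P 0 = 0) (I : ℕ) :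
    ∑ i ∈ range I, P (i+1) * (L i - L (i+1)) = ∑ i ∈ range I, (P (i+1) - P i) * L i - P I * L I := by
  induction I with
  | zero => simp [h0]
  | succ I ih => rw [Finset.sum_range_succ, Finset.sum_range_succ, ih]; ring

lemma Lo_natdiv (N m : ℕ) : Lo ((N/m : ℕ) : ℝ) = Lo ((N:ℝ)/m) := by
  unfold Lo
  rw [Nat.floor_natCast, Nat.floor_div_natCast, Nat.floor_natCast]

lemma Lo_half (x : ℝ) (hx : 0 ≤ x) : |Lo x| ≤ x/2 + 1 := by
  have := Lo_diff' 0 x le_rfl hx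
  rwa [Lo_of_lt 0 (by norm_num), sub_zero, sub_zero] at this

theorem F_main (c : ℕ → ℝ) (E : ℕ) (h0 : ∑ i ∈ range E, c i/(2*i+1) = 0) (B C2 : ℝ)
    (hB : 1 + (∑ i ∈ range E, |c i|)/2 ≤ B) (hC2 : ∑ i ∈ range E, |c i|/Real.sqrt (2*i+1) ≤ C2)
    (N I0 I1 : ℕ) (hI : I0 ≤ I1) (δ κ A : ℝ) (hδ : 0 ≤ δ)
    (hL : ∀ i ≤ I0, |Lo ((N:ℝ)/(2*i+1))| ≤ δ * (N/(2*i+1)))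
    (hκ : ∑ i ∈ range I0, |PPs c E (i+1) - PPs c E i|/(2*i+1) + |PPs c E I0|/(2*I0+1) ≤ κ)
    (hA : ∑ i ∈ Ico I0 I1, |PPs c E (i+1)| * (1/(2*i+1) - 1/(2*i+3)) ≤ A) :
    |Lo (N:ℝ)| ≤ (κ*δ + A/2 + B/(2*(2*I1+1))) * N + B*(I1-I0) + 2*B + C2 * Real.sqrt N/2 := by
  set L : ℕ → ℝ := fun i => Lo ((N/(2*i+1) : ℕ):ℝ) with hLdef
  have hLr : ∀ i, L i = Lo ((N:ℝ)/(2*i+1)) := by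
    intro i; rw [hLdef]; simp only; rw [Lo_natdiv]; push_cast; rfl
  have hBP : ∀ k, |PPs c E k| ≤ B := fun k => PPs_le c E k h0 B hB
  have hB0 : 0 ≤ B := (abs_nonneg _).trans (hBP 0)
  have hN0 : (0:ℝ) ≤ N := Nat.cast_nonneg N
  -- first part
  have p1 : |∑ i ∈ range I0, PPs c E (i+1) * (L i - L (i+1))| ≤ κ*δ*N := by
    rw [abel_sum (PPs c E) L (by simp [PPs])]
    refine (abs_sub _ _).trans ?_
    have e1 : |∑ i ∈ range I0, (PPs c E (i+1) - PPs c E i) * L i| ≤ (∑ i ∈ range I0, |PPs c E (i+1) - PPs c E i|/(2*i+1)) * (δ*N) := by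
      refine (Finset.abs_sum_le_sum_abs _ _).trans ?_
      rw [Finset.sum_mul]
      refine Finset.sum_le_sum fun i hi => ?_
      rw [abs_mul, hLr]
      have := hL i (by simp at hi; omega)
      calc _ ≤ |PPs c E (i+1) - PPs c E i| * (δ * (N/(2*i+1))) := by gcongr
        _ = _ := by ring
    have e2 : |PPs c E I0 * L I0| ≤ |PPs c E I0|/(2*I0+1) * (δ*N) := by
      rw [abs_mul, hLr]
      calc _ ≤ |PPs c E I0| * (δ * (N/(2*I0+1))) := by gcongr; exact hL I0 le_rfl
        _ = _ := by ring
    calc _ ≤ (∑ i ∈ range I0, |PPs c E (i+1) - PPs c E i|/(2*i+1) + |PPs c E I0|/(2*I0+1)) * (δ*N) := by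
          rw [add_mul]; exact add_le_add e1 e2
      _ ≤ κ * (δ*N) := by gcongr
      _ = _ := by ring
  have p2 : |∑ i ∈ Ico I0 I1, PPs c E (i+1) * (L i - L (i+1))| ≤ A/2*N + B*(I1-I0) := by
    refine (Finset.abs_sum_le_sum_abs _ _).trans ?_
    have : ∀ i ∈ Ico I0 I1, |PPs c E (i+1) * (L i - L (i+1))| ≤ |PPs c E (i+1)| * (1/(2*i+1) - 1/(2*i+3)) * (N/2) + B := by
      intro i _
      rw [abs_mul]
      have h := Lo_diff' ((N:ℝ)/(2*(i+1:ℕ)+1)) ((N:ℝ)/(2*i+1)) (by positivity) (by gcongr; push_cast; linarith)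
      rw [hLr, hLr]
      calc _ ≤ |PPs c E (i+1)| * (((N:ℝ)/(2*i+1) - (N:ℝ)/(2*(i+1:ℕ)+1))/2+1) := by gcongr
        _ = |PPs c E (i+1)| * (1/(2*i+1) - 1/(2*i+3)) * (N/2) + |PPs c E (i+1)| := by
          push_cast; rw [show 2*((i:ℝ)+1)+1 = 2*i+3 by ring]; ring
        _ ≤ _ := by gcongr; exact hBP _
    refine (Finset.sum_le_sum this).trans ?_
    rw [Finset.sum_add_distrib, ← Finset.sum_mul, Finset.sum_const, Nat.card_Ico, nsmul_eq_mul, Nat.cast_sub hI]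
    have : (∑ i ∈ Ico I0 I1, |PPs c E (i+1)| * (1/(2*i+1) - 1/(2*i+3))) * ((N:ℝ)/2) ≤ A * (N/2) := by gcongr
    linarith
  have p3 : |∑ n ∈ Ioc 0 (N/(2*I1+1)), lo n * psi c E (N/n)| ≤ B/(2*(2*I1+1)) * N + B := by
    refine (Finset.abs_sum_le_sum_abs _ _).trans ?_
    have : ∀ n ∈ Ioc 0 (N/(2*I1+1)), |lo n * psi c E (N/n)| ≤ B * oA n := by
      intro n _
      rw [abs_mul, mul_comm, oA_apply]
      have h1 := psi_le c E (N/n) h0 B hB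
      by_cases h : Odd n
      · rw [if_pos h]
        exact mul_le_mul h1 (lo_abs_le n) (abs_nonneg _) hB0
      · rw [lo_even n h, if_neg h]; simp
    refine (Finset.sum_le_sum this).trans ?_
    rw [← Finset.mul_sum, sum_oA]
    have h1 : ((((N/(2*I1+1))+1)/2 : ℕ) : ℝ) ≤ (((N/(2*I1+1))+1 : ℕ):ℝ)/2 := Nat.cast_div_le
    have h2 : ((N/(2*I1+1) : ℕ) : ℝ) ≤ (N:ℝ)/((2*I1+1:ℕ):ℝ) := Nat.cast_div_le
    push_cast at h1 h2
    calc _ ≤ B * (((N:ℝ)/(2*I1+1)+1)/2) := by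
          gcongr; linarith
      _ = B/(2*(2*I1+1)) * N + B/2 := by field_simp
      _ ≤ _ := by linarith
  have p4 : |∑ i ∈ range E, c i * (((Nat.sqrt (N/(2*i+1))+1)/2 : ℕ) : ℝ)| ≤ C2 * Real.sqrt N/2 + B := by
    refine (Finset.abs_sum_le_sum_abs _ _).trans ?_
    have : ∀ i ∈ range E, |c i * (((Nat.sqrt (N/(2*i+1))+1)/2 : ℕ) : ℝ)| ≤ |c i|/Real.sqrt (2*i+1) * (Real.sqrt N/2) + |c i|/2 := by
      intro i _
      rw [abs_mul, Nat.abs_cast]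
      have h1 : (((Nat.sqrt (N/(2*i+1))+1)/2 : ℕ) : ℝ) ≤ ((Nat.sqrt (N/(2*i+1))+1 : ℕ):ℝ)/2 := Nat.cast_div_le
      have h2 : ((Nat.sqrt (N/(2*i+1)) : ℕ) : ℝ) ≤ Real.sqrt ((N/(2*i+1) : ℕ) : ℝ) := Real.nat_sqrt_le_real_sqrt
      have h3 : ((N/(2*i+1) : ℕ) : ℝ) ≤ (N:ℝ)/((2*i+1:ℕ):ℝ) := Nat.cast_div_le
      have h4 := Real.sqrt_le_sqrt h3
      rw [Real.sqrt_div hN0] at h4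
      push_cast at h1 h4
      calc _ ≤ |c i| * ((Real.sqrt N/Real.sqrt (2*i+1)+1)/2) := by gcongr; linarith
        _ = _ := by ring
    refine (Finset.sum_le_sum this).trans ?_
    rw [Finset.sum_add_distrib, ← Finset.sum_mul, ← Finset.sum_div]
    have := mul_le_mul_of_nonneg_right hC2 (by positivity : 0 ≤ Real.sqrt N/2)
    linarith
  rw [Lo_decomp c E N]
  have hsp : ∑ n ∈ Ioc 0 N, lo n * psi c E (N/n) = ∑ n ∈ Ioc 0 (N/(2*I1+1)), lo n * psi c E (N/n)
     + (∑ i ∈ range I0, PPs c E (i+1) * (L i - L (i+1)) + ∑ i ∈ Ico I0 I1, PPs c E (i+1) * (L i - L (i+1))) := by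
    rw [Finset.sum_range_add_sum_Ico _ hI, ← block_sum, Finset.sum_Ioc_consecutive _ (Nat.zero_le _) (Nat.div_le_self _ _)]
  rw [hsp]
  refine (abs_add_le _ _).trans ?_
  have q1 := (abs_add_le (∑ n ∈ Ioc 0 (N/(2*I1+1)), lo n * psi c E (N/n)) (∑ i ∈ range I0, PPs c E (i+1) * (L i - L (i+1)) + ∑ i ∈ Ico I0 I1, PPs c E (i+1) * (L i - L (i+1))))
  have q2 := abs_add_le (∑ i ∈ range I0, PPs c E (i+1) * (L i - L (i+1))) (∑ i ∈ Ico I0 I1, PPs c E (i+1) * (L i - L (i+1)))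
  linarith

/-- digit table -/
def dg (T i : ℕ) : ℕ := T / 4^i % 4
def sT (T k : ℕ) : ℕ → ℕ
  | 0 => 0
  | n+1 => sT T k n + dg T n * oc n k
def s1 (k : ℕ) : ℕ → ℕ
  | 0 => 0
  | n+1 => s1 k n + oc n k
def av (T n k : ℕ) : ℕ := 32769 + 2 * s1 k n - sT T k n
def hit (J N i : ℕ) : ℕ :=
  65536^((i+(2*i+1)-J%(2*i+1))%(2*i+1)) *
    ((65536^((2*i+1)*((N+2*i-(i+(2*i+1)-J%(2*i+1))%(2*i+1))/(2*i+1))) - 1)/(65536^(2*i+1)-1))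
def hT (T J N : ℕ) : ℕ → ℕ
  | 0 => 0
  | n+1 => hT T J N n + dg T n * hit J N n
def h1 (J N : ℕ) : ℕ → ℕ
  | 0 => 0
  | n+1 => h1 J N n + hit J N n
def VV (T n J N : ℕ) : ℕ :=
  (av T n (2*(J+N)) * 65536^N + hT T J N n - (2 * h1 J N n + av T n (2*J)))/65535
def ts0 : ℕ → ℕ → ℕ
  | 0, V => (V - 32768) + (32768 - V)
  | k+1, V => ts0 k (V % 65536^(2^k)) + ts0 k (V / 65536^(2^k))
def tw : ℕ → ℕ → ℕ → ℕ
  | 0, V, m => ts0 3 V * (2000000000000000/(m*(m+2))+1)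
  | k+1, V, m => tw k (V % 65536^(8*2^k)) m + tw k (V / 65536^(8*2^k)) (m+16*2^k)

def cz (T i : ℕ) : ℤ := (dg T i : ℤ) - 2
def psiZ (T n k : ℕ) : ℤ := 1 - ∑ i ∈ range n, cz T i * (oc i k : ℤ)

lemma sT_eq (T k n : ℕ) : sT T k n = ∑ i ∈ range n, dg T i * oc i k := by
  induction n with
  | zero => rfl
  | succ n ih => rw [sT, ih, Finset.sum_range_succ]
lemma s1_eq (k n : ℕ) : s1 k n = ∑ i ∈ range n, oc i k := by
  induction n with
  | zero => rfl
  | succ n ih => rw [s1, ih, Finset.sum_range_succ]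
lemma hT_eq (T J N n : ℕ) : hT T J N n = ∑ i ∈ range n, dg T i * hit J N i := by
  induction n with
  | zero => rfl
  | succ n ih => rw [hT, ih, Finset.sum_range_succ]
lemma h1_eq (J N n : ℕ) : h1 J N n = ∑ i ∈ range n, hit J N i := by
  induction n with
  | zero => rfl
  | succ n ih => rw [h1, ih, Finset.sum_range_succ]

lemma psiZ_eq (T n k : ℕ) : psiZ T n k = 1 + 2 * (s1 k n : ℤ) - sT T k n := by
  rw [psiZ, sT_eq, s1_eq]
  push_cast
  rw [Finset.mul_sum, add_sub_assoc, ← Finset.sum_sub_distrib, sub_eq_add_neg, ← Finset.sum_neg_distrib]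
  congr 1
  refine Finset.sum_congr rfl fun i _ => ?_
  rw [cz]; ring

lemma av_eq (T n k : ℕ) (h : |psiZ T n k| ≤ 1000) : (av T n k : ℤ) = 32768 + psiZ T n k := by
  have := psiZ_eq T n k
  rw [abs_le] at h
  unfold av
  omega

lemma oc_succ (i j : ℕ) : oc i (2*j+1) = oc i (2*j) + if (2*i+1) ∣ 2*j+1 then 1 else 0 := by
  unfold oc
  by_cases h : (2*i+1) ∣ 2*j+1
  · rw [if_pos h, Nat.succ_div_of_dvd h]
    obtain ⟨q, hq⟩ := h
    have h1 : (2*j)/(2*i+1)+1 = q := by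
      rw [← Nat.succ_div_of_dvd ⟨q, hq⟩, hq]; exact Nat.mul_div_cancel_left _ (by omega)
    have hqo : Odd q := by
      have : Odd ((2*i+1)*q) := by rw [← hq]; exact ⟨j, by ring⟩
      exact (Nat.odd_mul.mp this).2
    obtain ⟨r, hr⟩ := hqo
    omega
  · rw [if_neg h, Nat.succ_div_of_not_dvd h, add_zero]

lemma hit_eq (J N i : ℕ) : hit J N i = ∑ k ∈ range N, if (2*i+1) ∣ 2*(J+k)+1 then 65536^k else 0 := by
  rw [← Finset.sum_filter]
  unfold hit
  set d := 2*i+1 with hd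
  have hd0 : 0 < d := by omega
  set r := (i+d-J%d)%d with hr
  have hrd : r < d := Nat.mod_lt _ hd0
  have key : ∀ k, d ∣ 2*(J+k)+1 ↔ d ∣ J + k + (i+1) := by
    intro k
    have hc : Nat.Coprime d 2 := by rw [hd]; simp
    have e : 2*(J+k+(i+1)) = (2*(J+k)+1) + d := by omega
    rw [← hc.dvd_mul_left (n := J+k+(i+1)), e]
    exact (Nat.dvd_add_left dvd_rfl).symm
  have hr0 : d ∣ J + r + (i+1) := by
    have hJ := Nat.mod_lt J hd0
    have e1 := Nat.div_add_mod J d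
    have e2 := Nat.div_add_mod (i+d-J%d) d
    rw [← hr] at e2
    have : J + r + (i+1) + d*((i+d-J%d)/d) = d*(J/d) + 2*d := by omega
    have h3 : d ∣ J + r + (i+1) + d*((i+d-J%d)/d) := by rw [this]; exact ⟨J/d+2, by ring⟩
    exact (Nat.dvd_add_left (Dvd.intro _ rfl)).mp h3
  set q := (N+2*i-r)/d with hq
  have hgeo : (65536^(d*q)-1)/(65536^d-1) = ∑ j ∈ range q, (65536^d)^j := by
    rw [Nat.geomSum_eq]
    · rw [pow_mul]
    · exact le_trans (by norm_num) (Nat.pow_le_pow_right (by norm_num) hd0)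
  rw [hgeo, Finset.mul_sum]
  have hset : (range N).filter (fun k => d ∣ 2*(J+k)+1) = (range q).image (fun j => r+d*j) := by
    ext k
    simp only [mem_filter, mem_range, mem_image]
    constructor
    · rintro ⟨hk, hdv⟩
      rw [key] at hdv
      have hrk : r ≤ k := by
        by_contra hlt
        have : d ∣ r - k := by
          have := Nat.dvd_sub hr0 hdv
          rwa [show J + r + (i+1) - (J+k+(i+1)) = r-k by omega] at this
        have := Nat.le_of_dvd (by omega) this
        omega
      have : d ∣ k - r := by
        have := Nat.dvd_sub hdv hr0
        rwa [show J + k + (i+1) - (J+r+(i+1)) = k-r by omega] at this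
      obtain ⟨j, hj⟩ := this
      refine ⟨j, ?_, by omega⟩
      rw [hq]
      rw [Nat.lt_iff_add_one_le, Nat.le_div_iff_mul_le hd0]
      have : (j+1)*d = d*j+d := by ring
      omega
    · rintro ⟨j, hj, rfl⟩
      rw [hq, Nat.lt_iff_add_one_le, Nat.le_div_iff_mul_le hd0] at hj
      have e : (j+1)*d = d*j+d := by ring
      refine ⟨by omega, ?_⟩
      rw [key, show J + (r+d*j)+(i+1) = J+r+(i+1)+d*j by ring]
      exact dvd_add hr0 (Dvd.intro _ rfl)
  rw [hset, Finset.sum_image]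
  · refine Finset.sum_congr rfl fun j _ => ?_
    rw [pow_add _ r (d*j), pow_mul _ d j]
  · intro a _ b _ h
    simp only [add_right_inj] at h
    exact Nat.eq_of_mul_eq_mul_left hd0 h

lemma psiZ_even (T n j : ℕ) : psiZ T n (2*j+2) = psiZ T n (2*j+1) := by
  simp only [psiZ, oc_even]

lemma psiZ_step (T n j : ℕ) : psiZ T n (2*j+1) = psiZ T n (2*j) - ∑ i ∈ range n, cz T i * (if (2*i+1) ∣ 2*j+1 then 1 else 0) := by
  simp only [psiZ, oc_succ]
  push_cast
  simp only [mul_add, Finset.sum_add_distrib]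
  ring

lemma V_tel (v g : ℕ → ℤ) (hg : ∀ k, v (k+1) = v k - g k) (N : ℕ) :
    65535 * ∑ k ∈ range N, v (k+1) * 65536^k = v N * 65536^N - v 0 + ∑ k ∈ range N, g k * 65536^k := by
  induction N with
  | zero => simp
  | succ N ih => rw [Finset.sum_range_succ, Finset.sum_range_succ, mul_add, ih, hg, pow_succ]; ring

lemma VV_eq (T n J N : ℕ) (h : ∀ k, k ≤ 2*(J+N) → |psiZ T n k| ≤ 1000) :
    VV T n J N = ∑ k ∈ range N, av T n (2*(J+k)+1) * 65536^k := by
  set g : ℕ → ℤ := fun k => ∑ i ∈ range n, cz T i * (if (2*i+1) ∣ 2*(J+k)+1 then 1 else 0) with hg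
  have hs : ∀ k, 32768 + psiZ T n (2*(J+(k+1))) = (32768 + psiZ T n (2*(J+k))) - g k := by
    intro k
    rw [show 2*(J+(k+1)) = 2*(J+k)+2 by ring, psiZ_even, psiZ_step, hg]; ring
  have tel := V_tel (fun k => 32768 + psiZ T n (2*(J+k))) g hs N
  simp only [add_zero] at tel
  have e1 : ∑ k ∈ range N, (32768 + psiZ T n (2*(J+(k+1)))) * (65536:ℤ)^k = ((∑ k ∈ range N, av T n (2*(J+k)+1) * 65536^k : ℕ) : ℤ) := by
    push_cast
    refine Finset.sum_congr rfl fun k hk => ?_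
    rw [mem_range] at hk
    rw [av_eq _ _ _ (h _ (by omega)), show 2*(J+(k+1)) = 2*(J+k)+2 by ring, psiZ_even]
  have e2 : ∑ k ∈ range N, g k * 65536^k = (hT T J N n : ℤ) - 2 * (h1 J N n : ℤ) := by
    rw [hT_eq, h1_eq]
    push_cast
    rw [Finset.mul_sum, ← Finset.sum_sub_distrib]
    simp only [hg, Finset.sum_mul]
    rw [Finset.sum_comm]
    refine Finset.sum_congr rfl fun i _ => ?_
    rw [hit_eq]
    push_cast
    rw [← sub_mul, Finset.mul_sum]
    refine Finset.sum_congr rfl fun k _ => ?_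
    rw [cz]; split_ifs <;> simp
  rw [e1, e2, ← av_eq _ _ _ (h _ le_rfl), ← av_eq _ _ _ (h _ (by omega))] at tel
  unfold VV
  generalize (∑ k ∈ range N, av T n (2*(J+k)+1) * 65536^k) = S at *
  have : 65535 * S + (2 * h1 J N n + av T n (2*J)) = av T n (2*(J+N)) * 65536^N + hT T J N n := by
    zify; linarith
  rw [← this, Nat.add_sub_cancel, Nat.mul_div_cancel_left _ (by norm_num)]

lemma dig_split (v : ℕ → ℕ) (hv : ∀ k, v k < 65536) (a b : ℕ) :
    (∑ k ∈ range (a+b), v k * 65536^k) % 65536^a = ∑ k ∈ range a, v k * 65536^k ∧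
    (∑ k ∈ range (a+b), v k * 65536^k) / 65536^a = ∑ k ∈ range b, v (a+k) * 65536^k := by
  have hlt : ∀ a, ∑ k ∈ range a, v k * 65536^k < 65536^a := by
    intro a
    induction a with
    | zero => simp
    | succ a ih =>
      rw [Finset.sum_range_succ, pow_succ]
      have := hv a
      have : v a * 65536^a ≤ 65535 * 65536^a := Nat.mul_le_mul_right _ (by omega)
      omega
  have e : ∑ k ∈ range (a+b), v k * 65536^k = ∑ k ∈ range a, v k * 65536^k + 65536^a * ∑ k ∈ range b, v (a+k) * 65536^k := by
    rw [Finset.sum_range_add, Finset.mul_sum]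
    congr 1
    refine Finset.sum_congr rfl fun k _ => ?_
    rw [pow_add]; ring
  rw [e]
  constructor
  · rw [Nat.add_mul_mod_self_left, Nat.mod_eq_of_lt (hlt a)]
  · rw [Nat.add_mul_div_left _ _ (by positivity), Nat.div_eq_of_lt (hlt a), zero_add]

lemma ts0_eq (K : ℕ) : ∀ (v : ℕ → ℕ) (_ : ∀ k, v k < 65536),
    ts0 K (∑ k ∈ range (2^K), v k * 65536^k) = ∑ k ∈ range (2^K), ((v k - 32768) + (32768 - v k)) := by
  induction K with
  | zero => intro v hv; simp [ts0]
  | succ K ih =>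
    intro v hv
    rw [ts0, show 2^(K+1) = 2^K+2^K by ring, (dig_split v hv _ _).1, (dig_split v hv _ _).2, ih v hv,
      ih (fun k => v (2^K+k)) (fun k => hv _), Finset.sum_range_add]

lemma tw_ge (K : ℕ) : ∀ (v : ℕ → ℕ) (_ : ∀ k, v k < 65536) (m : ℕ) (_ : 0 < m),
    ∑ k ∈ range (8*2^K), (((v k - 32768) + (32768 - v k) : ℕ) : ℝ) * (1/((m:ℝ)+2*k) - 1/((m:ℝ)+2*k+2)) ≤
    (tw K (∑ k ∈ range (8*2^K), v k * 65536^k) m : ℝ) / 10^15 := by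
  induction K with
  | zero =>
    intro v hv m hm
    have hm' : (0:ℝ) < m := by exact_mod_cast hm
    have e := ts0_eq 3 v hv
    rw [show (2:ℕ)^3 = 8*2^0 by norm_num] at e
    rw [tw, e]
    have hw : 2/((m:ℝ)*(m+2)) ≤ ((2000000000000000/(m*(m+2))+1 : ℕ):ℝ)/10^15 := by
      have := Nat.lt_div_mul_add (a := 2000000000000000) (b := m*(m+2)) (by positivity)
      have h2 : (2000000000000000:ℝ) < ((2000000000000000/(m*(m+2)) : ℕ):ℝ)*(m*(m+2)) + m*(m+2) := by exact_mod_cast this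
      push_cast
      rw [div_le_div_iff₀ (by positivity) (by positivity)]
      nlinarith
    push_cast
    rw [Finset.sum_mul, Finset.sum_div]
    refine Finset.sum_le_sum fun k _ => ?_
    rw [mul_div_assoc]
    push_cast at hw
    refine mul_le_mul_of_nonneg_left ?_ (add_nonneg (Nat.cast_nonneg _) (Nat.cast_nonneg _))
    refine le_trans ?_ hw
    rw [div_sub_div _ _ (by positivity) (by positivity)]
    have : 1*((m:ℝ)+2*k+2) - (m+2*k)*1 = 2 := by ring
    rw [this]
    have hk : (0:ℝ) ≤ k := Nat.cast_nonneg k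
    apply div_le_div_of_nonneg_left (by norm_num) (by positivity)
    nlinarith
  | succ K ih =>
    intro v hv m hm
    rw [tw, show 8*2^(K+1) = 8*2^K+8*2^K by ring, (dig_split v hv _ _).1, (dig_split v hv _ _).2, Finset.sum_range_add]
    push_cast
    rw [add_div]
    have h1 := ih v hv m hm
    have h2 := ih (fun k => v (8*2^K+k)) (fun k => hv _) (m+16*2^K) (by omega)
    refine add_le_add ?_ ?_
    · push_cast at h1; exact h1
    · push_cast at h2
      refine le_trans (le_of_eq ?_) h2
      refine Finset.sum_congr rfl fun k _ => ?_
      congr 2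
      · congr 1; ring
      · congr 1; ring

lemma chunk (T n J K S : ℕ) (h : ∀ k, k ≤ 2*(J+8*2^K) → |psiZ T n k| ≤ 1000)
    (hS : tw K (VV T n J (8*2^K)) (2*J+1) ≤ S) :
    ∑ i ∈ Ico J (J+8*2^K), |(psiZ T n (2*i+1) : ℝ)| * (1/(2*(i:ℝ)+1) - 1/(2*(i:ℝ)+3)) ≤ (S:ℝ)/10^15 := by
  have h1 : (tw K (VV T n J (8*2^K)) (2*J+1) : ℝ)/10^15 ≤ (S:ℝ)/10^15 := by gcongr
  refine le_trans ?_ h1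
  set v : ℕ → ℕ := fun k => if k < 8*2^K then av T n (2*(J+k)+1) else 0 with hv
  have hvv : ∀ k, k < 8*2^K → (v k : ℤ) = 32768 + psiZ T n (2*(J+k)+1) := by
    intro k hk
    simp only [hv, if_pos hk]
    exact av_eq _ _ _ (h _ (by omega))
  have hvb : ∀ k, v k < 65536 := by
    intro k
    by_cases hk : k < 8*2^K
    · have e1 := hvv k hk
      have e2 := h (2*(J+k)+1) (by omega)
      rw [abs_le] at e2; omega
    · simp [hv, hk]
  have e : VV T n J (8*2^K) = ∑ k ∈ range (8*2^K), v k * 65536^k := by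
    rw [VV_eq _ _ _ _ h]
    refine Finset.sum_congr rfl fun k hk => ?_
    rw [mem_range] at hk
    simp only [hv, if_pos hk]
  rw [e]
  refine le_trans (le_of_eq ?_) (tw_ge K v hvb (2*J+1) (by omega))
  rw [Finset.sum_Ico_eq_sum_range, Nat.add_sub_cancel_left]
  refine Finset.sum_congr rfl fun k hk => ?_
  rw [mem_range] at hk
  have e1 := hvv k hk
  have e3 : (((v k - 32768) + (32768 - v k) : ℕ) : ℤ) = |psiZ T n (2*(J+k)+1)| := by
    rcases abs_cases (psiZ T n (2*(J+k)+1)) with ⟨h1, h2⟩ | ⟨h1, h2⟩ <;> rw [h1] <;> omega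
  have e4 : (((v k - 32768) + (32768 - v k) : ℕ) : ℝ) = |(psiZ T n (2*(J+k)+1) : ℝ)| := by exact_mod_cast e3
  rw [e4]
  push_cast
  congr 2
  · congr 1; ring
  · congr 1; ring

/-- table sums -/
def sabs (T : ℕ) : ℕ → ℕ
  | 0 => 0
  | n+1 => sabs T n + ((dg T n - 2) + (2 - dg T n))
def sP (T : ℕ) : ℕ → ℕ
  | 0 => 0
  | n+1 => sP T n + dg T n * (10^15/(2*n+1))
def sQ : ℕ → ℕ
  | 0 => 0
  | n+1 => sQ n + 2 * (10^15/(2*n+1))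

noncomputable def ss (T n : ℕ) : ℝ := ∑ j ∈ range n, (cz T j : ℝ)/(2*j+1)
noncomputable def tabC (T n e i : ℕ) : ℝ :=
  (if i < n then (cz T i : ℝ) else 0) + (if i = e then -(2*e+1)*ss T n else 0)

lemma cz_abs (T i : ℕ) : |(cz T i : ℝ)| = (((dg T i - 2) + (2 - dg T i) : ℕ) : ℝ) := by
  have : |cz T i| = (((dg T i - 2) + (2 - dg T i) : ℕ) : ℤ) := by
    unfold cz
    rcases abs_cases ((dg T i : ℤ) - 2) with ⟨h1, h2⟩ | ⟨h1, h2⟩ <;> rw [h1] <;> omega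
  exact_mod_cast this

lemma sabs_eq (T n : ℕ) : (sabs T n : ℝ) = ∑ i ∈ range n, |(cz T i : ℝ)| := by
  induction n with
  | zero => simp [sabs]
  | succ n ih => rw [Finset.sum_range_succ, ← ih, cz_abs, ← Nat.cast_add]; rfl

lemma ss_err (T n : ℕ) : |10^15 * ss T n - ((sP T n : ℝ) - sQ n)| ≤ (sabs T n : ℝ) := by
  induction n with
  | zero => simp [ss, sP, sQ, sabs]
  | succ n ih =>
    have e1 : ss T (n+1) = ss T n + (cz T n : ℝ)/(2*n+1) := by rw [ss, Finset.sum_range_succ, ← ss]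
    have e2 : (sabs T (n+1) : ℝ) = sabs T n + |(cz T n : ℝ)| := by rw [sabs_eq, sabs_eq, Finset.sum_range_succ]
    have e3 : (sP T (n+1) : ℝ) = sP T n + dg T n * ((10^15/(2*n+1) : ℕ) : ℝ) := by rw [sP]; push_cast; rfl
    have e4 : (sQ (n+1) : ℝ) = sQ n + 2 * ((10^15/(2*n+1) : ℕ) : ℝ) := by rw [sQ]; push_cast; rfl
    have e5 : (cz T n : ℝ) = dg T n - 2 := by rw [cz]; push_cast; rfl
    set F := ((10^15/(2*n+1) : ℕ) : ℝ) with hF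
    have hF' : F = ⌊((10:ℝ)^15/(2*n+1))⌋₊ := by
      rw [hF]
      have := Nat.floor_div_eq_div (K := ℝ) (10^15) (2*n+1)
      rw [← this]; push_cast; norm_num
    have b1 : F ≤ (10:ℝ)^15/(2*n+1) := by rw [hF']; exact Nat.floor_le (by positivity)
    have b2 : (10:ℝ)^15/(2*n+1) < F + 1 := by rw [hF']; exact Nat.lt_floor_add_one _
    have e6 : 10^15 * ss T (n+1) - ((sP T (n+1) : ℝ) - sQ (n+1)) = (10^15 * ss T n - ((sP T n : ℝ) - sQ n)) + (cz T n : ℝ)*((10:ℝ)^15/(2*n+1) - F) := by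
      rw [e1, e3, e4, e5]; ring
    rw [e6, e2]
    refine (abs_add_le _ _).trans (add_le_add ih ?_)
    rw [abs_mul]
    have : |(10:ℝ)^15/(2*n+1) - F| ≤ 1 := by rw [abs_le]; constructor <;> linarith
    exact mul_le_of_le_one_right (abs_nonneg _) this

lemma ss_le (T n a R : ℕ) (ha : sabs T n ≤ a) (h1 : sP T n ≤ sQ n + R) (h2 : sQ n ≤ sP T n + R) :
    |ss T n| ≤ ((R:ℝ) + a)/10^15 := by
  have h := ss_err T n
  have h1' : (sP T n : ℝ) ≤ sQ n + R := by exact_mod_cast h1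
  have h2' : (sQ n : ℝ) ≤ sP T n + R := by exact_mod_cast h2
  have ha' : (sabs T n : ℝ) ≤ a := by exact_mod_cast ha
  rw [abs_le] at h ⊢
  constructor
  · have : -ss T n ≤ ((R:ℝ)+a)/10^15 := by rw [le_div_iff₀ (by positivity)]; linarith
    linarith
  · rw [le_div_iff₀ (by positivity)]; linarith

lemma sum_tab (T n e : ℕ) (hn : n ≤ e) (f : ℕ → ℝ → ℝ) (hf : ∀ i, f i 0 = 0) :
    ∑ i ∈ range (e+1), f i (tabC T n e i) = ∑ i ∈ range n, f i (cz T i) + f e (-(2*e+1)*ss T n) := by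
  rw [Finset.sum_range_succ]
  congr 1
  · rw [← Finset.sum_range_add_sum_Ico _ hn]
    rw [Finset.sum_eq_zero (s := Ico n e), add_zero]
    · refine Finset.sum_congr rfl fun i hi => ?_
      rw [mem_range] at hi
      rw [tabC, if_pos hi, if_neg (by omega), add_zero]
    · intro i hi
      rw [mem_Ico] at hi
      rw [tabC, if_neg (by omega), if_neg (by omega), add_zero, hf]
  · rw [tabC, if_neg (by omega), if_pos rfl, zero_add]

lemma tab_h0 (T n e : ℕ) (hn : n ≤ e) : ∑ i ∈ range (e+1), tabC T n e i/(2*i+1) = 0 := by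
  rw [sum_tab T n e hn (fun i x => x/(2*i+1)) (by simp)]
  rw [← ss]
  have : (2*(e:ℝ)+1) ≠ 0 := by positivity
  field_simp
  ring

lemma tab_abs (T n e : ℕ) (hn : n ≤ e) : ∑ i ∈ range (e+1), |tabC T n e i| = sabs T n + (2*e+1)*|ss T n| := by
  rw [sum_tab T n e hn (fun i x => |x|) (by simp), ← sabs_eq, abs_mul, abs_neg, abs_of_nonneg (a := 2*(e:ℝ)+1) (by positivity)]

lemma psi_tab (T n e k : ℕ) (hn : n ≤ e) (hk : k < 2*e+1) : psi (tabC T n e) (e+1) k = (psiZ T n k : ℝ) := by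
  rw [psi, sum_tab T n e hn (fun i x => x*(oc i k : ℝ)) (by simp), psiZ]
  have : oc e k = 0 := by
    unfold oc; rw [Nat.div_eq_of_lt hk]
  rw [this]; push_cast; simp

lemma psiZ_bd (T n e : ℕ) (hn : n ≤ e) (B : ℝ) (hB : 1 + (sabs T n + (2*e+1)*|ss T n|)/2 ≤ B) (hB' : B ≤ 1000) (k : ℕ) (hk : k ≤ 2*e) : |psiZ T n k| ≤ 1000 := by
  have h := psi_le (tabC T n e) (e+1) k (tab_h0 T n e hn) B (by rw [tab_abs _ _ _ hn]; exact hB)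
  rw [psi_tab _ _ _ _ hn (by omega)] at h
  have : |(psiZ T n k : ℝ)| ≤ 1000 := by linarith
  exact_mod_cast this

lemma stage (T n e I0 : ℕ) (hn : n ≤ e) (hI : I0 ≤ e) (B C2 : ℝ)
    (hB : 1 + (sabs T n + (2*e+1)*|ss T n|)/2 ≤ B) (hC2 : sabs T n + (2*e+1)*|ss T n| ≤ C2)
    (κ A : ℝ)
    (hκ : ∑ i ∈ range I0, |PPs (tabC T n e) (e+1) (i+1) - PPs (tabC T n e) (e+1) i|/(2*i+1) + |PPs (tabC T n e) (e+1) I0|/(2*I0+1) ≤ κ)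
    (hA : ∑ i ∈ Ico I0 e, |(psiZ T n (2*i+1) : ℝ)| * (1/(2*(i:ℝ)+1) - 1/(2*(i:ℝ)+3)) ≤ A)
    (δ X0 δ' : ℝ) (hδ : 0 ≤ δ) (hX0 : 0 < X0) (hL : ∀ x, X0 ≤ x*(2*I0+1) → |Lo x| ≤ δ*x)
    (h' : κ*δ + A/2 + B/(2*(2*e+1)) + (B*((e:ℝ)-I0+2))/X0 + C2/(2*√X0) ≤ δ') (x : ℝ) (hx : X0 + 1 ≤ x) : |Lo x| ≤ δ'*x := by
  have hx0 : 0 ≤ x := by linarith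
  have e1 : Lo x = Lo (⌊x⌋₊ : ℝ) := by unfold Lo; rw [Nat.floor_natCast]
  set N := ⌊x⌋₊ with hN
  have hNx : (N:ℝ) ≤ x := Nat.floor_le hx0
  have hNX : X0 ≤ N := by have := Nat.lt_floor_add_one x; rw [← hN] at this; linarith
  have hN0 : (0:ℝ) < N := by linarith
  have B0 : 0 ≤ B := by
    have : 0 ≤ (sabs T n + (2*(e:ℝ)+1)*|ss T n|)/2 := by positivity
    linarith
  have C0 : 0 ≤ C2 := le_trans (by positivity) hC2
  have hm := F_main (tabC T n e) (e+1) (tab_h0 T n e hn) B C2 (by rw [tab_abs _ _ _ hn]; exact hB)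
    (by
      refine le_trans (Finset.sum_le_sum fun i _ => ?_) (le_trans (le_of_eq (tab_abs T n e hn)) hC2)
      refine div_le_self (abs_nonneg _) ?_
      rw [Real.one_le_sqrt]
      have : (0:ℝ) ≤ i := Nat.cast_nonneg i
      linarith) N I0 e hI δ κ A hδ ?_ hκ ?_
  · rw [e1]
    refine hm.trans ?_
    have k1 : B*((e:ℝ)-I0+2) ≤ (B*((e:ℝ)-I0+2))/X0 * N := by
      have hI' : (I0:ℝ) ≤ e := by exact_mod_cast hI
      have : 0 ≤ B*((e:ℝ)-I0+2) := mul_nonneg B0 (by linarith)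
      rw [div_mul_eq_mul_div, le_div_iff₀ hX0]
      exact mul_le_mul_of_nonneg_left hNX this
    have k2 : C2*√N/2 ≤ C2/(2*√X0) * N := by
      have s1 : 0 < √X0 := Real.sqrt_pos.mpr hX0
      have s2 : √X0 ≤ √N := Real.sqrt_le_sqrt hNX
      have s3 : (N:ℝ) = √N*√N := (Real.mul_self_sqrt hN0.le).symm
      rw [div_mul_eq_mul_div, div_le_div_iff₀ (by norm_num) (by positivity)]
      have : √(N:ℝ)*√X0 ≤ N := by
        conv_rhs => rw [s3]
        exact mul_le_mul_of_nonneg_left s2 (Real.sqrt_nonneg _)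
      nlinarith
    have hp : 0 ≤ δ' := by
      by_contra hneg
      have := (abs_nonneg _).trans hm
      nlinarith
    have : (κ*δ + A/2 + B/(2*(2*e+1)) + (B*((e:ℝ)-I0+2))/X0 + C2/(2*√X0))*N ≤ δ'*N := mul_le_mul_of_nonneg_right h' hN0.le
    have h3 : δ'*N ≤ δ'*x := mul_le_mul_of_nonneg_left hNx hp
    nlinarith
  · intro i hi
    have : (i:ℝ) ≤ I0 := by exact_mod_cast hi
    apply hL
    have hi0 : (0:ℝ) < 2*i+1 := by positivity
    rw [div_mul_eq_mul_div, le_div_iff₀ hi0]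
    nlinarith
  · refine le_trans (le_of_eq (Finset.sum_congr rfl fun i hi => ?_)) hA
    rw [mem_Ico] at hi
    rw [PPs, if_neg (by omega), show 2*(i+1)-1 = 2*i+1 by omega, psi_tab _ _ _ _ hn (by omega)]

/-- digit -/
def dgt (V i : ℕ) : ℕ := V / 65536^i % 65536
def kp (V : ℕ) : ℕ → ℕ
  | 0 => 0
  | i+1 => kp V i + ((dgt V (i+1) - dgt V i) + (dgt V i - dgt V (i+1))) * (1000000000000/(2*i+1)+1)
def kap (T n I0 : ℕ) : ℕ :=
  kp (VV T n 0 I0 * 65536 + 32768) I0 +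
    ((dgt (VV T n 0 I0 * 65536 + 32768) I0 - 32768) + (32768 - dgt (VV T n 0 I0 * 65536 + 32768) I0)) * (1000000000000/(2*I0+1)+1)

lemma dgt_eq (w : ℕ → ℕ) (hw : ∀ k, w k < 65536) (N i : ℕ) (hi : i < N) :
    dgt (∑ k ∈ range N, w k * 65536^k) i = w i := by
  unfold dgt
  have h1 := (dig_split w hw i (N-i)).2
  rw [show i+(N-i) = N by omega] at h1
  rw [h1]
  have h2 := (dig_split (fun k => w (i+k)) (fun k => hw _) 1 (N-i-1)).1
  rw [show 1+(N-i-1) = N-i by omega] at h2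
  simpa using h2

lemma wt_le (m : ℕ) (hm : 0 < m) : 1/(m:ℝ) ≤ ((1000000000000/m+1 : ℕ):ℝ)/10^12 := by
  have := Nat.lt_div_mul_add (a := 1000000000000) (b := m) hm
  have h2 : (1000000000000:ℝ) < ((1000000000000/m : ℕ):ℝ)*m + m := by exact_mod_cast this
  have hm' : (0:ℝ) < m := by exact_mod_cast hm
  rw [div_le_div_iff₀ hm' (by positivity), Nat.cast_add, Nat.cast_one]
  linarith

lemma nabs (a b : ℕ) : (((a - b) + (b - a) : ℕ) : ℝ) = |(a:ℝ) - b| := by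
  have : (((a - b) + (b - a) : ℕ) : ℤ) = |(a:ℤ) - b| := by
    rcases abs_cases ((a:ℤ) - b) with ⟨h1, h2⟩ | ⟨h1, h2⟩ <;> rw [h1] <;> omega
  exact_mod_cast this

lemma kp_ge (V : ℕ) (w : ℕ → ℝ) (I : ℕ) (h : ∀ i ≤ I, (dgt V i : ℝ) = 32768 + w i) :
    ∑ i ∈ range I, |w (i+1) - w i|/(2*i+1) ≤ (kp V I : ℝ)/10^12 := by
  induction I with
  | zero => simp [kp]
  | succ I ih =>
    rw [Finset.sum_range_succ, kp, Nat.cast_add, add_div]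
    refine add_le_add (ih fun i hi => h i (by omega)) ?_
    rw [Nat.cast_mul, nabs, h _ le_rfl, h I (by omega), mul_div_assoc, div_eq_mul_one_div]
    have e : (32768 + w (I+1) - (32768 + w I)) = w (I+1) - w I := by ring
    rw [e]
    refine mul_le_mul_of_nonneg_left ?_ (abs_nonneg _)
    have := wt_le (2*I+1) (by omega)
    refine le_trans (le_of_eq ?_) this
    push_cast; rfl

lemma kappa (T n e I0 : ℕ) (hn : n ≤ e) (hI : I0 ≤ e) (h : ∀ k, k ≤ 2*e → |psiZ T n k| ≤ 1000) (S : ℕ) (hS : kap T n I0 ≤ S) :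
    ∑ i ∈ range I0, |PPs (tabC T n e) (e+1) (i+1) - PPs (tabC T n e) (e+1) i|/(2*i+1) + |PPs (tabC T n e) (e+1) I0|/(2*I0+1) ≤ (S:ℝ)/10^12 := by
  have hS' : (kap T n I0 : ℝ)/10^12 ≤ (S:ℝ)/10^12 := by gcongr
  refine le_trans ?_ hS'
  set w : ℕ → ℕ := fun j => if j = 0 then 32768 else if j ≤ I0 then av T n (2*(j-1)+1) else 0 with hw
  have hwv : ∀ j ≤ I0, (w j : ℝ) = 32768 + PPs (tabC T n e) (e+1) j := by
    intro j hj
    rcases Nat.eq_zero_or_pos j with rfl | h0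
    · simp [hw, PPs]
    · simp only [hw]
      rw [if_neg (by omega), if_pos hj, PPs, if_neg (by omega), show 2*j-1 = 2*(j-1)+1 by omega, psi_tab _ _ _ _ hn (by omega)]
      have := av_eq T n (2*(j-1)+1) (h _ (by omega))
      exact_mod_cast this
  have hwb : ∀ k, w k < 65536 := by
    intro j
    simp only [hw]
    split_ifs with h1 h2
    · norm_num
    · have e1 := av_eq T n (2*(j-1)+1) (h _ (by omega))
      have e2 := h (2*(j-1)+1) (by omega)
      rw [abs_le] at e2; omega
    · norm_num
  have hV : VV T n 0 I0 * 65536 + 32768 = ∑ k ∈ range (I0+1), w k * 65536^k := by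
    rw [VV_eq T n 0 I0 (fun k hk => h k (by omega)), Finset.sum_range_succ', Finset.sum_mul]
    have hw0 : w 0 * 65536^0 = 32768 := by simp [hw]
    rw [hw0, add_left_inj]
    refine Finset.sum_congr rfl fun k hk => ?_
    rw [mem_range] at hk
    simp only [hw]
    rw [if_neg (by omega), if_pos (by omega), zero_add, Nat.add_sub_cancel, pow_succ, mul_assoc]
  have hd : ∀ i ≤ I0, (dgt (VV T n 0 I0 * 65536 + 32768) i : ℝ) = 32768 + PPs (tabC T n e) (e+1) i := by
    intro i hi
    rw [hV, dgt_eq w hwb _ _ (by omega), hwv i hi]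
  rw [kap, Nat.cast_add, add_div]
  refine add_le_add (kp_ge _ _ _ hd) ?_
  rw [Nat.cast_mul, nabs, hd _ le_rfl, mul_div_assoc, div_eq_mul_one_div]
  have e2 : (32768 + PPs (tabC T n e) (e+1) I0 - ((32768:ℕ):ℝ)) = PPs (tabC T n e) (e+1) I0 := by push_cast; ring
  rw [e2]
  refine mul_le_mul_of_nonneg_left ?_ (abs_nonneg _)
  refine le_trans (le_of_eq ?_) (wt_le (2*I0+1) (by omega))
  push_cast; rfl

/-- tables -/
def TS : ℕ := 2930685367895
def TM : ℕ := 56713727820151342535854501122180240983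
def TB : ℕ := 14355106184988112302770268392773610557877204291794107510445853296642489082815705181255926862592565385756964541907075608546388333507392882188681602429087730316627544198890700240172509605112801373000368740127572935181437860400394756162374641560451716140831020183182543234891368632235678794050466588478669144385513760651525492296593563677171388522026583

lemma ssTS : |ss TS 22| ≤ ((2077249990581:ℕ) + (15:ℕ))/10^15 :=
  ss_le TS 22 15 2077249990581 (by decide +kernel) (by decide +kernel) (by decide +kernel)
lemma ssTM : |ss TM 64| ≤ ((20897374022:ℕ) + (36:ℕ))/10^15 :=
  ss_le TM 64 36 20897374022 (by decide +kernel) (by decide +kernel) (by decide +kernel)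
set_option maxRecDepth 100000 in
lemma ssTB : |ss TB 580| ≤ ((161456274:ℕ) + (364:ℕ))/10^15 :=
  ss_le TB 580 364 161456274 (by decide +kernel) (by decide +kernel) (by decide +kernel)
lemma saTS : (sabs TS 22 : ℝ) = 15 := by
  have : sabs TS 22 = 15 := by decide +kernel
  rw [this]; norm_num
lemma saTM : (sabs TM 64 : ℝ) = 36 := by
  have : sabs TM 64 = 36 := by decide +kernel
  rw [this]; norm_num
set_option maxRecDepth 100000 in
lemma saTB : (sabs TB 580 : ℝ) = 364 := by
  have : sabs TB 580 = 364 := by decide +kernel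
  rw [this]; norm_num

lemma SB : sabs TS 22 + (2*((128:ℕ):ℝ)+1)*|ss TS 22| ≤ 15.54 := by
  have h := ssTS
  rw [saTS]
  push_cast at h ⊢
  norm_num at h ⊢
  linarith
lemma MB : sabs TM 64 + (2*((1024:ℕ):ℝ)+1)*|ss TM 64| ≤ 36.05 := by
  have h := ssTM
  rw [saTM]
  push_cast at h ⊢
  norm_num at h ⊢
  linarith
lemma BB : sabs TB 580 + (2*((198400:ℕ):ℝ)+1)*|ss TB 580| ≤ 364.07 := by
  have h := ssTB
  rw [saTB]
  push_cast at h ⊢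
  norm_num at h ⊢
  linarith

lemma psS (k : ℕ) (hk : k ≤ 2*128) : |psiZ TS 22 k| ≤ 1000 :=
  psiZ_bd TS 22 128 (by norm_num) 100 (by have := SB; linarith) (by norm_num) k hk
lemma psM (k : ℕ) (hk : k ≤ 2*1024) : |psiZ TM 64 k| ≤ 1000 :=
  psiZ_bd TM 64 1024 (by norm_num) 100 (by have := MB; linarith) (by norm_num) k hk
lemma psB (k : ℕ) (hk : k ≤ 2*198400) : |psiZ TB 580 k| ≤ 1000 :=
  psiZ_bd TB 580 198400 (by norm_num) 200 (by have := BB; linarith) (by norm_num) k hk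

set_option maxRecDepth 100000 in
lemma cS : ∑ i ∈ Ico 0 128, |(psiZ TS 22 (2*i+1) : ℝ)| * (1/(2*(i:ℝ)+1) - 1/(2*(i:ℝ)+3)) ≤ ((45200444829026:ℕ):ℝ)/10^15 :=
  chunk TS 22 0 4 45200444829026 (fun k hk => psS k (le_trans hk (by norm_num))) (by decide +kernel)
set_option maxRecDepth 100000 in
lemma cM : ∑ i ∈ Ico 0 1024, |(psiZ TM 64 (2*i+1) : ℝ)| * (1/(2*(i:ℝ)+1) - 1/(2*(i:ℝ)+3)) ≤ ((20510873784142:ℕ):ℝ)/10^15 :=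
  chunk TM 64 0 7 20510873784142 (fun k hk => psM k (le_trans hk (by norm_num))) (by decide +kernel)
set_option maxRecDepth 100000 in
lemma cB0 : ∑ i ∈ Ico 0 1024, |(psiZ TB 580 (2*i+1) : ℝ)| * (1/(2*(i:ℝ)+1) - 1/(2*(i:ℝ)+3)) ≤ ((2517494009682:ℕ):ℝ)/10^15 :=
  chunk TB 580 0 7 2517494009682 (fun k hk => psB k (le_trans hk (by norm_num))) (by decide +kernel)
set_option maxRecDepth 100000 in
lemma cB1 : ∑ i ∈ Ico 1024 1536, |(psiZ TB 580 (2*i+1) : ℝ)| * (1/(2*(i:ℝ)+1) - 1/(2*(i:ℝ)+3)) ≤ ((619230896251:ℕ):ℝ)/10^15 :=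
  chunk TB 580 1024 6 619230896251 (fun k hk => psB k (le_trans hk (by norm_num))) (by decide +kernel)
set_option maxRecDepth 100000 in
lemma cB2 : ∑ i ∈ Ico 1536 1792, |(psiZ TB 580 (2*i+1) : ℝ)| * (1/(2*(i:ℝ)+1) - 1/(2*(i:ℝ)+3)) ≤ ((328466186530:ℕ):ℝ)/10^15 :=
  chunk TB 580 1536 5 328466186530 (fun k hk => psB k (le_trans hk (by norm_num))) (by decide +kernel)
set_option maxRecDepth 100000 in
lemma cB3 : ∑ i ∈ Ico 1792 18176, |(psiZ TB 580 (2*i+1) : ℝ)| * (1/(2*(i:ℝ)+1) - 1/(2*(i:ℝ)+3)) ≤ ((919384466836:ℕ):ℝ)/10^15 :=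
  chunk TB 580 1792 11 919384466836 (fun k hk => psB k (le_trans hk (by norm_num))) (by decide +kernel)
set_option maxRecDepth 100000 in
lemma cB4 : ∑ i ∈ Ico 18176 34560, |(psiZ TB 580 (2*i+1) : ℝ)| * (1/(2*(i:ℝ)+1) - 1/(2*(i:ℝ)+3)) ≤ ((49341675897:ℕ):ℝ)/10^15 :=
  chunk TB 580 18176 11 49341675897 (fun k hk => psB k (le_trans hk (by norm_num))) (by decide +kernel)
set_option maxRecDepth 100000 in
lemma cB5 : ∑ i ∈ Ico 34560 50944, |(psiZ TB 580 (2*i+1) : ℝ)| * (1/(2*(i:ℝ)+1) - 1/(2*(i:ℝ)+3)) ≤ ((19429641062:ℕ):ℝ)/10^15 :=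
  chunk TB 580 34560 11 19429641062 (fun k hk => psB k (le_trans hk (by norm_num))) (by decide +kernel)
set_option maxRecDepth 100000 in
lemma cB6 : ∑ i ∈ Ico 50944 67328, |(psiZ TB 580 (2*i+1) : ℝ)| * (1/(2*(i:ℝ)+1) - 1/(2*(i:ℝ)+3)) ≤ ((10306676549:ℕ):ℝ)/10^15 :=
  chunk TB 580 50944 11 10306676549 (fun k hk => psB k (le_trans hk (by norm_num))) (by decide +kernel)
set_option maxRecDepth 100000 in
lemma cB7 : ∑ i ∈ Ico 67328 83712, |(psiZ TB 580 (2*i+1) : ℝ)| * (1/(2*(i:ℝ)+1) - 1/(2*(i:ℝ)+3)) ≤ ((5556904769:ℕ):ℝ)/10^15 :=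
  chunk TB 580 67328 11 5556904769 (fun k hk => psB k (le_trans hk (by norm_num))) (by decide +kernel)
set_option maxRecDepth 100000 in
lemma cB8 : ∑ i ∈ Ico 83712 100096, |(psiZ TB 580 (2*i+1) : ℝ)| * (1/(2*(i:ℝ)+1) - 1/(2*(i:ℝ)+3)) ≤ ((3589695583:ℕ):ℝ)/10^15 :=
  chunk TB 580 83712 11 3589695583 (fun k hk => psB k (le_trans hk (by norm_num))) (by decide +kernel)
set_option maxRecDepth 100000 in
lemma cB9 : ∑ i ∈ Ico 100096 116480, |(psiZ TB 580 (2*i+1) : ℝ)| * (1/(2*(i:ℝ)+1) - 1/(2*(i:ℝ)+3)) ≤ ((2880806701:ℕ):ℝ)/10^15 :=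
  chunk TB 580 100096 11 2880806701 (fun k hk => psB k (le_trans hk (by norm_num))) (by decide +kernel)
set_option maxRecDepth 100000 in
lemma cB10 : ∑ i ∈ Ico 116480 132864, |(psiZ TB 580 (2*i+1) : ℝ)| * (1/(2*(i:ℝ)+1) - 1/(2*(i:ℝ)+3)) ≤ ((2099881180:ℕ):ℝ)/10^15 :=
  chunk TB 580 116480 11 2099881180 (fun k hk => psB k (le_trans hk (by norm_num))) (by decide +kernel)
set_option maxRecDepth 100000 in
lemma cB11 : ∑ i ∈ Ico 132864 149248, |(psiZ TB 580 (2*i+1) : ℝ)| * (1/(2*(i:ℝ)+1) - 1/(2*(i:ℝ)+3)) ≤ ((1617831116:ℕ):ℝ)/10^15 :=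
  chunk TB 580 132864 11 1617831116 (fun k hk => psB k (le_trans hk (by norm_num))) (by decide +kernel)
set_option maxRecDepth 100000 in
lemma cB12 : ∑ i ∈ Ico 149248 165632, |(psiZ TB 580 (2*i+1) : ℝ)| * (1/(2*(i:ℝ)+1) - 1/(2*(i:ℝ)+3)) ≤ ((1275211568:ℕ):ℝ)/10^15 :=
  chunk TB 580 149248 11 1275211568 (fun k hk => psB k (le_trans hk (by norm_num))) (by decide +kernel)
set_option maxRecDepth 100000 in
lemma cB13 : ∑ i ∈ Ico 165632 182016, |(psiZ TB 580 (2*i+1) : ℝ)| * (1/(2*(i:ℝ)+1) - 1/(2*(i:ℝ)+3)) ≤ ((1087738885:ℕ):ℝ)/10^15 :=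
  chunk TB 580 165632 11 1087738885 (fun k hk => psB k (le_trans hk (by norm_num))) (by decide +kernel)
set_option maxRecDepth 100000 in
lemma cB14 : ∑ i ∈ Ico 182016 198400, |(psiZ TB 580 (2*i+1) : ℝ)| * (1/(2*(i:ℝ)+1) - 1/(2*(i:ℝ)+3)) ≤ ((916129856:ℕ):ℝ)/10^15 :=
  chunk TB 580 182016 11 916129856 (fun k hk => psB k (le_trans hk (by norm_num))) (by decide +kernel)

set_option maxRecDepth 100000 in
lemma kapB : ∑ i ∈ range 1792, |PPs (tabC TB 580 198400) (198400+1) (i+1) - PPs (tabC TB 580 198400) (198400+1) i|/(2*i+1) + |PPs (tabC TB 580 198400) (198400+1) 1792|/(2*(1792:ℕ)+1) ≤ ((547666474249:ℕ):ℝ)/10^12 :=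
  kappa TB 580 198400 1792 (by norm_num) (by norm_num) psB 547666474249 (by decide +kernel)

lemma cAB : ∑ i ∈ Ico 1792 198400, |(psiZ TB 580 (2*i+1) : ℝ)| * (1/(2*(i:ℝ)+1) - 1/(2*(i:ℝ)+3)) ≤ 0.001017488 := by
  have q4 := cB3
  have q5 := add_le_add q4 cB4
  rw [Finset.sum_Ico_consecutive _ (by norm_num) (by norm_num)] at q5
  have q6 := add_le_add q5 cB5
  rw [Finset.sum_Ico_consecutive _ (by norm_num) (by norm_num)] at q6
  have q7 := add_le_add q6 cB6
  rw [Finset.sum_Ico_consecutive _ (by norm_num) (by norm_num)] at q7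
  have q8 := add_le_add q7 cB7
  rw [Finset.sum_Ico_consecutive _ (by norm_num) (by norm_num)] at q8
  have q9 := add_le_add q8 cB8
  rw [Finset.sum_Ico_consecutive _ (by norm_num) (by norm_num)] at q9
  have q10 := add_le_add q9 cB9
  rw [Finset.sum_Ico_consecutive _ (by norm_num) (by norm_num)] at q10
  have q11 := add_le_add q10 cB10
  rw [Finset.sum_Ico_consecutive _ (by norm_num) (by norm_num)] at q11
  have q12 := add_le_add q11 cB11
  rw [Finset.sum_Ico_consecutive _ (by norm_num) (by norm_num)] at q12
  have q13 := add_le_add q12 cB12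
  rw [Finset.sum_Ico_consecutive _ (by norm_num) (by norm_num)] at q13
  have q14 := add_le_add q13 cB13
  rw [Finset.sum_Ico_consecutive _ (by norm_num) (by norm_num)] at q14
  have q15 := add_le_add q14 cB14
  rw [Finset.sum_Ico_consecutive _ (by norm_num) (by norm_num)] at q15
  refine q15.trans ?_
  norm_num
lemma cA0 : ∑ i ∈ Ico 0 198400, |(psiZ TB 580 (2*i+1) : ℝ)| * (1/(2*(i:ℝ)+1) - 1/(2*(i:ℝ)+3)) ≤ 0.004482681 := by
  have q1 := cB0
  have q2 := add_le_add q1 cB1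
  rw [Finset.sum_Ico_consecutive _ (by norm_num) (by norm_num)] at q2
  have q3 := add_le_add q2 cB2
  rw [Finset.sum_Ico_consecutive _ (by norm_num) (by norm_num)] at q3
  have q4 := add_le_add q3 cAB
  rw [Finset.sum_Ico_consecutive _ (by norm_num) (by norm_num)] at q4
  refine q4.trans ?_
  norm_num

lemma sqY (Y : ℝ) (hY : 0 < Y) : √(Y^2) = Y := Real.sqrt_sq hY.le

lemma stage0 (T n e : ℕ) (hn : n ≤ e) (C2 A : ℝ)
    (hC2 : sabs T n + (2*(e:ℝ)+1)*|ss T n| ≤ C2)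
    (hA : ∑ i ∈ Ico 0 e, |(psiZ T n (2*i+1) : ℝ)| * (1/(2*(i:ℝ)+1) - 1/(2*(i:ℝ)+3)) ≤ A)
    (Y δ' : ℝ) (hY : 0 < Y)
    (h' : A/2 + (1+C2/2)/(2*(2*e+1)) + ((1+C2/2)*((e:ℝ)+2))/Y^2 + C2/(2*Y) ≤ δ') (x : ℝ) (hx : Y^2 + 1 ≤ x) :
    |Lo x| ≤ δ'*x := by
  refine stage T n e 0 hn (Nat.zero_le _) (1+C2/2) C2 (by linarith) hC2 0 A (by simp [PPs]) hA 1 (Y^2) δ' (by norm_num) (by positivity) ?_ ?_ x hx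
  · intro x hx
    rw [one_mul]
    refine Lo_abs_le x ?_
    push_cast at hx
    nlinarith [sq_nonneg Y]
  · rw [sqY Y hY]
    push_cast
    simpa using h'

lemma LoS (x : ℝ) (hx : 315^2 + 1 ≤ x) : |Lo x| ≤ 0.0761*x :=
  stage0 TS 22 128 (by norm_num) 15.54 _ SB cS 315 0.0761 (by norm_num) (by norm_num) x hx
lemma LoM (x : ℝ) (hx : 3000^2 + 1 ≤ x) : |Lo x| ≤ 0.0232*x :=
  stage0 TM 64 1024 (by norm_num) 36.05 _ MB cM 3000 0.0232 (by norm_num) (by norm_num) x hx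
lemma LoB (x : ℝ) (hx : 1205000^2 + 1 ≤ x) : |Lo x| ≤ 0.00265*x :=
  stage0 TB 580 198400 (by norm_num) 364.07 _ BB cA0 1205000 0.00265 (by norm_num) (by norm_num) x hx

lemma boot (Y δ δ' : ℝ) (hY : 10^6 ≤ Y) (hδ : 0 ≤ δ) (h : ∀ x, Y^2+1 ≤ x → |Lo x| ≤ δ*x)
    (hd : 0.547667*δ + 0.0007425 ≤ δ') (x : ℝ) (hx : (60*Y)^2+1 ≤ x) : |Lo x| ≤ δ'*x := by
  have hY0 : 0 < Y := by linarith
  have hY2 : (10:ℝ)^12 ≤ Y^2 := by nlinarith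
  refine stage TB 580 198400 1792 (by norm_num) (by norm_num) 183.035 364.07 (by have := BB; linarith) BB _ _ kapB cAB δ ((60*Y)^2) δ' hδ (by positivity) ?_ ?_ x hx
  · intro z hz
    apply h
    push_cast at hz
    nlinarith
  · rw [sqY (60*Y) (by positivity)]
    have h1 : (183.035*(((198400:ℕ):ℝ)-(1792:ℕ)+2))/(60*Y)^2 ≤ 0.00000002 := by
      rw [div_le_iff₀ (by positivity)]
      push_cast
      nlinarith
    have h2 : 364.07/(2*(60*Y)) ≤ (0.00000304:ℝ) := by
      rw [div_le_iff₀ (by positivity)]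
      nlinarith
    have h3 : (183.035:ℝ)/(2*(2*((198400:ℕ):ℝ)+1)) ≤ 0.00023065 := by
      push_cast
      norm_num
    have h4 : ((547666474249:ℕ):ℝ)/10^12*δ ≤ 0.547667*δ := by
      refine mul_le_mul_of_nonneg_right ?_ hδ
      push_cast; norm_num
    linarith

lemma LoF (x : ℝ) (hx : (1205000*60^7)^2 + 1 ≤ x) : |Lo x| ≤ 0.00166*x := by
  have b1 := boot 1205000 0.00265 0.002195 (by norm_num) (by norm_num) LoB (by norm_num)
  have b2 := boot _ 0.002195 0.001946 (by norm_num) (by norm_num) b1 (by norm_num)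
  have b3 := boot _ 0.001946 0.00181 (by norm_num) (by norm_num) b2 (by norm_num)
  have b4 := boot _ 0.00181 0.001735 (by norm_num) (by norm_num) b3 (by norm_num)
  have b5 := boot _ 0.001735 0.001694 (by norm_num) (by norm_num) b4 (by norm_num)
  have b6 := boot _ 0.001694 0.001672 (by norm_num) (by norm_num) b5 (by norm_num)
  have b7 := boot _ 0.001672 0.00166 (by norm_num) (by norm_num) b6 (by norm_num)
  refine b7 x (le_trans (le_of_eq ?_) hx)
  norm_num

noncomputable def kA : ArithmeticFunction ℝ := ⟨fun n => if Odd n then (-2)^(cardFactors n) else 0, by simp⟩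
noncomputable def mA : ArithmeticFunction ℝ := ⟨fun n => if Odd n ∧ Squarefree n then 1 else 0, by simp⟩
lemma kA_apply (n : ℕ) : kA n = if Odd n then (-2)^(cardFactors n) else 0 := rfl
lemma mA_apply (n : ℕ) : mA n = if Odd n ∧ Squarefree n then 1 else 0 := rfl

lemma kA_mult : kA.IsMultiplicative := by
  refine ⟨by simp [kA_apply], fun {m n} _ => ?_⟩
  simp only [kA_apply, Nat.odd_mul]
  by_cases h1 : Odd m <;> by_cases h2 : Odd n <;> simp only [h1, h2, if_true, if_false, and_self, and_true, and_false, mul_zero, zero_mul]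
  rw [cardFactors_mul (by rintro rfl; simp at h1) (by rintro rfl; simp at h2), pow_add]

lemma mA_mult : mA.IsMultiplicative := by
  refine ⟨by simp [mA_apply], fun {m n} h => ?_⟩
  simp only [mA_apply, Nat.odd_mul, Nat.squarefree_mul h]
  by_cases h1 : Odd m <;> by_cases h2 : Odd n <;> by_cases h3 : Squarefree m <;> by_cases h4 : Squarefree n <;> simp [h1, h2, h3, h4]

lemma mA_one : mA 1 = 1 := mA_mult.1
lemma mA_two (k : ℕ) : mA (2^(k+1)) = 0 := by
  rw [mA_apply, if_neg]; intro h; exact two_pp_even k h.1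
lemma mA_p (p : ℕ) (hp : p.Prime) (h2 : p ≠ 2) : mA p = 1 := by
  rw [mA_apply, if_pos ⟨hp.odd_of_ne_two h2, hp.squarefree⟩]
lemma mA_pp (p k : ℕ) (hp : p.Prime) : mA (p^(k+2)) = 0 := by
  rw [mA_apply, if_neg]
  rintro ⟨_, h⟩
  have := h p ⟨p^k, by ring⟩
  exact hp.one_lt.ne' (Nat.isUnit_iff.mp this)

lemma mul_mA_two (f : ArithmeticFunction ℝ) (k : ℕ) : (f * mA) (2^k) = f (2^k) := by
  rw [mul_pp _ _ _ _ Nat.prime_two, Finset.sum_range_succ, Finset.sum_eq_zero, Nat.sub_self, pow_zero, mA_one, zero_add, mul_one]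
  intro i hi
  rw [mem_range] at hi
  rw [show k - i = (k-i-1)+1 by omega, mA_two, mul_zero]

lemma mul_mA_pp (f : ArithmeticFunction ℝ) (p k : ℕ) (hp : p.Prime) (h2 : p ≠ 2) :
    (f * mA) (p^(k+1)) = f (p^(k+1)) + f (p^k) := by
  rw [mul_pp _ _ _ _ hp, Finset.sum_range_succ, Finset.sum_range_succ, Finset.sum_eq_zero, Nat.sub_self, pow_zero, mA_one, zero_add, mul_one,
    show k+1-k = 1 by omega, pow_one, mA_p p hp h2, mul_one, add_comm]
  intro i hi
  rw [mem_range] at hi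
  rw [show k + 1 - i = (k-i-1)+2 by omega, mA_pp p _ hp, mul_zero]

lemma lo_mul_m : loA * mA = 1 := by
  rw [(loA_mult.mul mA_mult).eq_iff_eq_on_prime_powers _ _ isMultiplicative_one]
  intro p k hp
  rcases k with _ | k
  · simp [loA_apply, lo_one, mA_one]
  · rw [one_apply_ne (Nat.one_lt_pow (by omega) hp.one_lt).ne']
    by_cases h2 : p = 2
    · subst h2
      rw [mul_mA_two, loA_apply, lo_even _ (two_pp_even k)]
    · rw [mul_mA_pp _ _ _ hp h2, loA_apply, loA_apply, lo_pp _ _ hp h2, lo_pp _ _ hp h2, pow_succ]; ring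

noncomputable def hA : ArithmeticFunction ℝ := kA * mA * mA
lemma hA_mult : hA.IsMultiplicative := (kA_mult.mul mA_mult).mul mA_mult
lemma kA_eq : kA = hA * (loA * loA) := by
  have : hA * (loA * loA) = kA * (loA * mA) * (loA * mA) := by unfold hA; ring
  rw [this, lo_mul_m, mul_one, mul_one]

lemma kA_pp (p k : ℕ) (hp : p.Prime) (h2 : p ≠ 2) : kA (p^k) = (-2)^k := by
  rw [kA_apply, if_pos (odd_pp p k hp h2), cardFactors_apply_prime_pow hp]

lemma hA_two (k : ℕ) : hA (2^(k+1)) = 0 := by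
  rw [hA, mul_mA_two, mul_mA_two, kA_apply, if_neg (two_pp_even k)]
lemma hA_p (p : ℕ) (hp : p.Prime) (h2 : p ≠ 2) : hA (p^1) = 0 := by
  rw [hA, show (1:ℕ) = 0+1 by rfl, mul_mA_pp _ _ _ hp h2, mul_mA_pp _ _ _ hp h2, pow_zero, zero_add, (kA_mult.mul mA_mult).1, kA_mult.1,
    kA_pp _ _ hp h2]; norm_num
lemma hA_pp (p k : ℕ) (hp : p.Prime) (h2 : p ≠ 2) : hA (p^(k+2)) = (-2)^k := by
  rw [hA, show k+2 = (k+1)+1 by rfl, mul_mA_pp _ _ _ hp h2, mul_mA_pp _ _ _ hp h2, mul_mA_pp _ _ _ hp h2,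
    kA_pp _ _ hp h2, kA_pp _ _ hp h2, kA_pp _ _ hp h2]
  ring

noncomputable def hf (n : ℕ) : ℝ := |hA n|/n
lemma hf_one : hf 1 = 1 := by simp [hf, hA_mult.1]
lemma hf_mul {m n : ℕ} (h : m.Coprime n) : hf (m*n) = hf m * hf n := by
  unfold hf
  rw [hA_mult.2 h, abs_mul, Nat.cast_mul, mul_div_mul_comm]
lemma hf_two (k : ℕ) : hf (2^(k+1)) = 0 := by rw [hf, hA_two]; simp
lemma hf_p (p : ℕ) (hp : p.Prime) (h2 : p ≠ 2) : hf (p^1) = 0 := by rw [hf, hA_p p hp h2]; simp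
lemma hf_pp (p k : ℕ) (hp : p.Prime) (h2 : p ≠ 2) : hf (p^(k+2)) = (1/p^2)*(2/p:ℝ)^k := by
  rw [hf, hA_pp p k hp h2, abs_pow, abs_neg, abs_two]
  have : (p:ℝ) ≠ 0 := by exact_mod_cast hp.ne_zero
  push_cast
  rw [div_pow, pow_add]
  field_simp

lemma hasSum_congr_val {f : ℕ → ℝ} {a b : ℝ} (h : HasSum f a) (e : b = a) : HasSum f b := e ▸ h
lemma hf_sum (p : ℕ) (hp : p.Prime) (h2 : p ≠ 2) : HasSum (fun n => hf (p^n)) (1 + 1/(p*(p-2))) := by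
  have h3 : 3 ≤ p := by have := hp.two_le; omega
  have h3' : (3:ℝ) ≤ p := by exact_mod_cast h3
  rw [← hasSum_nat_add_iff' 2]
  have hg := (hasSum_geometric_of_lt_one (r := (2/p:ℝ)) (by positivity) (by rw [div_lt_one (by linarith)]; linarith)).mul_left (1/(p:ℝ)^2)
  simp only [hf_pp p _ hp h2]
  refine (hasSum_congr_val hg ?_)
  rw [Finset.sum_range_succ, Finset.sum_range_one, pow_zero, hf_one, hf_p p hp h2]
  have : (p:ℝ) - 2 ≠ 0 := by intro h; linarith
  have : (p:ℝ) ≠ 0 := by intro h; linarith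
  field_simp
  ring
lemma hf_sum2 : HasSum (fun n => hf (2^n)) 1 := by
  have := hasSum_single (f := fun n => hf (2^n)) 0 (by
    intro n hn
    rw [show n = (n-1)+1 by omega]; exact hf_two _)
  rwa [pow_zero, hf_one] at this
lemma hf_nonneg (n : ℕ) : 0 ≤ hf n := by unfold hf; positivity

noncomputable def g17 (i : ℕ) : ℝ := 1/(2*(2*(i:ℝ)+15)) - 1/(2*(2*(i:ℝ)+17))
lemma g17_sum (N : ℕ) : ∑ i ∈ range N, g17 i ≤ 1/30 := by
  have : ∑ i ∈ range N, g17 i = 1/30 - 1/(2*(2*(N:ℝ)+15)) := by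
    induction N with
    | zero => norm_num
    | succ N ih => rw [Finset.sum_range_succ, ih, g17]; push_cast; ring_nf
  rw [this]
  have : 0 ≤ 1/(2*(2*(N:ℝ)+15)) := by positivity
  linarith

lemma hf_tail (N : ℕ) : ∏ p ∈ N.primesBelow.filter (fun p => ¬ p < 17), (∑' n, hf (p^n)) ≤ 1.035 := by
  have h1 : ∀ p ∈ N.primesBelow.filter (fun p => ¬ p < 17), (∑' n, hf (p^n)) ≤ Real.exp (1/((p:ℝ)*(p-2))) := by
    intro p hp
    rw [mem_filter, Nat.mem_primesBelow] at hp
    rw [(hf_sum p hp.1.2 (by omega)).tsum_eq, add_comm]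
    exact Real.add_one_le_exp _
  refine (Finset.prod_le_prod (fun p _ => tsum_nonneg fun n => hf_nonneg _) h1).trans ?_
  rw [← Real.exp_sum]
  have h2 : ∑ p ∈ N.primesBelow.filter (fun p => ¬ p < 17), 1/((p:ℝ)*(p-2)) ≤ ∑ i ∈ range N, g17 i := by
    have e : ∑ p ∈ N.primesBelow.filter (fun p => ¬ p < 17), 1/((p:ℝ)*(p-2)) = ∑ i ∈ (N.primesBelow.filter (fun p => ¬ p < 17)).image (fun p => (p-17)/2), g17 i := by
      rw [Finset.sum_image]
      · refine Finset.sum_congr rfl fun p hp => ?_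
        rw [mem_filter, Nat.mem_primesBelow] at hp
        obtain ⟨r, hr⟩ := hp.1.2.odd_of_ne_two (by omega)
        obtain ⟨s, rfl⟩ : ∃ s, r = s + 8 := ⟨r-8, by omega⟩
        subst hr
        rw [show (2*(s+8)+1-17)/2 = s by omega, g17]
        push_cast
        have e1 : (2*((s:ℝ)+8)+1-2) = 2*s+15 := by ring
        have e2 : (2*((s:ℝ)+8)+1) = 2*s+17 := by ring
        rw [e1, e2]
        field_simp
        ring
      · intro p hp q hq h
        have hp' := Finset.mem_coe.mp hp
        have hq' := Finset.mem_coe.mp hq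
        rw [mem_filter, Nat.mem_primesBelow] at hp' hq'
        obtain ⟨r, hr⟩ := hp'.1.2.odd_of_ne_two (by omega)
        obtain ⟨s, hs⟩ := hq'.1.2.odd_of_ne_two (by omega)
        simp only at h
        omega
    rw [e]
    refine Finset.sum_le_sum_of_subset_of_nonneg ?_ ?_
    · intro i hi
      rw [mem_image] at hi
      obtain ⟨p, hp, rfl⟩ := hi
      rw [mem_filter, Nat.mem_primesBelow] at hp
      rw [mem_range]; omega
    · intro i _ _
      rw [g17, sub_nonneg]
      apply one_div_le_one_div_of_le <;> nlinarith [Nat.cast_nonneg (α := ℝ) i]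
  have h3 := h2.trans (g17_sum N)
  have h4 := Real.exp_bound_div_one_sub_of_interval (x := 1/30) (by norm_num) (by norm_num)
  refine (Real.exp_le_exp.mpr h3).trans (h4.trans ?_)
  norm_num

lemma h_sum (N : ℕ) : ∑ n ∈ Ioc 0 N, |hA n|/n ≤ 1.541 := by
  have hs : ∀ {p : ℕ}, p.Prime → Summable (fun n : ℕ ↦ ‖hf (p ^ n)‖) := by
    intro p hp
    simp only [Real.norm_of_nonneg (hf_nonneg _)]
    by_cases h2 : p = 2
    · subst h2; exact hf_sum2.summable
    · exact (hf_sum p hp h2).summable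
  obtain ⟨h1, h2⟩ := EulerProduct.summable_and_hasSum_smoothNumbers_prod_primesBelow_tsum hf_one hf_mul hs (N+17)
  have h3 : ∑ n ∈ Ioc 0 N, hf n ≤ ∏ p ∈ (N+17).primesBelow, ∑' n : ℕ, hf (p ^ n) := by
    have hmem : ∀ n ∈ Ioc 0 N, n ∈ (N+17).smoothNumbers := by
      intro n hn
      rw [mem_Ioc] at hn
      exact Nat.mem_smoothNumbers_of_lt hn.1 (by omega)
    have := sum_le_hasSum ((Ioc 0 N).attach.image fun n => (⟨n.1, hmem n.1 n.2⟩ : (N+17).smoothNumbers)) (fun i _ => hf_nonneg _) h2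
    rw [Finset.sum_image] at this
    · rwa [Finset.sum_attach (Ioc 0 N) hf] at this
    · intro a _ b _ h
      simp only [Subtype.mk.injEq] at h
      exact Subtype.ext h
  refine h3.trans ?_
  rw [← Finset.prod_filter_mul_prod_filter_not _ (fun p => p < 17)]
  have e : (N+17).primesBelow.filter (fun p => p < 17) = {2,3,5,7,11,13} := by
    have : (N+17).primesBelow.filter (fun p => p < 17) = Nat.primesBelow 17 := by
      ext p
      simp only [mem_filter, Nat.mem_primesBelow]
      constructor
      · rintro ⟨⟨_, h⟩, h'⟩; exact ⟨h', h⟩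
      · rintro ⟨h', h⟩; exact ⟨⟨by omega, h⟩, h'⟩
    rw [this]; decide
  rw [e]
  have t := hf_tail (N+17)
  rw [Finset.prod_insert (by decide), Finset.prod_insert (by decide), Finset.prod_insert (by decide), Finset.prod_insert (by decide),
    Finset.prod_insert (by decide), Finset.prod_singleton, hf_sum2.tsum_eq, (hf_sum 3 (by norm_num) (by norm_num)).tsum_eq,
    (hf_sum 5 (by norm_num) (by norm_num)).tsum_eq, (hf_sum 7 (by norm_num) (by norm_num)).tsum_eq,
    (hf_sum 11 (by norm_num) (by norm_num)).tsum_eq, (hf_sum 13 (by norm_num) (by norm_num)).tsum_eq]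
  refine (mul_le_mul_of_nonneg_left t (by norm_num)).trans ?_
  norm_num

noncomputable def L2 (y : ℝ) : ℝ := ∑ n ∈ Ioc 0 ⌊y⌋₊, (loA * loA) n
noncomputable def Gs (y : ℝ) : ℝ := ∑ n ∈ Ioc 0 ⌊y⌋₊, kA n

lemma W_Ioc (x : ℝ) : W x = ∑ n ∈ Ioc 0 ⌊x⌋₊, (-2:ℝ)^(cardFactors n) := rfl

lemma w_split (N : ℕ) : ∑ n ∈ Ioc 0 N, (-2:ℝ)^(cardFactors n) = ∑ n ∈ Ioc 0 N, kA n - 2 * ∑ n ∈ Ioc 0 (N/2), (-2:ℝ)^(cardFactors n) := by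
  induction N with
  | zero => simp
  | succ N ih =>
    rw [Finset.sum_Ioc_succ_top (by omega), Finset.sum_Ioc_succ_top (by omega), ih, kA_apply]
    by_cases h : Odd (N+1)
    · rw [if_pos h]
      have : (N+1)/2 = N/2 := by obtain ⟨r, hr⟩ := h; omega
      rw [this]; ring
    · rw [if_neg h]
      rw [Nat.not_odd_iff_even] at h
      obtain ⟨r, hr⟩ := h
      have e1 : (N+1)/2 = N/2+1 := by omega
      rw [e1, Finset.sum_Ioc_succ_top (by omega)]
      have e2 : N+1 = 2*(N/2+1) := by omega
      have e3 : cardFactors (N+1) = 1 + cardFactors (N/2+1) := by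
        conv_lhs => rw [e2]
        rw [cardFactors_mul (by norm_num) (by omega), cardFactors_apply_prime Nat.prime_two]
      rw [e3, pow_add, pow_one]; ring

lemma W_split (x : ℝ) : W x = Gs x - 2 * W (x/2) := by
  rw [W_Ioc, W_Ioc, Gs, w_split]
  have : ⌊x/2⌋₊ = ⌊x⌋₊/2 := Nat.floor_div_ofNat x 2
  rw [this]

lemma W_iter (x : ℝ) (J : ℕ) : |W x| ≤ ∑ j ∈ range J, 2^j*|Gs (x/2^j)| + 2^J*|W (x/2^J)| := by
  induction J with
  | zero => simp
  | succ J ih =>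
    rw [Finset.sum_range_succ]
    have e := W_split (x/2^J)
    have e2 : x/2^J/2 = x/2^(J+1) := by rw [pow_succ, div_div]
    rw [e2] at e
    have : |W (x/2^J)| ≤ |Gs (x/2^J)| + 2*|W (x/2^(J+1))| := by
      rw [e]
      refine (abs_sub _ _).trans ?_
      rw [abs_mul, abs_two]
    have h2 : (2:ℝ)^J*|W (x/2^J)| ≤ 2^J*(|Gs (x/2^J)| + 2*|W (x/2^(J+1))|) := mul_le_mul_of_nonneg_left this (by positivity)
    have e3 : ∀ w : ℝ, (2:ℝ)^(J+1) * w = 2^J*(2*w) := fun w => by rw [pow_succ]; ring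
    rw [e3]
    linarith

lemma Gs_eq (y : ℝ) : Gs y = ∑ n ∈ Ioc 0 ⌊y⌋₊, hA n * L2 (y/n) := by
  rw [Gs, kA_eq, ArithmeticFunction.sum_Ioc_mul_eq_sum_sum]
  refine Finset.sum_congr rfl fun n _ => ?_
  rw [L2, Nat.floor_div_natCast]

lemma W_red (C : ℝ) (hC : ∀ y : ℝ, 0 < y → ∀ J : ℕ, ∑ j ∈ range J, 2^j*|L2 (y/2^j)| ≤ C*y) (x : ℝ) (hx : 0 < x) :
    |W x| ≤ 1.541*C*x := by
  obtain ⟨J, hJ⟩ := pow_unbounded_of_one_lt x (one_lt_two)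
  have h := W_iter x J
  have h0 : W (x/2^J) = 0 := by
    have : ⌊x/2^J⌋₊ = 0 := by rw [Nat.floor_eq_zero, div_lt_one (by positivity)]; exact hJ
    rw [W_Ioc, this]; simp
  rw [h0, abs_zero, mul_zero, add_zero] at h
  refine h.trans ?_
  have C0 : 0 ≤ C := by have := hC 1 one_pos 0; simpa using this
  have step : ∀ j, (2:ℝ)^j*|Gs (x/2^j)| ≤ ∑ n ∈ Ioc 0 ⌊x⌋₊, |hA n| * (2^j*|L2 (x/n/2^j)|) := by
    intro j
    rw [Gs_eq]
    have hsub : Ioc 0 ⌊x/2^j⌋₊ ⊆ Ioc 0 ⌊x⌋₊ := by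
      refine Finset.Ioc_subset_Ioc le_rfl (Nat.floor_le_floor ?_)
      exact div_le_self hx.le (one_le_pow₀ one_le_two)
    calc (2:ℝ)^j*|∑ n ∈ Ioc 0 ⌊x/2^j⌋₊, hA n * L2 (x/2^j/n)| ≤ 2^j * ∑ n ∈ Ioc 0 ⌊x/2^j⌋₊, |hA n * L2 (x/2^j/n)| := by
          gcongr; exact Finset.abs_sum_le_sum_abs _ _
      _ = ∑ n ∈ Ioc 0 ⌊x/2^j⌋₊, |hA n| * (2^j*|L2 (x/n/2^j)|) := by
          rw [Finset.mul_sum]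
          refine Finset.sum_congr rfl fun n _ => ?_
          rw [abs_mul, div_right_comm]; ring
      _ ≤ _ := Finset.sum_le_sum_of_subset_of_nonneg hsub fun _ _ _ => by positivity
  refine (Finset.sum_le_sum fun j _ => step j).trans ?_
  rw [Finset.sum_comm]
  have : ∀ n ∈ Ioc 0 ⌊x⌋₊, ∑ j ∈ range J, |hA n| * (2^j*|L2 (x/n/2^j)|) ≤ (|hA n|/n)*(C*x) := by
    intro n hn
    rw [mem_Ioc] at hn
    have hn0 : (0:ℝ) < n := by exact_mod_cast hn.1
    rw [← Finset.mul_sum]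
    refine (mul_le_mul_of_nonneg_left (hC (x/n) (by positivity) J) (abs_nonneg _)).trans (le_of_eq ?_)
    field_simp
  refine (Finset.sum_le_sum this).trans ?_
  rw [← Finset.sum_mul, mul_assoc]
  exact mul_le_mul_of_nonneg_right (h_sum _) (by positivity)

/-- hyperbola method -/
lemma hyp (z : ℝ) (hz : 0 ≤ z) : L2 z = 2 * ∑ a ∈ Ioc 0 ⌊√z⌋₊, lo a * Lo (z/a) - (Lo (√z))^2 := by
  set N := ⌊z⌋₊ with hN
  set r := ⌊√z⌋₊ with hr
  have hrr : ∀ a : ℕ, a ≤ r ↔ a*a ≤ N := by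
    intro a
    rw [hr, hN, Nat.le_floor_iff (Real.sqrt_nonneg _), Nat.le_floor_iff hz, Real.le_sqrt (by positivity) hz, pow_two]
    push_cast; rfl
  have hrN : r ≤ N := by
    have := (hrr r).1 le_rfl
    nlinarith
  have e0 : L2 z = ∑ a ∈ Ioc 0 N, ∑ b ∈ Ioc 0 N, if a*b ≤ N then lo a * lo b else 0 := by
    rw [L2, ArithmeticFunction.sum_Ioc_mul_eq_sum_prod_filter, Finset.sum_filter, Finset.sum_product]
    simp only [loA_apply]
    rfl
  have e1 : ∀ a b : ℕ, (if a*b ≤ N then lo a * lo b else 0) = (if a ≤ r then (if a*b ≤ N then lo a*lo b else 0) else 0)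
      + (if b ≤ r then (if b*a ≤ N then lo b*lo a else 0) else 0) - (if a ≤ r then lo a else 0)*(if b ≤ r then lo b else 0) := by
    intro a b
    rw [mul_comm b a, mul_comm (lo b) (lo a)]
    by_cases ha : a ≤ r <;> by_cases hb : b ≤ r
    · have : a*b ≤ N := (Nat.mul_le_mul ha hb).trans ((hrr r).1 le_rfl)
      simp [ha, hb, this]
    · simp [ha, hb]
    · simp [ha, hb]
    · have : ¬ a*b ≤ N := by
        intro h
        rcases le_total a b with h1 | h1
        · exact ha ((hrr a).2 ((Nat.mul_le_mul_left a h1).trans h))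
        · exact hb ((hrr b).2 ((Nat.mul_le_mul_right b h1).trans h))
      simp [ha, hb, this]
  have e2 : ∑ a ∈ Ioc 0 N, (if a ≤ r then lo a else 0) = Lo (√z) := by
    rw [← Finset.sum_filter]
    have : (Ioc 0 N).filter (· ≤ r) = Icc 1 r := by ext a; simp only [mem_filter, mem_Ioc, mem_Icc]; omega
    rw [this]; rfl
  have e3 : ∑ a ∈ Ioc 0 N, ∑ b ∈ Ioc 0 N, (if a ≤ r then (if a*b ≤ N then lo a*lo b else 0) else 0) = ∑ a ∈ Ioc 0 r, lo a * Lo (z/a) := by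
    have : Ioc 0 r = (Ioc 0 N).filter (· ≤ r) := by ext a; simp only [mem_filter, mem_Ioc]; omega
    rw [this, Finset.sum_filter]
    refine Finset.sum_congr rfl fun a ha => ?_
    rw [mem_Ioc] at ha
    split_ifs with h
    · rw [Lo, Nat.floor_div_natCast, ← hN, Finset.mul_sum, ← Finset.sum_filter]
      refine Finset.sum_congr ?_ fun _ _ => rfl
      ext b
      simp only [mem_filter, mem_Ioc, mem_Icc]
      rw [Nat.le_div_iff_mul_le ha.1, mul_comm b a]
      constructor
      · rintro ⟨⟨h1,h2⟩,h3⟩; exact ⟨h1, h3⟩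
      · rintro ⟨h1,h3⟩; refine ⟨⟨h1, ?_⟩, h3⟩; nlinarith
    · simp
  rw [e0, Finset.sum_congr rfl fun a _ => Finset.sum_congr rfl fun b _ => e1 a b]
  simp_rw [Finset.sum_sub_distrib, Finset.sum_add_distrib]
  rw [e3, ← Finset.sum_mul_sum, e2, Finset.sum_comm, e3]
  ring

/-- normalised summatory function in logarithmic scale -/
noncomputable def lv (v : ℝ) : ℝ := |Lo (Real.exp v)| * Real.exp (-v)

lemma lv_nonneg (v : ℝ) : 0 ≤ lv v := by unfold lv; positivity
lemma lv_meas : Measurable lv := by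
  unfold lv
  have := Lo_measurable.comp Real.measurable_exp
  exact (this.abs).mul (Real.measurable_exp.comp measurable_neg)
lemma lv_le_of (v c : ℝ) (h : |Lo (Real.exp v)| ≤ c * Real.exp v) : lv v ≤ c := by
  unfold lv
  calc _ ≤ c * Real.exp v * Real.exp (-v) := by gcongr
    _ = c := by rw [mul_assoc, ← Real.exp_add]; simp
lemma lv_one (v : ℝ) : lv v ≤ 1 := lv_le_of v 1 (by simpa using Lo_abs_le _ (Real.exp_pos v).le)
lemma lv_intble (a b : ℝ) : IntervalIntegrable lv volume a b := by
  refine (intervalIntegrable_const (c := (1:ℝ))).mono_fun' lv_meas.aestronglyMeasurable ?_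
  refine Filter.Eventually.of_forall fun v => ?_
  show ‖lv v‖ ≤ 1
  rw [Real.norm_eq_abs, abs_of_nonneg (lv_nonneg v)]; exact lv_one v
lemma Lo_lv (x : ℝ) (hx : 0 < x) : |Lo x| = lv (Real.log x) * x := by
  unfold lv
  rw [Real.exp_log hx, mul_assoc, Real.exp_neg, Real.exp_log hx, inv_mul_cancel₀ hx.ne', mul_one]

lemma lo_sum_odd (g : ℕ → ℝ) (r : ℕ) : |∑ a ∈ Ioc 0 r, lo a * g a| ≤ ∑ k ∈ range ((r+1)/2), |g (2*k+1)| := by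
  induction r with
  | zero => simp
  | succ r ih =>
    rw [Finset.sum_Ioc_succ_top (by omega)]
    refine (abs_add_le _ _).trans ?_
    rcases Nat.even_or_odd (r+1) with h | h
    · rw [lo_even _ (Nat.not_odd_iff_even.2 h)]
      have : (r+1+1)/2 = (r+1)/2 := by obtain ⟨q, hq⟩ := h; omega
      rw [this]; simpa using ih
    · obtain ⟨q, hq⟩ := h
      have e1 : (r+1+1)/2 = (r+1)/2+1 := by omega
      have e2 : 2*((r+1)/2)+1 = r+1 := by omega
      rw [e1, Finset.sum_range_succ, e2]
      have : |lo (r+1) * g (r+1)| ≤ |g (r+1)| := by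
        rw [abs_mul]; exact mul_le_of_le_one_left (abs_nonneg _) (lo_abs_le _)
      linarith

lemma piece (z : ℝ) (hz : 0 < z) (k : ℕ) (hk : 1 ≤ k) :
    2*|Lo (z/((2*k+1:ℕ):ℝ))| ≤ z * (∫ v in (Real.log z - Real.log (2*((k+1:ℕ):ℝ)))..(Real.log z - Real.log (2*(k:ℝ))), lv v)
      + (z/((2*k+1)*(2*k)) + 2) := by
  have hk1 : (1:ℝ) ≤ k := by exact_mod_cast hk
  set c1 := Real.log z - Real.log (2*((k+1:ℕ):ℝ)) with hc1
  set c2 := Real.log z - Real.log (2*(k:ℝ)) with hc2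
  push_cast at hc1 ⊢
  have hc : c1 ≤ c2 := by
    have := Real.log_le_log (show (0:ℝ) < 2*k by positivity) (show (2*k:ℝ) ≤ 2*(k+1) by linarith)
    rw [hc1, hc2]; linarith
  have E2 : z*Real.exp (-c2) = 2*k := by
    rw [hc2, neg_sub, Real.exp_sub, Real.exp_log hz, Real.exp_log (by positivity)]; field_simp
  have E1 : z*Real.exp (-c1) = 2*(k+1) := by
    rw [hc1, neg_sub, Real.exp_sub, Real.exp_log hz, Real.exp_log (by positivity)]; field_simp
  have hI : ∫ v in c1..c2, z*Real.exp (-v) = 2 := by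
    rw [intervalIntegral.integral_const_mul]
    have : ∫ v in c1..c2, Real.exp (-v) = Real.exp (-c1) - Real.exp (-c2) := by
      rw [intervalIntegral.integral_comp_neg (fun v => Real.exp v), integral_exp]
    rw [this, mul_sub, E1, E2]; ring
  set Ea := z/(2*((2*k+1)*(2*k)))+1 with hEa
  have key : ∀ v ∈ Set.Icc c1 c2, |Lo (z/(2*k+1))| * (z*Real.exp (-v)) ≤ z*lv v + Ea*(z*Real.exp (-v)) := by
    intro v hv
    set b := z*Real.exp (-v) with hb
    have hb0 : 0 < b := by positivity
    have hb1 : 2*k ≤ b := by rw [← E2, hb]; gcongr; exact hv.2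
    have hb2 : b ≤ 2*(k+1) := by rw [← E1, hb]; gcongr; exact hv.1
    have hev : Real.exp v = z/b := by rw [hb, Real.exp_neg]; field_simp
    have hdiff : |Lo (z/(2*k+1)) - Lo (z/b)| ≤ Ea := by
      have hsplit : ∀ x y : ℝ, 0 < x → x ≤ y → z/x - z/y = z*(y-x)/(x*y) := by
        intro x y hx hxy
        have : 0 < y := by linarith
        field_simp
      have hcmp : ∀ x y : ℝ, 0 < x → x ≤ y → y - x ≤ 1 → (2*k+1)*(2*k) ≤ x*y → z/x - z/y ≤ z/((2*k+1)*(2*k)) := by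
        intro x y hx hxy h1 h2
        rw [hsplit x y hx hxy]
        calc z*(y-x)/(x*y) ≤ z*1/(x*y) := by gcongr; nlinarith
          _ ≤ z*1/((2*k+1)*(2*k)) := by gcongr
          _ = _ := by rw [mul_one]
      have hE : Ea = (z/((2*k+1)*(2*k)))/2+1 := by rw [hEa]; field_simp
      rw [hE]
      rcases le_total b (2*k+1) with h | h
      · have := Lo_diff' (z/(2*k+1)) (z/b) (by positivity) (by gcongr)
        rw [abs_sub_comm]
        have h2 := hcmp b (2*k+1) hb0 h (by linarith) (by nlinarith)
        linarith
      · have := Lo_diff' (z/b) (z/(2*k+1)) (by positivity) (by gcongr)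
        have h2 := hcmp (2*k+1) b (by positivity) h (by linarith) (by nlinarith)
        linarith
    have h3 : |Lo (z/(2*k+1))| ≤ |Lo (z/b)| + Ea := by
      have := abs_sub_abs_le_abs_sub (Lo (z/(2*k+1))) (Lo (z/b))
      linarith
    have h4 : z*lv v = |Lo (z/b)| * b := by
      unfold lv
      rw [← hev, hb]; ring
    rw [h4, ← add_mul]
    gcongr
  have hce : IntervalIntegrable (fun v => z*Real.exp (-v)) volume c1 c2 := by
    apply Continuous.intervalIntegrable; fun_prop
  have := intervalIntegral.integral_mono_on hc (hce.const_mul _) (((lv_intble c1 c2).const_mul z).add (hce.const_mul Ea)) key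
  rw [intervalIntegral.integral_const_mul, hI, intervalIntegral.integral_add ((lv_intble c1 c2).const_mul z) (hce.const_mul Ea),
    intervalIntegral.integral_const_mul, intervalIntegral.integral_const_mul, hI] at this
  have hE : Ea*2 = z/((2*k+1)*(2*k)) + 2 := by rw [hEa]; field_simp
  rw [hE] at this
  linarith

lemma pieces (z : ℝ) (hz : 0 < z) (m : ℕ) (hm : 1 ≤ m) (n : ℕ) (hmn : m ≤ n) :
    2*∑ k ∈ Finset.Ico m n, |Lo (z/((2*k+1:ℕ):ℝ))| ≤ z * (∫ v in (Real.log z - Real.log (2*(n:ℝ)))..(Real.log z - Real.log (2*(m:ℝ))), lv v)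
      + (z/2*(1/(2*m-1) - 1/(2*n-1)) + 2*(n-m)) := by
  induction n, hmn using Nat.le_induction with
  | base => simp
  | succ n hn ih =>
    rw [Finset.sum_Ico_succ_top hn, mul_add]
    have h := piece z hz n (by omega)
    have hI := intervalIntegral.integral_add_adjacent_intervals (lv_intble (Real.log z - Real.log (2*((n+1:ℕ):ℝ))) (Real.log z - Real.log (2*(n:ℝ)))) (lv_intble _ (Real.log z - Real.log (2*(m:ℝ))))
    rw [← hI]
    have hn1 : (1:ℝ) ≤ n := by exact_mod_cast hm.trans hn
    have h5 : z/((2*n+1)*(2*n)) ≤ z/2*(1/(2*n-1) - 1/(2*((n+1:ℕ):ℝ)-1)) := by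
      push_cast
      have : z/2*(1/(2*n-1) - 1/(2*((n:ℝ)+1)-1)) = z/((2*n+1)*(2*n-1)) := by
        have : (2*(n:ℝ)-1) ≠ 0 := by linarith
        have : (2*((n:ℝ)+1)-1) ≠ 0 := by linarith
        field_simp; ring
      rw [this]
      gcongr
      · nlinarith
      · linarith
    push_cast at h5 h ih ⊢
    linarith

lemma hypbound (z : ℝ) (hz : 1 ≤ z) (m : ℕ) (hm : 1 ≤ m) (v1 : ℝ) (hv1 : v1 ≤ Real.log z - Real.log (√z+1)) (hv2 : v1 ≤ Real.log z - Real.log (2*(m:ℝ))) :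
    |L2 z| ≤ 2*∑ k ∈ range m, |Lo (z/((2*k+1:ℕ):ℝ))| + z * (∫ v in v1..(Real.log z - Real.log (2*(m:ℝ))), lv v)
      + (z/(2*(2*m-1)) + (√z+1)) + (Lo (√z))^2 := by
  have hz0 : 0 < z := by linarith
  have hm1 : (1:ℝ) ≤ m := by exact_mod_cast hm
  rw [hyp z (by linarith)]
  set r := ⌊√z⌋₊ with hr
  have h1 := lo_sum_odd (fun a => Lo (z/(a:ℝ))) r
  set n := (r+1)/2 with hn
  have hA : |2 * ∑ a ∈ Ioc 0 r, lo a * Lo (z/a) - (Lo (√z))^2| ≤ 2*∑ k ∈ range n, |Lo (z/((2*k+1:ℕ):ℝ))| + (Lo (√z))^2 := by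
    refine (abs_sub _ _).trans ?_
    rw [abs_mul, abs_two, abs_of_nonneg (sq_nonneg (Lo (√z)))]
    gcongr
  refine hA.trans ?_
  have hI0 : ∀ a b : ℝ, a ≤ b → 0 ≤ ∫ v in a..b, lv v := fun a b h => intervalIntegral.integral_nonneg h fun v _ => lv_nonneg v
  have hrz : (r:ℝ) ≤ √z := Nat.floor_le (Real.sqrt_nonneg _)
  have h2n : (2*n:ℝ) ≤ √z+1 := by
    have : 2*n ≤ r+1 := by omega
    have : (2*n:ℝ) ≤ r+1 := by exact_mod_cast this
    linarith
  have hp : 0 ≤ z/(2*(2*m-1)) := div_nonneg hz0.le (by linarith)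
  rcases le_total n m with h | h
  · have : ∑ k ∈ range n, |Lo (z/((2*k+1:ℕ):ℝ))| ≤ ∑ k ∈ range m, |Lo (z/((2*k+1:ℕ):ℝ))| :=
      Finset.sum_le_sum_of_subset_of_nonneg (Finset.range_mono h) fun _ _ _ => abs_nonneg _
    have := mul_nonneg hz0.le (hI0 _ _ hv2)
    have := Real.sqrt_nonneg z
    linarith
  · have hp := pieces z hz0 m hm n h
    rw [← Finset.sum_range_add_sum_Ico _ h, mul_add]
    have hnn : (1:ℝ) ≤ n := by exact_mod_cast hm.trans h
    have hv3 : v1 ≤ Real.log z - Real.log (2*(n:ℝ)) := by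
      have := Real.log_le_log (by positivity) h2n
      linarith
    have hI := intervalIntegral.integral_add_adjacent_intervals (lv_intble v1 (Real.log z - Real.log (2*(n:ℝ)))) (lv_intble _ (Real.log z - Real.log (2*(m:ℝ))))
    have := mul_nonneg hz0.le (hI0 _ _ hv3)
    rw [← hI, mul_add]
    have e : z/2*(1/(2*m-1) - 1/(2*n-1)) ≤ z/(2*(2*m-1)) := by
      have : z/(2*(2*m-1)) = z/2*(1/(2*m-1)) := by
        have : (2*(m:ℝ)-1) ≠ 0 := by linarith
        field_simp
      rw [this]
      have : 0 ≤ 1/(2*(n:ℝ)-1) := div_nonneg zero_le_one (by linarith)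
      gcongr; linarith
    linarith

lemma ge_exp (a q v : ℝ) (n m : ℕ) (hn : 0 < n) (ha : 0 < a) (h : a^n ≤ 2^m) (hq : m*0.6931472 ≤ n*q) (hv : q ≤ v) :
    a ≤ Real.exp v := by
  have := log_le_nm a q n m hn ha h hq
  rw [← Real.log_le_iff_le_exp ha]; linarith

lemma P0 (v : ℝ) (hv : 7.5 ≤ v) : lv v ≤ 0.5006 := by
  refine lv_le_of v _ ((Lo_half _ (Real.exp_pos v).le).trans ?_)
  have : (1667:ℝ) ≤ Real.exp v := ge_exp 1667 7.5 v 5 54 (by norm_num) (by norm_num) (by norm_num) (by norm_num) hv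
  norm_num at this ⊢; linarith
lemma P1 (v : ℝ) (hv : 11.52 ≤ v) : lv v ≤ 0.0761 :=
  lv_le_of v _ (LoS _ (ge_exp _ 11.52 v 5 83 (by norm_num) (by norm_num) (by norm_num) (by norm_num) hv))
lemma P2 (v : ℝ) (hv : 16.03 ≤ v) : lv v ≤ 0.0232 :=
  lv_le_of v _ (LoM _ (ge_exp _ 16.03 v 9 208 (by norm_num) (by norm_num) (by norm_num) (by norm_num) hv))
set_option exponentiation.threshold 2000 in
lemma P3 (v : ℝ) (hv : 28.02 ≤ v) : lv v ≤ 0.00265 :=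
  lv_le_of v _ (LoB _ (ge_exp _ 28.02 v 12 485 (by norm_num) (by norm_num) (by norm_num) (by norm_num) hv))
set_option exponentiation.threshold 2000 in
lemma P4 (v : ℝ) (hv : 85.4 ≤ v) : lv v ≤ 0.00166 :=
  lv_le_of v _ (LoF _ (ge_exp _ 85.4 v 9 1108 (by norm_num) (by norm_num) (by norm_num) (by norm_num) hv))

lemma en_intble (a b : ℝ) : IntervalIntegrable (fun v => v^10*lv v^2) volume a b := by
  have hm : Measurable (fun v => v^10*lv v^2) := (measurable_id.pow_const 10).mul (lv_meas.pow_const 2)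
  refine (Continuous.intervalIntegrable (u := fun v : ℝ => v^10) (by fun_prop) a b).mono_fun' hm.aestronglyMeasurable ?_
  refine Filter.Eventually.of_forall fun v => ?_
  show ‖v^10*lv v^2‖ ≤ v^10
  have h0 : (0:ℝ) ≤ v^10 := by positivity
  rw [Real.norm_eq_abs, abs_of_nonneg (by positivity)]
  have := lv_one v
  have := lv_nonneg v
  have : lv v^2 ≤ 1 := by nlinarith
  exact mul_le_of_le_one_right h0 this

lemma energy (a b : ℝ) (ha : 0 ≤ a) (hab : a ≤ b) : ∫ v in a..b, v^10*lv v^2 ≤ 90900000000000000000000000 := by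
  have h := main_L2 b
  have e : ∀ u : ℝ, u^10*(Lo (Real.exp u)*Real.exp (-u))^2 = u^10*lv u^2 := by
    intro u; unfold lv; rw [mul_pow, mul_pow, sq_abs]
  simp_rw [e] at h
  have hi := en_intble 0 b
  rw [intervalIntegrable_iff_integrableOn_Ioc_of_le (by linarith)] at hi
  rw [← ofReal_integral_eq_lintegral_ofReal hi (Filter.Eventually.of_forall fun v => by positivity), ENNReal.ofReal_le_ofReal_iff (by norm_num)] at h
  rw [intervalIntegral.integral_of_le hab]
  refine le_trans (setIntegral_mono_set hi (Filter.Eventually.of_forall fun v => by positivity) ?_) h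
  exact (Set.Ioc_subset_Ioc_left ha).eventuallyLE

lemma Pinf (v : ℝ) (hv : 3000 ≤ v) : lv v ≤ 50000000/v^3 := by
  by_contra hcon
  push Not at hcon
  set L := lv v with hL
  have hv0 : 0 < v := by linarith
  have hL1 : L ≤ 0.00166 := P4 v (by norm_num; linarith)
  have hL0 : 0 < L := lt_trans (by positivity) hcon
  have hL3 : 50000000 < L*v^3 := by rwa [div_lt_iff₀ (by positivity)] at hcon
  have hexp : Real.exp (-v) ≤ 0.001*L := by
    have h1 : v^6/720 ≤ Real.exp v := by
      have := Real.pow_div_factorial_le_exp v hv0.le 6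
      simpa [Nat.factorial] using this
    rw [Real.exp_neg, inv_le_comm₀ (Real.exp_pos _) (by positivity)]
    refine le_trans ?_ h1
    rw [inv_le_iff_one_le_mul₀ (by positivity)]
    have : (1:ℝ) ≤ v^3 := one_le_pow₀ (by linarith)
    have : v^6/720*(0.001*L) = 0.001/720*(v^3*(L*v^3)) := by ring
    rw [this]
    nlinarith
  have key : ∀ w ∈ Set.Icc v (v+0.65*L), v^10*(0.67*L)^2 ≤ w^10*lv w^2 := by
    intro w hw
    have h1 := Lo_diff' (Real.exp v) (Real.exp w) (Real.exp_pos _).le (Real.exp_le_exp.2 hw.1)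
    have h2 : |Lo (Real.exp v)| - ((Real.exp w - Real.exp v)/2+1) ≤ |Lo (Real.exp w)| := by
      have := abs_sub_abs_le_abs_sub (Lo (Real.exp v)) (Lo (Real.exp w))
      rw [abs_sub_comm] at this
      linarith
    have h3 : |Lo (Real.exp v)| = L*Real.exp v := by
      rw [hL]; unfold lv; rw [mul_assoc, ← Real.exp_add]; simp
    rw [h3] at h2
    have h4 : (L*Real.exp v - ((Real.exp w - Real.exp v)/2+1))*Real.exp (-w) ≤ lv w := by
      unfold lv; gcongr
    have h5 : (L*Real.exp v - ((Real.exp w - Real.exp v)/2+1))*Real.exp (-w) = L*Real.exp (v-w) - (1-Real.exp (v-w))/2 - Real.exp (-w) := by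
      have e1 : Real.exp v*Real.exp (-w) = Real.exp (v-w) := by rw [← Real.exp_add]; ring_nf
      have e2 : Real.exp w*Real.exp (-w) = 1 := by rw [← Real.exp_add]; simp
      linear_combination (L+1/2)*e1 - e2/2
    have h6 : 1 - (w-v) ≤ Real.exp (v-w) := by have := Real.add_one_le_exp (v-w); linarith
    have h7 : Real.exp (-w) ≤ 0.001*L := le_trans (Real.exp_le_exp.2 (by linarith [hw.1])) hexp
    have h8 : 0.67*L ≤ lv w := by
      rw [h5] at h4
      have h9 : (L+1/2)*(1-(w-v)) ≤ (L+1/2)*Real.exp (v-w) := by gcongr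
      have h10 : (L+1/2)*(w-v) ≤ 0.502*(0.65*L) := by
        apply mul_le_mul _ (by linarith [hw.2]) (by linarith [hw.1]) (by norm_num)
        norm_num at hL1 ⊢; linarith
      norm_num at h10 h7 ⊢
      linarith
    have : v ≤ w := hw.1
    gcongr
  have hI := intervalIntegral.integral_mono_on (by linarith : v ≤ v+0.65*L) intervalIntegrable_const (en_intble _ _) key
  rw [intervalIntegral.integral_const] at hI
  have hE := energy v (v+0.65*L) hv0.le (by linarith)
  have h11 : 0.29*(v*(L*v^3)^3) ≤ 90900000000000000000000000 := by
    refine le_trans ?_ (hI.trans hE)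
    rw [smul_eq_mul]
    have : (v+0.65*L-v)*(v^10*(0.67*L)^2) = 0.65*0.67^2*(v*(L*v^3)^3) := by ring
    rw [this]
    have : (0:ℝ) ≤ v*(L*v^3)^3 := by positivity
    gcongr; norm_num
  have h12 : (50000000:ℝ)^3 ≤ (L*v^3)^3 := by gcongr
  have h13 : (3000:ℝ)*(50000000)^3 ≤ v*(L*v^3)^3 := by gcongr
  norm_num at h11 h13
  linarith

lemma vl_intble (a b : ℝ) : IntervalIntegrable (fun v => v*lv v) volume a b :=
  (lv_intble a b).continuousOn_mul continuousOn_id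

lemma vl_piece (a b P : ℝ) (ha : 0 ≤ a) (hab : a ≤ b) (h : ∀ v, a ≤ v → lv v ≤ P) :
    ∫ v in a..b, v*lv v ≤ P*((b^2-a^2)/2) := by
  have hi : IntervalIntegrable (fun v => P*v) volume a b := by apply Continuous.intervalIntegrable; fun_prop
  refine (intervalIntegral.integral_mono_on hab (vl_intble a b) hi (fun v hv => ?_)).trans (le_of_eq ?_)
  · rw [mul_comm]; exact mul_le_mul_of_nonneg_right (h v hv.1) (ha.trans hv.1)
  · rw [intervalIntegral.integral_const_mul, integral_id]

lemma vl_tail (V : ℝ) (hV : 772 ≤ V) : ∫ v in (772:ℝ)..V, v*lv v ≤ 282.5 := by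
  have hi8 : IntervalIntegrable (fun v : ℝ => v^(-8:ℤ)) volume 772 V := by
    apply intervalIntegral.intervalIntegrable_zpow
    right; rw [Set.uIcc_of_le hV]; intro h; have := h.1; norm_num at this
  have h8 : ∫ v in (772:ℝ)..V, v^(-8:ℤ) ≤ 772^(-7:ℤ)/7 := by
    rw [integral_zpow (Or.inr ⟨by norm_num, by rw [Set.uIcc_of_le hV]; intro h; have := h.1; norm_num at this⟩)]
    have : 0 ≤ V^(-7:ℤ) := by positivity
    have e : (-8:ℤ)+1 = -7 := by norm_num
    rw [e]
    push_cast
    have e2 : (V^(-7:ℤ) - 772^(-7:ℤ))/(-8+1) = 772^(-7:ℤ)/7 - V^(-7:ℤ)/7 := by ring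
    rw [e2]
    linarith
  have hpt : ∀ v ∈ Set.Icc (772:ℝ) V, v*lv v ≤ 0.00000000000000000000000155*(v^10*lv v^2) + (1/0.0000000000000000000000062)*v^(-8:ℤ) := by
    intro v hv
    have hv0 : 0 < v := by have := hv.1; linarith
    have e : v^(-8:ℤ) = (v^8)⁻¹ := by rw [zpow_neg]; norm_cast
    rw [e]
    set y := (v^4)⁻¹ with hy
    have e2 : (v^8)⁻¹ = y^2 := by rw [hy, inv_pow, ← pow_mul]
    have e3 : v*lv v = (v^5*lv v)*y := by rw [hy]; field_simp
    have e4 : v^10*lv v^2 = (v^5*lv v)^2 := by ring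
    rw [e2, e3, e4]
    have := sq_nonneg (0.0000000000000000000000031*(v^5*lv v) - y)
    norm_num at this ⊢
    nlinarith
  have := intervalIntegral.integral_mono_on hV (vl_intble _ _) (((en_intble 772 V).const_mul _).add (hi8.const_mul _)) hpt
  rw [intervalIntegral.integral_add ((en_intble 772 V).const_mul _) (hi8.const_mul _), intervalIntegral.integral_const_mul, intervalIntegral.integral_const_mul] at this
  have hE := energy 772 V (by norm_num) hV
  refine this.trans ?_
  calc _ ≤ (0.00000000000000000000000155:ℝ)*90900000000000000000000000 + (1/0.0000000000000000000000062)*((772:ℝ)^(-7:ℤ)/7) := by gcongr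
    _ ≤ _ := by norm_num

lemma vl_int (V : ℝ) (hV : 772 ≤ V) : ∫ v in (7.5:ℝ)..V, v*lv v ≤ 812 := by
  rw [← intervalIntegral.integral_add_adjacent_intervals (vl_intble 7.5 11.52) (vl_intble 11.52 V),
    ← intervalIntegral.integral_add_adjacent_intervals (vl_intble 11.52 16.03) (vl_intble 16.03 V),
    ← intervalIntegral.integral_add_adjacent_intervals (vl_intble 16.03 28.02) (vl_intble 28.02 V),
    ← intervalIntegral.integral_add_adjacent_intervals (vl_intble 28.02 85.4) (vl_intble 85.4 V),
    ← intervalIntegral.integral_add_adjacent_intervals (vl_intble 85.4 772) (vl_intble 772 V)]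
  have h0 := vl_piece 7.5 11.52 _ (by norm_num) (by norm_num) P0
  have h1 := vl_piece 11.52 16.03 _ (by norm_num) (by norm_num) P1
  have h2 := vl_piece 16.03 28.02 _ (by norm_num) (by norm_num) P2
  have h3 := vl_piece 28.02 85.4 _ (by norm_num) (by norm_num) P3
  have h4 := vl_piece 85.4 772 _ (by norm_num) (by norm_num) P4
  have h5 := vl_tail V hV
  refine (add_le_add h0 (add_le_add h1 (add_le_add h2 (add_le_add h3 (add_le_add h4 h5))))).trans ?_
  norm_num

/-- telescoping along an arithmetic progression -/
lemma tele (f Ψ : ℝ → ℝ) (c : ℝ) (h : ∀ t, f t ≤ Ψ t - Ψ (t-c)) (t : ℝ) (J : ℕ) :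
    ∑ j ∈ range J, f (t - j*c) ≤ Ψ t - Ψ (t - J*c) := by
  induction J with
  | zero => simp
  | succ J ih =>
    rw [Finset.sum_range_succ]
    have := h (t - J*c)
    have e : t - J*c - c = t - (J+1:ℕ)*c := by push_cast; ring
    rw [e] at this
    linarith

open Classical in
lemma count (a b c t : ℝ) (J : ℕ) (hc : 0 < c) (hab : a ≤ b) :
    ∑ j ∈ range J, (if a ≤ t - j*c ∧ t - j*c ≤ b then (1:ℝ) else 0) ≤ (b-a)/c+1 := by
  have h := tele (fun t => if a ≤ t ∧ t ≤ b then (1:ℝ) else 0) (fun t => max (min t b) (a-c)/c) c ?_ t J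
  · refine h.trans ?_
    have h1 : max (min t b) (a-c) ≤ b := max_le (min_le_right _ _) (by linarith)
    have h2 : a-c ≤ max (min (t-J*c) b) (a-c) := le_max_right _ _
    rw [div_sub_div_same]
    have : (b-a)/c+1 = (b-(a-c))/c := by field_simp; ring
    rw [this]; gcongr
  · intro t
    rw [div_sub_div_same, le_div_iff₀ hc]
    split_ifs with h
    · rw [min_eq_left h.2, min_eq_left (by linarith), max_eq_left (by linarith), max_eq_left (by linarith)]; linarith
    · have : max (min (t-c) b) (a-c) ≤ max (min t b) (a-c) := max_le_max (min_le_min (by linarith) le_rfl) le_rfl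
      linarith

noncomputable def hs (m : ℕ) : ℝ := ∑ k ∈ range m, 2/(2*(k:ℝ)+1)

lemma hs_succ (m : ℕ) : hs (m+1) = hs m + 2/(2*(m:ℝ)+1) := by unfold hs; rw [Finset.sum_range_succ]
lemma hs_step (m0 m : ℕ) (h0 : 1 ≤ m0) (h : m0 ≤ m) : hs m ≤ hs m0 + Real.log (2*m-1) - Real.log (2*m0-1) := by
  induction m, h using Nat.le_induction with
  | base => linarith
  | succ m hm ih =>
    rw [hs_succ]
    have hm1 : (1:ℝ) ≤ m := by exact_mod_cast h0.trans hm
    have h1 : 2/(2*(m:ℝ)+1) ≤ Real.log (2*m+1) - Real.log (2*m-1) := by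
      have := Real.log_le_sub_one_of_pos (show 0 < (2*(m:ℝ)-1)/(2*m+1) from div_pos (by linarith) (by linarith))
      rw [Real.log_div (by linarith) (by linarith)] at this
      have e : (2*(m:ℝ)-1)/(2*m+1) - 1 = -(2/(2*m+1)) := by field_simp; ring
      linarith
    have e : (2*((m+1:ℕ):ℝ)-1) = 2*m+1 := by push_cast; ring
    rw [e]; linarith
lemma hs_one : hs 1 = 2 := by simp [hs]
lemma hs_100 : hs 100 ≤ 6.57 := by
  unfold hs
  norm_num [Finset.sum_range_succ]

lemma Lo_cnt (x : ℝ) (hx : 0 ≤ x) : |Lo x| ≤ (x+1)/2 := by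
  have h := lo_sum_odd (fun _ => 1) ⌊x⌋₊
  have e : Lo x = ∑ a ∈ Ioc 0 ⌊x⌋₊, lo a * 1 := by simp_rw [mul_one]; rfl
  rw [e]
  refine h.trans ?_
  simp only [abs_one, Finset.sum_const, Finset.card_range, nsmul_eq_mul, mul_one]
  have h1 : (⌊x⌋₊:ℝ) ≤ x := Nat.floor_le hx
  have h2 : 2*((⌊x⌋₊+1)/2) ≤ ⌊x⌋₊+1 := by omega
  have h3 : 2*(((⌊x⌋₊+1)/2:ℕ):ℝ) ≤ ⌊x⌋₊+1 := by exact_mod_cast h2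
  linarith

lemma L2_small (z : ℝ) (hz : z < 1) : L2 z = 0 := by
  unfold L2
  rw [Nat.floor_eq_zero.2 hz]; simp

lemma L2_triv (z : ℝ) (hz : 1 ≤ z) : |L2 z| ≤ (Real.log z/4+1)*z := by
  have e : L2 z = ∑ a ∈ Ioc 0 ⌊z⌋₊, lo a * Lo (z/a) := by
    unfold L2
    rw [ArithmeticFunction.sum_Ioc_mul_eq_sum_sum]
    refine Finset.sum_congr rfl fun n _ => ?_
    rw [Lo, Nat.floor_div_natCast, loA_apply]
    simp only [loA_apply]
    rfl
  rw [e]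
  refine (lo_sum_odd (fun a => Lo (z/(a:ℝ))) _).trans ?_
  set n := (⌊z⌋₊+1)/2 with hn
  have h1 : (⌊z⌋₊:ℝ) ≤ z := Nat.floor_le (by linarith)
  have h0 : 1 ≤ ⌊z⌋₊ := Nat.le_floor (by simpa using hz)
  have h2 : 2*n ≤ ⌊z⌋₊+1 := by omega
  have hn1 : 1 ≤ n := by omega
  have hn1' : (1:ℝ) ≤ n := by exact_mod_cast hn1
  have h3 : 2*(n:ℝ) ≤ ⌊z⌋₊+1 := by exact_mod_cast h2
  have h4 : ∑ k ∈ range n, |Lo (z/((2*k+1:ℕ):ℝ))| ≤ ∑ k ∈ range n, (z/4*(2/(2*(k:ℝ)+1)) + 1/2) := by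
    refine Finset.sum_le_sum fun k _ => ?_
    refine (Lo_cnt _ (by positivity)).trans (le_of_eq ?_)
    push_cast
    field_simp; ring
  refine h4.trans ?_
  rw [Finset.sum_add_distrib, ← Finset.mul_sum]
  change z/4*hs n + _ ≤ _
  have h5 := hs_step 1 n le_rfl hn1
  rw [hs_one] at h5
  have h6 : Real.log (2*n-1) ≤ Real.log z := Real.log_le_log (by linarith) (by linarith)
  norm_num at h5
  have h7 : z/4*hs n ≤ z/4*(2+Real.log z) := by gcongr; linarith
  simp only [Finset.sum_const, Finset.card_range, nsmul_eq_mul]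
  nlinarith

lemma l2_bound (t : ℝ) (ht : 17 ≤ t) (m : ℕ) (hm : 100 ≤ m) (P Q R : ℝ) (hR : hs m ≤ R) (hlog : Real.log (2*(m:ℝ)) ≤ (t+1)/2)
    (hP : ∀ v, t - Real.log (2*(m:ℝ)) ≤ v → lv v ≤ P) (hQ : lv (t/2) ≤ Q) :
    |L2 (Real.exp t)| * Real.exp (-t) ≤ R*P + 1/(2*(2*m-1)) + 2*Real.exp (-(t/2)) + Q^2 + ∫ v in ((t-1)/2)..(t-5.29), lv v := by
  have hm1 : (100:ℝ) ≤ m := by exact_mod_cast hm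
  have hz1 : 1 ≤ Real.exp t := Real.one_le_exp (by linarith)
  have hsq : √(Real.exp t) = Real.exp (t/2) := by rw [Real.exp_half]
  have hP0 : 0 ≤ P := (lv_nonneg t).trans (hP t (by have := Real.log_nonneg (show (1:ℝ) ≤ 2*m by linarith); linarith))
  have hb := hypbound (Real.exp t) hz1 m (by omega) ((t-1)/2) (by
    rw [Real.log_exp, hsq]
    have h1 : Real.exp (t/2)+1 ≤ Real.exp ((t+1)/2) := by
      have e : (t+1)/2 = t/2+1/2 := by ring
      rw [e, Real.exp_add]
      have h2 := Real.add_one_le_exp (1/2:ℝ)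
      have h3 := Real.add_one_le_exp (t/2)
      nlinarith
    have := Real.log_le_log (by positivity) h1
    rw [Real.log_exp] at this; linarith) (by rw [Real.log_exp]; linarith)
  rw [Real.log_exp, hsq] at hb
  have hS : 2*∑ k ∈ range m, |Lo (Real.exp t/((2*k+1:ℕ):ℝ))| ≤ Real.exp t*(R*P) := by
    have h1 : ∀ k ∈ range m, |Lo (Real.exp t/((2*k+1:ℕ):ℝ))| ≤ P*Real.exp t/2*(2/(2*(k:ℝ)+1)) := by
      intro k hk
      rw [Finset.mem_range] at hk
      have hk' : ((2*k+1:ℕ):ℝ) ≤ 2*m := by exact_mod_cast (by omega : 2*k+1 ≤ 2*m)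
      rw [Lo_lv _ (by positivity), Real.log_div (by positivity) (by positivity), Real.log_exp]
      have h2 := hP (t - Real.log ((2*k+1:ℕ):ℝ)) (by have := Real.log_le_log (by positivity) hk'; linarith)
      refine (mul_le_mul_of_nonneg_right h2 (by positivity)).trans (le_of_eq ?_)
      push_cast; field_simp
    have h2 := Finset.sum_le_sum h1
    rw [← Finset.mul_sum] at h2
    change _ ≤ _*hs m at h2
    have h3 : P*Real.exp t/2*hs m ≤ P*Real.exp t/2*R := by gcongr
    nlinarith
  have hI : ∫ v in ((t-1)/2)..(t-Real.log (2*(m:ℝ))), lv v ≤ ∫ v in ((t-1)/2)..(t-5.29), lv v := by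
    have h5 : 5.29 ≤ Real.log (2*(m:ℝ)) := by
      have h1 := log_ge_nm 200 5.29 11 84 (by norm_num) (by norm_num) (by norm_num) (by norm_num)
      have := Real.log_le_log (by norm_num) (show (200:ℝ) ≤ 2*m by linarith)
      linarith
    rw [← intervalIntegral.integral_add_adjacent_intervals (lv_intble ((t-1)/2) (t-Real.log (2*(m:ℝ)))) (lv_intble _ (t-5.29))]
    have := intervalIntegral.integral_nonneg (show t-Real.log (2*(m:ℝ)) ≤ t-5.29 by linarith) (f := lv) (μ := volume) fun v _ => lv_nonneg v
    linarith
  have hL : (Lo (Real.exp (t/2)))^2 ≤ Real.exp t*Q^2 := by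
    have e : (Lo (Real.exp (t/2)))^2 = Real.exp t*lv (t/2)^2 := by
      rw [← sq_abs, Lo_lv _ (Real.exp_pos _), Real.log_exp, mul_pow, ← Real.exp_nat_mul]
      push_cast
      rw [mul_div_cancel₀ t two_ne_zero, mul_comm]
    rw [e]
    have := lv_nonneg (t/2)
    gcongr
  have hE : Real.exp (t/2)+1 ≤ Real.exp t*(2*Real.exp (-(t/2))) := by
    have e : Real.exp t*Real.exp (-(t/2)) = Real.exp (t/2) := by rw [← Real.exp_add]; ring_nf
    have := Real.one_le_exp (show 0 ≤ t/2 by linarith)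
    linarith
  rw [Real.exp_neg, ← div_eq_mul_inv, div_le_iff₀ (Real.exp_pos _)]
  have hI2 := mul_le_mul_of_nonneg_left hI (Real.exp_pos t).le
  have e : Real.exp t/(2*(2*(m:ℝ)-1)) = Real.exp t*(1/(2*(2*m-1))) := by ring
  rw [e] at hb
  linarith

noncomputable def l2 (t : ℝ) : ℝ := |L2 (Real.exp t)| * Real.exp (-t)
noncomputable def gI (t : ℝ) : ℝ := ∫ v in ((t-1)/2)..(t-5.29), lv v

lemma tier1 (t p P Q ε : ℝ) (ht : 17 ≤ t) (hp : p + 5.31 ≤ t) (hP : ∀ v, p ≤ v → lv v ≤ P) (hQ : lv (t/2) ≤ Q)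
    (hε : ε⁻¹ ≤ Real.exp (t/2)) (hε0 : 0 < ε) :
    l2 t ≤ 6.57*P + 0.002513 + 2*ε + Q^2 + gI t := by
  have hl : Real.log (2*((100:ℕ):ℝ)) ≤ 5.31 := by
    have := log_le_nm 200 5.31 17 130 (by norm_num) (by norm_num) (by norm_num) (by norm_num)
    convert this using 2; norm_num
  have h := l2_bound t ht 100 le_rfl P Q 6.57 hs_100 (by norm_num at hl ⊢; linarith)
    (fun v hv => hP v ((by linarith : p ≤ t - 5.31).trans ((sub_le_sub_left hl t).trans hv))) hQ
  have h1 : Real.exp (-(t/2)) ≤ ε := by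
    rw [Real.exp_neg]; exact inv_le_of_inv_le₀ hε0 hε
  have h2 : (1:ℝ)/(2*(2*((100:ℕ):ℝ)-1)) ≤ 0.002513 := by norm_num
  unfold l2 gI
  linarith

lemma tier1a (t : ℝ) (h1 : 17 ≤ t) : l2 t ≤ 0.754 + gI t := by
  have := tier1 t 11.52 _ _ (1/4000) h1 (by norm_num; linarith) P1 (P0 (t/2) (by norm_num; linarith))
    (by simpa using ge_exp 4000 8.5 (t/2) 1 12 (by norm_num) (by norm_num) (by norm_num) (by norm_num) (by norm_num; linarith)) (by norm_num)
  norm_num at this ⊢; linarith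
lemma tier1b (t : ℝ) (h1 : 21.4 ≤ t) : l2 t ≤ 0.4061 + gI t := by
  have h17 : 17 ≤ t := by norm_num at h1; linarith
  have := tier1 t 16.03 _ _ (1/4000) h17 (by norm_num at h1 ⊢; linarith) P2 (P0 (t/2) (by norm_num; linarith))
    (by simpa using ge_exp 4000 8.5 (t/2) 1 12 (by norm_num) (by norm_num) (by norm_num) (by norm_num) (by norm_num; linarith)) (by norm_num)
  norm_num at this ⊢; linarith
lemma tier1c (t : ℝ) (h1 : 33.4 ≤ t) : l2 t ≤ 0.0205 + gI t := by
  have h17 : 17 ≤ t := by norm_num at h1; linarith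
  have := tier1 t 28.02 _ _ (1/10^7) h17 (by norm_num at h1 ⊢; linarith) P3 (P2 (t/2) (by norm_num at h1 ⊢; linarith))
    (by simpa using ge_exp (10^7) 16.7 (t/2) 1 24 (by norm_num) (by norm_num) (by norm_num) (by norm_num) (by norm_num at h1 ⊢; linarith)) (by norm_num)
  norm_num at this ⊢; linarith
lemma tier1d (t : ℝ) (h1 : 91 ≤ t) : l2 t ≤ 0.01343 + gI t := by
  have h17 : 17 ≤ t := by linarith
  have := tier1 t 85.4 _ _ (1/10^7) h17 (by norm_num; linarith) P4 (P3 (t/2) (by norm_num; linarith))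
    (by simpa using ge_exp (10^7) 16.7 (t/2) 1 24 (by norm_num) (by norm_num) (by norm_num) (by norm_num) (by norm_num; linarith)) (by norm_num)
  norm_num at this ⊢; linarith

lemma tier2 (t : ℝ) (h1 : 3200 < t) : l2 t ≤ 129300/t^2 + gI t := by
  have ht0 : 0 < t := by linarith
  obtain ⟨s, hs1, hts⟩ : ∃ s : ℝ, 1 ≤ s ∧ t = 3200*s := ⟨t/3200, by rw [le_div_iff₀ (by norm_num)]; linarith, by ring⟩
  set q := ⌈t^2/10^5⌉₊ with hq
  have hq1 : t^2/10^5 ≤ q := Nat.le_ceil _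
  have hq2 : (q:ℝ) < t^2/10^5+1 := Nat.ceil_lt_add_one (by positivity)
  have ht2 : t^2/10^5 = 102.4*s^2 := by rw [hts]; ring
  rw [ht2] at hq1 hq2
  have hs2 : 1 ≤ s^2 := one_le_pow₀ hs1
  have hq99 : 99 ≤ q := by
    have : (99:ℝ) ≤ q := by norm_num at hq1; linarith
    exact_mod_cast this
  have hm : ((q+1:ℕ):ℝ) = q+1 := by push_cast; ring
  have hlogs : Real.log (s^2) ≤ 2*(s-1) := by
    rw [Real.log_pow]; have := Real.log_le_sub_one_of_pos (show 0 < s by linarith); push_cast; linarith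
  have hl1 : Real.log (2*((q+1:ℕ):ℝ)) ≤ 5.36+2*(s-1) := by
    rw [hm]
    have h2 : 2*((q:ℝ)+1) ≤ 209*s^2 := by norm_num at hq2; linarith
    have h3 := Real.log_le_log (by positivity) h2
    rw [Real.log_mul (x := 209) (y := s^2) (by norm_num) (by positivity)] at h3
    have h4 := log_le_nm 209 5.36 11 85 (by norm_num) (by norm_num) (by norm_num) (by norm_num)
    linarith
  have hl2 : Real.log (2*((q+1:ℕ):ℝ)-1) - Real.log (2*((100:ℕ):ℝ)-1) ≤ 0.046+2*(s-1) := by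
    rw [hm]
    have h2 : 2*((q:ℝ)+1)-1 ≤ 199*((208/199)*s^2) := by norm_num at hq2 ⊢; linarith
    have h3 := Real.log_le_log (by linarith [(Nat.cast_nonneg q : (0:ℝ) ≤ q)]) h2
    rw [Real.log_mul (by norm_num) (by positivity), Real.log_mul (by norm_num) (by positivity)] at h3
    have h4 := Real.log_le_sub_one_of_pos (show (0:ℝ) < 208/199 by norm_num)
    norm_num at h3 h4 hlogs ⊢
    linarith
  have hR : hs (q+1) ≤ 6.62*s := by
    have := hs_step 100 (q+1) (by norm_num) (by omega)
    have h100 := hs_100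
    norm_num at h100 hl2 this ⊢
    linarith
  have hP : ∀ v, t - Real.log (2*((q+1:ℕ):ℝ)) ≤ v → lv v ≤ 50000000/(0.998*t)^3 := by
    intro v hv
    have hv1 : 0.998*t ≤ v := by
      rw [hts] at hv ⊢
      norm_num at hl1 hv ⊢
      linarith
    refine (Pinf v (by norm_num at hv1; linarith)).trans ?_
    gcongr
  have hQ : ∃ Q, lv (t/2) ≤ Q ∧ Q^2 ≤ 130/t^2 := by
    rcases le_total t 6000 with h | h
    · refine ⟨_, P4 (t/2) (by norm_num; linarith), ?_⟩
      rw [le_div_iff₀ (by positivity)]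
      have : t^2 ≤ 6000^2 := by gcongr
      norm_num at this ⊢; linarith
    · refine ⟨_, Pinf (t/2) (by linarith), ?_⟩
      have e : (50000000/(t/2)^3)^2 = (160000000000000000/t^4)/t^2 := by field_simp; norm_num
      rw [e]
      gcongr
      rw [div_le_iff₀ (by positivity)]
      have : (6000:ℝ)^4 ≤ t^4 := by gcongr
      norm_num at this ⊢; linarith
  obtain ⟨Q, hQ1, hQ2⟩ := hQ
  have h := l2_bound t (by linarith) (q+1) (by omega) _ Q _ hR (by rw [hts]; norm_num at hl1 ⊢; linarith) hP hQ1
  have b1 : 6.62*s*(50000000/(0.998*t)^3) ≤ 104100/t^2 := by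
    have : 6.62*s*(50000000/(0.998*t)^3) = (6.62*50000000/0.998^3/3200)/t^2 := by rw [hts]; field_simp
    rw [this]
    gcongr
    norm_num
  have b2 : 1/(2*(2*((q+1:ℕ):ℝ)-1)) ≤ 25000/t^2 := by
    rw [← ht2] at hq1
    rw [div_le_div_iff₀ (by rw [hm]; linarith [(Nat.cast_nonneg q : (0:ℝ) ≤ q)]) (by positivity), hm]
    linarith
  have b3 : 2*Real.exp (-(t/2)) ≤ 1/t^2 := by
    have h4 := Real.pow_div_factorial_le_exp (t/2) (by linarith) 4
    have e : (t/2)^4/((Nat.factorial 4:ℕ):ℝ) = t^2*t^2/384 := by norm_num [Nat.factorial]; ring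
    rw [e] at h4
    have : (3200:ℝ)^2 ≤ t^2 := by gcongr
    rw [Real.exp_neg, ← div_eq_mul_inv, div_le_div_iff₀ (Real.exp_pos _) (by positivity)]
    nlinarith
  have b5 : 104100/t^2 + 25000/t^2 + 1/t^2 + 130/t^2 ≤ 129300/t^2 := by
    rw [← add_div, ← add_div, ← add_div]; gcongr; norm_num
  unfold l2 gI
  linarith

open Classical in
noncomputable def ind (a b t : ℝ) : ℝ := if a ≤ t ∧ t ≤ b then 1 else 0
open Classical in
noncomputable def f0 (t : ℝ) : ℝ := if 0 ≤ t ∧ t ≤ 17 then t/4+1 else 0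
open Classical in
noncomputable def f5 (t : ℝ) : ℝ := if 3200 < t then 1/t^2 else 0
open Classical in
noncomputable def gJ (t : ℝ) : ℝ := if 17 ≤ t then gI t else 0

lemma ind_nonneg (a b t : ℝ) : 0 ≤ ind a b t := by unfold ind; split_ifs <;> norm_num
lemma f0_nonneg (t : ℝ) : 0 ≤ f0 t := by
  unfold f0; split_ifs with h
  · linarith [h.1]
  · exact le_rfl
lemma f5_nonneg (t : ℝ) : 0 ≤ f5 t := by unfold f5; split_ifs <;> positivity
lemma gI_nonneg (t : ℝ) (ht : 17 ≤ t) : 0 ≤ gI t :=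
  intervalIntegral.integral_nonneg (by norm_num; linarith) fun v _ => lv_nonneg v
lemma gJ_nonneg (t : ℝ) : 0 ≤ gJ t := by
  unfold gJ; split_ifs with h
  · exact gI_nonneg t h
  · exact le_rfl

lemma l2_all (t : ℝ) : l2 t ≤ f0 t + 0.754*ind 17 21.4 t + 0.4061*ind 21.4 33.4 t + 0.0205*ind 33.4 91 t
    + 0.01343*ind 91 3200 t + 129300*f5 t + gJ t := by
  have n0 := f0_nonneg t
  have n1 := ind_nonneg 17 21.4 t
  have n2 := ind_nonneg 21.4 33.4 t
  have n3 := ind_nonneg 33.4 91 t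
  have n4 := ind_nonneg 91 3200 t
  have n5 := f5_nonneg t
  have n6 := gJ_nonneg t
  rcases lt_or_ge t 0 with h0 | h0
  · have : l2 t = 0 := by
      unfold l2; rw [L2_small _ (by rw [← Real.exp_zero]; exact Real.exp_lt_exp.2 h0)]; simp
    rw [this]; positivity
  rcases lt_or_ge t 17 with h1 | h1
  · have e : f0 t = t/4+1 := by unfold f0; rw [if_pos ⟨h0, h1.le⟩]
    have : l2 t ≤ t/4+1 := by
      have := L2_triv (Real.exp t) (Real.one_le_exp h0)
      rw [Real.log_exp] at this
      unfold l2
      rw [Real.exp_neg, ← div_eq_mul_inv, div_le_iff₀ (Real.exp_pos _)]; exact this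
    norm_num at *
    linarith
  have e6 : gJ t = gI t := by unfold gJ; rw [if_pos h1]
  rw [e6] at n6 ⊢
  rcases le_total t 21.4 with h2 | h2
  · have e : ind 17 21.4 t = 1 := by unfold ind; rw [if_pos ⟨h1, h2⟩]
    have := tier1a t h1
    rw [e]
    norm_num at *
    linarith
  rcases le_total t 33.4 with h3 | h3
  · have e : ind 21.4 33.4 t = 1 := by unfold ind; rw [if_pos ⟨h2, h3⟩]
    have := tier1b t h2
    rw [e]
    norm_num at *
    linarith
  rcases le_total t 91 with h4 | h4
  · have e : ind 33.4 91 t = 1 := by unfold ind; rw [if_pos ⟨h3, h4⟩]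
    have := tier1c t h3
    rw [e]
    norm_num at *
    linarith
  rcases le_or_gt t 3200 with h5 | h5
  · have e : ind 91 3200 t = 1 := by unfold ind; rw [if_pos ⟨h4, h5⟩]
    have := tier1d t h4
    rw [e]
    norm_num at *
    linarith
  · have e : 129300*f5 t = 129300/t^2 := by unfold f5; rw [if_pos h5]; ring
    have := tier2 t h5
    norm_num at *
    linarith

lemma sum_ind (a b t : ℝ) (J : ℕ) (hab : a ≤ b) :
    ∑ j ∈ range J, ind a b (t - j*Real.log 2) ≤ (b-a)/Real.log 2+1 := by
  unfold ind
  exact count a b (Real.log 2) t J (Real.log_pos one_lt_two) hab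

lemma sum_f0 (t : ℝ) (J : ℕ) : ∑ j ∈ range J, f0 (t - j*Real.log 2) ≤ 81 := by
  set c := Real.log 2 with hc
  have c1 : 0.6931471803 < c := Real.log_two_gt_d9
  have c2 : c < 0.6931471808 := Real.log_two_lt_d9
  have c0 : 0 < c := Real.log_pos one_lt_two
  have hmono : ∀ x y : ℝ, -c ≤ x → x ≤ y → x^2/8+1.0867*x ≤ y^2/8+1.0867*y := by
    intro x y h1 h2
    norm_num at c1 c2 ⊢
    nlinarith
  have h := tele f0 (fun t => ((max (min t 17) (-c))^2/8 + 1.0867*(max (min t 17) (-c)))/c) c ?_ t J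
  · refine h.trans ?_
    rw [div_sub_div_same, div_le_iff₀ c0]
    have h1 := hmono (max (min t 17) (-c)) 17 (le_max_right _ _) (max_le (min_le_right _ _) (by linarith))
    have h2 := hmono (-c) (max (min (t-J*c) 17) (-c)) le_rfl (le_max_right _ _)
    norm_num at h1 h2 c1 c2 ⊢
    nlinarith
  · intro t
    rw [div_sub_div_same, le_div_iff₀ c0]
    unfold f0
    split_ifs with h
    · rw [min_eq_left h.2, min_eq_left (by linarith [h.2]), max_eq_left (by linarith [h.1]), max_eq_left (by linarith [h.1])]
      norm_num at c2 ⊢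
      nlinarith
    · have := hmono (max (min (t-c) 17) (-c)) (max (min t 17) (-c)) (le_max_right _ _) (max_le_max (min_le_min (by linarith) le_rfl) le_rfl)
      linarith

lemma sum_f5 (t : ℝ) (J : ℕ) : ∑ j ∈ range J, f5 (t - j*Real.log 2) ≤ 1/2217 := by
  set c := Real.log 2 with hc
  have c1 : 0.6931471803 < c := Real.log_two_gt_d9
  have c2 : c < 0.6931471808 := Real.log_two_lt_d9
  have c0 : 0 < c := Real.log_pos one_lt_two
  have c3 : c < 1 := by norm_num at c2; linarith
  have hpos : ∀ t : ℝ, 0 < max t (3200-c) := fun t => lt_of_lt_of_le (by linarith) (le_max_right _ _)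
  have h := tele f5 (fun t => (-(max t (3200-c))⁻¹)/c) c ?_ t J
  · refine h.trans ?_
    rw [div_sub_div_same]
    have h1 : 0 < (max t (3200-c))⁻¹ := inv_pos.2 (hpos t)
    have h2 : (max (t-J*c) (3200-c))⁻¹ ≤ (3200-c)⁻¹ := by
      gcongr
      · linarith
      · exact le_max_right _ _
    calc (-(max t (3200-c))⁻¹ - -(max (t-J*c) (3200-c))⁻¹)/c ≤ (3200-c)⁻¹/c := by gcongr; linarith
      _ = 1/((3200-c)*c) := by rw [one_div, mul_inv, div_eq_mul_inv]
      _ ≤ 1/2217 := by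
        gcongr
        norm_num at c1 c2 ⊢
        nlinarith
  · intro t
    rw [div_sub_div_same, le_div_iff₀ c0]
    unfold f5
    split_ifs with h
    · rw [max_eq_left (by linarith), max_eq_left (by linarith)]
      have ht : 0 < t := by linarith
      have ht' : 0 < t-c := by linarith
      have e : -t⁻¹ - -(t-c)⁻¹ = c/(t*(t-c)) := by field_simp; ring
      rw [e, one_div_mul_eq_div]
      gcongr
      nlinarith
    · have : (max t (3200-c))⁻¹ ≤ (max (t-c) (3200-c))⁻¹ := by
        gcongr
        · exact hpos _
        · linarith
      linarith

lemma gJ_eq (t V : ℝ) (htV : t ≤ V) : gJ t = ∫ v in Set.Ioc 7.5 V, (if 17 ≤ t then (Set.Ioc ((t-1)/2) (t-5.29)).indicator lv v else 0) := by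
  unfold gJ
  split_ifs with h
  · rw [setIntegral_indicator measurableSet_Ioc, gI, intervalIntegral.integral_of_le (by norm_num; linarith),
      Set.inter_eq_right.2]
    intro v hv
    refine ⟨?_, ?_⟩
    · have := hv.1; norm_num; linarith
    · have := hv.2; norm_num at this; linarith
  · simp

lemma sum_gJ (t : ℝ) (J : ℕ) : ∑ j ∈ range J, gJ (t - j*Real.log 2) ≤ 812/Real.log 2 := by
  set c := Real.log 2 with hc
  have c1 : 0.6931471803 < c := Real.log_two_gt_d9
  have c2 : c < 0.6931471808 := Real.log_two_lt_d9
  have c0 : 0 < c := Real.log_pos one_lt_two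
  set V := max t 772 with hV
  have hV7 : (7.5:ℝ) ≤ V := le_trans (by norm_num) (le_max_right t 772)
  have e : ∀ j ∈ range J, gJ (t - j*c) = ∫ v in Set.Ioc 7.5 V, (if 17 ≤ t - j*c then (Set.Ioc ((t-j*c-1)/2) (t-j*c-5.29)).indicator lv v else 0) := by
    intro j _
    refine gJ_eq _ V ?_
    have : 0 ≤ j*c := by positivity
    exact le_trans (by linarith) (le_max_left t 772)
  have hl : IntegrableOn lv (Set.Ioc 7.5 V) := by
    rw [← intervalIntegrable_iff_integrableOn_Ioc_of_le hV7]; exact lv_intble _ _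
  have hv : IntegrableOn (fun v => v*lv v) (Set.Ioc 7.5 V) := by
    rw [← intervalIntegrable_iff_integrableOn_Ioc_of_le hV7]; exact vl_intble _ _
  have hitg : ∀ j ∈ range J, Integrable (fun v => if 17 ≤ t - j*c then (Set.Ioc ((t-j*c-1)/2) (t-j*c-5.29)).indicator lv v else 0) (volume.restrict (Set.Ioc 7.5 V)) := by
    intro j _
    split_ifs
    · exact Integrable.indicator hl measurableSet_Ioc
    · exact integrable_zero _ _ _
  rw [Finset.sum_congr rfl e, ← integral_finsetSum _ hitg]
  have hpt : ∀ v ∈ Set.Ioc (7.5:ℝ) V, ∑ j ∈ range J, (if 17 ≤ t - j*c then (Set.Ioc ((t-j*c-1)/2) (t-j*c-5.29)).indicator lv v else 0) ≤ c⁻¹*(v*lv v) := by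
    intro v hv
    have hv1 : 7.5 < v := hv.1
    norm_num at hv1
    have h1 : ∀ j ∈ range J, (if 17 ≤ t - j*c then (Set.Ioc ((t-j*c-1)/2) (t-j*c-5.29)).indicator lv v else 0) ≤ ind (v+5.29) (2*v+1) (t-j*c) * lv v := by
      intro j _
      have n1 := mul_nonneg (ind_nonneg (v+5.29) (2*v+1) (t-j*c)) (lv_nonneg v)
      split_ifs with h
      · by_cases hm : v ∈ Set.Ioc ((t-j*c-1)/2) (t-j*c-5.29)
        · rw [Set.indicator_of_mem hm]
          unfold ind
          rw [if_pos ⟨by linarith [hm.2], by linarith [hm.1]⟩, one_mul]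
        · rw [Set.indicator_of_notMem hm]; exact n1
      · exact n1
    refine (Finset.sum_le_sum h1).trans ?_
    rw [← Finset.sum_mul, ← mul_assoc]
    refine mul_le_mul_of_nonneg_right ?_ (lv_nonneg v)
    refine (sum_ind (v+5.29) (2*v+1) t J (by norm_num; linarith)).trans ?_
    rw [← hc]
    have : (2*v+1-(v+5.29))/c+1 = (v-4.29+c)/c := by field_simp; ring
    rw [this, inv_mul_eq_div]
    gcongr
    norm_num at c2 ⊢; linarith
  refine (setIntegral_mono_on (integrable_finsetSum _ hitg) (hv.const_mul _) measurableSet_Ioc hpt).trans ?_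
  rw [integral_const_mul, ← intervalIntegral.integral_of_le hV7, inv_mul_eq_div]
  gcongr
  exact vl_int V (le_max_right _ _)

lemma sum_l2 (t : ℝ) (J : ℕ) : ∑ j ∈ range J, l2 (t - j*Real.log 2) ≤ 1400 := by
  refine (Finset.sum_le_sum fun j _ => l2_all _).trans ?_
  simp only [Finset.sum_add_distrib, ← Finset.mul_sum]
  have h0 := sum_f0 t J
  have h1 := sum_ind 17 21.4 t J (by norm_num)
  have h2 := sum_ind 21.4 33.4 t J (by norm_num)
  have h3 := sum_ind 33.4 91 t J (by norm_num)
  have h4 := sum_ind 91 3200 t J (by norm_num)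
  have h5 := sum_f5 t J
  have h6 := sum_gJ t J
  have hi : 1/Real.log 2 ≤ 1.44270 := by
    rw [div_le_iff₀ (Real.log_pos one_lt_two)]
    have := Real.log_two_gt_d9
    norm_num at this ⊢; linarith
  have hd : ∀ x : ℝ, x/Real.log 2 = x*(1/Real.log 2) := fun x => by ring
  rw [hd] at h1 h2 h3 h4 h6
  generalize 1/Real.log 2 = i at *
  norm_num at h0 h1 h2 h3 h4 h5 h6 hi ⊢
  linarith

lemma sum_L2 (y : ℝ) (hy : 0 < y) (J : ℕ) : ∑ j ∈ range J, 2^j*|L2 (y/2^j)| ≤ 1400*y := by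
  have e : ∀ j ∈ range J, 2^j*|L2 (y/2^j)| = y * l2 (Real.log y - j*Real.log 2) := by
    intro j _
    have h2 : Real.exp (Real.log y - j*Real.log 2) = y/2^j := by
      rw [Real.exp_sub, Real.exp_log hy, Real.exp_nat_mul, Real.exp_log two_pos]
    unfold l2
    rw [Real.exp_neg, h2]
    field_simp
  rw [Finset.sum_congr rfl e, ← Finset.mul_sum, mul_comm]
  exact mul_le_mul_of_nonneg_right (sum_l2 _ J) hy.le

lemma W_lt (x : ℝ) (hx : 1 ≤ x) : |W x| < 2260*x := by
  have := W_red 1400 (fun y hy J => sum_L2 y hy J) x (by linarith)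
  norm_num at this
  linarith
end
theorem W_bound :
    (∀ x : ℝ, 1 ≤ x → |W x| < 2260 * x) ∧ W =O[atTop] (fun x : ℝ => x) := by
  refine ⟨W_lt, ?_⟩
  refine IsBigO.of_bound 2260 ?_
  filter_upwards [eventually_ge_atTop 1] with x hx
  rw [Real.norm_eq_abs, Real.norm_eq_abs, abs_of_nonneg (show 0 ≤ x by linarith)]
  exact (W_lt x hx).le
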